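/- Let ξ be a real number, let k be a positive integer, and let c > 3 be a non-integer real number with c > k. Let f(x) = x^c + x^k. Then for every ε > 0 there is a constant C = C(c, k, ξ, ε) such that for all sufficiently large N, the minimum over primes p with 2 ≤ p ≤ N of ‖ξ·⌊f(p)⌋‖ is at most C·N^(−ρ_d + ε), where ρ_d = 1/(24c² + 36c + 30). -/

import Mathlib

open Finset Filter

noncomputable section

/-- Distance from `x` to the nearest integer. -/
def nearestIntDist (x : ℝ) : ℝ := |x - round x|

namespace PS

open scoped ComplexConjugate

lemma addChar_map_sum {A M ι : Type*} [AddCommMonoid A] [CommMonoid M] (ψ : AddChar A M)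
    (s : Finset ι) (f : ι → A) : ψ (∑ i ∈ s, f i) = ∏ i ∈ s, ψ (f i) := by
  classical
  induction s using Finset.induction_on with
  | empty => simp
  | insert i s hi ih => rw [Finset.sum_insert hi, Finset.prod_insert hi, ψ.map_add_eq_mul, ih]

section Fourier
variable {κ : Type*} [Fintype κ] {Q : ℕ} [NeZero Q]

/-- The additive character of `(ℤ/Q)^κ` with integer frequency vector `v`. -/
def ch (v : κ → ℤ) (a : κ → ZMod Q) : ℂ := ZMod.stdAddChar (∑ j, a j * (v j : ZMod Q))

lemma ch_zero (a : κ → ZMod Q) : ch 0 a = 1 := by simp [ch]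

lemma ch_add (v w : κ → ℤ) (a : κ → ZMod Q) : ch (v + w) a = ch v a * ch w a := by
  simp only [ch, ← AddChar.map_add_eq_mul, ← Finset.sum_add_distrib]
  congr 1
  exact Finset.sum_congr rfl fun j _ => by simp [mul_add]

lemma norm_ch (v : κ → ℤ) (a : κ → ZMod Q) : ‖ch v a‖ = 1 := by
  rw [ch, ZMod.stdAddChar_apply, Circle.norm_coe]

lemma ch_neg (v : κ → ℤ) (a : κ → ZMod Q) : ch (-v) a = conj (ch v a) := by
  have h := ch_add v (-v) a
  rw [add_neg_cancel, ch_zero] at h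
  have h2 : ch v a ≠ 0 := by
    intro h0
    have := norm_ch v a
    rw [h0] at this; simp at this
  have h3 : ch v a * conj (ch v a) = 1 := by
    rw [Complex.mul_conj, Complex.normSq_eq_norm_sq, norm_ch]; simp
  exact mul_left_cancel₀ h2 (h.symm.trans h3.symm)

lemma ch_sub (v w : κ → ℤ) (a : κ → ZMod Q) : ch (v - w) a = ch v a * conj (ch w a) := by
  rw [sub_eq_add_neg, ch_add, ch_neg]

lemma ch_sum {ι : Type*} (s : Finset ι) (v : ι → κ → ℤ) (a : κ → ZMod Q) :
    ch (∑ i ∈ s, v i) a = ∏ i ∈ s, ch (v i) a := by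
  classical
  induction s using Finset.induction_on with
  | empty => simp [ch_zero]
  | insert i s hi ih => rw [Finset.sum_insert hi, Finset.prod_insert hi, ch_add, ih]

lemma sum_ch_eq_zero [DecidableEq κ] {v : κ → ℤ} (hv : ¬ ∀ j, (Q : ℤ) ∣ v j) :
    ∑ a : κ → ZMod Q, ch v a = 0 := by
  classical
  push Not at hv
  obtain ⟨j, hj⟩ := hv
  have h1 : ∀ a : κ → ZMod Q, ch v a = ∏ i, (ZMod.stdAddChar (a i * (v i : ZMod Q)) : ℂ) := by
    intro a
    simp only [ch]
    exact addChar_map_sum _ _ _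
  simp_rw [h1]
  have h2 := Finset.prod_univ_sum (fun _ : κ => (univ : Finset (ZMod Q)))
    (fun i x => (ZMod.stdAddChar (x * (v i : ZMod Q)) : ℂ))
  rw [Fintype.piFinset_univ] at h2
  rw [← h2]
  apply Finset.prod_eq_zero (Finset.mem_univ j)
  rw [AddChar.sum_mulShift _ (ZMod.isPrimitive_stdAddChar Q)]
  rw [if_neg]
  · simp
  · rwa [ZMod.intCast_zmod_eq_zero_iff_dvd]

lemma ch_eq_one {v : κ → ℤ} (hv : ∀ j, (Q : ℤ) ∣ v j) (a : κ → ZMod Q) : ch v a = 1 := by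
  have : ∀ j, (v j : ZMod Q) = 0 := fun j => (ZMod.intCast_zmod_eq_zero_iff_dvd _ _).2 (hv j)
  simp [ch, this]

/-- Parseval's identity as a count of congruent pairs. -/
lemma sum_norm_sq_sum_ch [DecidableEq κ] {ι : Type*} (s : Finset ι) (v : ι → κ → ℤ) :
    ∑ a : κ → ZMod Q, ‖∑ i ∈ s, ch (v i) a‖ ^ 2 =
      (Q : ℝ) ^ Fintype.card κ *
        #{x ∈ s ×ˢ s | ∀ j, v x.1 j ≡ v x.2 j [ZMOD Q]} := by
  classical
  have key : ∀ a : κ → ZMod Q, ((‖∑ i ∈ s, ch (v i) a‖ ^ 2 : ℝ) : ℂ) =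
      ∑ x ∈ s ×ˢ s, ch (v x.1 - v x.2) a := by
    intro a
    have : ((‖∑ i ∈ s, ch (v i) a‖ ^ 2 : ℝ) : ℂ) =
        (∑ i ∈ s, ch (v i) a) * conj (∑ i ∈ s, ch (v i) a) := by
      rw [Complex.mul_conj, Complex.normSq_eq_norm_sq]
    rw [this, map_sum, Finset.sum_mul_sum, ← Finset.sum_product']
    exact Finset.sum_congr rfl fun x _ => (ch_sub _ _ _).symm
  have : ((∑ a : κ → ZMod Q, ‖∑ i ∈ s, ch (v i) a‖ ^ 2 : ℝ) : ℂ) =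
      (((Q : ℝ) ^ Fintype.card κ *
        #{x ∈ s ×ˢ s | ∀ j, v x.1 j ≡ v x.2 j [ZMOD Q]} : ℝ) : ℂ) := by
    push_cast
    have h2 : ∀ a : κ → ZMod Q, ((‖∑ i ∈ s, ch (v i) a‖ : ℝ) : ℂ) ^ 2 =
      ∑ x ∈ s ×ˢ s, ch (v x.1 - v x.2) a := by
      intro a; rw [← key a]; push_cast; rfl
    simp_rw [h2]
    rw [Finset.sum_comm, Finset.card_filter, Nat.cast_sum, Finset.mul_sum]
    refine Finset.sum_congr rfl fun x _ => ?_
    by_cases hx : ∀ j, v x.1 j ≡ v x.2 j [ZMOD Q]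
    · have hx' : ∀ j, (Q : ℤ) ∣ (v x.1 - v x.2) j := fun j => (hx j).symm.dvd
      simp only [ch_eq_one hx', if_pos hx]
      simp
    · rw [if_neg hx, sum_ch_eq_zero]
      · simp
      · intro h
        exact hx fun j => (Int.modEq_iff_dvd.2 (h j)).symm
  exact_mod_cast this

/-- Even moments of an exponential sum count solutions of systems of congruences. -/
lemma sum_norm_pow_sum_ch [DecidableEq κ] {ι : Type*} [DecidableEq ι] (s : Finset ι)
    (v : ι → κ → ℤ) (r : ℕ) :
    ∑ a : κ → ZMod Q, ‖∑ i ∈ s, ch (v i) a‖ ^ (2 * r) =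
      (Q : ℝ) ^ Fintype.card κ *
        #{x ∈ Fintype.piFinset (fun _ : Fin r => s) ×ˢ Fintype.piFinset (fun _ : Fin r => s) |
          ∀ j, ∑ i, v (x.1 i) j ≡ ∑ i, v (x.2 i) j [ZMOD Q]} := by
  have h := sum_norm_sq_sum_ch (Q := Q) (Fintype.piFinset (fun _ : Fin r => s))
    (fun x => ∑ i, v (x i))
  simp only [Finset.sum_apply] at h
  rw [← h]
  refine Finset.sum_congr rfl fun a _ => ?_
  rw [mul_comm 2 r, pow_mul, ← norm_pow]
  congr 2
  have := Finset.prod_univ_sum (fun _ : Fin r => s) (fun _ i => ch (v i) a)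
  simp only [Finset.prod_const, Finset.card_univ, Fintype.card_fin] at this
  rw [this]
  exact Finset.sum_congr rfl fun x _ => (ch_sum _ _ _).symm

/-- The span of the characters whose frequency has degree `α` for the grading `π`. -/
def deg {A : Type*} [AddCommGroup A] (π : (κ → ℤ) →+ A) (α : A) :
    Submodule ℂ ((κ → ZMod Q) → ℂ) :=
  Submodule.span ℂ {f | ∃ v, π v = α ∧ f = ch v}

variable {A : Type*} [AddCommGroup A] {π : (κ → ℤ) →+ A}

lemma ch_mem_deg (v : κ → ℤ) : (ch v : (κ → ZMod Q) → ℂ) ∈ deg (Q := Q) π (π v) :=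
  Submodule.subset_span ⟨v, rfl, rfl⟩

lemma mul_mem_deg {α β : A} {f g : (κ → ZMod Q) → ℂ} (hf : f ∈ deg π α) (hg : g ∈ deg π β) :
    f * g ∈ deg π (α + β) := by
  have h := Submodule.mul_mem_mul hf hg
  rw [deg, deg, Submodule.span_mul_span] at h
  refine Submodule.span_mono ?_ h
  rintro _ ⟨_, ⟨v, rfl, rfl⟩, _, ⟨w, rfl, rfl⟩, rfl⟩
  exact ⟨v + w, map_add _ _ _, by ext a; simp [ch_add]⟩

lemma one_mem_deg : (1 : (κ → ZMod Q) → ℂ) ∈ deg (Q := Q) π 0 :=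
  Submodule.subset_span ⟨0, map_zero _, by ext a; simp [ch_zero]⟩

lemma prod_mem_deg {ι : Type*} (s : Finset ι) {α : ι → A} {f : ι → (κ → ZMod Q) → ℂ}
    (hf : ∀ i ∈ s, f i ∈ deg π (α i)) : ∏ i ∈ s, f i ∈ deg π (∑ i ∈ s, α i) := by
  classical
  induction s using Finset.induction_on with
  | empty => simpa using one_mem_deg
  | insert i s hi ih =>
    rw [Finset.sum_insert hi, Finset.prod_insert hi]
    exact mul_mem_deg (hf i (by simp)) (ih fun j hj => hf j (by simp [hj]))

lemma sum_mul_conj_eq_zero [DecidableEq κ] (hπ : ∀ v, (∀ j, (Q : ℤ) ∣ v j) → π v = 0) {α β : A}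
    (hαβ : α ≠ β) {f g : (κ → ZMod Q) → ℂ} (hf : f ∈ deg π α) (hg : g ∈ deg π β) :
    ∑ a, f a * conj (g a) = 0 := by
  induction hf using Submodule.span_induction with
  | zero => simp
  | add x y _ _ hx hy => simp [add_mul, Finset.sum_add_distrib, hx, hy]
  | smul c x _ hx => simp [mul_assoc, ← Finset.mul_sum, hx]
  | mem x hx =>
    obtain ⟨v, hv, rfl⟩ := hx
    induction hg using Submodule.span_induction with
    | zero => simp
    | add x y _ _ hx hy => simp [mul_add, Finset.sum_add_distrib, hx, hy]
    | smul c x _ hx => simp [mul_left_comm _ (conj c), ← Finset.mul_sum, hx]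
    | mem y hy =>
      obtain ⟨w, hw, rfl⟩ := hy
      simp_rw [← ch_sub]
      apply sum_ch_eq_zero
      intro h
      have := hπ _ h
      rw [map_sub, hv, hw, sub_eq_zero] at this
      exact hαβ this

/-- Almost orthogonality: pieces of pairwise different degrees are orthogonal. -/
lemma sum_norm_sq_le_of_deg [DecidableEq κ] (hπ : ∀ v, (∀ j, (Q : ℤ) ∣ v j) → π v = 0)
    {ι : Type*} (s : Finset ι) (F : ι → (κ → ZMod Q) → ℂ) (α : ι → A)
    (hF : ∀ i ∈ s, F i ∈ deg π (α i)) (D : ℕ)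
    (hD : ∀ β, Set.ncard {i | i ∈ s ∧ α i = β} ≤ D) :
    ∑ a, ‖∑ i ∈ s, F i a‖ ^ 2 ≤ D * ∑ i ∈ s, ∑ a, ‖F i a‖ ^ 2 := by
  classical
  set G : A → (κ → ZMod Q) → ℂ := fun β => ∑ i ∈ s with α i = β, F i with hG
  have hGdeg : ∀ β, G β ∈ deg π β := fun β => Submodule.sum_mem _ fun i hi => by
    obtain ⟨h1, rfl⟩ := Finset.mem_filter.1 hi
    exact hF i h1
  have hsum : ∀ a, ∑ i ∈ s, F i a = ∑ β ∈ s.image α, G β a := by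
    intro a
    rw [← Finset.sum_fiberwise_of_maps_to (g := α) (t := s.image α)
      (fun i hi => Finset.mem_image_of_mem _ hi)]
    exact Finset.sum_congr rfl fun β _ => by simp [hG]
  have hpyth : ∑ a, ‖∑ i ∈ s, F i a‖ ^ 2 = ∑ β ∈ s.image α, ∑ a, ‖G β a‖ ^ 2 := by
    have : ((∑ a, ‖∑ i ∈ s, F i a‖ ^ 2 : ℝ) : ℂ) =
        ((∑ β ∈ s.image α, ∑ a, ‖G β a‖ ^ 2 : ℝ) : ℂ) := by
      have hn : ∀ z : ℂ, ((‖z‖ : ℝ) : ℂ) ^ 2 = z * conj z := fun z => by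
        rw [Complex.mul_conj, Complex.normSq_eq_norm_sq]; push_cast; rfl
      push_cast
      simp_rw [hsum, hn, map_sum, Finset.sum_mul_sum]
      rw [Finset.sum_comm]
      refine Finset.sum_congr rfl fun β hβ => ?_
      rw [Finset.sum_comm]
      rw [Finset.sum_eq_single β]
      · intro γ _ hγ
        exact sum_mul_conj_eq_zero hπ hγ.symm (hGdeg _) (hGdeg _)
      · exact fun h => absurd hβ h
    exact_mod_cast this
  rw [hpyth, ← Finset.sum_fiberwise_of_maps_to (g := α) (t := s.image α)
      (fun i hi => Finset.mem_image_of_mem _ hi), Finset.mul_sum]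
  refine Finset.sum_le_sum fun β _ => ?_
  rw [Finset.sum_comm, Finset.mul_sum]
  refine Finset.sum_le_sum fun a _ => ?_
  have h1 : ‖G β a‖ ≤ ∑ i ∈ s with α i = β, ‖F i a‖ := by
    simp only [hG, Finset.sum_apply]
    exact norm_sum_le _ _
  have h2 := sq_sum_le_card_mul_sum_sq (s := s.filter (fun i => α i = β)) (f := fun i => ‖F i a‖)
  have h3 : #(s.filter (fun i => α i = β)) ≤ D := by
    have := hD β
    rwa [show {i | i ∈ s ∧ α i = β} = ((s.filter (fun i => α i = β) : Finset ι) : Set ι) by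
      ext; simp, Set.ncard_coe_finset] at this
  calc ‖G β a‖ ^ 2 ≤ (∑ i ∈ s with α i = β, ‖F i a‖) ^ 2 := by gcongr
    _ ≤ _ := h2
    _ ≤ _ := by
      gcongr

end Fourier

section PowerSums

/-- Congruent power sums stay congruent after a translation. -/
lemma powsum_translate {ι : Type*} [Fintype ι] {m : ℤ} {k : ℕ} {x y : ι → ℤ}
    (hxy : ∀ j ≤ k, ∑ i, x i ^ j ≡ ∑ i, y i ^ j [ZMOD m]) (h : ℤ) :
    ∀ j ≤ k, ∑ i, (x i + h) ^ j ≡ ∑ i, (y i + h) ^ j [ZMOD m] := by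
  intro j hj
  simp_rw [add_pow]
  rw [Finset.sum_comm, Finset.sum_comm (s := univ)]
  refine Int.ModEq.sum fun l hl => ?_
  simp_rw [← Finset.sum_mul]
  refine (Int.ModEq.mul_right _ (Int.ModEq.mul_right _ (hxy l ?_)))
  have := Finset.mem_range.1 hl
  omega

/-- Uniqueness of lifts for the Vinogradov system away from the diagonal. -/
lemma powsum_lift_unique {k p : ℕ} (hp : p.Prime) (hkp : k < p) {w w' : Fin k → ℤ}
    (h0 : ∀ i, w i ≡ w' i [ZMOD p]) (hinj : ∀ i j, i ≠ j → ¬ w i ≡ w j [ZMOD p]) {n : ℕ}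
    (hsum : ∀ j ≤ k, ∑ i, w i ^ j ≡ ∑ i, w' i ^ j [ZMOD (p : ℤ) ^ n]) :
    ∀ i, w i ≡ w' i [ZMOD (p : ℤ) ^ n] := by
  rcases Nat.eq_zero_or_pos n with rfl | hn
  · intro i; simp [Int.modEq_one]
  have : Fact p.Prime := ⟨hp⟩
  have key : ∀ m, 1 ≤ m → m ≤ n → ∀ i, w i ≡ w' i [ZMOD (p : ℤ) ^ m] := by
    intro m hm
    induction m, hm using Nat.le_induction with
    | base => intro _; simpa using h0
    | succ m hm ih =>
      intro hmn
      have ih := ih (by omega)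
      choose h hh using fun i => (ih i).dvd
      have hw : ∀ i, w' i = w i + (p : ℤ) ^ m * h i := fun i => by rw [← hh i]; ring
      have hP : (p : ℤ) ^ m ≠ 0 := by
        have := hp.pos
        positivity
      have hdvd : ∀ j : Fin k, (p : ℤ) ∣ ∑ i, h i * w i ^ (j : ℕ) := by
        intro j
        have h1 := (hsum (j + 1) j.2).dvd
        have h2 : (p : ℤ) ^ (m + 1) ∣ ∑ i, w' i ^ ((j : ℕ) + 1) - ∑ i, w i ^ ((j : ℕ) + 1) :=
          (pow_dvd_pow _ hmn).trans h1
        rw [← Finset.sum_sub_distrib] at h2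
        have h3 : (p : ℤ) ^ (m + 1) ∣ (∑ i, (w' i ^ ((j : ℕ) + 1) - w i ^ ((j : ℕ) + 1)))
            - (p : ℤ) ^ m * (((j : ℕ) + 1 : ℤ) * ∑ i, h i * w i ^ (j : ℕ)) := by
          rw [Finset.mul_sum, Finset.mul_sum, ← Finset.sum_sub_distrib]
          refine Finset.dvd_sum fun i _ => ?_
          obtain ⟨e, he⟩ := Polynomial.powAddExpansion (w i) ((p : ℤ) ^ m * h i) ((j : ℕ) + 1)
          rw [hw i, he]
          have : (p : ℤ) ^ (m + 1) ∣ (p : ℤ) ^ m * (p : ℤ) ^ m := by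
            rw [← pow_add]
            exact pow_dvd_pow _ (by omega)
          obtain ⟨q, hq⟩ := this
          refine ⟨q * e * h i ^ 2, ?_⟩
          simp only [Nat.add_sub_cancel]
          push_cast
          linear_combination e * h i ^ 2 * hq
        have h4 := (Int.dvd_iff_dvd_of_dvd_sub h3).1 h2
        rw [pow_succ] at h4
        have h5 := Int.dvd_of_mul_dvd_mul_left hP h4
        rcases (Nat.prime_iff_prime_int.1 hp).dvd_or_dvd h5 with h6 | h6
        · exfalso
          have h7 : p ∣ (j : ℕ) + 1 := by exact_mod_cast h6
          have := Nat.le_of_dvd (by omega) h7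
          have := j.2
          omega
        · exact h6
      have hz : (fun i => ((h i : ℤ) : ZMod p)) = 0 := by
        apply Matrix.eq_zero_of_forall_pow_sum_mul_pow_eq_zero (f := fun i => ((w i : ℤ) : ZMod p))
        · intro i j hij
          by_contra hne
          exact hinj i j hne ((ZMod.intCast_eq_intCast_iff _ _ _).1 hij)
        · intro j
          have := (ZMod.intCast_zmod_eq_zero_iff_dvd _ p).2 (hdvd j)
          push_cast at this
          exact this
      intro i
      have hi : (p : ℤ) ∣ h i := (ZMod.intCast_zmod_eq_zero_iff_dvd _ p).1 (congrFun hz i)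
      obtain ⟨q, hq⟩ := hi
      refine Int.modEq_iff_dvd.2 ⟨q, ?_⟩
      rw [hw i, hq, pow_succ]; ring
  exact key n hn le_rfl

lemma modEq_of_digit_eq {m d x y : ℤ} (hxy : x ≡ y [ZMOD d]) (hdm : d ∣ m)
    (h : x % m / d = y % m / d) : x ≡ y [ZMOD m] := by
  have h1 : x % m % d = y % m % d := by
    rw [Int.emod_emod_of_dvd _ hdm, Int.emod_emod_of_dvd _ hdm]; exact hxy
  have h2 := Int.emod_add_mul_ediv (x % m) d
  have h3 := Int.emod_add_mul_ediv (y % m) d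
  rw [h1, h] at h2
  exact h2.symm.trans h3

lemma digit_mem {p : ℕ} (hp : 0 < p) (x : ℤ) {u v : ℕ} (huv : u ≤ v) :
    x % (p : ℤ) ^ v / (p : ℤ) ^ u ∈ Ico (0 : ℤ) ((p : ℤ) ^ (v - u)) := by
  have hpz : (0 : ℤ) < p := by exact_mod_cast hp
  rw [Finset.mem_Ico]
  constructor
  · exact Int.ediv_nonneg (Int.emod_nonneg _ (by positivity)) (by positivity)
  · apply Int.ediv_lt_of_lt_mul (by positivity)
    rw [← pow_add, Nat.sub_add_cancel huv]
    exact Int.emod_lt_of_pos _ (by positivity)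

/-- Counting residue tuples with prescribed power sums to graded moduli. -/
lemma powsum_fiber_card {k p a b : ℕ} (hp : p.Prime) (hkp : k < p) (hk : 2 ≤ k) (hab : a ≤ b)
    (hb : 1 ≤ b) {ξ : Fin k → ℤ} (hξ : ∀ i j, ξ i ≡ ξ j [ZMOD (p : ℤ) ^ a])
    (hinj : ∀ i j, i ≠ j → ¬ ξ i ≡ ξ j [ZMOD (p : ℤ) ^ (a + 1)]) (η : ℤ)
    (s : Finset (Fin k → ℤ))
    (hs : ∀ z ∈ s, ∀ i, 0 ≤ z i ∧ z i < (p : ℤ) ^ (k * b) ∧ z i ≡ ξ i [ZMOD (p : ℤ) ^ (a + 1)])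
    (hss : ∀ z ∈ s, ∀ z' ∈ s, ∀ j : ℕ, j ≤ k →
      ∑ i, (z i - η) ^ j ≡ ∑ i, (z' i - η) ^ j [ZMOD (p : ℤ) ^ (j * b)]) :
    #s ≤ p ^ ((a + b) * ∑ j ∈ range k, j) := by
  classical
  have hpz : (0 : ℤ) < p := by exact_mod_cast hp.pos
  have hkb : a + 1 ≤ k * b := by nlinarith
  set i0 : Fin k := ⟨0, by omega⟩
  set W : (Fin k → ℤ) → Fin k → ℤ := fun z i => (z i - ξ i0) / (p : ℤ) ^ a with hW
  have hWz : ∀ z ∈ s, ∀ i, z i - ξ i0 = (p : ℤ) ^ a * W z i := by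
    intro z hz i
    refine (Int.mul_ediv_cancel' ?_).symm
    have h1 : z i ≡ ξ i [ZMOD (p : ℤ) ^ a] :=
      ((hs z hz i).2.2).of_dvd (pow_dvd_pow _ (by omega))
    exact (h1.trans (hξ i i0)).symm.dvd
  set T : Finset ((Fin k → ℤ) × (Fin k → ℤ)) :=
    Fintype.piFinset (fun j : Fin k => Ico (0 : ℤ) ((p : ℤ) ^ (k * b - (j + 1) * b))) ×ˢ
    Fintype.piFinset (fun j : Fin k =>
      Ico (0 : ℤ) ((p : ℤ) ^ ((k * b - a) - (k * b - (j + 1) * a)))) with hT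
  set Φ : (Fin k → ℤ) → (Fin k → ℤ) × (Fin k → ℤ) := fun z =>
    (fun j => (∑ i, (z i - η) ^ ((j : ℕ) + 1)) % (p : ℤ) ^ (k * b) / (p : ℤ) ^ (((j : ℕ) + 1) * b),
     fun j => (∑ i, W z i ^ ((j : ℕ) + 1)) % (p : ℤ) ^ (k * b - a) /
      (p : ℤ) ^ (k * b - ((j : ℕ) + 1) * a)) with hΦ
  have hle1 : ∀ j : Fin k, ((j : ℕ) + 1) * b ≤ k * b := fun j =>
    Nat.mul_le_mul_right _ j.2
  have hle2 : ∀ j : Fin k, ((j : ℕ) + 1) * a ≤ k * b := fun j =>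
    Nat.mul_le_mul j.2 hab
  have hle3 : ∀ j : Fin k, k * b - ((j : ℕ) + 1) * a ≤ k * b - a := fun j => by
    have : a ≤ ((j : ℕ) + 1) * a := Nat.le_mul_of_pos_left _ (by omega)
    omega
  have hmaps : ∀ z ∈ s, Φ z ∈ T := by
    intro z _
    rw [hT, Finset.mem_product, Fintype.mem_piFinset, Fintype.mem_piFinset]
    exact ⟨fun j => digit_mem hp.pos _ (hle1 j), fun j => digit_mem hp.pos _ (hle3 j)⟩
  have hinjOn : Set.InjOn Φ s := by
    intro z hz z' hz' hzz
    have hz : z ∈ s := hz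
    have hz' : z' ∈ s := hz'
    obtain ⟨e1, e2⟩ := Prod.mk.inj hzz
    have s1 : ∀ j ≤ k, ∑ i, (z i - η) ^ j ≡ ∑ i, (z' i - η) ^ j [ZMOD (p : ℤ) ^ (k * b)] := by
      intro j hj
      rcases j with _ | j
      · simp [Int.ModEq.refl]
      · have h1 := hss z hz z' hz' (j + 1) hj
        refine modEq_of_digit_eq h1 (pow_dvd_pow _ (hle1 ⟨j, by omega⟩)) ?_
        exact congrFun e1 ⟨j, by omega⟩
    have s2 := powsum_translate s1 (η - ξ i0)
    have s3 : ∀ j ≤ k, ∑ i, W z i ^ j ≡ ∑ i, W z' i ^ j [ZMOD (p : ℤ) ^ (k * b - a)] := by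
      intro j hj
      rcases j with _ | j
      · simp [Int.ModEq.refl]
      · have h1 := (s2 (j + 1) hj)
        have h2 : ∀ y ∈ s, ∑ i, (y i - η + (η - ξ i0)) ^ (j + 1) =
            (p : ℤ) ^ ((j + 1) * a) * ∑ i, W y i ^ (j + 1) := by
          intro y hy
          rw [Finset.mul_sum]
          refine Finset.sum_congr rfl fun i _ => ?_
          rw [sub_add_sub_cancel, hWz y hy i, mul_pow, ← pow_mul, mul_comm a]
        rw [h2 z hz, h2 z' hz'] at h1
        have h3 : ∑ i, W z i ^ (j + 1) ≡ ∑ i, W z' i ^ (j + 1)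
            [ZMOD (p : ℤ) ^ (k * b - (j + 1) * a)] := by
          have h4 := h1.dvd
          rw [← mul_sub, ← Nat.sub_add_cancel (hle2 ⟨j, by omega⟩), pow_add, mul_comm] at h4
          exact Int.modEq_iff_dvd.2 (Int.dvd_of_mul_dvd_mul_left (by positivity) h4)
        refine modEq_of_digit_eq h3 (pow_dvd_pow _ (hle3 ⟨j, by omega⟩)) ?_
        exact congrFun e2 ⟨j, by omega⟩
    have hWp : ∀ y ∈ s, ∀ y' ∈ s, ∀ i i', y i ≡ y' i' [ZMOD (p : ℤ) ^ (a + 1)] ↔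
        W y i ≡ W y' i' [ZMOD p] := by
      intro y hy y' hy' i i'
      have e1 : y' i' - y i = (p : ℤ) ^ a * (W y' i' - W y i) := by
        rw [mul_sub, ← hWz y hy, ← hWz y' hy']; ring
      rw [Int.modEq_iff_dvd, Int.modEq_iff_dvd, e1, pow_succ]
      exact mul_dvd_mul_iff_left (by positivity)
    have s4 := powsum_lift_unique hp hkp (w := W z) (w' := W z')
      (fun i => (hWp z hz z' hz' i i).1 ((hs z hz i).2.2.trans (hs z' hz' i).2.2.symm))
      (fun i j hij h => hinj i j hij
        ((hs z hz i).2.2.symm.trans (((hWp z hz z hz i j).2 h).trans (hs z hz j).2.2))) s3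
    funext i
    have h1 : z i ≡ z' i [ZMOD (p : ℤ) ^ (k * b)] := by
      have e1 : z' i - z i = (p : ℤ) ^ a * (W z' i - W z i) := by
        rw [mul_sub, ← hWz z hz, ← hWz z' hz']; ring
      rw [Int.modEq_iff_dvd, e1, show k * b = a + (k * b - a) by omega, pow_add]
      exact mul_dvd_mul_left _ (s4 i).dvd
    have h2 := Int.emod_eq_of_lt (hs z hz i).1 (hs z hz i).2.1
    have h3 := Int.emod_eq_of_lt (hs z' hz' i).1 (hs z' hz' i).2.1
    rw [← h2, ← h3]; exact h1
  refine (Finset.card_le_card_of_injOn Φ hmaps hinjOn).trans (le_of_eq ?_)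
  have hp' : ∀ n : ℕ, #(Ico (0 : ℤ) ((p : ℤ) ^ n)) = p ^ n := fun n => by
    rw [Int.card_Ico, sub_zero]
    have : ((p : ℤ) ^ n) = ((p ^ n : ℕ) : ℤ) := by push_cast; rfl
    rw [this, Int.toNat_natCast]
  rw [hT, Finset.card_product, Fintype.card_piFinset, Fintype.card_piFinset]
  simp_rw [hp']
  rw [Finset.prod_pow_eq_pow_sum, Finset.prod_pow_eq_pow_sum, ← pow_add]
  congr 1
  rw [Fin.sum_univ_eq_sum_range (fun j => k * b - (j + 1) * b) k,
    Fin.sum_univ_eq_sum_range (fun j => (k * b - a) - (k * b - (j + 1) * a)) k, add_mul, add_comm]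
  congr 1
  · rw [Finset.mul_sum]
    refine Finset.sum_congr rfl fun j hj => ?_
    have h1 := hle2 ⟨j, Finset.mem_range.1 hj⟩
    simp only at h1
    have : (j + 1) * a = a * j + a := by ring
    omega
  · rw [← Finset.sum_range_reflect, Finset.mul_sum]
    refine Finset.sum_congr rfl fun j hj => ?_
    have hj := Finset.mem_range.1 hj
    rw [← Nat.sub_mul, mul_comm]
    congr 1
    omega

end PowerSums

/-- Either a sum is dominated by one term or by the product of `n` distinct large terms. -/
lemma sum_pow_le_max_add_distinct {C : Type*} [Fintype C] [DecidableEq C] (v : C → ℝ)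
    (hv : ∀ c, 0 ≤ v c) (n m P : ℕ) (hn : 1 ≤ n) (hm : 1 ≤ m) (hP : Fintype.card C ≤ P)
    (hP1 : 1 ≤ P) :
    (∑ c, v c) ^ (m * n) ≤ (2 * n : ℝ) ^ (m * n) * ∑ c, v c ^ (m * n) +
      (2 * P : ℝ) ^ (m * n) * ∑ τ : Fin n ↪ C, ∏ i, v (τ i) ^ m := by
  classical
  have hmn : m * n ≠ 0 := by positivity
  have hPr : (1 : ℝ) ≤ P := by exact_mod_cast hP1
  have hn1 : (1 : ℝ) ≤ n := by exact_mod_cast hn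
  set M := ∑ c, v c with hM
  have hM0 : 0 ≤ M := Finset.sum_nonneg fun c _ => hv c
  have hA : 0 ≤ (2 * n : ℝ) ^ (m * n) * ∑ c, v c ^ (m * n) :=
    mul_nonneg (by positivity) (Finset.sum_nonneg fun c _ => pow_nonneg (hv c) _)
  have hB' : ∀ τ : Fin n ↪ C, 0 ≤ ∏ i, v (τ i) ^ m := fun τ =>
    Finset.prod_nonneg fun i _ => pow_nonneg (hv _) _
  have hB : 0 ≤ (2 * P : ℝ) ^ (m * n) * ∑ τ : Fin n ↪ C, ∏ i, v (τ i) ^ m :=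
    mul_nonneg (by positivity) (Finset.sum_nonneg fun τ _ => hB' τ)
  set L : Finset C := univ.filter (fun c => M / (2 * P) ≤ v c) with hL
  rcases lt_or_ge (#L) n with hc | hc
  · have h1 : ∑ c ∈ univ.filter (fun c => ¬ M / (2 * P) ≤ v c), v c ≤ M / 2 := by
      calc _ ≤ ∑ c ∈ univ.filter (fun c => ¬ M / (2 * P) ≤ v c), M / (2 * P) :=
            Finset.sum_le_sum fun c hc => le_of_lt (not_le.1 (Finset.mem_filter.1 hc).2)
        _ = #(univ.filter (fun c => ¬ M / (2 * P) ≤ v c)) * (M / (2 * P)) := by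
            rw [Finset.sum_const, nsmul_eq_mul]
        _ ≤ P * (M / (2 * P)) := by
            gcongr
            exact (Finset.card_le_univ _).trans hP
        _ = M / 2 := by field_simp
    have h2 : M / 2 ≤ ∑ c ∈ L, v c := by
      have := Finset.sum_filter_add_sum_filter_not univ (fun c => M / (2 * P) ≤ v c) v
      rw [← hL] at this
      linarith
    rcases eq_or_lt_of_le hM0 with h0 | h0
    · rw [← h0, zero_pow hmn]; positivity
    · have hLne : L.Nonempty := by
        by_contra hne
        rw [Finset.not_nonempty_iff_eq_empty.1 hne, Finset.sum_empty] at h2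
        linarith
      obtain ⟨c, hcL, hcmax⟩ := Finset.exists_max_image L v hLne
      have h3 : ∑ c ∈ L, v c ≤ n * v c := by
        calc _ ≤ ∑ _c ∈ L, v c := Finset.sum_le_sum fun x hx => hcmax x hx
          _ = #L * v c := by rw [Finset.sum_const, nsmul_eq_mul]
          _ ≤ n * v c := by
            have := hv c
            gcongr
      have h4 : M ≤ 2 * n * v c := by linarith
      calc M ^ (m * n) ≤ (2 * n * v c) ^ (m * n) := by gcongr
        _ = (2 * n : ℝ) ^ (m * n) * v c ^ (m * n) := mul_pow _ _ _
        _ ≤ (2 * n : ℝ) ^ (m * n) * ∑ c, v c ^ (m * n) := by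
            gcongr
            exact Finset.single_le_sum (f := fun c => v c ^ (m * n))
              (fun c _ => pow_nonneg (hv c) _) (Finset.mem_univ c)
        _ ≤ _ := by linarith
  · obtain ⟨L', hL'L, hL'⟩ := Finset.exists_subset_card_eq hc
    let e := L'.equivFinOfCardEq hL'
    let τ : Fin n ↪ C := ⟨fun i => (e.symm i : C), fun i j hij => by
      have := Subtype.ext hij
      exact e.symm.injective this⟩
    have hτ : ∀ i, M / (2 * P) ≤ v (τ i) := fun i =>
      (Finset.mem_filter.1 (hL'L (e.symm i).2)).2
    have h1 : (M / (2 * P)) ^ (m * n) ≤ ∏ i, v (τ i) ^ m := by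
      calc (M / (2 * P)) ^ (m * n) = ∏ _i : Fin n, (M / (2 * P)) ^ m := by
            rw [Finset.prod_const, Finset.card_univ, Fintype.card_fin, pow_mul]
        _ ≤ _ := Finset.prod_le_prod (fun i _ => by positivity) fun i _ => by
            have := hτ i
            gcongr
    calc M ^ (m * n) = (2 * P : ℝ) ^ (m * n) * (M / (2 * P)) ^ (m * n) := by
          rw [← mul_pow]; congr 1; field_simp
      _ ≤ (2 * P : ℝ) ^ (m * n) * ∑ τ : Fin n ↪ C, ∏ i, v (τ i) ^ m := by
          gcongr
          exact h1.trans (Finset.single_le_sum (f := fun τ : Fin n ↪ C => ∏ i, v (τ i) ^ m)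
            (fun τ _ => hB' τ) (Finset.mem_univ τ))
      _ ≤ _ := by linarith

section Average
variable {Ω : Type*} [Fintype Ω]

/-- The average of a real function on a finite type. -/
def av (F : Ω → ℝ) : ℝ := (∑ a, F a) / Fintype.card Ω

lemma av_mono {F G : Ω → ℝ} (h : ∀ a, F a ≤ G a) : av F ≤ av G := by
  unfold av
  gcongr
  exact h _

lemma av_nonneg {F : Ω → ℝ} (h : ∀ a, 0 ≤ F a) : 0 ≤ av F :=
  div_nonneg (Finset.sum_nonneg fun a _ => h a) (Nat.cast_nonneg _)

lemma av_add (F G : Ω → ℝ) : av (fun a => F a + G a) = av F + av G := by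
  simp [av, Finset.sum_add_distrib, add_div]

lemma av_const_mul (c : ℝ) (F : Ω → ℝ) : av (fun a => c * F a) = c * av F := by
  simp [av, ← Finset.mul_sum, mul_div_assoc]

lemma av_sum {ι : Type*} (s : Finset ι) (F : ι → Ω → ℝ) :
    av (fun a => ∑ i ∈ s, F i a) = ∑ i ∈ s, av (F i) := by
  simp only [av]
  rw [Finset.sum_comm, Finset.sum_div]

lemma av_holder {F G : Ω → ℝ} (hF : ∀ a, 0 ≤ F a) (hG : ∀ a, 0 ≤ G a) {θ : ℝ} (h0 : 0 < θ)
    (h1 : θ < 1) : av (fun a => F a ^ θ * G a ^ (1 - θ)) ≤ av F ^ θ * av G ^ (1 - θ) := by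
  have h2 : 0 < 1 - θ := by linarith
  have hpq : Real.HolderConjugate θ⁻¹ (1 - θ)⁻¹ := by
    rw [Real.holderConjugate_iff]
    constructor
    · exact (one_lt_inv₀ h0).2 h1
    · simp
  have h := Real.inner_le_Lp_mul_Lq_of_nonneg univ hpq (f := fun a => F a ^ θ)
    (g := fun a => G a ^ (1 - θ)) (fun a _ => Real.rpow_nonneg (hF a) _)
    (fun a _ => Real.rpow_nonneg (hG a) _)
  simp only [one_div, inv_inv] at h
  have e1 : ∀ a, (F a ^ θ) ^ θ⁻¹ = F a := fun a => Real.rpow_rpow_inv (hF a) h0.ne'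
  have e2 : ∀ a, (G a ^ (1 - θ)) ^ (1 - θ)⁻¹ = G a := fun a => Real.rpow_rpow_inv (hG a) h2.ne'
  simp only [e1, e2] at h
  unfold av
  rcases Nat.eq_zero_or_pos (Fintype.card Ω) with hc | hc
  · rw [hc]
    simp only [Nat.cast_zero, div_zero]
    positivity
  · have hcr : (0 : ℝ) < Fintype.card Ω := by exact_mod_cast hc
    rw [Real.div_rpow (Finset.sum_nonneg fun a _ => hF a) hcr.le,
      Real.div_rpow (Finset.sum_nonneg fun a _ => hG a) hcr.le, div_mul_div_comm,
      ← Real.rpow_add hcr, add_sub_cancel, Real.rpow_one]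
    gcongr

lemma prod_le_sum_pow {n : ℕ} (hn : 1 ≤ n) (A : Fin n → ℝ) (hA : ∀ i, 0 ≤ A i) :
    ∏ i, A i ≤ ∑ i, A i ^ n := by
  have : Nonempty (Fin n) := ⟨⟨0, hn⟩⟩
  obtain ⟨i, hi⟩ := Finite.exists_max A
  calc ∏ j, A j ≤ ∏ _j : Fin n, A i := Finset.prod_le_prod (fun j _ => hA j) fun j _ => hi j
    _ = A i ^ n := by simp
    _ ≤ _ := Finset.single_le_sum (f := fun i => A i ^ n) (fun j _ => pow_nonneg (hA j) _)
      (Finset.mem_univ i)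

end Average

/-- Vinogradov's counting function. -/
def J (s k n : ℕ) : ℕ :=
  #{x ∈ Fintype.piFinset (fun _ : Fin s => Icc (1 : ℤ) n) ×ˢ
      Fintype.piFinset (fun _ : Fin s => Icc (1 : ℤ) n) |
    ∀ j : Fin (k + 1), ∑ i, x.1 i ^ (j : ℕ) = ∑ i, x.2 i ^ (j : ℕ)}

/-- The moment curve. -/
def nu (k : ℕ) (x : ℤ) : Fin (k + 1) → ℤ := fun j => x ^ (j : ℕ)

section Sums
variable (k p Q : ℕ) [NeZero Q] (X : ℕ)

/-- Exponential sum over a residue class modulo `p ^ m`. -/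
def fs (m : ℕ) (ξ : ℤ) (a : Fin (k + 1) → ZMod Q) : ℂ :=
  ∑ x ∈ (Icc (1 : ℤ) X).filter (fun x => x ≡ ξ [ZMOD (p : ℤ) ^ m]), ch (nu k x) a

variable {k p Q X}

lemma av_fs_pow_le (hp : 0 < p) (m : ℕ) (ξ : ℤ) (s : ℕ) (hQ : 2 * s * X ^ k < Q) :
    av (fun a => ‖fs k p Q X m ξ a‖ ^ (2 * s)) ≤ J s k (X / p ^ m + 1) := by
  classical
  have hpz : (0 : ℤ) < (p : ℤ) ^ m := by have : (0 : ℤ) < p := by exact_mod_cast hp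
                                         positivity
  unfold av
  rw [show (∑ a, ‖fs k p Q X m ξ a‖ ^ (2 * s)) = _ from
    sum_norm_pow_sum_ch (Q := Q) ((Icc (1 : ℤ) X).filter (fun x => x ≡ ξ [ZMOD (p : ℤ) ^ m]))
      (nu k) s]
  have hcard : (Fintype.card (Fin (k + 1) → ZMod Q) : ℝ) = (Q : ℝ) ^ Fintype.card (Fin (k + 1)) := by
    simp [ZMod.card]
  have hQ0 : (0 : ℝ) < (Q : ℝ) ^ Fintype.card (Fin (k + 1)) := by
    have : 0 < Q := Nat.pos_of_ne_zero (NeZero.ne Q)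
    positivity
  rw [hcard, mul_div_cancel_left₀ _ hQ0.ne']
  unfold J
  norm_cast
  set M : ℤ := (p : ℤ) ^ m with hM
  set r : ℤ := ξ % M with hr
  have hdec : ∀ x : ℤ, x ≡ ξ [ZMOD M] → x = M * (x / M + 1) + (r - M) := by
    intro x hx
    have h1 := Int.emod_add_mul_ediv x M
    rw [show x % M = r from hx] at h1
    linarith
  refine Finset.card_le_card_of_injOn
    (fun x => (fun i => x.1 i / M + 1, fun i => x.2 i / M + 1)) ?_ ?_
  · intro x hx
    simp only [Finset.coe_filter, Finset.mem_product, Fintype.mem_piFinset, Finset.mem_filter,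
      Finset.mem_Icc, Set.mem_ofPred_eq] at hx ⊢
    have hrange : ∀ y : ℤ, 1 ≤ y → y ≤ X → 1 ≤ y / M + 1 ∧ y / M + 1 ≤ ((X / p ^ m + 1 : ℕ) : ℤ) := by
      intro y h1 h2
      constructor
      · have := Int.ediv_nonneg (by omega : (0 : ℤ) ≤ y) hpz.le
        linarith
      · push_cast
        have := Int.ediv_le_ediv hpz h2
        linarith
    refine ⟨⟨fun i => hrange _ (hx.1.1 i).1.1 (hx.1.1 i).1.2,
      fun i => hrange _ (hx.1.2 i).1.1 (hx.1.2 i).1.2⟩, ?_⟩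
    have heq : ∀ j ≤ k, ∑ i, x.1 i ^ j ≡ ∑ i, x.2 i ^ j [ZMOD 0] := by
      intro j hj
      rw [Int.modEq_zero_iff]
      have h1 := (hx.2 ⟨j, by omega⟩).dvd
      simp only [nu] at h1
      have hb : ∀ y : Fin s → ℤ, (∀ i, (1 ≤ y i ∧ y i ≤ X) ∧ y i ≡ ξ [ZMOD M]) →
          0 ≤ ∑ i, y i ^ j ∧ ∑ i, y i ^ j ≤ s * X ^ k := by
        intro y hy
        constructor
        · exact Finset.sum_nonneg fun i _ => pow_nonneg (by linarith [(hy i).1.1]) _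
        · calc ∑ i, y i ^ j ≤ ∑ _i : Fin s, (X : ℤ) ^ k := by
                refine Finset.sum_le_sum fun i _ => ?_
                have h1 := (hy i).1.1
                have h2 := (hy i).1.2
                calc y i ^ j ≤ y i ^ k := pow_le_pow_right₀ h1 hj
                  _ ≤ (X : ℤ) ^ k := by gcongr
            _ = _ := by simp
      have b1 := hb _ hx.1.1
      have b2 := hb _ hx.1.2
      have hQz : (2 * s * X ^ k : ℤ) < Q := by exact_mod_cast hQ
      have := Int.eq_zero_of_abs_lt_dvd h1 (by
        rw [abs_lt]; constructor <;> nlinarith)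
      linarith
    have h2 := powsum_translate heq (M - r)
    intro j
    have h3 := (Int.modEq_zero_iff.1 (h2 j (Nat.lt_succ_iff.1 j.2)))
    have h4 : ∀ y : Fin s → ℤ, (∀ i, (1 ≤ y i ∧ y i ≤ X) ∧ y i ≡ ξ [ZMOD M]) →
        ∑ i, (y i + (M - r)) ^ (j : ℕ) = M ^ (j : ℕ) * ∑ i, (y i / M + 1) ^ (j : ℕ) := by
      intro y hy
      rw [Finset.mul_sum]
      refine Finset.sum_congr rfl fun i _ => ?_
      rw [← mul_pow]
      congr 1
      have := hdec _ (hy i).2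
      linarith
    rw [h4 _ hx.1.1, h4 _ hx.1.2] at h3
    exact mul_left_cancel₀ (pow_ne_zero _ hpz.ne') h3
  · intro x hx y hy hxy
    simp only [Finset.coe_filter, Finset.mem_product, Fintype.mem_piFinset, Finset.mem_filter,
      Finset.mem_Icc, Set.mem_ofPred_eq] at hx hy
    obtain ⟨h1, h2⟩ := Prod.mk.inj hxy
    refine Prod.ext (funext fun i => ?_) (funext fun i => ?_)
    · rw [hdec _ (hx.1.1 i).2, hdec _ (hy.1.1 i).2, congrFun h1 i]
    · rw [hdec _ (hx.1.2 i).2, hdec _ (hy.1.2 i).2, congrFun h2 i]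

lemma J_eq_av (s : ℕ) (hQ : 2 * s * X ^ k < Q) :
    (J s k X : ℝ) = av (fun a : Fin (k + 1) → ZMod Q =>
      ‖∑ x ∈ Icc (1 : ℤ) X, ch (nu k x) a‖ ^ (2 * s)) := by
  classical
  unfold av
  rw [sum_norm_pow_sum_ch (Q := Q) (Icc (1 : ℤ) X) (nu k) s]
  have hcard : (Fintype.card (Fin (k + 1) → ZMod Q) : ℝ) = (Q : ℝ) ^ Fintype.card (Fin (k + 1)) := by
    simp [ZMod.card]
  have hQ0 : (0 : ℝ) < (Q : ℝ) ^ Fintype.card (Fin (k + 1)) := by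
    have : 0 < Q := Nat.pos_of_ne_zero (NeZero.ne Q)
    positivity
  rw [hcard, mul_div_cancel_left₀ _ hQ0.ne']
  unfold J
  norm_cast
  congr 1
  ext x
  simp only [Finset.mem_filter]
  refine and_congr_right fun hx => forall_congr' fun j => ?_
  simp only [Finset.mem_product, Fintype.mem_piFinset, Finset.mem_Icc] at hx
  have hb : ∀ y : Fin s → ℤ, (∀ i, (1 ≤ y i ∧ y i ≤ X)) →
      0 ≤ ∑ i, y i ^ (j : ℕ) ∧ ∑ i, y i ^ (j : ℕ) ≤ s * X ^ k := by
    intro y hy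
    constructor
    · exact Finset.sum_nonneg fun i _ => pow_nonneg (by linarith [(hy i).1]) _
    · calc ∑ i, y i ^ (j : ℕ) ≤ ∑ _i : Fin s, (X : ℤ) ^ k := by
            refine Finset.sum_le_sum fun i _ => ?_
            have h1 := (hy i).1
            have h2 := (hy i).2
            calc y i ^ (j : ℕ) ≤ y i ^ k := pow_le_pow_right₀ h1 (Nat.lt_succ_iff.1 j.2)
              _ ≤ (X : ℤ) ^ k := by gcongr
        _ = _ := by simp
  have b1 := hb _ hx.1
  have b2 := hb _ hx.2
  have hQz : (2 * s * X ^ k : ℤ) < Q := by exact_mod_cast hQ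
  constructor
  · intro h; simp only [nu]; rw [h]
  · intro h
    have h1 := h.dvd
    simp only [nu] at h1
    have := Int.eq_zero_of_abs_lt_dvd h1 (by
        rw [abs_lt]; constructor <;> nlinarith)
    linarith

end Sums

section Sums
variable {k p Q : ℕ} [NeZero Q] {X : ℕ}

/-- Residues modulo `p ^ m'` lying above a residue modulo `p ^ m`. -/
def resid (p m m' : ℕ) (ξ : ℤ) : Finset ℤ :=
  (Ico (0 : ℤ) ((p : ℤ) ^ m')).filter (fun z => z ≡ ξ [ZMOD (p : ℤ) ^ m])

lemma card_resid_le (hp : 0 < p) {m m' : ℕ} (h : m ≤ m') (ξ : ℤ) :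
    #(resid p m m' ξ) ≤ p ^ (m' - m) := by
  have hpz : (0 : ℤ) < p := by exact_mod_cast hp
  have hc : #(Ico (0 : ℤ) ((p : ℤ) ^ (m' - m))) = p ^ (m' - m) := by
    rw [Int.card_Ico, sub_zero]
    have : ((p : ℤ) ^ (m' - m)) = ((p ^ (m' - m) : ℕ) : ℤ) := by push_cast; rfl
    rw [this, Int.toNat_natCast]
  rw [← hc]
  refine Finset.card_le_card_of_injOn (fun z => z / (p : ℤ) ^ m) ?_ ?_
  · intro z hz
    obtain ⟨h1, _⟩ := Finset.mem_filter.1 (Finset.mem_coe.1 hz)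
    rw [Finset.mem_Ico] at h1
    rw [Finset.mem_coe, Finset.mem_Ico]
    refine ⟨Int.ediv_nonneg h1.1 (by positivity), Int.ediv_lt_of_lt_mul (by positivity) ?_⟩
    rw [← pow_add, Nat.sub_add_cancel h]
    exact h1.2
  · intro z hz z' hz' hzz
    have h1 := (Finset.mem_filter.1 (Finset.mem_coe.1 hz)).2
    have h2 := (Finset.mem_filter.1 (Finset.mem_coe.1 hz')).2
    have e1 := Int.emod_add_mul_ediv z ((p : ℤ) ^ m)
    have e2 := Int.emod_add_mul_ediv z' ((p : ℤ) ^ m)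
    have e3 : z % (p : ℤ) ^ m = z' % (p : ℤ) ^ m := h1.trans h2.symm
    simp only at hzz
    rw [e3, hzz] at e1
    exact e1.symm.trans e2

lemma resid_distinct {m m' : ℕ} {ξ z z' : ℤ} (hz : z ∈ resid p m m' ξ)
    (hz' : z' ∈ resid p m m' ξ) (h : z ≡ z' [ZMOD (p : ℤ) ^ m']) : z = z' := by
  have h1 := Finset.mem_Ico.1 (Finset.mem_filter.1 hz).1
  have h2 := Finset.mem_Ico.1 (Finset.mem_filter.1 hz').1
  rw [← Int.emod_eq_of_lt h1.1 h1.2, ← Int.emod_eq_of_lt h2.1 h2.2]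
  exact h

lemma fs_split (hp : 0 < p) {m m' : ℕ} (h : m ≤ m') (ξ : ℤ) (a : Fin (k + 1) → ZMod Q) :
    fs k p Q X m ξ a = ∑ z ∈ resid p m m' ξ, fs k p Q X m' z a := by
  classical
  have hpz : (0 : ℤ) < (p : ℤ) ^ m' := by
    have : (0 : ℤ) < p := by exact_mod_cast hp
    positivity
  unfold fs
  rw [← Finset.sum_fiberwise_of_maps_to (g := fun x : ℤ => x % (p : ℤ) ^ m')
    (t := resid p m m' ξ)]
  · refine Finset.sum_congr rfl fun z hz => ?_
    refine Finset.sum_congr ?_ fun _ _ => rfl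
    obtain ⟨h1, h2⟩ := Finset.mem_filter.1 hz
    rw [Finset.mem_Ico] at h1
    ext x
    simp only [Finset.mem_filter, and_assoc]
    refine and_congr_right fun _ => ?_
    have hzz := Int.emod_eq_of_lt h1.1 h1.2
    constructor
    · rintro ⟨_, h4⟩
      rw [← hzz] at h4
      exact h4
    · intro h4
      have h5 : x ≡ z [ZMOD (p : ℤ) ^ m] := h4.of_dvd (pow_dvd_pow _ h)
      refine ⟨h5.trans h2, ?_⟩
      rw [← hzz]; exact h4
  · intro x hx
    have h2 := (Finset.mem_filter.1 hx).2
    refine Finset.mem_filter.2 ⟨Finset.mem_Ico.2 ⟨Int.emod_nonneg _ hpz.ne',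
      Int.emod_lt_of_pos _ hpz⟩, ?_⟩
    exact Int.ModEq.trans ((Int.mod_modEq x _).of_dvd (pow_dvd_pow _ h)) h2

/-- The grading by power sums of `x - η` to the moduli `p ^ (j b)`. -/
def grad (k p b : ℕ) (η : ℤ) : (Fin (k + 1) → ℤ) →+ (∀ j : Fin (k + 1), ZMod (p ^ ((j : ℕ) * b))) :=
  AddMonoidHom.mk' (fun v j =>
    ((∑ i : Fin (k + 1), v i * ((-η) ^ ((j : ℕ) - i) * ((j : ℕ).choose i : ℤ)) : ℤ) :
      ZMod (p ^ ((j : ℕ) * b)))) (fun v w => by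
    funext j
    rw [Pi.add_apply, ← Int.cast_add, ← Finset.sum_add_distrib]
    congr 1
    exact Finset.sum_congr rfl fun i _ => by rw [Pi.add_apply, add_mul])

lemma grad_nu (b : ℕ) (η x : ℤ) (j : Fin (k + 1)) :
    grad k p b η (nu k x) j = (((x - η) ^ (j : ℕ) : ℤ) : ZMod (p ^ ((j : ℕ) * b))) := by
  show ((∑ i : Fin (k + 1), x ^ (i : ℕ) * ((-η) ^ ((j : ℕ) - i) * ((j : ℕ).choose i : ℤ)) : ℤ) :
      ZMod (p ^ ((j : ℕ) * b))) = _
  congr 1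
  rw [sub_eq_add_neg, add_pow,
    Fin.sum_univ_eq_sum_range (fun i => x ^ i * ((-η) ^ ((j : ℕ) - i) * ((j : ℕ).choose i : ℤ)))]
  have : range ((j : ℕ) + 1) ⊆ range (k + 1) := Finset.range_subset_range.2 (by omega)
  rw [← Finset.sum_subset this]
  · exact Finset.sum_congr rfl fun i _ => by ring
  · intro i _ hi
    rw [Nat.choose_eq_zero_of_lt (by simp at hi; omega)]
    simp

lemma grad_eq_zero {b d : ℕ} {η : ℤ} (hd : ∀ j ≤ k, p ^ (j * b) ∣ d) (v : Fin (k + 1) → ℤ)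
    (hv : ∀ j, (d : ℤ) ∣ v j) : grad k p b η v = 0 := by
  funext j
  show ((∑ i : Fin (k + 1), v i * ((-η) ^ ((j : ℕ) - i) * ((j : ℕ).choose i : ℤ)) : ℤ) :
      ZMod (p ^ ((j : ℕ) * b))) = _
  rw [Pi.zero_apply, ZMod.intCast_zmod_eq_zero_iff_dvd]
  refine Finset.dvd_sum fun i _ => Dvd.dvd.mul_right (dvd_trans ?_ (hv i)) _
  exact_mod_cast hd j (Nat.lt_succ_iff.1 j.2)

lemma fs_mem_deg {m b : ℕ} {η z : ℤ} (α : ∀ j : Fin (k + 1), ZMod (p ^ ((j : ℕ) * b)))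
    (h : ∀ x : ℤ, x ≡ z [ZMOD (p : ℤ) ^ m] →
      ∀ j : Fin (k + 1), (((x - η) ^ (j : ℕ) : ℤ) : ZMod (p ^ ((j : ℕ) * b))) = α j) :
    fs k p Q X m z ∈ deg (grad k p b η) α := by
  have : fs k p Q X m z = ∑ x ∈ (Icc (1 : ℤ) X).filter (fun x => x ≡ z [ZMOD (p : ℤ) ^ m]),
      (ch (nu k x) : (Fin (k + 1) → ZMod Q) → ℂ) := by
    funext a; simp [fs]
  rw [this]
  refine Submodule.sum_mem _ fun x hx => ?_
  have e : grad k p b η (nu k x) = α := by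
    funext j
    rw [grad_nu]
    exact h x (Finset.mem_filter.1 hx).2 j
  rw [← e]
  exact ch_mem_deg _

/-- The congruencing step: exploiting the congruences forced by orthogonality. -/
lemma av_prod_le_of_lift (hp : p.Prime) (hkp : k < p) (hk : 2 ≤ k) {a b : ℕ} (hab : a ≤ b)
    (hb : 1 ≤ b) {ξ : Fin k → ℤ} (hξ : ∀ i j, ξ i ≡ ξ j [ZMOD (p : ℤ) ^ a])
    (hinj : ∀ i j, i ≠ j → ¬ ξ i ≡ ξ j [ZMOD (p : ℤ) ^ (a + 1)]) {η : ℤ} {η' : Fin k → ℤ}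
    (hη : ∀ i, η' i ≡ η [ZMOD (p : ℤ) ^ b]) (hQ : ∀ j ≤ k, p ^ (j * b) ∣ Q) {B : ℝ}
    (hB : ∀ i z, z ≡ ξ i [ZMOD (p : ℤ) ^ (a + 1)] →
      av (fun u => ‖fs k p Q X (k * b) z u‖ ^ (2 * k) *
        ∏ i, ‖fs k p Q X (b + 1) (η' i) u‖ ^ (2 * k)) ≤ B) :
    av (fun u => (∏ i, ‖fs k p Q X (a + 1) (ξ i) u‖ ^ 2) *
        ∏ i, ‖fs k p Q X (b + 1) (η' i) u‖ ^ (2 * k)) ≤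
      (p : ℝ) ^ ((a + b) * ∑ j ∈ range k, j) * ((p : ℝ) ^ (k * (k * b - a)) * (k * B)) := by
  classical
  have hkb : a + 1 ≤ k * b := by nlinarith
  have hp1 : (1 : ℝ) ≤ p := by exact_mod_cast hp.one_lt.le
  set Z : Fin k → Finset ℤ := fun i => resid p (a + 1) (k * b) (ξ i) with hZ
  set S := Fintype.piFinset Z with hS
  set G : (Fin (k + 1) → ZMod Q) → ℂ := (∏ i, fs k p Q X (b + 1) (η' i)) ^ k with hG
  have hGn : ∀ u, ‖G u‖ ^ 2 = ∏ i, ‖fs k p Q X (b + 1) (η' i) u‖ ^ (2 * k) := by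
    intro u
    simp only [hG, Pi.pow_apply, Finset.prod_apply, norm_pow, norm_prod]
    rw [← pow_mul, Finset.prod_pow, mul_comm]
  set F : (Fin k → ℤ) → (Fin (k + 1) → ZMod Q) → ℂ :=
    fun z => (∏ i, fs k p Q X (k * b) (z i)) * G with hF
  have hsum : ∀ u, (∏ i, fs k p Q X (a + 1) (ξ i) u) * G u = ∑ z ∈ S, F z u := by
    intro u
    simp_rw [fs_split hp.pos hkb]
    rw [Finset.prod_univ_sum, Finset.sum_mul]
    refine Finset.sum_congr rfl fun z _ => ?_
    simp [hF]
  set α : (Fin k → ℤ) → (∀ j : Fin (k + 1), ZMod (p ^ ((j : ℕ) * b))) := fun z j =>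
    ((∑ i, (z i - η) ^ (j : ℕ) : ℤ) : ZMod (p ^ ((j : ℕ) * b))) with hα
  have hdvd : ∀ j : Fin (k + 1), (p : ℤ) ^ ((j : ℕ) * b) ∣ (p : ℤ) ^ (k * b) := fun j =>
    pow_dvd_pow _ (Nat.mul_le_mul_right _ (Nat.lt_succ_iff.1 j.2))
  have hGdeg : G ∈ deg (grad k p b η) 0 := by
    have h1 : ∀ i, fs k p Q X (b + 1) (η' i) ∈ deg (Q := Q) (grad k p b η) 0 := by
      intro i
      apply fs_mem_deg
      intro x hx j
      rw [Pi.zero_apply, ZMod.intCast_zmod_eq_zero_iff_dvd]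
      have h2 : (p : ℤ) ^ b ∣ x - η :=
        ((hx.of_dvd (pow_dvd_pow _ (Nat.le_succ b))).trans (hη i)).symm.dvd
      have h3 := pow_dvd_pow_of_dvd h2 (j : ℕ)
      rw [← pow_mul, mul_comm b] at h3
      exact_mod_cast h3
    have h2 := prod_mem_deg univ (fun i _ => h1 i)
    rw [Finset.sum_const_zero] at h2
    have h3 := prod_mem_deg (range k) (fun _ _ => h2)
    rw [Finset.sum_const_zero, Finset.prod_const, Finset.card_range] at h3
    exact h3
  have hFdeg : ∀ z ∈ S, F z ∈ deg (grad k p b η) (α z) := by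
    intro z _
    have h1 := prod_mem_deg (Q := Q) (π := grad k p b η) univ
      (α := fun i : Fin k => fun j : Fin (k + 1) =>
        (((z i - η) ^ (j : ℕ) : ℤ) : ZMod (p ^ ((j : ℕ) * b))))
      (f := fun i => fs k p Q X (k * b) (z i)) (fun i _ => by
        apply fs_mem_deg
        intro x hx j
        rw [ZMod.intCast_eq_intCast_iff]
        push_cast
        exact ((hx.of_dvd (hdvd j)).sub_right η).pow _)
    have h2 := mul_mem_deg h1 hGdeg
    rw [add_zero] at h2
    have h3 : α z = ∑ i : Fin k, fun j : Fin (k + 1) =>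
        (((z i - η) ^ (j : ℕ) : ℤ) : ZMod (p ^ ((j : ℕ) * b))) := by
      funext j
      simp only [hα, Finset.sum_apply, Int.cast_sum]
    rw [h3]
    exact h2
  have hcard : ∀ β, Set.ncard {z | z ∈ S ∧ α z = β} ≤ p ^ ((a + b) * ∑ j ∈ range k, j) := by
    intro β
    have : {z | z ∈ S ∧ α z = β} = ((S.filter (fun z => α z = β) : Finset (Fin k → ℤ)) :
      Set (Fin k → ℤ)) := by ext; simp
    rw [this, Set.ncard_coe_finset]
    apply powsum_fiber_card hp hkp hk hab hb hξ hinj η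
    · intro z hz i
      have h1 := Fintype.mem_piFinset.1 (Finset.mem_filter.1 hz).1 i
      obtain ⟨h2, h3⟩ := Finset.mem_filter.1 h1
      rw [Finset.mem_Ico] at h2
      exact ⟨h2.1, h2.2, h3⟩
    · intro z hz z' hz' j hj
      have h1 := (Finset.mem_filter.1 hz).2.trans (Finset.mem_filter.1 hz').2.symm
      have h2 := congrFun h1 ⟨j, by omega⟩
      simp only [hα] at h2
      rw [ZMod.intCast_eq_intCast_iff] at h2
      exact_mod_cast h2
  have hortho := sum_norm_sq_le_of_deg (Q := Q) (grad_eq_zero hQ) S F α hFdeg _ hcard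
  have hFav : ∀ z ∈ S, av (fun u => ‖F z u‖ ^ 2) ≤ k * B := by
    intro z hz
    calc av (fun u => ‖F z u‖ ^ 2) ≤ av (fun u => ∑ i, ‖fs k p Q X (k * b) (z i) u‖ ^ (2 * k) *
        ∏ i, ‖fs k p Q X (b + 1) (η' i) u‖ ^ (2 * k)) := by
          apply av_mono
          intro u
          simp only [hF, Pi.mul_apply, norm_mul, mul_pow, hGn]
          rw [← Finset.sum_mul]
          refine mul_le_mul_of_nonneg_right ?_
            (Finset.prod_nonneg fun i _ => pow_nonneg (norm_nonneg _) _)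
          simp only [Finset.prod_apply, norm_prod, ← Finset.prod_pow]
          refine (prod_le_sum_pow (by omega) _ fun i => by positivity).trans (le_of_eq ?_)
          exact Finset.sum_congr rfl fun i _ => by rw [← pow_mul]
      _ = ∑ i, av (fun u => ‖fs k p Q X (k * b) (z i) u‖ ^ (2 * k) *
        ∏ i, ‖fs k p Q X (b + 1) (η' i) u‖ ^ (2 * k)) := av_sum _ _
      _ ≤ ∑ _i : Fin k, B := Finset.sum_le_sum fun i _ => by
          apply hB i
          have h1 := Fintype.mem_piFinset.1 hz i
          exact (Finset.mem_filter.1 h1).2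
      _ = k * B := by simp
  have hScard : (#S : ℝ) ≤ (p : ℝ) ^ (k * (k * b - a)) := by
    have h1 : #S ≤ p ^ (k * (k * b - a)) := by
      rw [hS, Fintype.card_piFinset]
      calc ∏ i, #(Z i) ≤ ∏ _i : Fin k, p ^ (k * b - a) := Finset.prod_le_prod' fun i _ =>
            (card_resid_le hp.pos hkb _).trans (Nat.pow_le_pow_right hp.pos (by omega))
        _ = _ := by simp [← pow_mul, mul_comm]
    exact_mod_cast h1
  have hlhs : av (fun u => (∏ i, ‖fs k p Q X (a + 1) (ξ i) u‖ ^ 2) *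
        ∏ i, ‖fs k p Q X (b + 1) (η' i) u‖ ^ (2 * k)) ≤
      ((p ^ ((a + b) * ∑ j ∈ range k, j) : ℕ) : ℝ) * ∑ z ∈ S, av (fun u => ‖F z u‖ ^ 2) := by
    have h1 : ∀ u, (∏ i, ‖fs k p Q X (a + 1) (ξ i) u‖ ^ 2) *
        ∏ i, ‖fs k p Q X (b + 1) (η' i) u‖ ^ (2 * k) = ‖∑ z ∈ S, F z u‖ ^ 2 := by
      intro u
      rw [← hsum, norm_mul, mul_pow, hGn, norm_prod, Finset.prod_pow]
    simp_rw [h1]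
    unfold av
    rw [← Finset.sum_div, ← mul_div_assoc]
    gcongr
  refine hlhs.trans ?_
  push_cast
  gcongr
  calc ∑ z ∈ S, av (fun u => ‖F z u‖ ^ 2) ≤ ∑ _z ∈ S, (k * B : ℝ) := Finset.sum_le_sum hFav
    _ = #S * (k * B) := by simp
    _ ≤ _ := by
      rcases S.eq_empty_or_nonempty with he | ⟨z, hz⟩
      · have hBn : 0 ≤ (k : ℝ) * B := by
          refine mul_nonneg (by positivity) (le_trans (av_nonneg fun u => ?_)
            (hB ⟨0, by omega⟩ _ rfl))
          positivity
        gcongr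
      · have : 0 ≤ (k : ℝ) * B := (av_nonneg fun u => by positivity).trans (hFav z hz)
        gcongr

end Sums

/-- Admissible configurations of residues for the efficient congruencing mean values. -/
def Adm (p a : ℕ) {k : ℕ} (ξ : Fin k → ℤ) (η : ℤ) : Prop :=
  (∀ i j, ξ i ≡ ξ j [ZMOD (p : ℤ) ^ a]) ∧
  (∀ i j, i ≠ j → ¬ ξ i ≡ ξ j [ZMOD (p : ℤ) ^ (a + 1)]) ∧ ∀ i, ¬ ξ i ≡ η [ZMOD (p : ℤ)]

/-- `T` bounds all the mixed mean values at levels `a, b`. -/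
def IB (k p Q : ℕ) [NeZero Q] (X a b : ℕ) (T : ℝ) : Prop :=
  ∀ (ξ : Fin k → ℤ) (η : ℤ), Adm p a ξ η →
    av (fun u => (∏ i, ‖fs k p Q X (a + 1) (ξ i) u‖ ^ 2) * ‖fs k p Q X b η u‖ ^ (2 * k * k)) ≤ T

section Steps
variable {k p Q : ℕ} [NeZero Q] {X : ℕ}

lemma av_narrow_broad (hp : p.Prime) (hk : 2 ≤ k) {a b : ℕ} (hb : 1 ≤ b) {ξ : Fin k → ℤ} {η : ℤ}
    (hA : Adm p a ξ η) {T1 T2 : ℝ} (hT1 : 0 ≤ T1) (hT2 : 0 ≤ T2) (h1 : IB k p Q X a (b + 1) T1)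
    (h2 : ∀ η' : Fin k → ℤ, (∀ i, η' i ≡ η [ZMOD (p : ℤ) ^ b]) →
      (∀ i j, i ≠ j → ¬ η' i ≡ η' j [ZMOD (p : ℤ) ^ (b + 1)]) →
      av (fun u => (∏ i, ‖fs k p Q X (a + 1) (ξ i) u‖ ^ 2) *
        ∏ i, ‖fs k p Q X (b + 1) (η' i) u‖ ^ (2 * k)) ≤ T2) :
    av (fun u => (∏ i, ‖fs k p Q X (a + 1) (ξ i) u‖ ^ 2) * ‖fs k p Q X b η u‖ ^ (2 * k * k)) ≤
      (2 * k : ℝ) ^ (2 * k * k) * (p * T1) + (2 * p : ℝ) ^ (2 * k * k) * ((p : ℝ) ^ k * T2) := by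
  classical
  set C := resid p b (b + 1) η with hC
  have hCcard : #C ≤ p := by
    have := card_resid_le hp.pos (Nat.le_succ b) η
    simpa using this
  set A : (Fin (k + 1) → ZMod Q) → ℝ := fun u => ∏ i, ‖fs k p Q X (a + 1) (ξ i) u‖ ^ 2 with hAdef
  have hA0 : ∀ u, 0 ≤ A u := fun u => Finset.prod_nonneg fun i _ => by positivity
  have hpt : ∀ u, A u * ‖fs k p Q X b η u‖ ^ (2 * k * k) ≤
      (2 * k : ℝ) ^ (2 * k * k) * ∑ c : C, A u * ‖fs k p Q X (b + 1) c u‖ ^ (2 * k * k) +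
      (2 * p : ℝ) ^ (2 * k * k) * ∑ τ : Fin k ↪ C,
        A u * ∏ i, ‖fs k p Q X (b + 1) (τ i) u‖ ^ (2 * k) := by
    intro u
    have e1 : ‖fs k p Q X b η u‖ ≤ ∑ c : C, ‖fs k p Q X (b + 1) c u‖ := by
      rw [fs_split hp.pos (Nat.le_succ b), ← Finset.sum_coe_sort]
      exact norm_sum_le _ _
    have e2 := sum_pow_le_max_add_distinct (fun c : C => ‖fs k p Q X (b + 1) c u‖)
      (fun c => norm_nonneg _) k (2 * k) p (by omega) (by omega) (by simpa using hCcard) hp.one_lt.le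
    have e3 : ‖fs k p Q X b η u‖ ^ (2 * k * k) ≤ _ := (pow_le_pow_left₀ (norm_nonneg _) e1 _).trans e2
    refine (mul_le_mul_of_nonneg_left e3 (hA0 u)).trans (le_of_eq ?_)
    rw [← Finset.mul_sum, ← Finset.mul_sum]
    ring
  refine (av_mono hpt).trans ?_
  rw [av_add, av_const_mul, av_const_mul, av_sum, av_sum]
  gcongr
  · calc _ ≤ ∑ _c : C, T1 := by
          refine Finset.sum_le_sum fun c _ => h1 ξ c ⟨hA.1, hA.2.1, fun i hi => hA.2.2 i ?_⟩
          have h3 := (Finset.mem_filter.1 c.2).2.of_dvd (dvd_pow_self (p : ℤ) (by omega : b ≠ 0))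
          exact hi.trans h3
      _ = #C * T1 := by simp
      _ ≤ p * T1 := by gcongr
  · calc _ ≤ ∑ _τ : Fin k ↪ C, T2 := by
          refine Finset.sum_le_sum fun τ _ => h2 _ (fun i => (Finset.mem_filter.1 (τ i).2).2) ?_
          intro i j hij h
          exact hij (τ.injective (Subtype.ext (resid_distinct (τ i).2 (τ j).2 h)))
      _ = (Fintype.card (Fin k ↪ C) : ℝ) * T2 := by simp
      _ ≤ (p : ℝ) ^ k * T2 := by
          gcongr
          have : Fintype.card (Fin k ↪ C) ≤ p ^ k := by
            rw [Fintype.card_embedding_eq]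
            simp only [Fintype.card_fin, Fintype.card_coe]
            exact (Nat.descFactorial_le_pow _ _).trans (Nat.pow_le_pow_left hCcard _)
          exact_mod_cast this

lemma av_lift_le (hp : p.Prime) (hkp : k < p) (hk : 2 ≤ k) {a b : ℕ} (hab : a ≤ b)
    (hb : 1 ≤ b) {ξ : Fin k → ℤ} {η : ℤ} (hA : Adm p a ξ η) {η' : Fin k → ℤ}
    (hη : ∀ i, η' i ≡ η [ZMOD (p : ℤ) ^ b])
    (hη' : ∀ i j, i ≠ j → ¬ η' i ≡ η' j [ZMOD (p : ℤ) ^ (b + 1)])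
    (hQ : ∀ j ≤ k, p ^ (j * b) ∣ Q) {T JB : ℝ} (hT : IB k p Q X b (k * b) T)
    (hJB : ∀ ζ : ℤ, av (fun u => ‖fs k p Q X (b + 1) ζ u‖ ^ (2 * (k * (k + 1)))) ≤ JB) :
    av (fun u => (∏ i, ‖fs k p Q X (a + 1) (ξ i) u‖ ^ 2) *
        ∏ i, ‖fs k p Q X (b + 1) (η' i) u‖ ^ (2 * k)) ≤
      (p : ℝ) ^ ((a + b) * ∑ j ∈ range k, j) * ((p : ℝ) ^ (k * (k * b - a)) *
        (k * (T ^ (1 / k : ℝ) * (k * JB) ^ (1 - 1 / k : ℝ)))) := by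
  refine av_prod_le_of_lift hp hkp hk hab hb hA.1 hA.2.1 hη hQ ?_
  intro i z hz
  have hk2 : (2 : ℝ) ≤ k := by exact_mod_cast hk
  have hk0 : (0 : ℝ) < k := by linarith
  have hθ0 : (0 : ℝ) < 1 / k := by positivity
  have hθ1 : (1 / k : ℝ) < 1 := by rw [div_lt_one hk0]; linarith
  set g : (Fin (k + 1) → ZMod Q) → ℝ := fun u => ∏ i, ‖fs k p Q X (b + 1) (η' i) u‖ with hg
  have hg0 : ∀ u, 0 ≤ g u := fun u => Finset.prod_nonneg fun i _ => norm_nonneg _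
  have hAdm : Adm p b η' z := by
    refine ⟨fun i j => (hη i).trans (hη j).symm, hη', fun l hl => hA.2.2 i ?_⟩
    have e1 := hz.of_dvd (dvd_pow_self (p : ℤ) (by omega : a + 1 ≠ 0))
    have e2 := (hη l).of_dvd (dvd_pow_self (p : ℤ) (by omega : b ≠ 0))
    exact e1.symm.trans (hl.symm.trans e2)
  have hF := hT η' z hAdm
  have hG : av (fun u => g u ^ (2 * (k + 1))) ≤ k * JB := by
    calc av (fun u => g u ^ (2 * (k + 1))) ≤
        av (fun u => ∑ i, ‖fs k p Q X (b + 1) (η' i) u‖ ^ (2 * (k * (k + 1)))) := by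
          refine av_mono fun u => ?_
          rw [hg, ← Finset.prod_pow]
          refine (prod_le_sum_pow (by omega) _ fun i => by positivity).trans (le_of_eq ?_)
          exact Finset.sum_congr rfl fun i _ => by rw [← pow_mul]; congr 1; ring
      _ = ∑ i, av (fun u => ‖fs k p Q X (b + 1) (η' i) u‖ ^ (2 * (k * (k + 1)))) := av_sum _ _
      _ ≤ ∑ _i : Fin k, JB := Finset.sum_le_sum fun i _ => hJB _
      _ = k * JB := by simp
  have hF0 : ∀ u, 0 ≤ (∏ i, ‖fs k p Q X (b + 1) (η' i) u‖ ^ 2) *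
      ‖fs k p Q X (k * b) z u‖ ^ (2 * k * k) := fun u =>
    mul_nonneg (Finset.prod_nonneg fun i _ => by positivity) (by positivity)
  have hG0 : ∀ u, 0 ≤ g u ^ (2 * (k + 1)) := fun u => pow_nonneg (hg0 u) _
  have hpt : ∀ u, ‖fs k p Q X (k * b) z u‖ ^ (2 * k) *
        ∏ i, ‖fs k p Q X (b + 1) (η' i) u‖ ^ (2 * k) =
      ((∏ i, ‖fs k p Q X (b + 1) (η' i) u‖ ^ 2) * ‖fs k p Q X (k * b) z u‖ ^ (2 * k * k)) ^
        (1 / k : ℝ) * (g u ^ (2 * (k + 1))) ^ (1 - 1 / k : ℝ) := by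
    intro u
    rw [Finset.prod_pow, Finset.prod_pow]
    change _ * g u ^ (2 * k) = (g u ^ 2 * _) ^ _ * _
    rw [Real.mul_rpow (by positivity) (by positivity), pow_mul _ (2 * k) k]
    have e1 : ((‖fs k p Q X (k * b) z u‖ ^ (2 * k)) ^ k) ^ (1 / k : ℝ) =
        ‖fs k p Q X (k * b) z u‖ ^ (2 * k) := by
      rw [one_div]
      exact Real.pow_rpow_inv_natCast (by positivity) (by omega)
    rw [e1]
    have e2 : (g u ^ 2) ^ (1 / k : ℝ) * (g u ^ (2 * (k + 1))) ^ (1 - 1 / k : ℝ) =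
        g u ^ (2 * k) := by
      rw [← Real.rpow_natCast, ← Real.rpow_natCast, ← Real.rpow_natCast, ← Real.rpow_mul (hg0 u),
        ← Real.rpow_mul (hg0 u), ← Real.rpow_add_of_nonneg (hg0 u)]
      · congr 1
        push_cast
        field_simp
        ring
      · positivity
      · have : 0 ≤ (1 - 1 / k : ℝ) := by linarith
        positivity
    rw [← e2]; ring
  calc _ = _ := congrArg av (funext hpt)
    _ ≤ _ := av_holder hF0 hG0 hθ0 hθ1
    _ ≤ _ := by
      have h3 : 0 ≤ (1 - 1 / k : ℝ) := by linarith
      have h1 := av_nonneg hF0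
      have h2 := av_nonneg hG0
      have hT0 : 0 ≤ T := h1.trans hF
      gcongr

lemma av_mixed_le (hk : 2 ≤ k) {a b : ℕ} {JA JB : ℝ}
    (hJA : ∀ ζ : ℤ, av (fun u => ‖fs k p Q X (a + 1) ζ u‖ ^ (2 * (k * (k + 1)))) ≤ JA)
    (hJB : ∀ ζ : ℤ, av (fun u => ‖fs k p Q X b ζ u‖ ^ (2 * (k * (k + 1)))) ≤ JB) :
    IB k p Q X a b (k * (JA ^ (1 / (k + 1) : ℝ) * JB ^ (1 - 1 / (k + 1) : ℝ))) := by
  intro ξ η _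
  have hk2 : (2 : ℝ) ≤ k := by exact_mod_cast hk
  have hθ0 : (0 : ℝ) < 1 / (k + 1) := by positivity
  have hθ1 : (1 / (k + 1) : ℝ) < 1 := by rw [div_lt_one (by positivity)]; linarith
  calc _ ≤ av (fun u => ∑ i, (‖fs k p Q X (a + 1) (ξ i) u‖ ^ (2 * (k * (k + 1)))) ^
        (1 / (k + 1) : ℝ) * (‖fs k p Q X b η u‖ ^ (2 * (k * (k + 1)))) ^
        (1 - 1 / (k + 1) : ℝ)) := by
        refine av_mono fun u => ?_
        rw [← Finset.sum_mul]
        have e1 : ∀ y : ℝ, 0 ≤ y → (y ^ (2 * (k * (k + 1)))) ^ (1 / (k + 1) : ℝ) = (y ^ 2) ^ k := by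
          intro y hy
          rw [← Real.rpow_natCast, ← Real.rpow_mul hy, ← pow_mul, ← Real.rpow_natCast]
          congr 1
          push_cast
          field_simp
        have e2 : ∀ y : ℝ, 0 ≤ y → (y ^ (2 * (k * (k + 1)))) ^ (1 - 1 / (k + 1) : ℝ) =
            y ^ (2 * k * k) := by
          intro y hy
          rw [← Real.rpow_natCast, ← Real.rpow_mul hy, ← Real.rpow_natCast]
          congr 1
          push_cast
          field_simp
          ring
        rw [e2 _ (norm_nonneg _)]
        refine mul_le_mul_of_nonneg_right ?_ (by positivity)
        refine (prod_le_sum_pow (by omega) _ fun i => by positivity).trans (le_of_eq ?_)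
        exact Finset.sum_congr rfl fun i _ => (e1 _ (norm_nonneg _)).symm
    _ = ∑ i, av (fun u => (‖fs k p Q X (a + 1) (ξ i) u‖ ^ (2 * (k * (k + 1)))) ^
        (1 / (k + 1) : ℝ) * (‖fs k p Q X b η u‖ ^ (2 * (k * (k + 1)))) ^
        (1 - 1 / (k + 1) : ℝ)) := av_sum _ _
    _ ≤ ∑ _i : Fin k, (JA ^ (1 / (k + 1) : ℝ) * JB ^ (1 - 1 / (k + 1) : ℝ)) := by
        refine Finset.sum_le_sum fun i _ => ?_
        refine (av_holder (fun u => by positivity) (fun u => by positivity) hθ0 hθ1).trans ?_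
        have h1 := hJA (ξ i)
        have h2 := hJB η
        have h3 : 0 ≤ (1 - 1 / (k + 1) : ℝ) := by linarith
        have h4 : 0 ≤ av (fun u => ‖fs k p Q X (a + 1) (ξ i) u‖ ^ (2 * (k * (k + 1)))) :=
          av_nonneg fun u => by positivity
        have h5 : 0 ≤ av (fun u => ‖fs k p Q X b η u‖ ^ (2 * (k * (k + 1)))) :=
          av_nonneg fun u => by positivity
        have hJA0 : 0 ≤ JA := h4.trans h1
        gcongr
    _ = _ := by simp

/-- The first step, from the full mean value to the mixed ones. -/
lemma J_le_of_IB (hp : p.Prime) (hk : 2 ≤ k) (hQ : 2 * (k * (k + 1)) * X ^ k < Q) {JB T : ℝ}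
    (hJB0 : 0 ≤ JB) (hT0 : 0 ≤ T)
    (hJB : ∀ ζ : ℤ, av (fun u => ‖fs k p Q X 1 ζ u‖ ^ (2 * (k * (k + 1)))) ≤ JB)
    (hT : IB k p Q X 0 1 T) :
    (J (k * (k + 1)) k X : ℝ) ≤ (2 * (k + 1 : ℕ) : ℝ) ^ (2 * k * (k + 1)) * (p * JB) +
      (2 * p : ℝ) ^ (2 * k * (k + 1)) * ((p : ℝ) ^ (k + 1) * ((k + 1) * T)) := by
  classical
  rw [J_eq_av (Q := Q) (k * (k + 1)) hQ]
  set C := resid p 0 1 0 with hC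
  have hCcard : #C ≤ p := by
    have := card_resid_le hp.pos (Nat.zero_le 1) 0
    simpa using this
  have hfull : ∀ u : Fin (k + 1) → ZMod Q,
      ∑ x ∈ Icc (1 : ℤ) X, ch (nu k x) u = fs k p Q X 0 0 u := by
    intro u
    simp [fs, Int.modEq_one]
  have hpt : ∀ u : Fin (k + 1) → ZMod Q,
      ‖∑ x ∈ Icc (1 : ℤ) X, ch (nu k x) u‖ ^ (2 * (k * (k + 1))) ≤
      (2 * (k + 1 : ℕ) : ℝ) ^ (2 * k * (k + 1)) *
        ∑ c : C, ‖fs k p Q X 1 c u‖ ^ (2 * (k * (k + 1))) +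
      (2 * p : ℝ) ^ (2 * k * (k + 1)) * ∑ τ : Fin (k + 1) ↪ C,
        ∏ i, ‖fs k p Q X 1 (τ i) u‖ ^ (2 * k) := by
    intro u
    rw [hfull]
    have e1 : ‖fs k p Q X 0 0 u‖ ≤ ∑ c : C, ‖fs k p Q X 1 c u‖ := by
      rw [fs_split hp.pos (Nat.zero_le 1), ← Finset.sum_coe_sort]
      exact norm_sum_le _ _
    have e2 := sum_pow_le_max_add_distinct (fun c : C => ‖fs k p Q X 1 c u‖)
      (fun c => norm_nonneg _) (k + 1) (2 * k) p (by omega) (by omega) (by simpa using hCcard)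
      hp.one_lt.le
    rw [← mul_assoc 2 k (k + 1)]
    exact (pow_le_pow_left₀ (norm_nonneg _) e1 _).trans e2
  refine (av_mono hpt).trans ?_
  rw [av_add, av_const_mul, av_const_mul, av_sum, av_sum]
  gcongr
  · calc _ ≤ ∑ _c : C, JB := Finset.sum_le_sum fun c _ => hJB _
      _ = #C * JB := by simp
      _ ≤ p * JB := by gcongr
  · calc _ ≤ ∑ _τ : Fin (k + 1) ↪ C, ((k + 1) * T) := by
          refine Finset.sum_le_sum fun τ _ => ?_
          have hne : ∀ i j, i ≠ j → ¬ ((τ i : ℤ) ≡ τ j [ZMOD (p : ℤ) ^ 1]) := fun i j hij h =>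
            hij (τ.injective (Subtype.ext (resid_distinct (τ i).2 (τ j).2 h)))
          calc _ ≤ av (fun u => ∑ j : Fin (k + 1),
                (∏ i : Fin k, ‖fs k p Q X (0 + 1) (τ (j.succAbove i)) u‖ ^ 2) *
                  ‖fs k p Q X 1 (τ j) u‖ ^ (2 * k * k)) := by
                refine av_mono fun u => ?_
                set A : Fin (k + 1) → ℝ := fun i => ‖fs k p Q X 1 (τ i) u‖ with hAd
                have hA0 : ∀ i, 0 ≤ A i := fun i => norm_nonneg _
                change ∏ i, A i ^ (2 * k) ≤
                  ∑ j, (∏ i : Fin k, A (j.succAbove i) ^ 2) * A j ^ (2 * k * k)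
                obtain ⟨j, hj⟩ := Finite.exists_max A
                refine le_trans ?_ (Finset.single_le_sum (f := fun j =>
                  (∏ i : Fin k, A (j.succAbove i) ^ 2) * A j ^ (2 * k * k))
                  (fun l _ => mul_nonneg (Finset.prod_nonneg fun i _ => by have := hA0 (l.succAbove i); positivity)
                    (pow_nonneg (hA0 l) _)) (Finset.mem_univ j))
                rw [Fin.prod_univ_succAbove _ j]
                have h1 : ∏ i : Fin k, A (j.succAbove i) ^ (2 * k) ≤
                    ∏ i : Fin k, (A (j.succAbove i) ^ 2 * A j ^ (2 * k - 2)) := by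
                  refine Finset.prod_le_prod (fun i _ => pow_nonneg (hA0 _) _) fun i _ => ?_
                  have h2 := hj (j.succAbove i)
                  have h3 := hA0 (j.succAbove i)
                  calc A (j.succAbove i) ^ (2 * k) =
                      A (j.succAbove i) ^ 2 * A (j.succAbove i) ^ (2 * k - 2) := by
                        rw [← pow_add]; congr 1; omega
                    _ ≤ _ := by gcongr
                rw [Finset.prod_mul_distrib, Finset.prod_const, Finset.card_univ, Fintype.card_fin]
                  at h1
                calc _ ≤ A j ^ (2 * k) * ((∏ i : Fin k, A (j.succAbove i) ^ 2) *
                      (A j ^ (2 * k - 2)) ^ k) := by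
                      have := hA0 j
                      gcongr
                  _ = (∏ i : Fin k, A (j.succAbove i) ^ 2) *
                      (A j ^ (2 * k) * (A j ^ (2 * k - 2)) ^ k) := by ring
                  _ = _ := by
                      rw [← pow_mul, ← pow_add]
                      congr 2
                      obtain ⟨l, rfl⟩ : ∃ l, k = l + 2 := ⟨k - 2, by omega⟩
                      rw [show 2 * (l + 2) - 2 = 2 * l + 2 by omega]
                      ring
            _ = ∑ j : Fin (k + 1), av (fun u =>
                (∏ i : Fin k, ‖fs k p Q X (0 + 1) (τ (j.succAbove i)) u‖ ^ 2) *
                  ‖fs k p Q X 1 (τ j) u‖ ^ (2 * k * k)) := av_sum _ _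
            _ ≤ ∑ _j : Fin (k + 1), T := by
                refine Finset.sum_le_sum fun j _ => hT (fun i => τ (j.succAbove i)) (τ j) ⟨?_, ?_, ?_⟩
                · intro i i'; simp [Int.modEq_one]
                · intro i i' hii
                  exact hne _ _ fun h => hii (Fin.succAbove_right_injective h)
                · intro i h
                  refine hne _ _ (Fin.succAbove_ne j i) ?_
                  simpa using h
            _ = (k + 1) * T := by simp
      _ = (Fintype.card (Fin (k + 1) ↪ C) : ℝ) * ((k + 1) * T) := by simp
      _ ≤ (p : ℝ) ^ (k + 1) * ((k + 1) * T) := by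
          gcongr
          have : Fintype.card (Fin (k + 1) ↪ C) ≤ p ^ (k + 1) := by
            rw [Fintype.card_embedding_eq]
            simp only [Fintype.card_fin, Fintype.card_coe]
            exact (Nat.descFactorial_le_pow _ _).trans (Nat.pow_le_pow_left hCcard _)
          exact_mod_cast this

end Steps

section Stage
variable {k p Q : ℕ} [NeZero Q] {X : ℕ} {W ω η₀ : ℝ}

/-- The loss in the exponents in the iteration of efficient congruencing. -/
def zeta0 (k : ℕ) : ℝ := 2 * (4 * k ^ 2 + k + 5)

/-- `W` is the size of the full mean value, with exponent `ω`. -/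
structure Size (k p Q X : ℕ) [NeZero Q] (W ω η₀ : ℝ) : Prop where
  prime : p.Prime
  two_le : 2 ≤ k
  lt : k < p
  pos : 0 < W
  dvd : ∀ b, p ^ (k * b) ≤ X → p ^ (k * b) ∣ Q
  le_exp : 3 / 2 * k * (k + 1) + η₀ ≤ ω
  gain : 0 ≤ η₀
  const : (2 * k : ℝ) ^ (2 * k * k) ≤ p
  av_le : ∀ m m' ζ, p ^ m ≤ X → m ≤ m' →
    av (fun u => ‖fs k p Q X m' ζ u‖ ^ (2 * (k * (k + 1)))) ≤ W * (p : ℝ) ^ (2 - m * ω)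

def Stage (k p Q X : ℕ) [NeZero Q] (W Y : ℝ) (B : ℕ) : Prop :=
  ∀ a b, a ≤ b → 1 ≤ b → p ^ (b * B) ≤ X →
    IB k p Q X a b (W * (p : ℝ) ^ (zeta0 k - Y * b + (k * (k - 3) / 2) * a))

lemma IB.mono {a b : ℕ} {T T' : ℝ} (h : IB k p Q X a b T) (hT : T ≤ T') : IB k p Q X a b T' :=
  fun ξ η hA => (h ξ η hA).trans hT

namespace Size

lemma one_lt (h : Size k p Q X W ω η₀) : (1 : ℝ) < p := by exact_mod_cast h.prime.one_lt

lemma trivial_le (h : Size k p Q X W ω η₀) {a b : ℕ} (hab : a ≤ b) (hX : p ^ b ≤ X) :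
    IB k p Q X a b (W * (p : ℝ) ^ (3 - 3 / 2 * (k : ℝ) * a - 3 / 2 * (k : ℝ) ^ 2 * b)) := by
  have hk2 : (2 : ℝ) ≤ k := by exact_mod_cast h.two_le
  have hp1 := h.one_lt
  have hp0 : (0 : ℝ) < p := by linarith
  have hXa : p ^ a ≤ X := (Nat.pow_le_pow_right h.prime.pos hab).trans hX
  refine (av_mixed_le h.two_le (fun ζ => h.av_le a (a + 1) ζ hXa (by omega))
    (fun ζ => h.av_le b b ζ hX le_rfl)).mono ?_
  rw [Real.mul_rpow h.pos.le (by positivity), Real.mul_rpow h.pos.le (by positivity),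
    ← Real.rpow_mul hp0.le, ← Real.rpow_mul hp0.le]
  calc _ = k * ((W ^ (1 / (k + 1) : ℝ) * W ^ (1 - 1 / (k + 1) : ℝ)) *
        ((p : ℝ) ^ ((2 - a * ω) * (1 / (k + 1))) * (p : ℝ) ^ ((2 - b * ω) * (1 - 1 / (k + 1))))) := by
        ring
    _ = W * (k * (p : ℝ) ^ ((2 - a * ω) * (1 / (k + 1)) + (2 - b * ω) * (1 - 1 / (k + 1)))) := by
        rw [← Real.rpow_add h.pos, ← Real.rpow_add hp0, add_sub_cancel, Real.rpow_one]
        ring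
    _ ≤ W * ((p : ℝ) ^ (1 : ℝ) * (p : ℝ) ^ (2 - 3 / 2 * (k : ℝ) * a - 3 / 2 * (k : ℝ) ^ 2 * b)) := by
        have hW := h.pos
        have hkp : (k : ℝ) ≤ (p : ℝ) ^ (1 : ℝ) := by
          rw [Real.rpow_one]; exact_mod_cast h.lt.le
        gcongr
        · exact hp1.le
        · have h1 : 3 / 2 * k * (k + 1) ≤ ω := by linarith [h.le_exp, h.gain]
          have e1 : (2 - a * ω) * (1 / (k + 1)) + (2 - b * ω) * (1 - 1 / (k + 1)) =
            2 - (ω / (k + 1)) * a - (ω / (k + 1)) * k * b := by field_simp; ring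
          have h2 : 3 / 2 * k ≤ ω / (k + 1) := by
            rw [le_div_iff₀ (by positivity)]; exact h1
          rw [e1]
          have h3 : (3 / 2 * k) * a ≤ ω / (k + 1) * a := by gcongr
          have h4 : (3 / 2 * k) * k * b ≤ ω / (k + 1) * k * b := by gcongr
          linarith
    _ = _ := by rw [← Real.rpow_add hp0]; congr 2; ring

lemma stage_zero (h : Size k p Q X W ω η₀) : Stage k p Q X W (3 / 2 * k ^ 2) 1 := by
  intro a b hab _ hX
  rw [mul_one] at hX
  refine (h.trivial_le hab hX).mono ?_
  have hW := h.pos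
  have hk2 : (2 : ℝ) ≤ k := by exact_mod_cast h.two_le
  gcongr
  · exact h.one_lt.le
  · have ha : (0 : ℝ) ≤ a := by positivity
    unfold zeta0
    nlinarith [mul_nonneg ha (sq_nonneg (k : ℝ))]

lemma lift_le (h : Size k p Q X W ω η₀) {Y : ℝ} {B a b : ℕ} (hB : 1 ≤ B)
    (hS : Stage k p Q X W Y B) (hab : a ≤ b) (hb : 1 ≤ b) (hX : p ^ (k * b * B) ≤ X)
    {ξ : Fin k → ℤ} {η : ℤ} (hA : Adm p a ξ η) {η' : Fin k → ℤ}
    (hη : ∀ i, η' i ≡ η [ZMOD (p : ℤ) ^ b])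
    (hη' : ∀ i j, i ≠ j → ¬ η' i ≡ η' j [ZMOD (p : ℤ) ^ (b + 1)]) :
    av (fun u => (∏ i, ‖fs k p Q X (a + 1) (ξ i) u‖ ^ 2) *
        ∏ i, ‖fs k p Q X (b + 1) (η' i) u‖ ^ (2 * k)) ≤
      W * (p : ℝ) ^ (4 + zeta0 k / k - (Y + η₀ * (1 - 1 / k)) * b + (k * (k - 3) / 2) * a) := by
  have hk := h.two_le
  have hk2 : (2 : ℝ) ≤ k := by exact_mod_cast hk
  have hk0 : (0 : ℝ) < k := by linarith
  have hp1 := h.one_lt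
  have hp0 : (0 : ℝ) < p := by linarith
  have hX1 : p ^ (k * b) ≤ X :=
    (Nat.pow_le_pow_right h.prime.pos (Nat.le_mul_of_pos_right _ hB)).trans hX
  have hX2 : p ^ b ≤ X :=
    (Nat.pow_le_pow_right h.prime.pos (Nat.le_mul_of_pos_left _ (by omega))).trans hX1
  refine (av_lift_le h.prime h.lt hk hab hb hA hη hη'
    (fun j hj => (pow_dvd_pow p (Nat.mul_le_mul_right b hj)).trans (h.dvd b hX1))
    (hS b (k * b) (Nat.le_mul_of_pos_left _ (by omega)) (by nlinarith) hX)
    (fun ζ => h.av_le b (b + 1) ζ hX2 (by omega))).trans ?_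
  have hkp : (k : ℝ) ≤ (p : ℝ) ^ (1 : ℝ) := by
    rw [Real.rpow_one]; exact_mod_cast h.lt.le
  have hW := h.pos
  have hθ : (0 : ℝ) ≤ 1 - 1 / k := by
    rw [sub_nonneg, div_le_one hk0]; linarith
  have hsum : (((∑ j ∈ range k, j : ℕ)) : ℝ) = k * (k - 1) / 2 := by
    have := Finset.sum_range_id_mul_two k
    have h2 : (((∑ j ∈ range k, j : ℕ)) : ℝ) * 2 = k * (k - 1) := by
      have h3 : ((∑ j ∈ range k, j : ℕ) * 2 : ℕ) = k * (k - 1) := this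
      have h4 : (((∑ j ∈ range k, j : ℕ) * 2 : ℕ) : ℝ) = ((k * (k - 1) : ℕ) : ℝ) := by rw [h3]
      rw [Nat.cast_mul, Nat.cast_mul, Nat.cast_sub (by omega)] at h4
      exact_mod_cast h4
    linarith
  have hsub : ((k * (k * b - a) : ℕ) : ℝ) = k * (k * b - a) := by
    have : a ≤ k * b := hab.trans (Nat.le_mul_of_pos_left _ (by omega))
    push_cast [Nat.cast_sub this]; ring
  set E1 := zeta0 k - Y * ((k * b : ℕ) : ℝ) + (k * (k - 3) / 2 : ℝ) * b with hE1
  calc _ = (p : ℝ) ^ (((a + b : ℕ) : ℝ) * (k * (k - 1) / 2)) * ((p : ℝ) ^ (k * (k * b - a) : ℝ) *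
        (k * ((W * (p : ℝ) ^ E1) ^ (1 / k : ℝ) *
          (k * (W * (p : ℝ) ^ (2 - b * ω))) ^ (1 - 1 / k : ℝ)))) := by
        rw [← hsum, ← hsub, ← Nat.cast_mul, Real.rpow_natCast, Real.rpow_natCast]
    _ ≤ (p : ℝ) ^ (((a + b : ℕ) : ℝ) * (k * (k - 1) / 2)) * ((p : ℝ) ^ (k * (k * b - a) : ℝ) *
        ((p : ℝ) ^ (1 : ℝ) * ((W * (p : ℝ) ^ E1) ^ (1 / k : ℝ) *
          ((p : ℝ) ^ (1 : ℝ) * (W * (p : ℝ) ^ (2 - b * ω))) ^ (1 - 1 / k : ℝ)))) := by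
        gcongr
    _ = (W ^ (1 / k : ℝ) * W ^ (1 - 1 / k : ℝ)) * (p : ℝ) ^ (((a + b : ℕ) : ℝ) * (k * (k - 1) / 2)
          + k * (k * b - a) + 1 + E1 * (1 / k) + (3 - b * ω) * (1 - 1 / k)) := by
        rw [show (p : ℝ) ^ (1 : ℝ) * (W * (p : ℝ) ^ (2 - b * ω)) = W * (p : ℝ) ^ (3 - b * ω) by
          rw [mul_left_comm, ← Real.rpow_add hp0]; congr 2; ring]
        rw [Real.mul_rpow hW.le (by positivity), Real.mul_rpow hW.le (by positivity),
          ← Real.rpow_mul hp0.le, ← Real.rpow_mul hp0.le, Real.rpow_add hp0, Real.rpow_add hp0,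
          Real.rpow_add hp0, Real.rpow_add hp0]
        ring
    _ ≤ _ := by
        rw [← Real.rpow_add hW, add_sub_cancel, Real.rpow_one]
        refine mul_le_mul_of_nonneg_left (Real.rpow_le_rpow_of_exponent_le hp1.le ?_) hW.le
        · have h1 := mul_le_mul_of_nonneg_right h.le_exp hθ
          have e2 : (3 / 2 * k * (k + 1) + η₀) * (1 - 1 / k : ℝ) =
            3 / 2 * (k + 1) * (k - 1) + η₀ * (1 - 1 / k) := by field_simp
          have hb0 : (0 : ℝ) ≤ b := by positivity
          have h2 := mul_le_mul_of_nonneg_left h1 hb0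
          rw [e2] at h2
          have e3 : E1 * (1 / k) = zeta0 k / k - Y * b + (k - 3) / 2 * b := by
            rw [hE1]; push_cast; field_simp
          have e4 : (3 : ℝ) * (1 - 1 / k) ≤ 3 := by
            have : (0 : ℝ) ≤ 1 / k := by positivity
            linarith
          rw [e3]
          push_cast
          linarith only [h2, e4]

lemma stage_succ (h : Size k p Q X W ω η₀) {Y : ℝ} (hY : 3 ≤ Y) {B : ℕ} (hB : 1 ≤ B)
    (hS : Stage k p Q X W Y B) :
    Stage k p Q X W (Y + η₀ * (1 - 1 / k)) (k * B * (1 + ⌈Y + η₀ * (1 - 1 / k)⌉₊)) := by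
  have hk := h.two_le
  have hk2 : (2 : ℝ) ≤ k := by exact_mod_cast hk
  have hk0 : (0 : ℝ) < k := by linarith
  have hp1 := h.one_lt
  have hp0 : (0 : ℝ) < p := by linarith
  have hp2 : (2 : ℝ) ≤ p := by exact_mod_cast h.prime.two_le
  have hW := h.pos
  have hθ : (0 : ℝ) ≤ 1 - 1 / k := by
    rw [sub_nonneg, div_le_one hk0]; linarith
  set Y' := Y + η₀ * (1 - 1 / k) with hY'
  have hYY : Y ≤ Y' := by have := mul_nonneg h.gain hθ; linarith
  set g := ⌈Y'⌉₊ with hg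
  have hgY : Y' ≤ g := Nat.le_ceil _
  intro a b hab hb hX
  have hmain : ∀ r m : ℕ, m + r = g * b → IB k p Q X a (b + m)
      (W * (p : ℝ) ^ (zeta0 k - Y' * b + (k * (k - 3) / 2) * a - 3 * m)) := by
    intro r
    induction r with
    | zero =>
      intro m hm
      have hXm : p ^ (b + m) ≤ X := by
        refine (Nat.pow_le_pow_right h.prime.pos ?_).trans hX
        have : 1 ≤ k * B := Nat.mul_pos (by omega) hB
        calc b + m = 1 * (b * (1 + g)) := by rw [add_zero] at hm; rw [hm]; ring
          _ ≤ (k * B) * (b * (1 + g)) := Nat.mul_le_mul_right _ this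
          _ = _ := by ring
      refine (h.trivial_le (by omega) hXm).mono ?_
      refine mul_le_mul_of_nonneg_left (Real.rpow_le_rpow_of_exponent_le hp1.le ?_) hW.le
      · have hm' : (m : ℝ) = g * b := by exact_mod_cast (by simpa using hm : m = g * b)
        have ha : (0 : ℝ) ≤ a := by positivity
        have hb0 : (0 : ℝ) ≤ b := by positivity
        have hm0 : (0 : ℝ) ≤ m := by positivity
        have h1 : Y' * b ≤ m := by rw [hm']; gcongr
        have h4 : (6 : ℝ) ≤ 3 / 2 * k ^ 2 := by nlinarith
        have h5 : 6 * (b + m : ℝ) ≤ 3 / 2 * k ^ 2 * (b + m) := by gcongr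
        have h6 : 0 ≤ (k * (k - 3) / 2 + 3 / 2 * k : ℝ) * a := by
          have : (0 : ℝ) ≤ k * (k - 3) / 2 + 3 / 2 * k := by nlinarith
          positivity
        have h7 : (3 : ℝ) ≤ zeta0 k := by unfold zeta0; nlinarith
        push_cast
        linarith
    | succ r ih =>
      intro m hm ξ η hA
      have hXm : p ^ (k * (b + m) * B) ≤ X := by
        refine (Nat.pow_le_pow_right h.prime.pos ?_).trans hX
        have hmg : m ≤ g * b := by omega
        calc k * (b + m) * B ≤ k * (b + g * b) * B := by gcongr
          _ = _ := by ring
      have h1 := ih (m + 1) (by omega)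
      have h2 := av_narrow_broad h.prime hk (by omega : 1 ≤ b + m) hA (by positivity)
        (by positivity) h1 (fun η' e1 e2 => h.lift_le hB hS (by omega) (by omega) hXm hA e1 e2)
      refine h2.trans ?_
      set E := zeta0 k - Y' * b + (k * (k - 3) / 2) * a - 3 * m with hE
      have t1 : (2 * k : ℝ) ^ (2 * k * k) * (p * (W * (p : ℝ) ^
          (zeta0 k - Y' * b + (k * (k - 3) / 2) * a - 3 * ((m + 1 : ℕ) : ℝ)))) ≤
          W * (p : ℝ) ^ (E - 1) := by
        calc _ ≤ (p : ℝ) ^ (1 : ℝ) * ((p : ℝ) ^ (1 : ℝ) * (W * (p : ℝ) ^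
          (zeta0 k - Y' * b + (k * (k - 3) / 2) * a - 3 * ((m + 1 : ℕ) : ℝ)))) := by
              have := h.const
              rw [Real.rpow_one]
              gcongr
          _ = _ := by
              rw [mul_left_comm _ W, mul_left_comm _ W, ← Real.rpow_add hp0, ← Real.rpow_add hp0]
              congr 2
              rw [hE]; push_cast; ring
      have t2 : (2 * p : ℝ) ^ (2 * k * k) * ((p : ℝ) ^ k * (W * (p : ℝ) ^ (4 + zeta0 k / k -
          Y' * ((b + m : ℕ) : ℝ) + (k * (k - 3) / 2) * a))) ≤ W * (p : ℝ) ^ (E - 1) := by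
        calc _ ≤ ((p : ℝ) ^ (2 : ℝ)) ^ (2 * k * k) * ((p : ℝ) ^ k * (W * (p : ℝ) ^ (4 + zeta0 k / k -
          Y' * ((b + m : ℕ) : ℝ) + (k * (k - 3) / 2) * a))) := by
              gcongr
              rw [Real.rpow_two]; nlinarith
          _ = W * (p : ℝ) ^ (4 * k ^ 2 + k + (4 + zeta0 k / k -
          Y' * ((b + m : ℕ) : ℝ) + (k * (k - 3) / 2) * a)) := by
              rw [← Real.rpow_natCast, ← Real.rpow_mul hp0.le, ← Real.rpow_natCast,
                mul_left_comm _ W, mul_left_comm _ W, ← Real.rpow_add hp0, ← Real.rpow_add hp0]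
              congr 2
              push_cast; ring
          _ ≤ _ := by
              gcongr
              · exact hp1.le
              · have h3 : zeta0 k / k ≤ zeta0 k / 2 := by
                  have : 0 ≤ zeta0 k := by unfold zeta0; positivity
                  gcongr
                have h4 : (3 : ℝ) * m ≤ Y' * m := by gcongr; linarith
                have h5 : zeta0 k = 2 * (4 * k ^ 2 + k + 5) := rfl
                rw [hE]
                push_cast
                linarith
      calc _ ≤ W * (p : ℝ) ^ (E - 1) + W * (p : ℝ) ^ (E - 1) := add_le_add t1 t2
        _ = W * (2 * (p : ℝ) ^ (E - 1)) := by ring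
        _ ≤ W * ((p : ℝ) ^ (1 : ℝ) * (p : ℝ) ^ (E - 1)) := by
            gcongr
            rwa [Real.rpow_one]
        _ = _ := by rw [← Real.rpow_add hp0]; congr 2; ring
  have := hmain (g * b) 0 (by simp)
  simpa using this

/-- Levels reached after `n` steps. -/
def lvl (k : ℕ) (η₀ : ℝ) : ℕ → ℕ
  | 0 => 1
  | n + 1 => k * lvl k η₀ n * (1 + ⌈3 / 2 * (k : ℝ) ^ 2 + n * (η₀ * (1 - 1 / k)) +
      η₀ * (1 - 1 / k)⌉₊)

lemma stage (h : Size k p Q X W ω η₀) (n : ℕ) :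
    1 ≤ lvl k η₀ n ∧
    Stage k p Q X W (3 / 2 * (k : ℝ) ^ 2 + n * (η₀ * (1 - 1 / k))) (lvl k η₀ n) := by
  have hk := h.two_le
  have hk2 : (2 : ℝ) ≤ k := by exact_mod_cast hk
  have hθ : (0 : ℝ) ≤ 1 - 1 / k := by
    rw [sub_nonneg, div_le_one (by linarith)]; linarith
  induction n with
  | zero => exact ⟨le_rfl, by simpa [lvl] using h.stage_zero⟩
  | succ n ih =>
    refine ⟨Nat.mul_pos (Nat.mul_pos (by omega) ih.1) (by omega), ?_⟩
    have h3 : (3 : ℝ) ≤ 3 / 2 * (k : ℝ) ^ 2 + n * (η₀ * (1 - 1 / k)) := by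
      have := mul_nonneg (Nat.cast_nonneg n : (0 : ℝ) ≤ n) (mul_nonneg h.gain hθ)
      nlinarith
    have := h.stage_succ h3 ih.1 ih.2
    simp only [lvl]
    convert this using 1
    push_cast; ring

end Size
end Stage

lemma J_le (s k n : ℕ) : J s k n ≤ n ^ (2 * s) := by
  unfold J
  refine (Finset.card_filter_le _ _).trans ?_
  simp [Finset.card_product, Fintype.card_piFinset, two_mul, pow_add]

/-- `ω` is an admissible exponent in Vinogradov's mean value theorem. -/
def MeanExp (k : ℕ) (ω : ℝ) : Prop :=
  ∃ C : ℝ, 1 ≤ C ∧ ∀ n : ℕ, 1 ≤ n → (J (k * (k + 1)) k n : ℝ) ≤ C * (n : ℝ) ^ ω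

lemma MeanExp.mono {k : ℕ} {ω ω' : ℝ} (h : MeanExp k ω) (hω : ω ≤ ω') : MeanExp k ω' := by
  obtain ⟨C, hC, h⟩ := h
  refine ⟨C, hC, fun n hn => (h n hn).trans ?_⟩
  have : (1 : ℝ) ≤ n := by exact_mod_cast hn
  gcongr

lemma meanExp_trivial (k : ℕ) : MeanExp k (2 * k * (k + 1)) := by
  refine ⟨1, le_rfl, fun n _ => ?_⟩
  have := J_le (k * (k + 1)) k n
  rw [one_mul, show (2 * k * (k + 1) : ℝ) = ((2 * (k * (k + 1)) : ℕ) : ℝ) by push_cast; ring,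
    Real.rpow_natCast]
  exact_mod_cast this

lemma exists_size {k : ℕ} (hk : 2 ≤ k) {η₀ ω C : ℝ} (hη : 0 ≤ η₀)
    (hω : 3 / 2 * k * (k + 1) + η₀ ≤ ω)
    (hJ : ∀ n : ℕ, 1 ≤ n → (J (k * (k + 1)) k n : ℝ) ≤ C * (n : ℝ) ^ ω)
    {p X : ℕ} (hp : p.Prime) (hkp : k < p) (hX : 1 ≤ X) (hCp : C ≤ p)
    (hc1 : (2 * k : ℝ) ^ (2 * k * k) ≤ p) (hc2 : (2 : ℝ) ^ ω ≤ p) :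
    ∃ (Q : ℕ) (_ : NeZero Q), 2 * (k * (k + 1)) * X ^ k < Q ∧
      Size k p Q X ((X : ℝ) ^ ω) ω η₀ := by
  set R := 2 * (k * (k + 1)) * X ^ k with hR
  have hQ : R < p ^ R := Nat.lt_pow_self hp.one_lt
  have hne : NeZero (p ^ R) := ⟨(pow_pos hp.pos _).ne'⟩
  have hXr : (1 : ℝ) ≤ X := by exact_mod_cast hX
  have hXR : X ≤ R := by
    calc X = X ^ 1 := (pow_one X).symm
      _ ≤ X ^ k := Nat.pow_le_pow_right hX (by omega)
      _ ≤ R := Nat.le_mul_of_pos_left _ (by positivity)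
  have hp0 : (0 : ℝ) < p := by exact_mod_cast hp.pos
  have hω0 : 0 ≤ ω := le_trans (by positivity) hω
  refine ⟨p ^ R, hne, hQ, hp, hk, hkp, by positivity, fun b hb => pow_dvd_pow p ?_, hω, hη, hc1,
    fun m m' ζ hm hmm => ?_⟩
  · exact ((Nat.lt_pow_self hp.one_lt).le.trans hb).trans hXR
  · refine (av_fs_pow_le hp.pos m' ζ (k * (k + 1)) (by exact_mod_cast hQ)).trans
      ((hJ _ (Nat.succ_pos _)).trans ?_)
    have h1 : ((X / p ^ m' + 1 : ℕ) : ℝ) ≤ 2 * (X * ((p : ℝ) ^ m)⁻¹) := by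
      have h2 : ((X / p ^ m' : ℕ) : ℝ) ≤ X * ((p : ℝ) ^ m)⁻¹ := by
        have h3 : X / p ^ m' ≤ X / p ^ m :=
          Nat.div_le_div_left (Nat.pow_le_pow_right hp.pos hmm) (pow_pos hp.pos _)
        calc ((X / p ^ m' : ℕ) : ℝ) ≤ ((X / p ^ m : ℕ) : ℝ) := by exact_mod_cast h3
          _ ≤ (X : ℝ) / ((p ^ m : ℕ) : ℝ) := Nat.cast_div_le
          _ = _ := by push_cast; rw [div_eq_mul_inv]
      have h4 : 1 ≤ X * ((p : ℝ) ^ m)⁻¹ := by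
        rw [← div_eq_mul_inv, one_le_div (by positivity)]
        exact_mod_cast hm
      push_cast
      linarith
    calc C * ((X / p ^ m' + 1 : ℕ) : ℝ) ^ ω ≤ p * (2 * (X * ((p : ℝ) ^ m)⁻¹)) ^ ω := by gcongr
      _ = p * (2 ^ ω * ((X : ℝ) ^ ω * (p : ℝ) ^ (-(m * ω)))) := by
          rw [Real.mul_rpow (by norm_num) (by positivity), Real.mul_rpow (by positivity)
            (by positivity), ← Real.rpow_natCast, ← Real.rpow_neg hp0.le, ← Real.rpow_mul hp0.le]
          ring_nf
      _ ≤ p * (p * ((X : ℝ) ^ ω * (p : ℝ) ^ (-(m * ω)))) := by gcongr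
      _ = _ := by
          rw [sub_eq_add_neg, Real.rpow_add hp0, Real.rpow_two]
          ring

lemma J_le_of_size {k p Q X : ℕ} [NeZero Q] {ω η₀ : ℝ}
    (h : Size k p Q X ((X : ℝ) ^ ω) ω η₀) (hQ : 2 * (k * (k + 1)) * X ^ k < Q)
    (hc : (2 * (k + 1 : ℕ) : ℝ) ^ (2 * k * (k + 1)) ≤ p) {n : ℕ}
    (hn : zeta0 k + 4 * k * (k + 1) + k + 4 ≤ 3 / 2 * (k : ℝ) ^ 2 + n * (η₀ * (1 - 1 / k)))
    (hX : p ^ Size.lvl k η₀ n ≤ X) :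
    (J (k * (k + 1)) k X : ℝ) ≤ (X : ℝ) ^ ω * (p : ℝ) ^ (-1 : ℝ) := by
  obtain ⟨hB, hS⟩ := h.stage n
  set Y := 3 / 2 * (k : ℝ) ^ 2 + n * (η₀ * (1 - 1 / k)) with hY
  have hW := h.pos
  have hp1 := h.one_lt
  have hp0 : (0 : ℝ) < p := by linarith
  have hp2 : (2 : ℝ) ≤ p := by exact_mod_cast h.prime.two_le
  have hk2 : (2 : ℝ) ≤ k := by exact_mod_cast h.two_le
  have hpX : p ^ 1 ≤ X := (Nat.pow_le_pow_right h.prime.pos hB).trans hX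
  have hIB := hS 0 1 (by omega) le_rfl (by simpa using hX)
  refine (J_le_of_IB h.prime h.two_le hQ (by positivity) (by positivity)
    (fun ζ => h.av_le 1 1 ζ hpX le_rfl) hIB).trans ?_
  set W := (X : ℝ) ^ ω
  have hω9 : 9 ≤ ω := by nlinarith [h.le_exp, h.gain]
  have hkp : (k + 1 : ℝ) ≤ (p : ℝ) ^ (1 : ℝ) := by
    rw [Real.rpow_one]; exact_mod_cast h.lt
  have t1 : (2 * (k + 1 : ℕ) : ℝ) ^ (2 * k * (k + 1)) *
      (p * (W * (p : ℝ) ^ (2 - (1 : ℕ) * ω))) ≤ W * (p : ℝ) ^ (-2 : ℝ) := by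
    calc _ ≤ (p : ℝ) ^ (1 : ℝ) * ((p : ℝ) ^ (1 : ℝ) * (W * (p : ℝ) ^ (2 - (1 : ℕ) * ω))) := by
          rw [Real.rpow_one]; gcongr
      _ = W * (p : ℝ) ^ (4 - ω) := by
          rw [mul_left_comm _ W, mul_left_comm _ W, ← Real.rpow_add hp0, ← Real.rpow_add hp0]
          congr 2
          push_cast; ring
      _ ≤ _ := mul_le_mul_of_nonneg_left
          (Real.rpow_le_rpow_of_exponent_le hp1.le (by linarith)) hW.le
  have t2 : (2 * p : ℝ) ^ (2 * k * (k + 1)) * ((p : ℝ) ^ (k + 1) * ((k + 1) *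
      (W * (p : ℝ) ^ (zeta0 k - Y * (1 : ℕ) + k * (k - 3) / 2 * (0 : ℕ))))) ≤
      W * (p : ℝ) ^ (-2 : ℝ) := by
    calc _ ≤ ((p : ℝ) ^ (2 : ℝ)) ^ (2 * k * (k + 1)) * ((p : ℝ) ^ (k + 1) * ((p : ℝ) ^ (1 : ℝ) *
      (W * (p : ℝ) ^ (zeta0 k - Y * (1 : ℕ) + k * (k - 3) / 2 * (0 : ℕ))))) := by
          gcongr
          rw [Real.rpow_two]; nlinarith
      _ = W * (p : ℝ) ^ (4 * k * (k + 1) + (k + 1) + 1 + (zeta0 k - Y) : ℝ) := by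
          rw [← Real.rpow_natCast, ← Real.rpow_mul hp0.le, ← Real.rpow_natCast,
            mul_left_comm _ W, mul_left_comm _ W, mul_left_comm _ W, ← Real.rpow_add hp0,
            ← Real.rpow_add hp0, ← Real.rpow_add hp0]
          congr 2
          push_cast; ring
      _ ≤ _ := mul_le_mul_of_nonneg_left
          (Real.rpow_le_rpow_of_exponent_le hp1.le (by linarith)) hW.le
  calc _ ≤ W * (p : ℝ) ^ (-2 : ℝ) + W * (p : ℝ) ^ (-2 : ℝ) := add_le_add t1 t2
    _ = W * (2 * (p : ℝ) ^ (-2 : ℝ)) := by ring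
    _ ≤ W * ((p : ℝ) ^ (1 : ℝ) * (p : ℝ) ^ (-2 : ℝ)) := by
        gcongr
        rwa [Real.rpow_one]
    _ = _ := by rw [← Real.rpow_add hp0]; norm_num

lemma meanExp_gain {k : ℕ} (hk : 2 ≤ k) {η₀ : ℝ} (hη : 0 < η₀) :
    ∃ θ > (0 : ℝ), ∀ ω : ℝ, 3 / 2 * k * (k + 1) + η₀ ≤ ω → MeanExp k ω → MeanExp k (ω - θ) := by
  have hk2 : (2 : ℝ) ≤ k := by exact_mod_cast hk
  have hθ : (0 : ℝ) < 1 - 1 / k := by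
    rw [sub_pos, div_lt_one (by linarith)]; linarith
  obtain ⟨n, hn⟩ := exists_nat_ge ((zeta0 k + 4 * k * (k + 1) + k + 4) / (η₀ * (1 - 1 / k)))
  have hn' : zeta0 k + 4 * k * (k + 1) + k + 4 ≤ 3 / 2 * (k : ℝ) ^ 2 + n * (η₀ * (1 - 1 / k)) := by
    rw [div_le_iff₀ (by positivity)] at hn
    have : 0 ≤ 3 / 2 * (k : ℝ) ^ 2 := by positivity
    linarith
  set B := Size.lvl k η₀ n with hBdef
  have hB : 1 ≤ B := by
    rw [hBdef]
    clear_value B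
    clear hn hn' hBdef
    induction n with
    | zero => exact le_rfl
    | succ n ih => exact Nat.mul_pos (Nat.mul_pos (by omega) ih) (by omega)
  have hBr : (1 : ℝ) ≤ B := by exact_mod_cast hB
  refine ⟨1 / B, by positivity, fun ω hω ⟨C, hC, hJ⟩ => ?_⟩
  have hω9 : 9 ≤ ω := by nlinarith
  have hB1 : (1 / B : ℝ) ≤ 1 := by rw [div_le_one (by linarith)]; exact hBr
  obtain ⟨P, hP⟩ := exists_nat_ge (max (max C (2 ^ ω)) (max ((2 * k : ℝ) ^ (2 * k * k))
    (max ((2 * (k + 1 : ℕ) : ℝ) ^ (2 * k * (k + 1))) k)))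
  simp only [max_le_iff] at hP
  obtain ⟨⟨hP1, hP2⟩, hP3, hP4, hP5⟩ := hP
  have hkP : k ≤ P := by exact_mod_cast hP5
  set X0 : ℝ := (4 * (P + 1) : ℝ) ^ B with hX0
  have hX01 : 1 ≤ X0 := one_le_pow₀ (by
    have : (0 : ℝ) ≤ P := by positivity
    linarith)
  refine ⟨4 + X0 ^ (2 * (k * (k + 1))), by
    have : 0 ≤ X0 ^ (2 * (k * (k + 1))) := by positivity
    linarith, fun X hX => ?_⟩
  have hXr : (1 : ℝ) ≤ X := by exact_mod_cast hX
  have hX0r : (0 : ℝ) < X := by linarith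
  rcases lt_or_ge (X : ℝ) X0 with hlt | hge
  · have h1 : (J (k * (k + 1)) k X : ℝ) ≤ (X : ℝ) ^ (2 * (k * (k + 1))) := by
      exact_mod_cast J_le (k * (k + 1)) k X
    calc _ ≤ (X : ℝ) ^ (2 * (k * (k + 1))) := h1
      _ ≤ X0 ^ (2 * (k * (k + 1))) := by gcongr
      _ ≤ (4 + X0 ^ (2 * (k * (k + 1)))) * 1 := by linarith
      _ ≤ _ := by
          gcongr
          exact Real.one_le_rpow hXr (by linarith)
  · set y : ℝ := (X : ℝ) ^ (1 / B : ℝ) with hy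
    have hyB : y ^ B = X := by
      rw [hy, one_div]; exact Real.rpow_inv_natCast_pow (by positivity) (by omega)
    have hy4 : (4 * (P + 1) : ℝ) ≤ y := by
      refine le_of_pow_le_pow_left₀ (by omega : B ≠ 0) (by positivity) ?_
      rw [hyB]; exact hge
    have hm : P + 1 ≤ ⌊y / 2⌋₊ := by
      refine Nat.le_floor ?_
      push_cast; linarith
    obtain ⟨p, hp, hp1, hp2⟩ := Nat.exists_prime_lt_and_le_two_mul ⌊y / 2⌋₊ (by omega)
    have hy0 : 0 ≤ y := by positivity
    have hpy : (p : ℝ) ≤ y := by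
      have h1 : ((⌊y / 2⌋₊ : ℕ) : ℝ) ≤ y / 2 := Nat.floor_le (by positivity)
      have h2 : (p : ℝ) ≤ 2 * (⌊y / 2⌋₊ : ℕ) := by exact_mod_cast hp2
      linarith
    have hyp : y / 2 ≤ p := by
      have h1 := Nat.lt_floor_add_one (y / 2)
      have h2 : ((⌊y / 2⌋₊ : ℕ) : ℝ) + 1 ≤ p := by exact_mod_cast hp1
      linarith
    have hPp : (P : ℝ) ≤ p := by exact_mod_cast (by omega : P ≤ p)
    obtain ⟨Q, hQ0, hQ, hsize⟩ := exists_size hk hη.le hω hJ hp (by omega) hX (hP1.trans hPp)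
      (hP3.trans hPp) (hP2.trans hPp)
    have hpX : p ^ B ≤ X := by
      have : (p : ℝ) ^ B ≤ X := by rw [← hyB]; gcongr
      exact_mod_cast this
    have hp0 : (0 : ℝ) < p := by exact_mod_cast hp.pos
    calc (J (k * (k + 1)) k X : ℝ) ≤ (X : ℝ) ^ ω * (p : ℝ) ^ (-1 : ℝ) :=
          J_le_of_size hsize hQ (hP4.trans hPp) hn' hpX
      _ ≤ (X : ℝ) ^ ω * (4 * (X : ℝ) ^ (-(1 / B : ℝ))) := by
          gcongr
          rw [Real.rpow_neg_one, Real.rpow_neg hX0r.le, ← hy]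
          have hy1 : 0 < y := by positivity
          rw [← div_eq_mul_inv, inv_le_comm₀ hp0 (by positivity)]
          rw [inv_div]
          linarith
      _ = 4 * (X : ℝ) ^ (ω - 1 / B) := by
          rw [sub_eq_add_neg, Real.rpow_add hX0r]; ring
      _ ≤ _ := by
          gcongr
          have : 0 ≤ X0 ^ (2 * (k * (k + 1))) := by positivity
          linarith

/-- A weak form of Vinogradov's mean value theorem, with `k (k + 1)` variables. -/
theorem vinogradov_mean {k : ℕ} (hk : 2 ≤ k) {ε : ℝ} (hε : 0 < ε) :
    MeanExp k (3 / 2 * k * (k + 1) + ε) := by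
  obtain ⟨θ, hθ, h⟩ := meanExp_gain hk hε
  have hall : ∀ n : ℕ, MeanExp k (max (3 / 2 * k * (k + 1) + ε) (2 * k * (k + 1) - n * θ)) := by
    intro n
    induction n with
    | zero => exact (meanExp_trivial k).mono (by simp)
    | succ n ih =>
      rcases le_total (3 / 2 * k * (k + 1) + ε) (2 * k * (k + 1) - n * θ) with h1 | h1
      · rw [max_eq_right h1] at ih
        refine (h _ h1 ih).mono (le_max_of_le_right ?_)
        push_cast; linarith
      · rw [max_eq_left h1] at ih
        exact ih.mono (le_max_left _ _)
  obtain ⟨n, hn⟩ := exists_nat_ge ((2 * k * (k + 1)) / θ : ℝ)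
  rw [div_le_iff₀ hθ] at hn
  refine (hall n).mono (max_le le_rfl ?_)
  have : (0 : ℝ) ≤ 3 / 2 * k * (k + 1) + ε := by positivity
  linarith

/-- The additive character `x ↦ exp (2 π i x)`. -/
def e (x : ℝ) : ℂ := Complex.exp ((2 * Real.pi * x : ℝ) * Complex.I)

lemma norm_e (x : ℝ) : ‖e x‖ = 1 := Complex.norm_exp_ofReal_mul_I _

lemma e_zero : e 0 = 1 := by simp [e]

lemma e_add (x y : ℝ) : e (x + y) = e x * e y := by
  rw [e, e, e, ← Complex.exp_add]; congr 1; push_cast; ring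

lemma e_sum {ι : Type*} (s : Finset ι) (f : ι → ℝ) : e (∑ i ∈ s, f i) = ∏ i ∈ s, e (f i) := by
  classical
  induction s using Finset.induction_on with
  | empty => simp [e_zero]
  | insert i s hi ih => rw [Finset.sum_insert hi, Finset.prod_insert hi, e_add, ih]

lemma e_neg (x : ℝ) : e (-x) = (starRingEnd ℂ) (e x) := by
  rw [e, e, ← Complex.exp_conj]
  congr 1
  rw [map_mul, Complex.conj_ofReal, Complex.conj_I]
  push_cast
  ring

lemma e_int (n : ℤ) : e n = 1 := by
  rw [e, Complex.exp_eq_one_iff]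
  exact ⟨n, by push_cast; ring⟩

lemma e_add_int (x : ℝ) (n : ℤ) : e (x + n) = e x := by rw [e_add, e_int, mul_one]

lemma e_nat_mul (n : ℕ) (x : ℝ) : e (n * x) = e x ^ n := by
  induction n with
  | zero => simp [e_zero]
  | succ n ih => rw [pow_succ, ← ih, ← e_add]; congr 1; push_cast; ring

lemma norm_e_sub_e_le (x y : ℝ) : ‖e x - e y‖ ≤ 2 * Real.pi * |x - y| := by
  have h : e x - e y = e y * (e (x - y) - 1) := by
    rw [mul_sub, ← e_add, mul_one]; congr 2; ring
  rw [h, norm_mul, norm_e, one_mul, e, mul_comm _ Complex.I]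
  refine Real.norm_exp_I_mul_ofReal_sub_one_le.trans (le_of_eq ?_)
  rw [Real.norm_eq_abs, abs_mul, abs_of_pos Real.two_pi_pos]

lemma e_re (x : ℝ) : (e x).re = Real.cos (2 * Real.pi * x) := by
  rw [e, Complex.exp_ofReal_mul_I_re]

lemma half_le_e_re {x : ℝ} (hx : |x| ≤ 1 / 6) : 1 / 2 ≤ (e x).re := by
  rw [e_re, ← Real.cos_pi_div_three, ← Real.cos_abs (2 * Real.pi * x), abs_mul,
    abs_of_pos Real.two_pi_pos]
  have := Real.pi_pos
  refine Real.cos_le_cos_of_nonneg_of_le_pi (by positivity) (by linarith) ?_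
  nlinarith

lemma stdAddChar_eq_e {Q : ℕ} [NeZero Q] (j : ℤ) : ZMod.stdAddChar (j : ZMod Q) = e (j / Q) := by
  rw [ZMod.stdAddChar_coe, e]
  congr 1
  push_cast
  ring

lemma ch_add_point {κ : Type*} [Fintype κ] {Q : ℕ} [NeZero Q] (v : κ → ℤ) (a b : κ → ZMod Q) : ch v (a + b) = ch v a * ch v b := by
  simp only [ch, ← AddChar.map_add_eq_mul, ← Finset.sum_add_distrib, Pi.add_apply, add_mul]

section LargeSieve
open scoped ComplexConjugate
variable {κ : Type*} [Fintype κ] [DecidableEq κ] {Q : ℕ} [NeZero Q]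

lemma sum_norm_sq_sum_weight_ch_le {ι : Type*} (s : Finset ι) (v : ι → κ → ℤ) (w : ι → ℂ) {W : ℝ}
    (hw : ∀ i ∈ s, ‖w i‖ ≤ W) :
    ∑ a : κ → ZMod Q, ‖∑ i ∈ s, w i * ch (v i) a‖ ^ 2 ≤
      W ^ 2 * ((Q : ℝ) ^ Fintype.card κ * #{x ∈ s ×ˢ s | ∀ j, v x.1 j ≡ v x.2 j [ZMOD Q]}) := by
  classical
  have key : ∀ a : κ → ZMod Q, ((‖∑ i ∈ s, w i * ch (v i) a‖ ^ 2 : ℝ) : ℂ) =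
      ∑ x ∈ s ×ˢ s, (w x.1 * conj (w x.2)) * ch (v x.1 - v x.2) a := by
    intro a
    have : ((‖∑ i ∈ s, w i * ch (v i) a‖ ^ 2 : ℝ) : ℂ) =
        (∑ i ∈ s, w i * ch (v i) a) * conj (∑ i ∈ s, w i * ch (v i) a) := by
      rw [Complex.mul_conj, Complex.normSq_eq_norm_sq]
    rw [this, map_sum, Finset.sum_mul_sum, ← Finset.sum_product']
    refine Finset.sum_congr rfl fun x _ => ?_
    rw [ch_sub, map_mul]; ring
  have h1 : ((∑ a : κ → ZMod Q, ‖∑ i ∈ s, w i * ch (v i) a‖ ^ 2 : ℝ) : ℂ) =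
      ∑ x ∈ s ×ˢ s, (w x.1 * conj (w x.2)) *
        (if ∀ j, v x.1 j ≡ v x.2 j [ZMOD Q] then (Q : ℂ) ^ Fintype.card κ else 0) := by
    rw [Complex.ofReal_sum]
    simp_rw [key]
    rw [Finset.sum_comm]
    refine Finset.sum_congr rfl fun x _ => ?_
    rw [← Finset.mul_sum]
    congr 1
    split_ifs with hx
    · have hx' : ∀ j, (Q : ℤ) ∣ (v x.1 - v x.2) j := fun j => (hx j).symm.dvd
      simp [ch_eq_one hx']
    · exact sum_ch_eq_zero fun h => hx fun j => (Int.modEq_iff_dvd.2 (h j)).symm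
  have h2 : ∑ a : κ → ZMod Q, ‖∑ i ∈ s, w i * ch (v i) a‖ ^ 2 =
      ‖((∑ a : κ → ZMod Q, ‖∑ i ∈ s, w i * ch (v i) a‖ ^ 2 : ℝ) : ℂ)‖ := by
    rw [Complex.norm_real, Real.norm_of_nonneg (Finset.sum_nonneg fun _ _ => by positivity)]
  rw [h2, h1]
  calc _ ≤ ∑ x ∈ s ×ˢ s, ‖(w x.1 * conj (w x.2)) *
        (if ∀ j, v x.1 j ≡ v x.2 j [ZMOD Q] then (Q : ℂ) ^ Fintype.card κ else 0)‖ :=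
        norm_sum_le _ _
    _ ≤ ∑ x ∈ s ×ˢ s, W ^ 2 *
        (if ∀ j, v x.1 j ≡ v x.2 j [ZMOD Q] then (Q : ℝ) ^ Fintype.card κ else 0) := by
        refine Finset.sum_le_sum fun x hx => ?_
        rw [Finset.mem_product] at hx
        have e1 := hw _ hx.1
        have e2 := hw _ hx.2
        have hW : 0 ≤ W := (norm_nonneg _).trans e1
        rw [norm_mul, norm_mul, RCLike.norm_conj, sq]
        have : ‖(if ∀ j, v x.1 j ≡ v x.2 j [ZMOD Q] then (Q : ℂ) ^ Fintype.card κ else 0)‖ =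
          (if ∀ j, v x.1 j ≡ v x.2 j [ZMOD Q] then (Q : ℝ) ^ Fintype.card κ else 0) := by
          split_ifs <;> simp
        rw [this]
        gcongr
    _ = _ := by
        rw [← Finset.mul_sum, ← Finset.sum_filter, Finset.sum_const, nsmul_eq_mul,
          mul_comm (_ : ℝ) ((Q : ℝ) ^ _)]

lemma half_le_norm_avg {B : ℕ} (hB : 1 ≤ B) {v : ℤ} (hv : 6 * |v| * B ≤ Q) :
    (1 / 2 : ℝ) ≤
      ‖(B : ℂ)⁻¹ * ∑ b ∈ range B, (ZMod.stdAddChar ((b : ZMod Q) * (v : ZMod Q)) : ℂ)‖ := by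
  have hQ : (0 : ℝ) < Q := by exact_mod_cast Nat.pos_of_ne_zero (NeZero.ne Q)
  have hBr : (0 : ℝ) < B := by exact_mod_cast hB
  have h1 : ∀ b ∈ range B, (1 / 2 : ℝ) ≤
      (ZMod.stdAddChar ((b : ZMod Q) * (v : ZMod Q)) : ℂ).re := by
    intro b hb
    have e1 : ((b : ZMod Q) * (v : ZMod Q)) = (((b : ℤ) * v : ℤ) : ZMod Q) := by push_cast; ring
    rw [e1, stdAddChar_eq_e]
    apply half_le_e_re
    have hb' : (b : ℝ) ≤ B := by exact_mod_cast (Finset.mem_range.1 hb).le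
    have hv' : 6 * |(v : ℝ)| * B ≤ Q := by exact_mod_cast hv
    rw [abs_div, abs_of_pos hQ, div_le_iff₀ hQ]
    push_cast
    rw [abs_mul, Nat.abs_cast]
    have : (b : ℝ) * |(v : ℝ)| ≤ B * |(v : ℝ)| := by gcongr
    linarith
  refine le_trans ?_ (Complex.re_le_norm _)
  have e2 : ((B : ℂ)⁻¹ * ∑ b ∈ range B, (ZMod.stdAddChar ((b : ZMod Q) * (v : ZMod Q)) : ℂ)).re =
      (B : ℝ)⁻¹ * ∑ b ∈ range B, (ZMod.stdAddChar ((b : ZMod Q) * (v : ZMod Q)) : ℂ).re := by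
    rw [show ((B : ℂ)⁻¹) = (((B : ℝ)⁻¹ : ℝ) : ℂ) by push_cast; rfl, Complex.re_ofReal_mul,
      Complex.re_sum]
  rw [e2]
  calc (1 / 2 : ℝ) = (B : ℝ)⁻¹ * ∑ _b ∈ range B, (1 / 2 : ℝ) := by simp; field_simp
    _ ≤ _ := by gcongr with b hb; exact h1 b hb

/-- A large sieve inequality for points with bounded overlap. -/
lemma large_sieve_zmod {ι ι' : Type*} (A : Finset ι) (a : ι → κ → ZMod Q) {B : κ → ℕ}
    (hB : ∀ j, 1 ≤ B j) (hBQ : ∀ j, B j ≤ Q) {D : ℕ}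
    (hD : ∀ α : κ → ZMod Q, #{i ∈ A | ∀ j, ∃ b < B j, α j = a i j + (b : ℕ)} ≤ D)
    (s : Finset ι') (v : ι' → κ → ℤ) (hv : ∀ x ∈ s, ∀ j, 6 * |v x j| * B j ≤ Q) :
    ∑ i ∈ A, ‖∑ x ∈ s, ch (v x) (a i)‖ ^ 2 ≤
      4 ^ Fintype.card κ * (∏ j, (Q : ℝ) / B j) * D *
        #{x ∈ s ×ˢ s | ∀ j, v x.1 j ≡ v x.2 j [ZMOD Q]} := by
  classical
  set t : ι' → ℂ := fun x =>
    ∏ j, ((B j : ℂ)⁻¹ * ∑ b ∈ range (B j), (ZMod.stdAddChar ((b : ZMod Q) * (v x j : ZMod Q)) : ℂ))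
    with ht
  set Box := Fintype.piFinset (fun j => range (B j)) with hBox
  set pt : (κ → ℕ) → κ → ZMod Q := fun b j => (b j : ZMod Q) with hpt
  have ht2 : ∀ x ∈ s, (1 / 2 : ℝ) ^ Fintype.card κ ≤ ‖t x‖ := by
    intro x hx
    rw [ht, norm_prod]
    calc (1 / 2 : ℝ) ^ Fintype.card κ = ∏ _j : κ, (1 / 2 : ℝ) := by simp
      _ ≤ _ := Finset.prod_le_prod (fun _ _ => by norm_num)
        fun j _ => half_le_norm_avg (hB j) (hv x hx j)
  have hw : ∀ x ∈ s, ‖(t x)⁻¹‖ ≤ 2 ^ Fintype.card κ := by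
    intro x hx
    rw [norm_inv]
    have h1 := ht2 x hx
    have h2 : (0 : ℝ) < (1 / 2 : ℝ) ^ Fintype.card κ := by positivity
    rw [inv_le_comm₀ (h2.trans_le h1) (by positivity)]
    simpa using h1
  set PB : ℝ := ∏ j, (B j : ℝ) with hPB
  have hPB0 : 0 < PB := Finset.prod_pos fun j _ => by exact_mod_cast hB j
  have hBoxcard : (#Box : ℝ) = PB := by
    simp [hBox, hPB, Fintype.card_piFinset]
  set F : (κ → ZMod Q) → ℂ := fun α => ∑ x ∈ s, (t x)⁻¹ * ch (v x) α with hF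
  have havg : ∀ x ∈ s, ∀ α : κ → ZMod Q, ∑ b ∈ Box, ch (v x) (α + pt b) =
      (PB : ℂ) * t x * ch (v x) α := by
    intro x _ α
    simp_rw [ch_add_point, ← Finset.mul_sum]
    have h1 : ∑ b ∈ Box, ch (v x) (pt b) = (PB : ℂ) * t x := by
      have h2 := Finset.prod_univ_sum (fun j => range (B j))
        (fun j b => (ZMod.stdAddChar ((b : ZMod Q) * (v x j : ZMod Q)) : ℂ))
      have h3 : ∀ b : κ → ℕ, ch (v x) (pt b) =
          ∏ j, (ZMod.stdAddChar ((b j : ZMod Q) * (v x j : ZMod Q)) : ℂ) := fun b => by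
        simp only [ch, hpt]; exact addChar_map_sum _ _ _
      simp_rw [h3]
      rw [hBox, ← h2, ht]
      simp only [Finset.prod_mul_distrib, hPB]
      push_cast
      rw [← mul_assoc, ← Finset.prod_mul_distrib]
      have : ∏ j, ((B j : ℂ) * (B j : ℂ)⁻¹) = 1 := Finset.prod_eq_one fun j _ =>
        mul_inv_cancel₀ (by exact_mod_cast (Nat.one_le_iff_ne_zero.1 (hB j)))
      rw [this, one_mul]
    rw [h1]; ring
  have hf : ∀ α : κ → ZMod Q, (PB : ℂ) * ∑ x ∈ s, ch (v x) α = ∑ b ∈ Box, F (α + pt b) := by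
    intro α
    simp only [hF]
    rw [Finset.sum_comm, Finset.mul_sum]
    refine Finset.sum_congr rfl fun x hx => ?_
    rw [← Finset.mul_sum, havg x hx]
    have : t x ≠ 0 := by
      intro h0
      have := ht2 x hx
      rw [h0, norm_zero] at this
      exact absurd this (not_le.2 (by positivity))
    field_simp
  have hcs : ∀ α : κ → ZMod Q, PB * ‖∑ x ∈ s, ch (v x) α‖ ^ 2 ≤ ∑ b ∈ Box, ‖F (α + pt b)‖ ^ 2 := by
    intro α
    have h1 : PB * ‖∑ x ∈ s, ch (v x) α‖ ≤ ∑ b ∈ Box, ‖F (α + pt b)‖ := by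
      have h2 := congrArg norm (hf α)
      rw [norm_mul, Complex.norm_real, Real.norm_of_nonneg hPB0.le] at h2
      rw [h2]; exact norm_sum_le _ _
    have h3 := sq_sum_le_card_mul_sum_sq (s := Box) (f := fun b => ‖F (α + pt b)‖)
    rw [hBoxcard] at h3
    have h4 := (pow_le_pow_left₀ (by positivity) h1 2).trans h3
    rw [mul_pow, sq PB, mul_assoc] at h4
    exact le_of_mul_le_mul_left h4 hPB0
  have hswap : ∑ i ∈ A, ∑ b ∈ Box, ‖F (a i + pt b)‖ ^ 2 ≤ D * ∑ α, ‖F α‖ ^ 2 := by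
    rw [← Finset.sum_product', ← Finset.sum_fiberwise (A ×ˢ Box) (fun x => a x.1 + pt x.2),
      Finset.mul_sum]
    refine Finset.sum_le_sum fun α _ => ?_
    calc _ = ∑ x ∈ A ×ˢ Box with a x.1 + pt x.2 = α, ‖F α‖ ^ 2 :=
          Finset.sum_congr rfl fun x hx => by rw [(Finset.mem_filter.1 hx).2]
      _ = #{x ∈ A ×ˢ Box | a x.1 + pt x.2 = α} * ‖F α‖ ^ 2 := by simp
      _ ≤ _ := by
        gcongr
        refine le_trans ?_ (hD α)
        refine Finset.card_le_card_of_injOn Prod.fst ?_ ?_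
        · intro x hx
          simp only [Finset.coe_filter, Finset.mem_product, Set.mem_ofPred_eq] at hx ⊢
          refine ⟨hx.1.1, fun j => ⟨x.2 j, ?_, ?_⟩⟩
          · exact Finset.mem_range.1 (Fintype.mem_piFinset.1 hx.1.2 j)
          · rw [← hx.2]; rfl
        · rintro ⟨i, b⟩ hx ⟨i', b'⟩ hx' (rfl : i = i')
          simp only [Finset.coe_filter, Finset.mem_product, Set.mem_ofPred_eq] at hx hx'
          have h1 : pt b = pt b' := add_left_cancel (hx.2.trans hx'.2.symm)
          refine Prod.ext rfl (funext fun j => ?_)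
          have h2 : ((b j : ℕ) : ZMod Q) = (b' j : ℕ) := congrFun h1 j
          have l1 := (Finset.mem_range.1 (Fintype.mem_piFinset.1 hx.1.2 j)).trans_le (hBQ j)
          have l2 := (Finset.mem_range.1 (Fintype.mem_piFinset.1 hx'.1.2 j)).trans_le (hBQ j)
          have h3 := congrArg ZMod.val h2
          rwa [ZMod.val_cast_of_lt l1, ZMod.val_cast_of_lt l2] at h3
  have hpars := sum_norm_sq_sum_weight_ch_le (Q := Q) s v (fun x => (t x)⁻¹) hw
  have hfin : PB * ∑ i ∈ A, ‖∑ x ∈ s, ch (v x) (a i)‖ ^ 2 ≤ D * ((2 ^ Fintype.card κ) ^ 2 *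
      ((Q : ℝ) ^ Fintype.card κ * #{x ∈ s ×ˢ s | ∀ j, v x.1 j ≡ v x.2 j [ZMOD Q]})) := by
    rw [Finset.mul_sum]
    refine (Finset.sum_le_sum fun i _ => hcs (a i)).trans (hswap.trans ?_)
    gcongr
  have hprod : ∏ j, (Q : ℝ) / B j = (Q : ℝ) ^ Fintype.card κ / PB := by
    rw [Finset.prod_div_distrib]; simp [hPB]
  rw [hprod]
  rw [← le_div_iff₀' hPB0] at hfin
  refine hfin.trans (le_of_eq ?_)
  rw [show ((2 : ℝ) ^ Fintype.card κ) ^ 2 = 4 ^ Fintype.card κ by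
    rw [← pow_mul, mul_comm, pow_mul]; norm_num]
  ring

end LargeSieve

lemma prod_Y_eq (k s Y : ℕ) :
    ∏ j : Fin k, ((6 * s : ℝ) * (Y : ℝ) ^ ((j : ℕ) + 1)) =
      (6 * s : ℝ) ^ k * (Y : ℝ) ^ ((k * (k + 1) / 2 : ℕ)) := by
  rw [Finset.prod_mul_distrib, Finset.prod_const, Finset.card_univ, Fintype.card_fin,
    Finset.prod_pow_eq_pow_sum]
  congr 2
  rw [Fin.sum_univ_eq_sum_range (fun j => j + 1) k, Finset.sum_add_distrib]
  have := Finset.sum_range_id_mul_two k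
  simp only [Finset.sum_const, Finset.card_range, smul_eq_mul, mul_one]
  rcases k with _ | k
  · simp
  · have h2 : (k + 1) * (k + 1 + 1) = ((∑ i ∈ range (k + 1), i) + (k + 1)) * 2 := by
      simp only [Nat.add_sub_cancel] at this
      linarith
    rw [h2, Nat.mul_div_cancel _ (by norm_num)]

lemma norm_sum_e_sub_le {k Y Q : ℕ} (hQ : 0 < Q) (c : Fin k → ℝ) :
    ‖∑ y ∈ Icc (1 : ℤ) Y, e (∑ j : Fin k, c j * (y : ℝ) ^ ((j : ℕ) + 1)) -
      ∑ y ∈ Icc (1 : ℤ) Y, e (∑ j : Fin k, ((⌊Q * c j⌋ : ℝ) / Q) * (y : ℝ) ^ ((j : ℕ) + 1))‖ ≤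
      7 * k * (Y : ℝ) ^ (k + 1) / Q := by
  have hQr : (0 : ℝ) < Q := by exact_mod_cast hQ
  rw [← Finset.sum_sub_distrib]
  calc _ ≤ ∑ y ∈ Icc (1 : ℤ) Y, (7 * (k * ((Y : ℝ) ^ k / Q))) := by
        refine (norm_sum_le _ _).trans (Finset.sum_le_sum fun y hy => ?_)
        rw [Finset.mem_Icc] at hy
        have hy1 : (1 : ℝ) ≤ y := by exact_mod_cast hy.1
        have hy2 : (y : ℝ) ≤ Y := by exact_mod_cast hy.2
        refine (norm_e_sub_e_le _ _).trans ?_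
        have hpi : 2 * Real.pi ≤ 7 := by linarith [Real.pi_lt_d2]
        rw [← Finset.sum_sub_distrib]
        have : |∑ j : Fin k, (c j * (y : ℝ) ^ ((j : ℕ) + 1) -
            ((⌊Q * c j⌋ : ℝ) / Q) * (y : ℝ) ^ ((j : ℕ) + 1))| ≤ k * ((Y : ℝ) ^ k / Q) := by
          calc _ ≤ ∑ _j : Fin k, ((Y : ℝ) ^ k / Q) := by
                refine (Finset.abs_sum_le_sum_abs _ _).trans (Finset.sum_le_sum fun j _ => ?_)
                rw [← sub_mul, abs_mul, abs_of_pos (by positivity : (0 : ℝ) < (y : ℝ) ^ ((j : ℕ) + 1))]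
                have h1 : |c j - (⌊Q * c j⌋ : ℝ) / Q| ≤ 1 / Q := by
                  rw [show c j - (⌊Q * c j⌋ : ℝ) / Q = (Q * c j - ⌊Q * c j⌋) / Q by field_simp,
                    abs_div, abs_of_pos hQr]
                  gcongr
                  rw [abs_le]
                  constructor <;> linarith [Int.floor_le (Q * c j), Int.lt_floor_add_one (Q * c j)]
                have h2 : (y : ℝ) ^ ((j : ℕ) + 1) ≤ (Y : ℝ) ^ k := by
                  calc _ ≤ (y : ℝ) ^ k := pow_le_pow_right₀ hy1 j.2
                    _ ≤ _ := by gcongr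
                calc _ ≤ 1 / (Q : ℝ) * (Y : ℝ) ^ k := by gcongr
                  _ = _ := by ring
            _ = _ := by simp
        gcongr
    _ = _ := by
        simp only [Finset.sum_const, Int.card_Icc, nsmul_eq_mul]
        rw [show ((((Y : ℤ) + 1 - 1).toNat : ℕ) : ℝ) = Y by simp]
        ring

open Classical in
/-- The indices whose coefficient vector is close to that of `i₀` modulo one. -/
def near {ι : Type*} {k : ℕ} (A : Finset ι) (c : ι → Fin k → ℝ) (Y : ℕ) (i₀ : ι) : Finset ι :=
  {i ∈ A | ∀ j, ∃ n : ℤ, |c i j - c i₀ j - n| ≤ 1 / (Y : ℝ) ^ ((j : ℕ) + 1)}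

lemma mem_near {ι : Type*} {k : ℕ} {A : Finset ι} {c : ι → Fin k → ℝ} {Y : ℕ} {i₀ i : ι} :
    i ∈ near A c Y i₀ ↔
      i ∈ A ∧ ∀ j, ∃ n : ℤ, |c i j - c i₀ j - n| ≤ 1 / (Y : ℝ) ^ ((j : ℕ) + 1) := by
  simp [near]

lemma large_sieve_real {ι : Type*} {k s Y : ℕ} (hk : 1 ≤ k) (hs : 1 ≤ s) (hY : 1 ≤ Y)
    (A : Finset ι) (c : ι → Fin k → ℝ) {D : ℕ}
    (hD : ∀ i₀ ∈ A, #(near A c Y i₀) ≤ D) :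
    ∃ S' : ι → ℝ, (∀ i, 0 ≤ S' i) ∧
      (∀ i ∈ A, ‖∑ y ∈ Icc (1 : ℤ) Y, e (∑ j : Fin k, c i j * (y : ℝ) ^ ((j : ℕ) + 1))‖ ≤
        S' i + 1) ∧
      ∑ i ∈ A, S' i ^ (2 * s) ≤
        4 ^ k * ((6 * s : ℝ) ^ k * (Y : ℝ) ^ ((k * (k + 1) / 2 : ℕ))) * D * J s k Y := by
  classical
  set R := 2 * k * Y with hR
  have hR1 : 1 ≤ R := Nat.mul_pos (by omega) hY
  set Q := 6 * s * Y ^ k * R with hQ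
  have hQ0 : 0 < Q := by positivity
  have : NeZero Q := ⟨hQ0.ne'⟩
  have hQr : (0 : ℝ) < Q := by exact_mod_cast hQ0
  have hYr : (1 : ℝ) ≤ Y := by exact_mod_cast hY
  have hsr : (1 : ℝ) ≤ s := by exact_mod_cast hs
  set B : Fin k → ℕ := fun j => Y ^ (k - 1 - j) * R with hBdef
  have hB1 : ∀ j, 1 ≤ B j := fun j => Nat.mul_pos (pow_pos hY _) hR1
  have hQB : ∀ j : Fin k, Q = 6 * s * Y ^ ((j : ℕ) + 1) * B j := fun j => by
    have : Y ^ k = Y ^ ((j : ℕ) + 1) * Y ^ (k - 1 - j) := by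
      rw [← pow_add]; congr 1; omega
    rw [hQ, hBdef, this]; ring
  have hBQ : ∀ j, B j ≤ Q := fun j => by
    conv_rhs => rw [hQB j]
    exact Nat.le_mul_of_pos_left _ (by positivity)
  set a : ι → Fin k → ZMod Q := fun i j => ((⌊Q * c i j⌋ : ℤ) : ZMod Q) with ha
  have hDz : ∀ α : Fin k → ZMod Q, #{i ∈ A | ∀ j, ∃ b < B j, α j = a i j + (b : ℕ)} ≤ D := by
    intro α
    rcases Finset.eq_empty_or_nonempty {i ∈ A | ∀ j, ∃ b < B j, α j = a i j + (b : ℕ)} with h0 | ⟨i₀, hi₀⟩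
    · rw [h0]; simp
    · rw [Finset.mem_filter] at hi₀
      refine le_trans (Finset.card_le_card fun i hi => ?_) (hD i₀ hi₀.1)
      rw [Finset.mem_filter] at hi
      refine mem_near.2 ⟨hi.1, fun j => ?_⟩
      obtain ⟨b, hb, hb2⟩ := hi.2 j
      obtain ⟨b', hb', hb2'⟩ := hi₀.2 j
      have h1 : ((⌊Q * c i j⌋ + b : ℤ) : ZMod Q) = ((⌊Q * c i₀ j⌋ + b' : ℤ) : ZMod Q) := by
        push_cast
        exact hb2.symm.trans hb2'
      rw [ZMod.intCast_eq_intCast_iff] at h1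
      obtain ⟨n, hn⟩ := h1.dvd
      refine ⟨-n, ?_⟩
      have hnr : ((⌊Q * c i₀ j⌋ : ℝ) + b') - (⌊Q * c i j⌋ + b) = Q * n := by exact_mod_cast hn
      have f1 := Int.floor_le (Q * c i j)
      have f2 := Int.lt_floor_add_one (Q * c i j)
      have f3 := Int.floor_le (Q * c i₀ j)
      have f4 := Int.lt_floor_add_one (Q * c i₀ j)
      have hbr : (b : ℝ) + 1 ≤ B j := by exact_mod_cast hb
      have hbr' : (b' : ℝ) + 1 ≤ B j := by exact_mod_cast hb'
      have hb0 : (0 : ℝ) ≤ b := by positivity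
      have hb0' : (0 : ℝ) ≤ b' := by positivity
      have hkey : |Q * (c i j - c i₀ j - ((-n : ℤ) : ℝ))| ≤ B j := by
        push_cast
        rw [abs_le]; constructor <;> nlinarith
      rw [abs_mul, abs_of_pos hQr] at hkey
      rw [le_div_iff₀ (by positivity)]
      have hBr : (0 : ℝ) < B j := by exact_mod_cast hB1 j
      have hQBr : (Q : ℝ) = 6 * s * (Y : ℝ) ^ ((j : ℕ) + 1) * B j := by exact_mod_cast hQB j
      set z := |c i j - c i₀ j - ((-n : ℤ) : ℝ)| with hz
      have hz0 : 0 ≤ z := abs_nonneg _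
      rw [hQBr] at hkey
      have h2 : (6 * s * (z * (Y : ℝ) ^ ((j : ℕ) + 1))) * B j ≤ 1 * B j := by linarith
      have h3 := le_of_mul_le_mul_right h2 hBr
      have h4 : 0 ≤ z * (Y : ℝ) ^ ((j : ℕ) + 1) := by positivity
      nlinarith
  set v : (Fin s → ℤ) → Fin k → ℤ := fun x j => ∑ i, x i ^ ((j : ℕ) + 1) with hv
  set T := Fintype.piFinset (fun _ : Fin s => Icc (1 : ℤ) Y) with hT
  have hvb : ∀ x ∈ T, ∀ j, 0 ≤ v x j ∧ v x j ≤ s * (Y : ℤ) ^ ((j : ℕ) + 1) := by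
    intro x hx j
    have hx' : ∀ i, 1 ≤ x i ∧ x i ≤ Y := fun i => Finset.mem_Icc.1 (Fintype.mem_piFinset.1 hx i)
    constructor
    · exact Finset.sum_nonneg fun i _ => pow_nonneg (by linarith [(hx' i).1]) _
    · calc v x j ≤ ∑ _i : Fin s, (Y : ℤ) ^ ((j : ℕ) + 1) := by
            refine Finset.sum_le_sum fun i _ => ?_
            have h1 := (hx' i).1
            have h2 := (hx' i).2
            gcongr
        _ = _ := by simp
  have hLS := large_sieve_zmod (D := D) A a hB1 hBQ (fun α => by convert hDz α) T v (fun x hx j => by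
    rw [abs_of_nonneg (hvb x hx j).1]
    calc 6 * v x j * B j ≤ 6 * (s * (Y : ℤ) ^ ((j : ℕ) + 1)) * B j := by
          have := (hvb x hx j).2
          gcongr
      _ = Q := by rw [hQB j]; push_cast; ring)
  have hJ : #{x ∈ T ×ˢ T | ∀ j, v x.1 j ≡ v x.2 j [ZMOD Q]} = J s k Y := by
    unfold J
    congr 1
    ext x
    simp only [Finset.mem_filter]
    refine and_congr_right fun hx => ?_
    rw [Finset.mem_product] at hx
    constructor
    · intro h j
      induction j using Fin.cases with
      | zero => simp
      | succ j =>
        have h1 := (h j).dvd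
        have b1 := hvb _ hx.1 j
        have b2 := hvb _ hx.2 j
        have hQz : (Q : ℤ) = 6 * s * (Y : ℤ) ^ ((j : ℕ) + 1) * B j := by exact_mod_cast hQB j
        have hBz : (1 : ℤ) ≤ B j := by exact_mod_cast hB1 j
        have hpos : (0 : ℤ) < s * (Y : ℤ) ^ ((j : ℕ) + 1) := by
          have : (0 : ℤ) < Y := by exact_mod_cast hY
          have : (0 : ℤ) < s := by exact_mod_cast hs
          positivity
        have := Int.eq_zero_of_abs_lt_dvd h1 (by
          rw [abs_lt]; constructor <;> nlinarith)
        simp only [hv] at this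
        rw [Fin.val_succ]
        linarith
    · intro h j
      have := h j.succ
      rw [Fin.val_succ] at this
      simp only [hv]; rw [this]
  have hch : ∀ (y : ℤ) (i : ι), ch (fun j : Fin k => y ^ ((j : ℕ) + 1)) (a i) =
      e (∑ j : Fin k, ((⌊Q * c i j⌋ : ℝ) / Q) * (y : ℝ) ^ ((j : ℕ) + 1)) := by
    intro y i
    have : (∑ j : Fin k, a i j * ((y ^ ((j : ℕ) + 1) : ℤ) : ZMod Q)) =
        ((∑ j : Fin k, ⌊Q * c i j⌋ * y ^ ((j : ℕ) + 1) : ℤ) : ZMod Q) := by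
      push_cast; rfl
    rw [ch, this, stdAddChar_eq_e]
    congr 1
    push_cast
    rw [Finset.sum_div]
    exact Finset.sum_congr rfl fun j _ => by ring
  refine ⟨fun i => ‖∑ y ∈ Icc (1 : ℤ) Y, ch (fun j : Fin k => y ^ ((j : ℕ) + 1)) (a i)‖,
    fun i => norm_nonneg _, fun i _ => ?_, ?_⟩
  · simp_rw [hch]
    have h1 := norm_sum_e_sub_le (Y := Y) hQ0 (c i)
    have h2 : 7 * k * (Y : ℝ) ^ (k + 1) / Q ≤ 1 := by
      rw [div_le_one hQr, hQ, hR]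
      push_cast
      have hkr : (0 : ℝ) ≤ k := by positivity
      have : (Y : ℝ) ^ (k + 1) = Y ^ k * Y := pow_succ _ _
      rw [this]
      have h3 : 0 ≤ (k : ℝ) * (Y ^ k * Y) := by positivity
      nlinarith
    have h3 := norm_sub_norm_le (∑ y ∈ Icc (1 : ℤ) Y, e (∑ j : Fin k, c i j * (y : ℝ) ^ ((j : ℕ) + 1)))
      (∑ y ∈ Icc (1 : ℤ) Y, e (∑ j : Fin k, ((⌊Q * c i j⌋ : ℝ) / Q) * (y : ℝ) ^ ((j : ℕ) + 1)))
    linarith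
  · have hpow : ∀ i, ‖∑ y ∈ Icc (1 : ℤ) Y, ch (fun j : Fin k => y ^ ((j : ℕ) + 1)) (a i)‖ ^ (2 * s) =
        ‖∑ x ∈ T, ch (v x) (a i)‖ ^ 2 := by
      intro i
      rw [mul_comm 2 s, pow_mul, ← norm_pow]
      congr 2
      have := Finset.prod_univ_sum (fun _ : Fin s => Icc (1 : ℤ) Y)
        (fun _ y => ch (fun j : Fin k => y ^ ((j : ℕ) + 1)) (a i))
      simp only [Finset.prod_const, Finset.card_univ, Fintype.card_fin] at this
      rw [this]
      refine Finset.sum_congr rfl fun x _ => ?_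
      rw [← ch_sum]
      congr 1
      funext j
      simp [hv]
    simp_rw [hpow]
    refine hLS.trans (le_of_eq ?_)
    trans (4 ^ Fintype.card (Fin k) * ∏ j, (Q : ℝ) / (B j)) * D * J s k Y
    · congr 2
      convert hJ
    rw [Fintype.card_fin, ← prod_Y_eq]
    congr 3
    refine Finset.prod_congr rfl fun j _ => ?_
    have hBr : (0 : ℝ) < B j := by exact_mod_cast hB1 j
    have hQBr : (Q : ℝ) = 6 * s * (Y : ℝ) ^ ((j : ℕ) + 1) * B j := by exact_mod_cast hQB j
    rw [hQBr]
    field_simp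

/-- Mean value bounds of the strength supplied by Vinogradov's method. -/
def MeanBd (k s : ℕ) : Prop :=
  ∀ ε > (0 : ℝ), ∃ C : ℝ, 1 ≤ C ∧ ∀ n : ℕ, 1 ≤ n →
    (J s k n : ℝ) * (n : ℝ) ^ (k * (k + 1) / 2 : ℕ) ≤ C * (n : ℝ) ^ (2 * s + ε)

lemma meanBd_one : MeanBd 1 1 := by
  intro ε hε
  refine ⟨1, le_rfl, fun n hn => ?_⟩
  have hn1 : (1 : ℝ) ≤ n := by exact_mod_cast hn
  have hJ : J 1 1 n ≤ n := by
    unfold J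
    refine (Finset.card_le_card_of_injOn (t := Icc (1 : ℤ) n) (fun x => x.1 0) ?_ ?_).trans (by simp)
    · intro x hx
      simp only [Finset.coe_filter, Finset.mem_product, Fintype.mem_piFinset,
        Set.mem_ofPred_eq] at hx
      exact hx.1.1 0
    · intro x hx y hy h
      simp only [Finset.coe_filter, Set.mem_ofPred_eq] at hx hy
      have h1 := hx.2 1
      have h2 := hy.2 1
      simp at h1 h2
      refine Prod.ext (funext fun i => ?_) (funext fun i => ?_) <;> rw [Subsingleton.elim i 0]
      · exact h
      · rw [← h1, ← h2]; exact h
  have hJr : (J 1 1 n : ℝ) ≤ n := by exact_mod_cast hJ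
  calc (J 1 1 n : ℝ) * (n : ℝ) ^ (1 * (1 + 1) / 2 : ℕ) ≤ n * n := by
        simp only [Nat.reduceAdd, one_mul, Nat.reduceDiv, pow_one]; gcongr
    _ = (n : ℝ) ^ (2 : ℝ) := by rw [Real.rpow_two, sq]
    _ ≤ 1 * (n : ℝ) ^ (2 * ((1 : ℕ) : ℝ) + ε) := by
        rw [one_mul]
        refine Real.rpow_le_rpow_of_exponent_le hn1 ?_
        push_cast; linarith

lemma meanBd_vinogradov {k : ℕ} (hk : 2 ≤ k) : MeanBd k (k * (k + 1)) := by
  intro ε hε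
  obtain ⟨C, hC, h⟩ := vinogradov_mean hk hε
  refine ⟨C, hC, fun n hn => ?_⟩
  have hn0 : (0 : ℝ) < n := by exact_mod_cast hn
  have h2 : ((k * (k + 1) / 2 : ℕ) : ℝ) = k * (k + 1) / 2 := by
    rw [Nat.cast_div (Nat.even_mul_succ_self k).two_dvd (by norm_num)]; push_cast; ring
  calc _ ≤ (C * (n : ℝ) ^ (3 / 2 * k * (k + 1) + ε)) * (n : ℝ) ^ (k * (k + 1) / 2 : ℕ) := by
        gcongr; exact h n hn
    _ = _ := by
        rw [← Real.rpow_natCast, h2, mul_assoc, ← Real.rpow_add hn0]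
        congr 2
        push_cast; ring

/-- The average of short Weyl sums over a family with bounded overlap. -/
lemma sum_weyl_le {k s : ℕ} (hk : 1 ≤ k) (hs : 1 ≤ s) (hJ : MeanBd k s) {ε : ℝ} (hε : 0 < ε) :
    ∃ C : ℝ, 1 ≤ C ∧ ∀ (Y : ℕ), 1 ≤ Y → ∀ {ι : Type} (A : Finset ι) (c : ι → Fin k → ℝ) (D : ℕ) (N : ℝ),
    1 ≤ N → (#A : ℝ) ≤ N →
    (∀ i₀ ∈ A, #(near A c Y i₀) ≤ D) →
    ∑ i ∈ A, ‖∑ y ∈ Icc (1 : ℤ) Y, e (∑ j : Fin k, c i j * (y : ℝ) ^ ((j : ℕ) + 1))‖ ≤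
      N + C * (N * (Y : ℝ) ^ (1 + ε) * (D / N) ^ (1 / (2 * s) : ℝ)) := by
  obtain ⟨C, hC, hJ⟩ := hJ ε hε
  have hsr : (1 : ℝ) ≤ s := by exact_mod_cast hs
  refine ⟨4 ^ k * (6 * s : ℝ) ^ k * C, ?_, fun Y hY ι A c D N hN hA hD => ?_⟩
  · have h1 : (1 : ℝ) ≤ 4 ^ k := one_le_pow₀ (by norm_num)
    have h2 : (1 : ℝ) ≤ (6 * s : ℝ) ^ k := one_le_pow₀ (by linarith)
    exact one_le_mul_of_one_le_of_one_le (one_le_mul_of_one_le_of_one_le h1 h2) hC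
  obtain ⟨S', h0, h1, h2⟩ := large_sieve_real hk hs hY A c hD
  set K := 4 ^ k * (6 * s : ℝ) ^ k * C with hK
  have hK1 : 1 ≤ K := by
    have h1 : (1 : ℝ) ≤ 4 ^ k := one_le_pow₀ (by norm_num)
    have h2 : (1 : ℝ) ≤ (6 * s : ℝ) ^ k := one_le_pow₀ (by linarith)
    exact one_le_mul_of_one_le_of_one_le (one_le_mul_of_one_le_of_one_le h1 h2) hC
  have hYr : (1 : ℝ) ≤ Y := by exact_mod_cast hY
  have hN0 : 0 < N := by linarith
  have h3 : ∑ i ∈ A, S' i ^ (2 * s) ≤ K * (Y : ℝ) ^ (2 * s + ε) * D := by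
    refine h2.trans ?_
    calc _ = 4 ^ k * (6 * s : ℝ) ^ k * D * ((J s k Y : ℝ) * (Y : ℝ) ^ (k * (k + 1) / 2 : ℕ)) := by ring
      _ ≤ 4 ^ k * (6 * s : ℝ) ^ k * D * (C * (Y : ℝ) ^ (2 * s + ε)) :=
        mul_le_mul_of_nonneg_left (hJ Y hY) (by positivity)
      _ = _ := by rw [hK]; ring
  have h4 : (∑ i ∈ A, S' i) ^ (2 * s) ≤ N ^ (2 * s) * (K * (Y : ℝ) ^ (2 * s + ε) * (D / N)) := by
    obtain ⟨m, hm⟩ : ∃ m, 2 * s = m + 1 := ⟨2 * s - 1, by omega⟩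
    calc (∑ i ∈ A, S' i) ^ (2 * s) ≤ (#A : ℝ) ^ m * ∑ i ∈ A, S' i ^ (m + 1) := by
          rw [hm]
          exact pow_sum_le_card_mul_sum_pow (fun i _ => h0 i) m
      _ ≤ N ^ m * (K * (Y : ℝ) ^ (2 * s + ε) * D) := by
          rw [← hm]
          have : 0 ≤ ∑ i ∈ A, S' i ^ (2 * s) := Finset.sum_nonneg fun i _ => pow_nonneg (h0 i) _
          gcongr
      _ = _ := by rw [hm, pow_succ]; field_simp
  have hs0 : (2 * s : ℕ) ≠ 0 := by omega
  clear_value K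
  have h5 : ∑ i ∈ A, S' i ≤ K * (N * (Y : ℝ) ^ (1 + ε) * (D / N) ^ (1 / (2 * s) : ℝ)) := by
    refine le_of_pow_le_pow_left₀ hs0 (by positivity) (h4.trans ?_)
    rw [mul_pow, mul_pow, mul_pow, ← Real.rpow_natCast ((D / N : ℝ) ^ _), ← Real.rpow_mul (by positivity),
      ← Real.rpow_natCast ((Y : ℝ) ^ _), ← Real.rpow_mul (by positivity)]
    push_cast
    rw [one_div_mul_cancel (by positivity), Real.rpow_one]
    have e1 : K ≤ K ^ (2 * s) := le_self_pow₀ hK1 hs0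
    have e2 : (Y : ℝ) ^ (2 * s + ε) ≤ (Y : ℝ) ^ ((1 + ε) * (2 * s)) :=
      Real.rpow_le_rpow_of_exponent_le hYr (by nlinarith)
    calc _ = N ^ (2 * s) * (D / N) * (K * (Y : ℝ) ^ (2 * s + ε)) := by ring
      _ ≤ N ^ (2 * s) * (D / N) * (K ^ (2 * s) * (Y : ℝ) ^ ((1 + ε) * (2 * s))) := by
          refine mul_le_mul_of_nonneg_left (mul_le_mul e1 e2 (by positivity) (by positivity)) (by positivity)
      _ = _ := by ring
  calc _ ≤ ∑ i ∈ A, (S' i + 1) := Finset.sum_le_sum h1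
    _ = ∑ i ∈ A, S' i + #A := by rw [Finset.sum_add_distrib]; simp
    _ ≤ _ := by linarith

lemma card_le_of_abs_sub_le {S : Finset ℕ} {R : ℝ} (hR : 0 ≤ R)
    (h : ∀ a ∈ S, ∀ b ∈ S, |(a : ℝ) - b| ≤ R) : (#S : ℝ) ≤ R + 1 := by
  rcases S.eq_empty_or_nonempty with rfl | hS
  · simp; linarith
  have hsub : S ⊆ Icc (S.min' hS) (S.max' hS) := fun x hx =>
    Finset.mem_Icc.2 ⟨S.min'_le x hx, S.le_max' x hx⟩
  have h1 := Finset.card_le_card hsub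
  rw [Nat.card_Icc] at h1
  have h2 := (le_abs_self _).trans (h _ (S.max'_mem hS) _ (S.min'_mem hS))
  have h3 : S.min' hS ≤ S.max' hS := S.min'_le _ (S.max'_mem hS)
  have h4 : (#S : ℝ) ≤ (S.max' hS : ℝ) + 1 - S.min' hS := by
    rw [← Nat.cast_add_one, ← Nat.cast_sub (by omega)]; exact_mod_cast h1
  linarith

lemma card_le_of_int_abs_le {S : Finset ℤ} {R : ℝ} (hR : 0 ≤ R)
    (h : ∀ a ∈ S, |(a : ℝ)| ≤ R) : (#S : ℝ) ≤ 2 * R + 1 := by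
  have hsub : S ⊆ Icc (-⌊R⌋) ⌊R⌋ := fun x hx => by
    have := abs_le.1 (h x hx)
    rw [Finset.mem_Icc]
    refine ⟨?_, Int.le_floor.2 this.2⟩
    have : -x ≤ ⌊R⌋ := Int.le_floor.2 (by push_cast; linarith)
    linarith
  have h1 := Finset.card_le_card hsub
  rw [Int.card_Icc] at h1
  have h0 : 0 ≤ ⌊R⌋ := Int.floor_nonneg.2 hR
  have h2 : ((#S : ℤ) : ℝ) ≤ ((⌊R⌋ + 1 - -⌊R⌋ : ℤ) : ℝ) := by
    exact_mod_cast (by omega : (#S : ℤ) ≤ ⌊R⌋ + 1 - -⌊R⌋)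
  push_cast at h2
  linarith [Int.floor_le R]

lemma card_le_image_mul {ι κ : Type*} [DecidableEq κ] (S : Finset ι) (f : ι → κ) {F G : ℝ}
    (hF0 : 0 ≤ F) (hF : ∀ b ∈ S.image f, (#{a ∈ S | f a = b} : ℝ) ≤ F) (hG : (#(S.image f) : ℝ) ≤ G) :
    (#S : ℝ) ≤ G * F := by
  rw [Finset.card_eq_sum_card_image f S]
  push_cast
  calc _ ≤ ∑ _b ∈ S.image f, F := Finset.sum_le_sum hF
    _ = #(S.image f) * F := by simp
    _ ≤ _ := by gcongr

/-- Counting points of a well spaced sequence that are close to a given one modulo one. -/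
lemma card_near_le {S : Finset ℕ} {g : ℕ → ℝ} {κ R h : ℝ} {m₀ : ℕ} (hκ : 0 < κ) (hh0 : 0 ≤ h)
    (hh : h ≤ 1) (hR0 : 0 ≤ R)
    (hsep : ∀ a ∈ S, ∀ b ∈ S, κ * |(a : ℝ) - b| ≤ |g a - g b|)
    (hR : ∀ a ∈ S, |g a - g m₀| ≤ R)
    (hn : ∀ a ∈ S, ∃ n : ℤ, |g a - g m₀ - n| ≤ h) :
    (#S : ℝ) ≤ (2 * R + 3) * (2 * h / κ + 1) := by
  classical
  choose! n hn using hn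
  refine card_le_image_mul S n (by positivity) (fun b _ => ?_) ?_
  · refine card_le_of_abs_sub_le (by positivity) fun x hx y hy => ?_
    rw [Finset.mem_filter] at hx hy
    rw [le_div_iff₀ hκ, mul_comm]
    refine (hsep x hx.1 y hy.1).trans ?_
    have h1 := abs_le.1 (hn x hx.1)
    have h2 := abs_le.1 (hn y hy.1)
    rw [hx.2] at h1
    rw [hy.2] at h2
    rw [abs_le]; constructor <;> linarith [h1.1, h1.2, h2.1, h2.2]
  · refine (card_le_of_int_abs_le (R := R + 1) (by positivity) fun a ha => ?_).trans (by linarith)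
    obtain ⟨x, hx, rfl⟩ := Finset.mem_image.1 ha
    have h1 := abs_le.1 (hn x hx)
    have h2 := abs_le.1 (hR x hx)
    rw [abs_le]; constructor <;> linarith [h1.1, h1.2, h2.1, h2.2]

/-- Counting pairs of a two parameter family for which two coordinates are close to given ones
modulo one. -/
lemma card_near_pair_le {S : Finset (ℕ × ℕ)} {g g' : ℕ × ℕ → ℝ} {R R' R₃ R₄ h h' : ℝ} {p₀ : ℕ × ℕ}
    (hh : h ≤ 1) (hh' : h' ≤ 1) (hR0 : 0 ≤ R) (hR0' : 0 ≤ R')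
    (hR30 : 0 ≤ R₃) (hR40 : 0 ≤ R₄)
    (hsep : ∀ a ∈ S, ∀ b ∈ S, |g a - g b| ≤ 2 * h → |g' a - g' b| ≤ 2 * h' →
      |(a.2 : ℝ) - b.2| ≤ R₃)
    (hsep' : ∀ a ∈ S, ∀ b ∈ S, |g a - g b| ≤ 2 * h → a.2 = b.2 → |(a.1 : ℝ) - b.1| ≤ R₄)
    (hR : ∀ a ∈ S, |g a - g p₀| ≤ R) (hR' : ∀ a ∈ S, |g' a - g' p₀| ≤ R')
    (hn : ∀ a ∈ S, ∃ n : ℤ, |g a - g p₀ - n| ≤ h) (hn' : ∀ a ∈ S, ∃ n : ℤ, |g' a - g' p₀ - n| ≤ h') :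
    (#S : ℝ) ≤ (2 * R + 3) * ((2 * R' + 3) * ((R₃ + 1) * (R₄ + 1))) := by
  classical
  choose! n hn using hn
  choose! n' hn' using hn'
  refine card_le_image_mul S n (by positivity) (fun b _ => ?_) ?_
  · refine card_le_image_mul _ n' (by positivity) (fun b' _ => ?_) ?_
    · refine card_le_image_mul _ Prod.snd (by positivity) (fun m _ => ?_) ?_
      · rw [← Finset.card_image_of_injOn (f := Prod.fst) (fun x hx y hy hxy => ?_)]
        · refine card_le_of_abs_sub_le hR40 fun x hx y hy => ?_
          obtain ⟨p, hp, rfl⟩ := Finset.mem_image.1 hx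
          obtain ⟨q, hq, rfl⟩ := Finset.mem_image.1 hy
          simp only [Finset.mem_filter] at hp hq
          refine hsep' p hp.1.1.1 q hq.1.1.1 ?_ (hp.2.trans hq.2.symm)
          have h1 := abs_le.1 (hn p hp.1.1.1)
          have h2 := abs_le.1 (hn q hq.1.1.1)
          rw [hp.1.1.2] at h1
          rw [hq.1.1.2] at h2
          rw [abs_le]; constructor <;> linarith [h1.1, h1.2, h2.1, h2.2]
        · simp only [Finset.coe_filter, Finset.mem_filter, Set.mem_ofPred_eq] at hx hy
          exact Prod.ext hxy (hx.2.trans hy.2.symm)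
      · refine card_le_of_abs_sub_le hR30 fun x hx y hy => ?_
        obtain ⟨p, hp, rfl⟩ := Finset.mem_image.1 hx
        obtain ⟨q, hq, rfl⟩ := Finset.mem_image.1 hy
        simp only [Finset.mem_filter] at hp hq
        have h1 := abs_le.1 (hn p hp.1.1)
        have h2 := abs_le.1 (hn q hq.1.1)
        have h3 := abs_le.1 (hn' p hp.1.1)
        have h4 := abs_le.1 (hn' q hq.1.1)
        rw [hp.1.2] at h1
        rw [hq.1.2] at h2
        rw [hp.2] at h3
        rw [hq.2] at h4
        refine hsep p hp.1.1 q hq.1.1 ?_ ?_ <;> rw [abs_le] <;> constructor <;>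
          linarith [h1.1, h1.2, h2.1, h2.2, h3.1, h3.2, h4.1, h4.2]
    · refine (card_le_of_int_abs_le (R := R' + 1) (by positivity) fun a ha => ?_).trans (by linarith)
      obtain ⟨x, hx, rfl⟩ := Finset.mem_image.1 ha
      rw [Finset.mem_filter] at hx
      have h1 := abs_le.1 (hn' x hx.1)
      have h2 := abs_le.1 (hR' x hx.1)
      rw [abs_le]; constructor <;> linarith [h1.1, h1.2, h2.1, h2.2]
  · refine (card_le_of_int_abs_le (R := R + 1) (by positivity) fun a ha => ?_).trans (by linarith)
    obtain ⟨x, hx, rfl⟩ := Finset.mem_image.1 ha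
    have h1 := abs_le.1 (hn x hx)
    have h2 := abs_le.1 (hR x hx)
    rw [abs_le]; constructor <;> linarith [h1.1, h1.2, h2.1, h2.2]

lemma norm_sum_Ioc_sub_shift_le {g : ℕ → ℂ} (hg : ∀ n, ‖g n‖ ≤ 1) (a b y : ℕ) :
    ‖∑ m ∈ Ioc a b, g m - ∑ m ∈ Ioc a b, g (m + y)‖ ≤ 2 * y := by
  induction y with
  | zero => simp
  | succ y ih =>
    have h1 : ∑ m ∈ Ioc a b, g (m + y) - ∑ m ∈ Ioc a b, g (m + (y + 1)) =
        if a ≤ b then g (a + 1 + y) - g (b + 1 + y) else 0 := by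
      split_ifs with hab
      · rw [← Finset.sum_sub_distrib]
        have := Finset.sum_Ico_sub (fun m => g (m + y)) (show a + 1 ≤ b + 1 by omega)
        rw [← neg_inj, ← Finset.sum_neg_distrib, neg_sub, ← this]
        refine Finset.sum_congr ?_ fun m _ => ?_
        · ext; simp
        · rw [neg_sub]; congr 2; ring
      · rw [Finset.Ioc_eq_empty (by omega)]; simp
    have h2 : ‖∑ m ∈ Ioc a b, g (m + y) - ∑ m ∈ Ioc a b, g (m + (y + 1))‖ ≤ 2 := by
      rw [h1]
      split_ifs
      · exact (norm_sub_le _ _).trans (by linarith [hg (a + 1 + y), hg (b + 1 + y)])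
      · simp
    calc _ = ‖(∑ m ∈ Ioc a b, g m - ∑ m ∈ Ioc a b, g (m + y)) +
          (∑ m ∈ Ioc a b, g (m + y) - ∑ m ∈ Ioc a b, g (m + (y + 1)))‖ := by congr 1; ring
      _ ≤ _ := (norm_add_le _ _).trans (by push_cast; linarith)

lemma mul_norm_sum_le_sum_shift {g : ℕ → ℂ} (hg : ∀ n, ‖g n‖ ≤ 1) (a b Y : ℕ) :
    Y * ‖∑ m ∈ Ioc a b, g m‖ ≤
      ∑ m ∈ Ioc a b, ‖∑ y ∈ Icc 1 Y, g (m + y)‖ + 2 * (Y : ℝ) ^ 2 := by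
  have h1 : (Y : ℂ) * ∑ m ∈ Ioc a b, g m =
      ∑ y ∈ Icc 1 Y, (∑ m ∈ Ioc a b, g m - ∑ m ∈ Ioc a b, g (m + y)) +
      ∑ m ∈ Ioc a b, ∑ y ∈ Icc 1 Y, g (m + y) := by
    rw [Finset.sum_comm (s := Ioc a b), ← Finset.sum_add_distrib]
    simp
  calc (Y : ℝ) * ‖∑ m ∈ Ioc a b, g m‖ = ‖(Y : ℂ) * ∑ m ∈ Ioc a b, g m‖ := by simp
    _ ≤ ∑ y ∈ Icc 1 Y, (2 * Y : ℝ) + ∑ m ∈ Ioc a b, ‖∑ y ∈ Icc 1 Y, g (m + y)‖ := by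
        rw [h1]
        refine (norm_add_le _ _).trans (add_le_add ?_ (norm_sum_le _ _))
        refine (norm_sum_le _ _).trans (Finset.sum_le_sum fun y hy => ?_)
        refine (norm_sum_Ioc_sub_shift_le hg a b y).trans ?_
        have : (y : ℝ) ≤ Y := by exact_mod_cast (Finset.mem_Icc.1 hy).2
        linarith
    _ = _ := by simp; ring

lemma succ_mul_choose_succ (a : ℝ) (n : ℕ) :
    ((n : ℝ) + 1) * Ring.choose a (n + 1) = (a - n) * Ring.choose a n := by
  rw [Ring.choose_eq_smul, Ring.choose_eq_smul, ← Polynomial.aeval_eq_smeval,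
    ← Polynomial.aeval_eq_smeval, descPochhammer_succ_right, Nat.factorial_succ]
  have : (n.factorial : ℝ) ≠ 0 := by positivity
  simp only [map_mul, map_sub, Polynomial.aeval_X, map_natCast, smul_eq_mul]
  push_cast
  field_simp

lemma choose_ne_zero {c : ℝ} (hc : ∀ z : ℤ, (z : ℝ) ≠ c) (n : ℕ) : Ring.choose c n ≠ 0 := by
  induction n with
  | zero => simp
  | succ n ih =>
    intro h
    have h1 := succ_mul_choose_succ c n
    rw [h, mul_zero] at h1
    rcases mul_eq_zero.1 h1.symm with h2 | h2
    · exact hc n (by push_cast; linarith)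
    · exact ih h2

lemma choose_pos_of_le {c : ℝ} {n : ℕ} (h : (n : ℝ) < c + 1) : 0 < Ring.choose c n := by
  induction n with
  | zero => simp
  | succ n ih =>
    push_cast at h
    have h1 := succ_mul_choose_succ c n
    have h2 : 0 < (c - n) * Ring.choose c n := mul_pos (by linarith) (ih (by linarith))
    rw [← h1] at h2
    exact (pos_iff_pos_of_mul_pos h2).1 (by positivity)

lemma rpow_taylor (a : ℝ) (k : ℕ) : ∃ C : ℝ, 1 ≤ C ∧ ∃ δ : ℝ, 0 < δ ∧ δ ≤ 1 / 2 ∧ ∀ z : ℝ, |z| ≤ δ →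
    |(1 + z) ^ a - ∑ n ∈ range (k + 1), Ring.choose a n * z ^ n| ≤ C * |z| ^ (k + 1) := by
  have h := (Real.one_add_rpow_hasFPowerSeriesAt_zero (a := a)).isBigO_sub_partialSum_pow (k + 1)
  obtain ⟨C, hC⟩ := h.bound
  obtain ⟨δ, hδ, hδ2⟩ := Metric.eventually_nhds_iff.1 hC
  refine ⟨max C 1, le_max_right _ _, min (δ / 2) (1 / 2), by positivity, min_le_right _ _,
    fun z hz => ?_⟩
  have h1 := hδ2 (y := z) (by
    rw [Real.dist_eq, sub_zero]
    linarith [min_le_left (δ / 2) (1 / 2 : ℝ)])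
  rw [Real.norm_eq_abs, Real.norm_eq_abs, Real.norm_eq_abs, abs_pow, abs_abs] at h1
  have h2 : (binomialSeries ℝ a).partialSum (k + 1) z =
      ∑ n ∈ range (k + 1), Ring.choose a n * z ^ n := by
    rw [FormalMultilinearSeries.partialSum]
    refine Finset.sum_congr rfl fun n _ => ?_
    rw [binomialSeries_apply]
    simp
  rw [h2, zero_add] at h1
  refine h1.trans ?_
  gcongr
  exact le_max_left _ _

/-- The `j`-th Taylor coefficient at `m` of `x ↦ A x ^ c + B x ^ k₀`. -/
def coef (c : ℝ) (k₀ : ℕ) (A B : ℝ) (j : ℕ) (m : ℝ) : ℝ :=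
  A * Ring.choose c j * m ^ (c - j) + B * (k₀.choose j : ℝ) * m ^ ((k₀ : ℝ) - j)

lemma phase_taylor (c : ℝ) (k₀ k : ℕ) (hc : (k₀ : ℝ) < c) :
    ∃ C : ℝ, 1 ≤ C ∧ ∃ δ : ℝ, 0 < δ ∧ δ ≤ 1 / 2 ∧ ∀ A B m y : ℝ, 0 ≤ B → B ≤ A → 1 ≤ m → 0 ≤ y →
    y ≤ δ * m →
    |A * (m + y) ^ c + B * (m + y) ^ k₀ - ∑ j ∈ range (k + 1), coef c k₀ A B j m * y ^ j| ≤
      C * (A * m ^ c * (y / m) ^ (k + 1)) := by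
  obtain ⟨C₁, hC₁, δ₁, hδ₁, hδ₁', h₁⟩ := rpow_taylor c k
  obtain ⟨C₂, hC₂, δ₂, hδ₂, hδ₂', h₂⟩ := rpow_taylor k₀ k
  refine ⟨C₁ + C₂, by linarith, min δ₁ δ₂, lt_min hδ₁ hδ₂, (min_le_left _ _).trans hδ₁',
    fun A B m y hB hBA hm hy hym => ?_⟩
  have hm0 : 0 < m := by linarith
  have hz : 0 ≤ y / m := by positivity
  have hz2 : y / m ≤ min δ₁ δ₂ := by rwa [div_le_iff₀ hm0]
  have e₁ := h₁ (y / m) (by rw [abs_of_nonneg hz]; exact hz2.trans (min_le_left _ _))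
  have e₂ := h₂ (y / m) (by rw [abs_of_nonneg hz]; exact hz2.trans (min_le_right _ _))
  rw [abs_of_nonneg hz] at e₁ e₂
  have hA : 0 ≤ A := hB.trans hBA
  have key : A * (m + y) ^ c + B * (m + y) ^ k₀ - ∑ j ∈ range (k + 1), coef c k₀ A B j m * y ^ j =
      A * m ^ c * ((1 + y / m) ^ c - ∑ n ∈ range (k + 1), Ring.choose c n * (y / m) ^ n) +
      B * m ^ (k₀ : ℝ) * ((1 + y / m) ^ (k₀ : ℝ) -
        ∑ n ∈ range (k + 1), Ring.choose (k₀ : ℝ) n * (y / m) ^ n) := by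
    have hmy : m + y = m * (1 + y / m) := by field_simp
    rw [hmy, Real.mul_rpow hm0.le (by positivity), mul_pow, Real.rpow_natCast, Real.rpow_natCast,
      mul_sub, mul_sub, Finset.mul_sum, Finset.mul_sum]
    have : ∑ j ∈ range (k + 1), coef c k₀ A B j m * y ^ j =
        ∑ n ∈ range (k + 1), A * m ^ c * (Ring.choose c n * (y / m) ^ n) +
        ∑ n ∈ range (k + 1), B * m ^ k₀ * (Ring.choose (k₀ : ℝ) n * (y / m) ^ n) := by
      rw [← Finset.sum_add_distrib]
      refine Finset.sum_congr rfl fun j _ => ?_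
      rw [coef, Real.rpow_sub hm0, Real.rpow_sub hm0, Real.rpow_natCast, Real.rpow_natCast,
        Ring.choose_natCast, div_pow]
      ring
    rw [this]
    ring
  rw [key]
  have hmk : m ^ (k₀ : ℝ) ≤ m ^ c := Real.rpow_le_rpow_of_exponent_le hm hc.le
  calc _ ≤ A * m ^ c * (C₁ * (y / m) ^ (k + 1)) + B * m ^ (k₀ : ℝ) * (C₂ * (y / m) ^ (k + 1)) := by
        refine (abs_add_le _ _).trans (add_le_add ?_ ?_)
        · rw [abs_mul, abs_of_nonneg (by positivity : 0 ≤ A * m ^ c)]; gcongr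
        · rw [abs_mul, abs_of_nonneg (by positivity : 0 ≤ B * m ^ (k₀ : ℝ))]; gcongr
    _ ≤ A * m ^ c * (C₁ * (y / m) ^ (k + 1)) + A * m ^ c * (C₂ * (y / m) ^ (k + 1)) := by gcongr
    _ = _ := by ring

/-- The set of pairs `(l, m)` with `l ∈ L` and `a l < m ≤ b l`. -/
def pairs (L : Finset ℕ) (a b : ℕ → ℕ) : Finset (ℕ × ℕ) :=
  L.biUnion fun l => {l} ×ˢ Ioc (a l) (b l)

lemma mem_pairs {L : Finset ℕ} {a b : ℕ → ℕ} {p : ℕ × ℕ} :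
    p ∈ pairs L a b ↔ p.1 ∈ L ∧ p.2 ∈ Ioc (a p.1) (b p.1) := by
  simp only [pairs, Finset.mem_biUnion, Finset.mem_product, Finset.mem_singleton]
  constructor
  · rintro ⟨l, hl, rfl, h⟩; exact ⟨hl, h⟩
  · rintro ⟨h1, h2⟩; exact ⟨_, h1, rfl, h2⟩

lemma sum_icc_int_eq (Y : ℕ) (f : ℤ → ℂ) : ∑ y ∈ Icc (1 : ℤ) Y, f y = ∑ y ∈ Icc 1 Y, f (y : ℕ) := by
  symm
  refine Finset.sum_bij (fun y _ => (y : ℤ)) ?_ ?_ ?_ ?_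
  · intro y hy; rw [Finset.mem_Icc] at hy ⊢; omega
  · intro x _ y _ h; exact_mod_cast h
  · intro y hy
    rw [Finset.mem_Icc] at hy
    exact ⟨y.toNat, by rw [Finset.mem_Icc]; omega, by omega⟩
  · intro y _; rfl

lemma sum_phase_le {c : ℝ} {k₀ k s : ℕ} (hc : (k₀ : ℝ) < c) (hk : 1 ≤ k) (hs : 1 ≤ s)
    (hJ : MeanBd k s) {ε : ℝ} (hε : 0 < ε) :
    ∃ C : ℝ, 1 ≤ C ∧ ∃ δ : ℝ, 0 < δ ∧ ∀ (Y : ℕ) (M T N D : ℝ) (L : Finset ℕ) (a b : ℕ → ℕ)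
      (A B : ℕ → ℝ), 1 ≤ Y → 2 ≤ M → 0 ≤ T → Y ≤ δ * M →
      (∀ l ∈ L, 0 ≤ B l ∧ B l ≤ A l ∧ A l * M ^ c ≤ T ∧ M / 2 ≤ a l ∧ b l ≤ 2 * M) →
      1 ≤ N → (#(pairs L a b) : ℝ) ≤ N → 0 ≤ D →
      (∀ p₀ ∈ pairs L a b, (#(near (pairs L a b)
        (fun p j => coef c k₀ (A p.1) (B p.1) ((j : Fin k) + 1) p.2) Y p₀) : ℝ) ≤ D) →
      ∑ l ∈ L, ‖∑ m ∈ Ioc (a l) (b l), e (A l * (m : ℝ) ^ c + B l * (m : ℝ) ^ k₀)‖ ≤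
        N / Y + C * (N * (Y : ℝ) ^ ε * (D / N) ^ (1 / (2 * s) : ℝ)) +
          C * (N * (T * (Y / M) ^ (k + 1))) + 2 * Y * #L := by
  obtain ⟨C₁, hC₁, δ, hδ, -, hT⟩ := phase_taylor c k₀ k hc
  obtain ⟨C₂, hC₂, hW⟩ := sum_weyl_le hk hs hJ hε
  have hc0 : 0 < c := lt_of_le_of_lt (Nat.cast_nonneg _) hc
  set K : ℝ := 7 * C₁ * 2 ^ c * 2 ^ (k + 1) with hK
  have h2c : (1 : ℝ) ≤ 2 ^ c := Real.one_le_rpow (by norm_num) hc0.le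
  have h2k : (1 : ℝ) ≤ 2 ^ (k + 1) := one_le_pow₀ (by norm_num)
  have hK0 : 0 ≤ K := by positivity
  refine ⟨C₂ + K, by linarith, δ / 2, by positivity,
    fun Y M T N D L a b A B hY hM hT0 hYM hl hN hPN hD0 hD => ?_⟩
  have hYr : (1 : ℝ) ≤ Y := by exact_mod_cast hY
  have hY0 : (0 : ℝ) < Y := by linarith
  have hM0 : (0 : ℝ) < M := by linarith
  have hN0 : (0 : ℝ) < N := by linarith
  set P := pairs L a b with hP
  set cf : ℕ × ℕ → Fin k → ℝ := fun p j => coef c k₀ (A p.1) (B p.1) (j + 1) p.2 with hcf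
  have hW' := hW Y hY P cf ⌊D⌋₊ N hN hPN (fun p hp => Nat.le_floor (hD p hp))
  have hsum : ∀ F : ℕ × ℕ → ℝ, ∑ p ∈ P, F p = ∑ l ∈ L, ∑ m ∈ Ioc (a l) (b l), F (l, m) := fun F =>
    Finset.sum_finset_product P L (fun l => Ioc (a l) (b l)) (fun p => mem_pairs)
  -- each shifted sum is close to a Weyl sum
  have hstep : ∀ l ∈ L, ∀ m ∈ Ioc (a l) (b l),
      ‖∑ y ∈ Icc 1 Y, e (A l * ((m + y : ℕ) : ℝ) ^ c + B l * ((m + y : ℕ) : ℝ) ^ k₀)‖ ≤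
      ‖∑ y ∈ Icc (1 : ℤ) Y, e (∑ j : Fin k, cf (l, m) j * (y : ℝ) ^ ((j : ℕ) + 1))‖ +
        Y * (K * (T * (Y / M) ^ (k + 1))) := by
    intro l hlL m hm
    obtain ⟨h1, h2, h3, h4, h5⟩ := hl l hlL
    rw [Finset.mem_Ioc] at hm
    have hm1 : M / 2 ≤ m := h4.trans (by exact_mod_cast hm.1.le)
    have hm2 : (m : ℝ) ≤ 2 * M := le_trans (by exact_mod_cast hm.2) h5
    have hm3 : (1 : ℝ) ≤ m := by linarith
    have hm0 : (0 : ℝ) < m := by linarith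
    have hA : 0 ≤ A l := h1.trans h2
    rw [sum_icc_int_eq]
    have e0 : ‖e (coef c k₀ (A l) (B l) 0 m) *
        ∑ y ∈ Icc 1 Y, e (∑ j : Fin k, cf (l, m) j * (((y : ℕ) : ℤ) : ℝ) ^ ((j : ℕ) + 1))‖ =
        ‖∑ y ∈ Icc 1 Y, e (∑ j : Fin k, cf (l, m) j * (((y : ℕ) : ℤ) : ℝ) ^ ((j : ℕ) + 1))‖ := by
      rw [norm_mul, norm_e, one_mul]
    rw [← e0, ← sub_le_iff_le_add']
    refine (norm_sub_norm_le _ _).trans ?_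
    rw [Finset.mul_sum, ← Finset.sum_sub_distrib]
    calc _ ≤ ∑ y ∈ Icc 1 Y, (K * (T * (Y / M) ^ (k + 1))) := by
          refine (norm_sum_le _ _).trans (Finset.sum_le_sum fun y hy => ?_)
          rw [Finset.mem_Icc] at hy
          have hyY : (y : ℝ) ≤ Y := by exact_mod_cast hy.2
          rw [← e_add]
          refine (norm_e_sub_e_le _ _).trans ?_
          have e1 := hT (A l) (B l) m y h1 h2 hm3 (by positivity) (by
            calc (y : ℝ) ≤ δ / 2 * M := hyY.trans hYM
              _ = δ * (M / 2) := by ring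
              _ ≤ δ * m := by gcongr)
          have e2 : ∑ j ∈ range (k + 1), coef c k₀ (A l) (B l) j m * (y : ℝ) ^ j =
              coef c k₀ (A l) (B l) 0 m +
                ∑ j : Fin k, cf (l, m) j * (((y : ℕ) : ℤ) : ℝ) ^ ((j : ℕ) + 1) := by
            rw [Finset.sum_range_succ', add_comm, pow_zero, mul_one,
              ← Fin.sum_univ_eq_sum_range (fun j => coef c k₀ (A l) (B l) (j + 1) m * (y : ℝ) ^ (j + 1))]
            simp [hcf]
          rw [← e2]
          push_cast
          have hpi : 2 * Real.pi ≤ 7 := by linarith [Real.pi_lt_d2]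
          calc _ ≤ 7 * (C₁ * (A l * (m : ℝ) ^ c * (y / m) ^ (k + 1))) := by gcongr
            _ ≤ 7 * (C₁ * (A l * (2 * M) ^ c * (Y / (M / 2)) ^ (k + 1))) := by gcongr
            _ = K * ((A l * M ^ c) * (Y / M) ^ (k + 1)) := by
                rw [Real.mul_rpow (by norm_num) hM0.le, hK,
                  show (Y : ℝ) / (M / 2) = 2 * (Y / M) by field_simp, mul_pow]; ring
            _ ≤ _ := by gcongr
      _ = _ := by simp
  have hmain : ∀ l ∈ L,
      Y * ‖∑ m ∈ Ioc (a l) (b l), e (A l * (m : ℝ) ^ c + B l * (m : ℝ) ^ k₀)‖ ≤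
      ∑ m ∈ Ioc (a l) (b l),
        (‖∑ y ∈ Icc (1 : ℤ) Y, e (∑ j : Fin k, cf (l, m) j * (y : ℝ) ^ ((j : ℕ) + 1))‖ +
        Y * (K * (T * (Y / M) ^ (k + 1)))) + 2 * (Y : ℝ) ^ 2 := by
    intro l hlL
    refine (mul_norm_sum_le_sum_shift (g := fun m => e (A l * (m : ℝ) ^ c + B l * (m : ℝ) ^ k₀))
      (fun n => (norm_e _).le) (a l) (b l) Y).trans ?_
    gcongr with m hm
    exact hstep l hlL m hm
  have htot := Finset.sum_le_sum hmain
  rw [← Finset.mul_sum, Finset.sum_add_distrib, ← hsum (fun p =>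
    ‖∑ y ∈ Icc (1 : ℤ) Y, e (∑ j : Fin k, cf p j * (y : ℝ) ^ ((j : ℕ) + 1))‖ +
        Y * (K * (T * (Y / M) ^ (k + 1)))), Finset.sum_add_distrib] at htot
  simp only [Finset.sum_const, nsmul_eq_mul] at htot
  have hfl : ((⌊D⌋₊ : ℝ)) ≤ D := Nat.floor_le hD0
  have h5 : (⌊D⌋₊ / N : ℝ) ^ (1 / (2 * s) : ℝ) ≤ (D / N) ^ (1 / (2 * s) : ℝ) := by
    gcongr
  have h6 : N + C₂ * (N * (Y : ℝ) ^ (1 + ε) * (⌊D⌋₊ / N) ^ (1 / (2 * s) : ℝ)) ≤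
      N + C₂ * (N * (Y : ℝ) ^ (1 + ε) * (D / N) ^ (1 / (2 * s) : ℝ)) := by gcongr
  have h7 : (#P : ℝ) * (Y * (K * (T * (Y / M) ^ (k + 1)))) ≤ N * (Y * (K * (T * (Y / M) ^ (k + 1)))) := by
    gcongr
  refine le_of_mul_le_mul_left (a := (Y : ℝ)) ?_ hY0
  refine htot.trans ?_
  have h8 : 0 ≤ K * (N * (Y : ℝ) ^ ε * (D / N) ^ (1 / (2 * s) : ℝ)) := by positivity
  have h9 : 0 ≤ C₂ * (N * (T * (Y / M : ℝ) ^ (k + 1))) := by positivity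
  have h10 : (Y : ℝ) * (N / Y + (C₂ + K) * (N * (Y : ℝ) ^ ε * (D / N) ^ (1 / (2 * s) : ℝ)) +
      (C₂ + K) * (N * (T * (Y / M : ℝ) ^ (k + 1))) + 2 * Y * #L) =
      (N + C₂ * (N * (Y : ℝ) ^ (1 + ε) * (D / N) ^ (1 / (2 * s) : ℝ))) +
      N * (Y * (K * (T * (Y / M) ^ (k + 1)))) + #L * (2 * (Y : ℝ) ^ 2) +
      Y * (K * (N * (Y : ℝ) ^ ε * (D / N) ^ (1 / (2 * s) : ℝ))) +
      Y * (C₂ * (N * (T * (Y / M : ℝ) ^ (k + 1)))) := by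
    rw [Real.rpow_add hY0, Real.rpow_one]; field_simp; ring
  rw [h10]
  have h11 := mul_nonneg hY0.le h8
  have h12 := mul_nonneg hY0.le h9
  linarith

lemma rpow_le_two_rpow_abs {x : ℝ} (h1 : 1 / 2 ≤ x) (h2 : x ≤ 2) (e : ℝ) : x ^ e ≤ 2 ^ |e| := by
  have hx : 0 < x := by linarith
  rw [Real.rpow_def_of_pos hx, Real.rpow_def_of_pos (by norm_num : (0 : ℝ) < 2)]
  refine Real.exp_le_exp.2 ?_
  have h3 : Real.log x ≤ Real.log 2 := Real.log_le_log hx h2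
  have h4 : -Real.log 2 ≤ Real.log x := by
    rw [← Real.log_inv]; exact Real.log_le_log (by norm_num) (by linarith)
  calc _ ≤ |Real.log x * e| := le_abs_self _
    _ = |Real.log x| * |e| := abs_mul _ _
    _ ≤ _ := by
      gcongr
      exact abs_le.2 ⟨h4, h3⟩

lemma inv_two_rpow_abs_le {x : ℝ} (h1 : 1 / 2 ≤ x) (h2 : x ≤ 2) (e : ℝ) : (2 ^ |e|)⁻¹ ≤ x ^ e := by
  have hx : 0 < x := by linarith
  have := rpow_le_two_rpow_abs h1 h2 (-e)
  rw [abs_neg, Real.rpow_neg hx.le] at this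
  exact inv_le_of_inv_le₀ (by positivity) this

lemma rpow_le_of_mem {M x : ℝ} (hM : 0 < M) (h1 : M / 2 ≤ x) (h2 : x ≤ 2 * M) (e : ℝ) :
    x ^ e ≤ 2 ^ |e| * M ^ e := by
  have : x = x / M * M := by field_simp
  rw [this, Real.mul_rpow (div_nonneg (by linarith) hM.le) hM.le]
  gcongr
  exact rpow_le_two_rpow_abs (by rw [le_div_iff₀ hM]; linarith) (by rw [div_le_iff₀ hM]; linarith) e

lemma le_rpow_of_mem {M x : ℝ} (hM : 0 < M) (h1 : M / 2 ≤ x) (h2 : x ≤ 2 * M) (e : ℝ) :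
    (2 ^ |e|)⁻¹ * M ^ e ≤ x ^ e := by
  have : x = x / M * M := by field_simp
  rw [this, Real.mul_rpow (div_nonneg (by linarith) hM.le) hM.le]
  gcongr
  exact inv_two_rpow_abs_le (by rw [le_div_iff₀ hM]; linarith) (by rw [div_le_iff₀ hM]; linarith) e

lemma le_abs_rpow_sub {M x y : ℝ} (hM : 0 < M) (hx1 : M / 2 ≤ x) (hx2 : x ≤ 2 * M)
    (hy1 : M / 2 ≤ y) (hy2 : y ≤ 2 * M) (e : ℝ) :
    |e| * (2 ^ |e - 1|)⁻¹ * M ^ (e - 1) * |x - y| ≤ |x ^ e - y ^ e| := by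
  wlog hxy : y < x generalizing x y with H
  · rcases eq_or_lt_of_le (not_lt.1 hxy) with h | h
    · subst h; simp
    · rw [abs_sub_comm x y, abs_sub_comm (x ^ e)]
      exact H hy1 hy2 hx1 hx2 h
  obtain ⟨ξ, hξ, h⟩ := exists_hasDerivAt_eq_slope (fun t : ℝ => t ^ e) (fun t => e * t ^ (e - 1)) hxy
    (fun t ht => (Real.continuousAt_rpow_const t e (Or.inl (by
      have := ht.1; linarith))).continuousWithinAt)
    (fun t ht => Real.hasDerivAt_rpow_const (Or.inl (by
      have := ht.1; linarith)))
  have hd : 0 < x - y := by linarith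
  rw [eq_div_iff hd.ne'] at h
  rw [← h, abs_mul, abs_mul, mul_assoc |e|]
  have hξ0 : 0 < ξ := by linarith [hξ.1]
  rw [abs_of_nonneg (by positivity : 0 ≤ ξ ^ (e - 1))]
  gcongr
  exact le_rpow_of_mem hM (by linarith [hξ.1]) (by linarith [hξ.2]) _

lemma coef_sub_bounds {c : ℝ} {k₀ : ℕ} (hci : ∀ z : ℤ, (z : ℝ) ≠ c) (hc : (k₀ : ℝ) < c) (j : ℕ) :
    ∃ κ : ℝ, 0 < κ ∧ ∀ A B M x y : ℝ, 0 ≤ B → B ≤ A → 2 ≤ M →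
      M / 2 ≤ x → x ≤ 2 * M → M / 2 ≤ y → y ≤ 2 * M →
      κ * (A * M ^ (c - j - 1)) * |x - y| ≤ |coef c k₀ A B j x - coef c k₀ A B j y| := by
  set a := Ring.choose c j with ha
  have ha0 : a ≠ 0 := choose_ne_zero hci j
  have hcj : c - j ≠ 0 := fun h => hci j (by push_cast; linarith)
  refine ⟨|a| * (|c - j| * (2 ^ |c - j - 1|)⁻¹), by positivity, ?_⟩
  intro A B M x y hB hBA hM hx1 hx2 hy1 hy2
  have hM0 : 0 < M := by linarith
  have hA : 0 ≤ A := hB.trans hBA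
  have key : A * |a| * |x ^ (c - j) - y ^ (c - j)| ≤ |coef c k₀ A B j x - coef c k₀ A B j y| := by
    clear_value a
    wlog hxy : y ≤ x generalizing x y with H
    · rw [abs_sub_comm (x ^ _), abs_sub_comm (coef _ _ _ _ _ _)]
      exact H y x hy1 hy2 hx1 hx2 (not_le.1 hxy).le
    have hy0 : 0 < y := by linarith
    have e1 : coef c k₀ A B j x - coef c k₀ A B j y =
        A * a * (x ^ (c - j) - y ^ (c - j)) +
          B * (k₀.choose j : ℝ) * (x ^ ((k₀ : ℝ) - j) - y ^ ((k₀ : ℝ) - j)) := by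
      rw [coef, coef, ha]; ring
    rw [e1]
    rcases le_or_gt j k₀ with hj | hj
    · have hjr : (j : ℝ) ≤ k₀ := by exact_mod_cast hj
      have hapos : 0 < a := by rw [ha]; exact choose_pos_of_le (by linarith)
      have h1 : 0 ≤ x ^ (c - j) - y ^ (c - j) :=
        sub_nonneg.2 (Real.rpow_le_rpow hy0.le hxy (by linarith))
      have h2 : 0 ≤ x ^ ((k₀ : ℝ) - j) - y ^ ((k₀ : ℝ) - j) :=
        sub_nonneg.2 (Real.rpow_le_rpow hy0.le hxy (by linarith))
      rw [abs_of_pos hapos, abs_of_nonneg h1, abs_of_nonneg (by positivity)]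
      have : 0 ≤ B * (k₀.choose j : ℝ) * (x ^ ((k₀ : ℝ) - j) - y ^ ((k₀ : ℝ) - j)) := by positivity
      linarith
    · rw [Nat.choose_eq_zero_of_lt hj, Nat.cast_zero, mul_zero, zero_mul, add_zero, abs_mul, abs_mul,
        abs_of_nonneg hA]
  refine le_trans ?_ key
  have h3 := le_abs_rpow_sub hM0 hx1 hx2 hy1 hy2 (c - j)
  calc _ = A * |a| * (|c - j| * (2 ^ |c - j - 1|)⁻¹ * M ^ (c - j - 1) * |x - y|) := by ring
    _ ≤ _ := by gcongr

lemma abs_coef_le {c : ℝ} {k₀ : ℕ} (hc : (k₀ : ℝ) < c) (j : ℕ) :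
    ∃ K : ℝ, 0 < K ∧ ∀ A B M x : ℝ, 0 ≤ B → B ≤ A → 2 ≤ M →
      M / 2 ≤ x → x ≤ 2 * M → |coef c k₀ A B j x| ≤ K * (A * M ^ (c - j)) := by
  refine ⟨(|Ring.choose c j| + k₀.choose j + 1) * 2 ^ |c - j|, by positivity, ?_⟩
  intro A B M x hB hBA hM hx1 hx2
  have hM0 : 0 < M := by linarith
  have hx0 : 0 < x := by linarith
  have hA : 0 ≤ A := hB.trans hBA
  have h1 : x ^ ((k₀ : ℝ) - j) ≤ x ^ (c - j) := Real.rpow_le_rpow_of_exponent_le (by linarith) (by linarith)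
  have h2 := rpow_le_of_mem hM0 hx1 hx2 (c - j)
  have h3 : 0 ≤ x ^ (c - j) := by positivity
  calc |coef c k₀ A B j x| ≤ |A * Ring.choose c j * x ^ (c - j)| +
        |B * (k₀.choose j : ℝ) * x ^ ((k₀ : ℝ) - j)| := abs_add_le _ _
    _ = A * |Ring.choose c j| * x ^ (c - j) + B * (k₀.choose j : ℝ) * x ^ ((k₀ : ℝ) - j) := by
        rw [abs_mul, abs_mul, abs_of_nonneg hA, abs_of_nonneg h3,
          abs_of_nonneg (a := B * (k₀.choose j : ℝ) * x ^ ((k₀ : ℝ) - j)) (by positivity)]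
    _ ≤ A * |Ring.choose c j| * x ^ (c - j) + A * (k₀.choose j : ℝ) * x ^ (c - j) := by gcongr
    _ = A * (|Ring.choose c j| + k₀.choose j) * x ^ (c - j) := by ring
    _ ≤ A * (|Ring.choose c j| + k₀.choose j + 1) * (2 ^ |c - j| * M ^ (c - j)) :=
        mul_le_mul (mul_le_mul_of_nonneg_left (by linarith) hA) h2 h3 (by positivity)
    _ = _ := by ring

lemma rpow_sub_natCast' {M : ℝ} (hM : 0 < M) (c : ℝ) (j : ℕ) : M ^ (c - j) = M ^ c / M ^ j := by
  rw [Real.rpow_sub hM, Real.rpow_natCast]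

/-- Overlap of the Taylor coefficients of a single phase. -/
lemma near_single_le {c : ℝ} {k₀ k : ℕ} (hci : ∀ z : ℤ, (z : ℝ) ≠ c) (hc : (k₀ : ℝ) < c) (j : Fin k) :
    ∃ C : ℝ, 1 ≤ C ∧ ∀ (Y : ℕ) (M T : ℝ) (l a b : ℕ) (A B : ℕ → ℝ), 1 ≤ Y → 2 ≤ M → 0 ≤ B l →
      B l ≤ A l → A l * M ^ c = T → 0 < T → M / 2 ≤ a → b ≤ 2 * M →
      ∀ p₀ ∈ pairs {l} (fun _ => a) (fun _ => b), (#(near (pairs {l} (fun _ => a) (fun _ => b))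
        (fun p j => coef c k₀ (A p.1) (B p.1) ((j : Fin k) + 1) p.2) Y p₀) : ℝ) ≤
        C * ((1 + T / M ^ ((j : ℕ) + 1)) * (1 + M * (M / Y) ^ ((j : ℕ) + 1) / T)) := by
  obtain ⟨κ, hκ, h1⟩ := coef_sub_bounds hci hc ((j : ℕ) + 1)
  obtain ⟨K, hK, h2⟩ := abs_coef_le hc ((j : ℕ) + 1)
  refine ⟨(4 * K + 3) * (2 / κ + 1), ?_, fun Y M T l a b A B hY hM hB hBA hT hT0 ha hb p₀ hp₀ => ?_⟩
  · have : 0 < 2 / κ := by positivity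
    nlinarith
  classical
  have hM0 : 0 < M := by linarith
  have hYr : (1 : ℝ) ≤ Y := by exact_mod_cast hY
  have hA : 0 ≤ A l := hB.trans hBA
  have hmem : ∀ p ∈ pairs {l} (fun _ => a) (fun _ => b), p.1 = l ∧ M / 2 ≤ (p.2 : ℝ) ∧ (p.2 : ℝ) ≤ 2 * M := by
    intro p hp
    rw [mem_pairs, Finset.mem_singleton, Finset.mem_Ioc] at hp
    exact ⟨hp.1, ha.trans (by exact_mod_cast hp.2.1.le), le_trans (by exact_mod_cast hp.2.2) hb⟩
  set S := near (pairs {l} (fun _ => a) (fun _ => b))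
        (fun p j => coef c k₀ (A p.1) (B p.1) ((j : Fin k) + 1) p.2) Y p₀ with hS
  have hSm : ∀ p ∈ S, p.1 = l ∧ M / 2 ≤ (p.2 : ℝ) ∧ (p.2 : ℝ) ≤ 2 * M := fun p hp =>
    hmem p (mem_near.1 hp).1
  rw [← Finset.card_image_of_injOn (f := Prod.snd) (s := S) (fun x hx y hy hxy =>
    Prod.ext ((hSm x hx).1.trans (hSm y hy).1.symm) hxy)]
  have hp0 := hmem p₀ hp₀
  have hMc1 : A l * M ^ (c - ((j : ℕ) + 1 : ℕ) - 1) = T / M ^ ((j : ℕ) + 1) / M := by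
    rw [Real.rpow_sub hM0, rpow_sub_natCast' hM0, Real.rpow_one, ← hT]; ring
  have hMc2 : A l * M ^ (c - ((j : ℕ) + 1 : ℕ)) = T / M ^ ((j : ℕ) + 1) := by
    rw [rpow_sub_natCast' hM0, ← hT]; ring
  have hcard := card_near_le (S := S.image Prod.snd) (g := fun m => coef c k₀ (A l) (B l) ((j : ℕ) + 1) m)
    (κ := κ * (T / M ^ ((j : ℕ) + 1) / M)) (R := 2 * (K * (T / M ^ ((j : ℕ) + 1))))
    (h := 1 / (Y : ℝ) ^ ((j : ℕ) + 1)) (m₀ := p₀.2) (by positivity) (by positivity)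
    (by rw [div_le_one (by positivity)]; exact one_le_pow₀ hYr) (by positivity)
    (by
      intro x hx y hy
      obtain ⟨p, hp, rfl⟩ := Finset.mem_image.1 hx
      obtain ⟨q, hq, rfl⟩ := Finset.mem_image.1 hy
      have := h1 (A l) (B l) M p.2 q.2 hB hBA hM (hSm p hp).2.1 (hSm p hp).2.2 (hSm q hq).2.1 (hSm q hq).2.2
      rwa [hMc1] at this)
    (by
      intro x hx
      obtain ⟨p, hp, rfl⟩ := Finset.mem_image.1 hx
      have e1 := h2 (A l) (B l) M p.2 hB hBA hM (hSm p hp).2.1 (hSm p hp).2.2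
      have e2 := h2 (A l) (B l) M p₀.2 hB hBA hM hp0.2.1 hp0.2.2
      rw [hMc2] at e1 e2
      exact (abs_sub _ _).trans (by linarith))
    (by
      intro x hx
      obtain ⟨p, hp, rfl⟩ := Finset.mem_image.1 hx
      have e1 := (mem_near.1 hp).2 j
      simp only [(hSm p hp).1, hp0.1] at e1
      exact e1)
  refine hcard.trans ?_
  have e3 : 2 * (1 / (Y : ℝ) ^ ((j : ℕ) + 1)) / (κ * (T / M ^ ((j : ℕ) + 1) / M)) =
      2 / κ * (M * (M / Y) ^ ((j : ℕ) + 1) / T) := by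
    rw [div_pow]; field_simp
  rw [e3]
  have f1 : 0 ≤ T / M ^ ((j : ℕ) + 1) := by positivity
  have f2 : 0 ≤ M * (M / Y) ^ ((j : ℕ) + 1) / T := by positivity
  have f3 : 0 < 2 / κ := by positivity
  calc _ ≤ ((4 * K + 3) * (1 + T / M ^ ((j : ℕ) + 1))) *
        ((2 / κ + 1) * (1 + M * (M / Y) ^ ((j : ℕ) + 1) / T)) := by
        refine mul_le_mul ?_ ?_ (by positivity) (by positivity)
        · linarith
        · linarith
    _ = _ := by ring

set_option maxHeartbeats 1000000 in
/-- Overlap of the Taylor coefficients of degrees `j + 1`, `j + 2` of a family of phases. -/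
lemma near_joint_le {c : ℝ} {k₀ k : ℕ} (hci : ∀ z : ℤ, (z : ℝ) ≠ c) (hc : (k₀ : ℝ) < c) (i i' : Fin k)
    (hii : (i' : ℕ) = i + 1) (hi : k₀ < (i : ℕ) + 1) :
    ∃ C : ℝ, 1 ≤ C ∧ ∀ (Y : ℕ) (M T T₀ G : ℝ) (L : Finset ℕ) (a b : ℕ → ℕ) (A B : ℕ → ℝ), 1 ≤ Y → 2 ≤ M →
      Y ≤ M → 0 < T₀ → 0 < G →
      (∀ l ∈ L, 0 ≤ B l ∧ B l ≤ A l ∧ A l * M ^ c ≤ T ∧ T₀ ≤ A l * M ^ c ∧ M / 2 ≤ a l ∧ b l ≤ 2 * M) →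
      (∀ l ∈ L, ∀ l' ∈ L, G * |(l : ℝ) - l'| ≤ |A l * M ^ c - A l' * M ^ c|) →
      ∀ p₀ ∈ pairs L a b, (#(near (pairs L a b)
        (fun p j => coef c k₀ (A p.1) (B p.1) ((j : Fin k) + 1) p.2) Y p₀) : ℝ) ≤
        C * ((1 + T / M ^ ((i : ℕ) + 1)) * ((1 + T / M ^ ((i : ℕ) + 2)) *
          ((1 + M * (M / Y) ^ ((i : ℕ) + 2) / T₀) * (1 + (M / Y) ^ ((i : ℕ) + 1) / G)))) := by
  set j := (i : ℕ) + 1 with hj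
  obtain ⟨K, hK, h2⟩ := abs_coef_le hc j
  obtain ⟨K', hK', h2'⟩ := abs_coef_le hc (j + 1)
  set α := Ring.choose c j with hα
  set β := Ring.choose c (j + 1) with hβ
  have hα0 : α ≠ 0 := choose_ne_zero hci j
  have hβ0 : β ≠ 0 := choose_ne_zero hci (j + 1)
  have hα' : 0 < |α| := abs_pos.2 hα0
  have hβ' : 0 < |β| := abs_pos.2 hβ0
  set E := (2 : ℝ) ^ |c - (j + 1 : ℕ)| with hE
  set E' := (2 : ℝ) ^ |c - j| with hE'
  have hE0 : 0 < E := by positivity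
  have hE0' : 0 < E' := by positivity
  set K₃ := (2 * (|β| / |α|) + 4) * (E / |β|) with hK3
  set K₄ := 2 * E' / |α| with hK4
  have hK30 : 0 < K₃ := by positivity
  have hK40 : 0 < K₄ := by positivity
  refine ⟨(4 * K + 3) * ((4 * K' + 3) * ((K₃ + 1) * (K₄ + 1))), ?_, ?_⟩
  · exact one_le_mul_of_one_le_of_one_le (by linarith) (one_le_mul_of_one_le_of_one_le (by linarith)
      (one_le_mul_of_one_le_of_one_le (by linarith) (by linarith)))
  intro Y M T T₀ G L a b A B hY hM hYM hT₀ hG hl hsep p₀ hp₀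
  have hM0 : 0 < M := by linarith
  have hYr : (1 : ℝ) ≤ Y := by exact_mod_cast hY
  have hY0 : (0 : ℝ) < Y := by linarith
  have hmem : ∀ p ∈ pairs L a b, p.1 ∈ L ∧ M / 2 ≤ (p.2 : ℝ) ∧ (p.2 : ℝ) ≤ 2 * M := by
    intro p hp
    rw [mem_pairs, Finset.mem_Ioc] at hp
    obtain ⟨-, -, -, -, h5, h6⟩ := hl _ hp.1
    exact ⟨hp.1, h5.trans (by exact_mod_cast hp.2.1.le), le_trans (by exact_mod_cast hp.2.2) h6⟩
  set S := near (pairs L a b) (fun p j => coef c k₀ (A p.1) (B p.1) ((j : Fin k) + 1) p.2) Y p₀ with hS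
  have hSP : ∀ p ∈ S, p ∈ pairs L a b := fun p hp => (mem_near.1 hp).1
  have hp0 := hmem p₀ hp₀
  have hT0 : 0 ≤ T := by
    obtain ⟨-, -, h3, h4, -⟩ := hl _ hp0.1
    linarith
  set g : ℕ × ℕ → ℝ := fun p => coef c k₀ (A p.1) (B p.1) j p.2 with hg
  set g' : ℕ × ℕ → ℝ := fun p => coef c k₀ (A p.1) (B p.1) (j + 1) p.2 with hg'
  have hgeq : ∀ p, g p = A p.1 * α * (p.2 : ℝ) ^ (c - j) := fun p => by
    rw [hg]; simp only [coef]; rw [Nat.choose_eq_zero_of_lt hi]; simp [hα]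
  have hgeq' : ∀ p, g' p = A p.1 * β * (p.2 : ℝ) ^ (c - (j + 1 : ℕ)) := fun p => by
    rw [hg']; simp only [coef]; rw [Nat.choose_eq_zero_of_lt (by omega)]; simp [hβ]
  have hrel : ∀ p ∈ pairs L a b, (p.2 : ℝ) * g' p = β / α * g p := fun p hp => by
    have hm : (0 : ℝ) < p.2 := by linarith [(hmem p hp).2.1]
    rw [hgeq, hgeq', show c - (j + 1 : ℕ) = (c - j) - 1 by push_cast; ring, Real.rpow_sub_one hm.ne']
    field_simp
  have hlow : ∀ p ∈ pairs L a b, |β| / E * (T₀ / M ^ (j + 1)) ≤ |g' p| := fun p hp => by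
    obtain ⟨hpl, hm1, hm2⟩ := hmem p hp
    obtain ⟨q1, q2, q3, q4, -⟩ := hl _ hpl
    have hm : (0 : ℝ) < p.2 := by linarith
    rw [hgeq', abs_mul, abs_mul, abs_of_nonneg (q1.trans q2), abs_of_nonneg (by positivity : (0 : ℝ) ≤ (p.2 : ℝ) ^ (c - (j + 1 : ℕ)))]
    have := le_rpow_of_mem hM0 hm1 hm2 (c - (j + 1 : ℕ))
    rw [rpow_sub_natCast' hM0] at this
    have hA0 : 0 ≤ A p.1 := q1.trans q2
    calc |β| / E * (T₀ / M ^ (j + 1)) ≤ |β| / E * (A p.1 * M ^ c / M ^ (j + 1)) := by gcongr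
      _ = A p.1 * |β| * (E⁻¹ * (M ^ c / M ^ (j + 1))) := by ring
      _ ≤ _ := by gcongr
  have hcard := card_near_pair_le (S := S) (g := g) (g' := g') (p₀ := p₀)
    (R := 2 * (K * (T / M ^ j))) (R' := 2 * (K' * (T / M ^ (j + 1))))
    (R₃ := K₃ * (M * (M / Y) ^ (j + 1) / T₀)) (R₄ := K₄ * ((M / Y) ^ j / G))
    (h := 1 / (Y : ℝ) ^ j) (h' := 1 / (Y : ℝ) ^ (j + 1))
    (by rw [div_le_one (by positivity)]; exact one_le_pow₀ hYr)
    (by rw [div_le_one (by positivity)]; exact one_le_pow₀ hYr)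
    (by positivity) (by positivity) (by positivity) (by positivity)
    (by
      intro p hp q hq e1 e2
      have hp' := hSP p hp
      have hq' := hSP q hq
      have r1 := hrel p hp'
      have r2 := hrel q hq'
      have r3 := hlow p hp'
      have hq2 := (hmem q hq').2.2
      have r4 : ((p.2 : ℝ) - q.2) * g' p = β / α * (g p - g q) + q.2 * (g' q - g' p) := by
        linear_combination r1 - r2
      have r5 : |(p.2 : ℝ) - q.2| * |g' p| ≤ |β| / |α| * (2 * (1 / (Y : ℝ) ^ j)) +
          2 * M * (2 * (1 / (Y : ℝ) ^ (j + 1))) := by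
        rw [← abs_mul, r4]
        refine (abs_add_le _ _).trans (add_le_add ?_ ?_)
        · rw [abs_mul, abs_div]; gcongr
        · rw [abs_mul, Nat.abs_cast]
          rw [abs_sub_comm] at e2
          gcongr
      have r6 : 1 / (Y : ℝ) ^ j ≤ M * (1 / (Y : ℝ) ^ (j + 1)) := by
        rw [pow_succ (Y : ℝ) j, mul_one_div, div_le_div_iff₀ (by positivity) (by positivity)]
        have : (0 : ℝ) < (Y : ℝ) ^ j := by positivity
        nlinarith
      have r7 : |(p.2 : ℝ) - q.2| * (|β| / E * (T₀ / M ^ (j + 1))) ≤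
          (2 * (|β| / |α|) + 4) * (M * (1 / (Y : ℝ) ^ (j + 1))) := by
        calc _ ≤ |(p.2 : ℝ) - q.2| * |g' p| := by gcongr
          _ ≤ |β| / |α| * (2 * (M * (1 / (Y : ℝ) ^ (j + 1)))) + 2 * M * (2 * (1 / (Y : ℝ) ^ (j + 1))) := by
              refine r5.trans ?_
              gcongr
          _ = _ := by ring
      rw [← le_div_iff₀ (by positivity)] at r7
      refine r7.trans (le_of_eq ?_)
      rw [hK3, div_pow]; field_simp)
    (by
      intro p hp q hq e1 e2
      obtain ⟨hpl, hm1, hm2⟩ := hmem p (hSP p hp)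
      obtain ⟨hql, -, -⟩ := hmem q (hSP q hq)
      have hs := hsep _ hpl _ hql
      have hm : (0 : ℝ) < p.2 := by linarith
      rw [hgeq, hgeq, ← e2, ← sub_mul, ← sub_mul, abs_mul, abs_mul,
        abs_of_nonneg (by positivity : (0 : ℝ) ≤ (p.2 : ℝ) ^ (c - j))] at e1
      have h5 := le_rpow_of_mem hM0 hm1 hm2 (c - j)
      rw [rpow_sub_natCast' hM0] at h5
      rw [← sub_mul, abs_mul, abs_of_nonneg (by positivity : 0 ≤ M ^ c)] at hs
      have h6 : |A p.1 - A q.1| * |α| * (E'⁻¹ * (M ^ c / M ^ j)) ≤ 2 * (1 / (Y : ℝ) ^ j) :=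
        le_trans (by gcongr) e1
      have h7 : G * |(p.1 : ℝ) - q.1| * (|α| * E'⁻¹ / M ^ j) ≤ 2 * (1 / (Y : ℝ) ^ j) := by
        refine le_trans ?_ h6
        calc _ ≤ (|A p.1 - A q.1| * M ^ c) * (|α| * E'⁻¹ / M ^ j) := by gcongr
          _ = _ := by ring
      rw [mul_comm G, mul_assoc, ← le_div_iff₀ (by positivity)] at h7
      refine h7.trans (le_of_eq ?_)
      rw [hK4, div_pow]; field_simp)
    (by
      intro p hp
      obtain ⟨hpl, hm1, hm2⟩ := hmem p (hSP p hp)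
      obtain ⟨q1, q2, q3, -⟩ := hl _ hpl
      obtain ⟨q1', q2', q3', -⟩ := hl _ hp0.1
      have e1 := h2 (A p.1) (B p.1) M p.2 q1 q2 hM hm1 hm2
      have e2 := h2 (A p₀.1) (B p₀.1) M p₀.2 q1' q2' hM hp0.2.1 hp0.2.2
      rw [rpow_sub_natCast' hM0, ← mul_div_assoc] at e1 e2
      have e3 : K * (A p.1 * M ^ c / M ^ j) ≤ K * (T / M ^ j) := by gcongr
      have e4 : K * (A p₀.1 * M ^ c / M ^ j) ≤ K * (T / M ^ j) := by gcongr
      exact (abs_sub _ _).trans (by linarith))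
    (by
      intro p hp
      obtain ⟨hpl, hm1, hm2⟩ := hmem p (hSP p hp)
      obtain ⟨q1, q2, q3, -⟩ := hl _ hpl
      obtain ⟨q1', q2', q3', -⟩ := hl _ hp0.1
      have e1 := h2' (A p.1) (B p.1) M p.2 q1 q2 hM hm1 hm2
      have e2 := h2' (A p₀.1) (B p₀.1) M p₀.2 q1' q2' hM hp0.2.1 hp0.2.2
      rw [rpow_sub_natCast' hM0, ← mul_div_assoc] at e1 e2
      have e3 : K' * (A p.1 * M ^ c / M ^ (j + 1)) ≤ K' * (T / M ^ (j + 1)) := by gcongr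
      have e4 : K' * (A p₀.1 * M ^ c / M ^ (j + 1)) ≤ K' * (T / M ^ (j + 1)) := by gcongr
      exact (abs_sub _ _).trans (by linarith))
    (fun p hp => (mem_near.1 hp).2 i)
    (fun p hp => by
      have := (mem_near.1 hp).2 i'
      simp only [hii] at this
      exact this)
  refine hcard.trans ?_
  have f1 : 0 ≤ T / M ^ j := by positivity
  have f2 : 0 ≤ T / M ^ (j + 1) := by positivity
  have f3 : 0 ≤ M * (M / Y) ^ (j + 1) / T₀ := by positivity
  have f4 : 0 ≤ (M / Y) ^ j / G := by positivity
  have g1 : 2 * (2 * (K * (T / M ^ j))) + 3 ≤ (4 * K + 3) * (1 + T / M ^ j) := by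
    linarith
  have g2 : 2 * (2 * (K' * (T / M ^ (j + 1)))) + 3 ≤ (4 * K' + 3) * (1 + T / M ^ (j + 1)) := by
    linarith
  have g3 : K₃ * (M * (M / Y) ^ (j + 1) / T₀) + 1 ≤ (K₃ + 1) * (1 + M * (M / Y) ^ (j + 1) / T₀) := by linarith
  have g4 : K₄ * ((M / Y) ^ j / G) + 1 ≤ (K₄ + 1) * (1 + (M / Y) ^ j / G) := by linarith
  calc _ ≤ ((4 * K + 3) * (1 + T / M ^ j)) * (((4 * K' + 3) * (1 + T / M ^ (j + 1))) *
        (((K₃ + 1) * (1 + M * (M / Y) ^ (j + 1) / T₀)) * ((K₄ + 1) * (1 + (M / Y) ^ j / G)))) := by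
        gcongr
    _ = _ := by ring

/-- Power saving for a family of phases in terms of an exponent `d` of the overlap. -/
lemma sum_phase_pow_le {c : ℝ} {k₀ k s : ℕ} (hc : (k₀ : ℝ) < c) (hk : 1 ≤ k) (hs : 1 ≤ s) (hJ : MeanBd k s)
    {ε σ : ℝ} (hε : 0 < ε) (hσ : 0 < σ) {C₀ : ℝ} (hC₀ : 1 ≤ C₀) :
    ∃ C : ℝ, 1 ≤ C ∧ ∃ X₀ : ℝ, 1 ≤ X₀ ∧ ∀ (X ν l₀ t y d τ : ℝ) (L : Finset ℕ) (a b : ℕ → ℕ) (A B : ℕ → ℝ),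
      X₀ ≤ X → 0 ≤ t → ν ≤ 1 → 0 ≤ y → y = ν - (t + 3 * σ) / (k + 1) → 2 ≤ X ^ ν →
      τ ≤ 3 * σ → τ ≤ y → τ ≤ ν - y → (#L : ℝ) ≤ 2 * X ^ l₀ →
      (∀ l ∈ L, 0 ≤ B l ∧ B l ≤ A l ∧ A l * (X ^ ν) ^ c ≤ X ^ t ∧ X ^ ν / 2 ≤ a l ∧ b l ≤ 2 * X ^ ν) →
      2 * s * (τ + ε) ≤ ν + l₀ - d →
      (∀ p₀ ∈ pairs L a b, (#(near (pairs L a b)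
        (fun p j => coef c k₀ (A p.1) (B p.1) ((j : Fin k) + 1) p.2) ⌊X ^ y⌋₊ p₀) : ℝ) ≤ C₀ * X ^ d) →
      ∑ l ∈ L, ‖∑ m ∈ Ioc (a l) (b l), e (A l * (m : ℝ) ^ c + B l * (m : ℝ) ^ k₀)‖ ≤
        C * X ^ (ν + l₀ - τ) := by
  obtain ⟨C, hC, δ, hδ, H⟩ := sum_phase_le hc hk hs hJ hε
  have hk1 : (0 : ℝ) < k + 1 := by positivity
  obtain ⟨X₁, hX₁⟩ : ∃ X₁ : ℝ, ∀ X, X₁ ≤ X → X ^ (-(3 * σ / (k + 1))) ≤ δ := by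
    have := (tendsto_rpow_neg_atTop (show 0 < 3 * σ / ((k : ℝ) + 1) by positivity)).eventually
      (ge_mem_nhds hδ)
    exact eventually_atTop.1 this
  refine ⟨8 + C * (4 * C₀) + C * 4 + 4, ?_, max 1 X₁, le_max_left _ _, ?_⟩
  · have : 0 ≤ C * (4 * C₀) := by positivity
    linarith
  intro X ν l₀ t y d τ L a b A B hX ht hν hy hyd hM hτ1 hτ2 hτ3 hL hl hexp hnear
  have hX1 : 1 ≤ X := (le_max_left _ _).trans hX
  have hX0 : 0 < X := by linarith
  have hP : ∀ r : ℝ, 0 < X ^ r := fun r => Real.rpow_pos_of_pos hX0 r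
  have hmono : ∀ r r' : ℝ, r ≤ r' → X ^ r ≤ X ^ r' := fun r r' h => Real.rpow_le_rpow_of_exponent_le hX1 h
  set Y := ⌊X ^ y⌋₊ with hY
  have hXy : 1 ≤ X ^ y := Real.one_le_rpow hX1 hy
  have hY1 : 1 ≤ Y := Nat.one_le_floor_iff _ |>.2 hXy
  have hYle : (Y : ℝ) ≤ X ^ y := Nat.floor_le (by linarith)
  have hYge : X ^ y / 2 ≤ Y := by
    have := Nat.lt_floor_add_one (X ^ y)
    have h1 : (1 : ℝ) ≤ Y := by exact_mod_cast hY1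
    rw [← hY] at this
    linarith
  have hYν : X ^ (y - ν) ≤ δ := by
    refine le_trans (hmono _ _ ?_) (hX₁ X ((le_max_right _ _).trans hX))
    rw [hyd]
    have : 0 ≤ t / (k + 1) := by positivity
    rw [add_div]; linarith
  have hpairs : (#(pairs L a b) : ℝ) ≤ 4 * X ^ (ν + l₀) := by
    have h1 : #(pairs L a b) ≤ ∑ l ∈ L, (b l - a l) := by
      refine Finset.card_biUnion_le.trans (le_of_eq ?_)
      simp
    refine (Nat.cast_le (α := ℝ).2 h1).trans ?_
    push_cast
    calc ∑ l ∈ L, ((b l - a l : ℕ) : ℝ) ≤ ∑ l ∈ L, 2 * X ^ ν := Finset.sum_le_sum fun l h =>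
          (by exact_mod_cast Nat.sub_le _ _ : ((b l - a l : ℕ) : ℝ) ≤ b l).trans (hl l h).2.2.2.2
      _ = #L * (2 * X ^ ν) := by simp
      _ ≤ (2 * X ^ l₀) * (2 * X ^ ν) := by gcongr
      _ = _ := by rw [Real.rpow_add hX0]; ring
  rcases L.eq_empty_or_nonempty with rfl | hLne
  · simp only [Finset.sum_empty]
    have := hP (ν + l₀ - τ)
    positivity
  have hl0 : 1 ≤ 4 * X ^ (ν + l₀) := by
    have h1 : (1 : ℝ) ≤ #L := by exact_mod_cast hLne.card_pos
    have h2 : (1 : ℝ) ≤ (2 * X ^ l₀) := h1.trans hL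
    rw [Real.rpow_add hX0]
    nlinarith [hP l₀]
  have key := H Y (X ^ ν) (X ^ t) (4 * X ^ (ν + l₀)) (C₀ * X ^ d) L a b A B hY1 hM (hP _).le
    (by
      calc (Y : ℝ) ≤ X ^ y := hYle
        _ = X ^ (y - ν) * X ^ ν := by rw [← Real.rpow_add hX0]; ring_nf
        _ ≤ _ := by have := hP ν; gcongr)
    hl hl0 hpairs (by have := hP d; positivity) hnear
  refine key.trans ?_
  have t1 : 4 * X ^ (ν + l₀) / Y ≤ 8 * X ^ (ν + l₀ - τ) := by
    have hYp : (0 : ℝ) < Y := by exact_mod_cast hY1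
    rw [div_le_iff₀ hYp]
    calc 4 * X ^ (ν + l₀) = 8 * X ^ (ν + l₀ - y) * (X ^ y / 2) := by
          rw [Real.rpow_sub hX0]; have := (hP y).ne'; field_simp; ring
      _ ≤ 8 * X ^ (ν + l₀ - τ) * Y :=
          mul_le_mul (mul_le_mul_of_nonneg_left (hmono _ _ (by linarith)) (by norm_num)) hYge
            (by have := hP y; positivity) (by have := hP (ν + l₀ - τ); positivity)
  have t2 : 4 * X ^ (ν + l₀) * (Y : ℝ) ^ ε * (C₀ * X ^ d / (4 * X ^ (ν + l₀))) ^ (1 / (2 * s) : ℝ) ≤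
      4 * C₀ * X ^ (ν + l₀ - τ) := by
    have hs0 : (0 : ℝ) < 2 * s := by have : (1 : ℝ) ≤ s := by exact_mod_cast hs
                                     linarith
    have hs1 : (1 : ℝ) / (2 * s) ≤ 1 := by
      have : (1 : ℝ) ≤ s := by exact_mod_cast hs
      rw [div_le_one hs0]; linarith
    have a1 : (Y : ℝ) ^ ε ≤ X ^ ε := by
      refine Real.rpow_le_rpow (by positivity) (hYle.trans ?_) hε.le
      calc X ^ y ≤ X ^ (1 : ℝ) := hmono _ _ (by
            have : 0 ≤ (t + 3 * σ) / (k + 1) := by positivity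
            linarith)
        _ = X := Real.rpow_one X
    have a2 : C₀ * X ^ d / (4 * X ^ (ν + l₀)) ≤ C₀ * X ^ (-(2 * s * (τ + ε))) := by
      rw [div_le_iff₀ (by have := hP (ν + l₀); positivity)]
      calc C₀ * X ^ d ≤ C₀ * X ^ (-(2 * s * (τ + ε)) + (ν + l₀)) :=
            mul_le_mul_of_nonneg_left (hmono _ _ (by linarith)) (by linarith)
        _ = C₀ * (X ^ (-(2 * s * (τ + ε))) * X ^ (ν + l₀)) := by rw [Real.rpow_add hX0]
        _ ≤ _ := by
          have := mul_pos (hP (-(2 * s * (τ + ε)))) (hP (ν + l₀))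
          nlinarith
    have a3 : (C₀ * X ^ d / (4 * X ^ (ν + l₀))) ^ (1 / (2 * s) : ℝ) ≤ C₀ * X ^ (-(τ + ε)) := by
      calc _ ≤ (C₀ * X ^ (-(2 * s * (τ + ε)))) ^ (1 / (2 * s) : ℝ) :=
            Real.rpow_le_rpow (by have := hP d; have := hP (ν + l₀); positivity) a2 (by positivity)
        _ = C₀ ^ (1 / (2 * s) : ℝ) * X ^ (-(τ + ε)) := by
            rw [Real.mul_rpow (by linarith) (hP _).le, ← Real.rpow_mul hX0.le]
            congr 2; field_simp
        _ ≤ _ := by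
            have := hP (-(τ + ε))
            gcongr
            calc C₀ ^ (1 / (2 * s) : ℝ) ≤ C₀ ^ (1 : ℝ) := Real.rpow_le_rpow_of_exponent_le hC₀ hs1
              _ = C₀ := Real.rpow_one _
    calc _ ≤ 4 * X ^ (ν + l₀) * X ^ ε * (C₀ * X ^ (-(τ + ε))) := by
          have := hP (ν + l₀); have := hP ε; gcongr
      _ = 4 * C₀ * (X ^ (ν + l₀) * X ^ ε * X ^ (-(τ + ε))) := by ring
      _ = _ := by rw [← Real.rpow_add hX0, ← Real.rpow_add hX0]; ring_nf
  have t3 : 4 * X ^ (ν + l₀) * (X ^ t * (Y / X ^ ν) ^ (k + 1)) ≤ 4 * X ^ (ν + l₀ - τ) := by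
    have a1 : (Y / X ^ ν) ^ (k + 1) ≤ X ^ (-(t + 3 * σ)) := by
      calc (Y / X ^ ν) ^ (k + 1) ≤ (X ^ y / X ^ ν) ^ (k + 1) := by have := hP ν; gcongr
        _ = X ^ (-(t + 3 * σ)) := by
          rw [← Real.rpow_sub hX0, ← Real.rpow_mul_natCast hX0.le, hyd]
          congr 1; push_cast; field_simp; ring
    calc _ ≤ 4 * X ^ (ν + l₀) * (X ^ t * X ^ (-(t + 3 * σ))) := by
          have := hP (ν + l₀); have := hP t; gcongr
      _ = 4 * X ^ (ν + l₀ - 3 * σ) := by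
          rw [mul_assoc, ← Real.rpow_add hX0, ← Real.rpow_add hX0]; ring_nf
      _ ≤ _ := mul_le_mul_of_nonneg_left (hmono _ _ (by linarith)) (by norm_num)
  have t4 : 2 * (Y : ℝ) * #L ≤ 4 * X ^ (ν + l₀ - τ) := by
    calc 2 * (Y : ℝ) * #L ≤ 2 * X ^ y * (2 * X ^ l₀) := by have := hP y; gcongr
      _ = 4 * X ^ (y + l₀) := by rw [Real.rpow_add hX0]; ring
      _ ≤ _ := mul_le_mul_of_nonneg_left (hmono _ _ (by linarith)) (by norm_num)
  have t2' := mul_le_mul_of_nonneg_left t2 (by linarith : 0 ≤ C)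
  have t3' := mul_le_mul_of_nonneg_left t3 (by linarith : 0 ≤ C)
  linarith

lemma one_add_rpow_le {X r E : ℝ} (hX : 1 ≤ X) (h0 : 0 ≤ E) (hr : r ≤ E) : 1 + X ^ r ≤ 2 * X ^ E := by
  have h1 := Real.one_le_rpow hX h0
  have h2 := Real.rpow_le_rpow_of_exponent_le hX hr
  linarith

/-- `M / ⌊X ^ y⌋` is at most twice `X ^ (ν - y)`. -/
lemma rpow_div_floor_le {X ν y : ℝ} (hX : 1 ≤ X) (hy : 0 ≤ y) :
    X ^ ν / ⌊X ^ y⌋₊ ≤ 2 * X ^ (ν - y) := by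
  have hX0 : 0 < X := by linarith
  have h1 : 1 ≤ X ^ y := Real.one_le_rpow hX hy
  have h2 := Nat.lt_floor_add_one (X ^ y)
  have h3 : (1 : ℝ) ≤ ⌊X ^ y⌋₊ := by exact_mod_cast (Nat.one_le_floor_iff _).2 h1
  rw [div_le_iff₀ (by linarith), Real.rpow_sub hX0]
  have := Real.rpow_pos_of_pos hX0 ν
  have h4 : X ^ ν = 2 * (X ^ ν / X ^ y) * (X ^ y / 2) := by field_simp
  calc X ^ ν = 2 * (X ^ ν / X ^ y) * (X ^ y / 2) := h4
    _ ≤ _ := by gcongr; linarith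

lemma rpow_div_floor_pow_le {X ν y : ℝ} (hX : 1 ≤ X) (hy : 0 ≤ y) (n : ℕ) :
    (X ^ ν / ⌊X ^ y⌋₊) ^ n ≤ 2 ^ n * X ^ (n * (ν - y)) := by
  have hX0 : 0 < X := by linarith
  have h := rpow_div_floor_le (ν := ν) hX hy
  have := Real.rpow_pos_of_pos hX0 ν
  calc (X ^ ν / ⌊X ^ y⌋₊) ^ n ≤ (2 * X ^ (ν - y)) ^ n := by gcongr
    _ = _ := by rw [mul_pow, ← Real.rpow_mul_natCast hX0.le, mul_comm (ν - y)]

lemma phase_single_le {c : ℝ} {k₀ k s : ℕ} (hci : ∀ z : ℤ, (z : ℝ) ≠ c) (hc : (k₀ : ℝ) < c) (hk : 1 ≤ k)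
    (hs : 1 ≤ s) (hJ : MeanBd k s) {ε σ : ℝ} (hε : 0 < ε) (hσ : 0 < σ) (i : Fin k) :
    ∃ C : ℝ, 1 ≤ C ∧ ∃ X₀ : ℝ, 1 ≤ X₀ ∧ ∀ (X ν t y τ E₁ E₂ : ℝ) (a b : ℕ) (A B : ℝ),
      X₀ ≤ X → 0 ≤ t → ν ≤ 1 → 0 ≤ y → y = ν - (t + 3 * σ) / (k + 1) → 2 ≤ X ^ ν →
      τ ≤ 3 * σ → τ ≤ y → τ ≤ ν - y → 0 ≤ B → B ≤ A → A * (X ^ ν) ^ c = X ^ t → X ^ ν / 2 ≤ a →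
      b ≤ 2 * X ^ ν → 0 ≤ E₁ → 0 ≤ E₂ → t - ((i : ℕ) + 1) * ν ≤ E₁ → ν + ((i : ℕ) + 1) * (ν - y) - t ≤ E₂ →
      2 * s * (τ + ε) ≤ ν - E₁ - E₂ →
      ‖∑ m ∈ Ioc a b, e (A * (m : ℝ) ^ c + B * (m : ℝ) ^ k₀)‖ ≤ C * X ^ (ν - τ) := by
  obtain ⟨C₁, hC₁, h1⟩ := near_single_le (k₀ := k₀) hci hc i
  have h2 : (1 : ℝ) ≤ 2 ^ ((i : ℕ) + 1) := one_le_pow₀ (by norm_num)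
  obtain ⟨C, hC, X₀, hX₀, H⟩ := sum_phase_pow_le hc hk hs hJ hε hσ
    (C₀ := C₁ * (2 * (2 * 2 ^ ((i : ℕ) + 1))))
    (one_le_mul_of_one_le_of_one_le hC₁ (by linarith))
  refine ⟨C, hC, X₀, hX₀, ?_⟩
  intro X ν t y τ E₁ E₂ a b A B hX ht hν hy hyd hM hτ1 hτ2 hτ3 hB hBA hAT ha hb hE₁ hE₂ hE1 hE2 hexp
  have hX1 : 1 ≤ X := hX₀.trans hX
  have hX0 : 0 < X := by linarith
  have hP : ∀ r : ℝ, 0 < X ^ r := fun r => Real.rpow_pos_of_pos hX0 r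
  have hY1 : 1 ≤ ⌊X ^ y⌋₊ := (Nat.one_le_floor_iff _).2 (Real.one_le_rpow hX1 hy)
  have := H X ν 0 t y (E₁ + E₂) τ {0} (fun _ => a) (fun _ => b) (fun _ => A) (fun _ => B) hX ht hν hy hyd hM
    hτ1 hτ2 hτ3 (by simp) (fun l _ => ⟨hB, hBA, hAT.le, ha, hb⟩) (by linarith) (fun p₀ hp₀ => by
      refine (h1 ⌊X ^ y⌋₊ (X ^ ν) (X ^ t) 0 a b (fun _ => A) (fun _ => B) hY1 hM hB hBA hAT (hP t) ha hb
        p₀ hp₀).trans ?_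
      have a1 : X ^ t / (X ^ ν) ^ ((i : ℕ) + 1) = X ^ (t - ((i : ℕ) + 1) * ν) := by
        rw [← Real.rpow_mul_natCast hX0.le, ← Real.rpow_sub hX0]; congr 1; push_cast; ring
      have a2 : X ^ ν * (X ^ ν / ⌊X ^ y⌋₊) ^ ((i : ℕ) + 1) / X ^ t ≤
          2 ^ ((i : ℕ) + 1) * X ^ (ν + ((i : ℕ) + 1) * (ν - y) - t) := by
        calc _ ≤ X ^ ν * (2 * X ^ (ν - y)) ^ ((i : ℕ) + 1) / X ^ t := by
              have := hP ν; have := hP t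
              have := rpow_div_floor_le (ν := ν) hX1 hy
              gcongr
          _ = _ := by
            rw [mul_pow, ← Real.rpow_mul_natCast hX0.le, Real.rpow_sub hX0 _ t, Real.rpow_add hX0]
            push_cast; ring_nf
      rw [a1, Real.rpow_add hX0, mul_assoc C₁]
      refine mul_le_mul_of_nonneg_left ?_ (by linarith)
      calc _ ≤ (2 * X ^ E₁) * (2 * 2 ^ ((i : ℕ) + 1) * X ^ E₂) := by
            refine mul_le_mul (one_add_rpow_le hX1 hE₁ hE1) ?_ (by have := hP ν; have := hP t; positivity)
              (by have := hP E₁; positivity)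
            have := one_add_rpow_le hX1 hE₂ hE2
            nlinarith [hP E₂]
        _ = _ := by ring)
  simpa using this

set_option maxHeartbeats 1000000 in
lemma phase_joint_le {c : ℝ} {k₀ k s : ℕ} (hci : ∀ z : ℤ, (z : ℝ) ≠ c) (hc : (k₀ : ℝ) < c) (hk : 1 ≤ k)
    (hs : 1 ≤ s) (hJ : MeanBd k s) {ε σ : ℝ} (hε : 0 < ε) (hσ : 0 < σ) (i i' : Fin k)
    (hii : (i' : ℕ) = i + 1) (hi : k₀ < (i : ℕ) + 1) :
    ∃ C : ℝ, 1 ≤ C ∧ ∃ X₀ : ℝ, 1 ≤ X₀ ∧ ∀ (X ν l₀ t t₀ g y τ E₁ E₂ E₃ E₄ : ℝ) (L : Finset ℕ) (a b : ℕ → ℕ)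
      (A B : ℕ → ℝ),
      X₀ ≤ X → 0 ≤ t → ν ≤ 1 → 0 ≤ y → y = ν - (t + 3 * σ) / (k + 1) → 2 ≤ X ^ ν →
      τ ≤ 3 * σ → τ ≤ y → τ ≤ ν - y → (#L : ℝ) ≤ 2 * X ^ l₀ →
      (∀ l ∈ L, 0 ≤ B l ∧ B l ≤ A l ∧ A l * (X ^ ν) ^ c ≤ X ^ t ∧ X ^ t₀ ≤ A l * (X ^ ν) ^ c ∧
        X ^ ν / 2 ≤ a l ∧ b l ≤ 2 * X ^ ν) →
      (∀ l ∈ L, ∀ l' ∈ L, X ^ g * |(l : ℝ) - l'| ≤ |A l * (X ^ ν) ^ c - A l' * (X ^ ν) ^ c|) →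
      0 ≤ E₁ → 0 ≤ E₂ → 0 ≤ E₃ → 0 ≤ E₄ →
      t - ((i : ℕ) + 1) * ν ≤ E₁ → t - ((i : ℕ) + 2) * ν ≤ E₂ →
      ν + ((i : ℕ) + 2) * (ν - y) - t₀ ≤ E₃ → ((i : ℕ) + 1) * (ν - y) - g ≤ E₄ →
      2 * s * (τ + ε) ≤ ν + l₀ - (E₁ + E₂ + E₃ + E₄) →
      ∑ l ∈ L, ‖∑ m ∈ Ioc (a l) (b l), e (A l * (m : ℝ) ^ c + B l * (m : ℝ) ^ k₀)‖ ≤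
        C * X ^ (ν + l₀ - τ) := by
  obtain ⟨C₁, hC₁, h1⟩ := near_joint_le hci hc i i' hii hi
  have h2 : (1 : ℝ) ≤ 2 ^ ((i : ℕ) + 1) := one_le_pow₀ (by norm_num)
  have h3 : (1 : ℝ) ≤ 2 ^ ((i : ℕ) + 2) := one_le_pow₀ (by norm_num)
  obtain ⟨C, hC, X₀, hX₀, H⟩ := sum_phase_pow_le hc hk hs hJ hε hσ
    (C₀ := C₁ * (2 * (2 * ((2 * 2 ^ ((i : ℕ) + 2)) * (2 * 2 ^ ((i : ℕ) + 1))))))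
    (one_le_mul_of_one_le_of_one_le hC₁ (by nlinarith))
  refine ⟨C, hC, X₀, hX₀, ?_⟩
  intro X ν l₀ t t₀ g y τ E₁ E₂ E₃ E₄ L a b A B hX ht hν hy hyd hM hτ1 hτ2 hτ3 hL hl hsep hE₁ hE₂ hE₃ hE₄
    hE1 hE2 hE3 hE4 hexp
  have hX1 : 1 ≤ X := hX₀.trans hX
  have hX0 : 0 < X := by linarith
  have hP : ∀ r : ℝ, 0 < X ^ r := fun r => Real.rpow_pos_of_pos hX0 r
  have hY1 : 1 ≤ ⌊X ^ y⌋₊ := (Nat.one_le_floor_iff _).2 (Real.one_le_rpow hX1 hy)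
  have hYM : (⌊X ^ y⌋₊ : ℝ) ≤ X ^ ν := (Nat.floor_le (hP y).le).trans
    (Real.rpow_le_rpow_of_exponent_le hX1 (by
      have : 0 ≤ (t + 3 * σ) / (k + 1) := by positivity
      linarith))
  refine H X ν l₀ t y (E₁ + E₂ + E₃ + E₄) τ L a b A B hX ht hν hy hyd hM
    hτ1 hτ2 hτ3 hL (fun l h => ?_) hexp (fun p₀ hp₀ => ?_)
  · obtain ⟨q1, q2, q3, -, q5, q6⟩ := hl l h
    exact ⟨q1, q2, q3, q5, q6⟩
  refine (h1 ⌊X ^ y⌋₊ (X ^ ν) (X ^ t) (X ^ t₀) (X ^ g) L a b A B hY1 hM hYM (hP _) (hP _) hl hsep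
        p₀ hp₀).trans ?_
  have a1 : X ^ t / (X ^ ν) ^ ((i : ℕ) + 1) = X ^ (t - ((i : ℕ) + 1) * ν) := by
    rw [← Real.rpow_mul_natCast hX0.le, ← Real.rpow_sub hX0]; congr 1; push_cast; ring
  have a1' : X ^ t / (X ^ ν) ^ ((i : ℕ) + 2) = X ^ (t - ((i : ℕ) + 2) * ν) := by
    rw [← Real.rpow_mul_natCast hX0.le, ← Real.rpow_sub hX0]; congr 1; push_cast; ring
  have a2 : X ^ ν * (X ^ ν / ⌊X ^ y⌋₊) ^ ((i : ℕ) + 2) / X ^ t₀ ≤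
      2 ^ ((i : ℕ) + 2) * X ^ (ν + ((i : ℕ) + 2) * (ν - y) - t₀) := by
    have h := rpow_div_floor_pow_le (ν := ν) hX1 hy ((i : ℕ) + 2)
    push_cast at h
    rw [Real.rpow_sub hX0 _ t₀, Real.rpow_add hX0]
    rw [mul_div_assoc', div_le_div_iff_of_pos_right (hP t₀), ← mul_assoc, mul_comm _ (X ^ ν), mul_assoc]
    exact mul_le_mul_of_nonneg_left h (hP ν).le
  have a3 : (X ^ ν / ⌊X ^ y⌋₊) ^ ((i : ℕ) + 1) / X ^ g ≤
      2 ^ ((i : ℕ) + 1) * X ^ (((i : ℕ) + 1) * (ν - y) - g) := by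
    have h := rpow_div_floor_pow_le (ν := ν) hX1 hy ((i : ℕ) + 1)
    push_cast at h
    rw [Real.rpow_sub hX0 _ g, mul_div_assoc', div_le_div_iff_of_pos_right (hP g)]
    exact h
  rw [a1, a1', Real.rpow_add hX0, Real.rpow_add hX0, Real.rpow_add hX0, mul_assoc C₁]
  refine mul_le_mul_of_nonneg_left ?_ (by linarith)
  have p1 := hP E₁
  have p2 := hP E₂
  have p3 := hP E₃
  have p4 := hP E₄
  have p5 := hP ν
  have p6 := hP t₀
  have p7 := hP g
  calc _ ≤ (2 * X ^ E₁) * ((2 * X ^ E₂) * ((2 * 2 ^ ((i : ℕ) + 2) * X ^ E₃) * (2 * 2 ^ ((i : ℕ) + 1) * X ^ E₄))) := by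
        refine mul_le_mul (one_add_rpow_le hX1 hE₁ hE1) (mul_le_mul (one_add_rpow_le hX1 hE₂ hE2)
          (mul_le_mul ?_ ?_ ?_ ?_) ?_ ?_) ?_ ?_
        · have := one_add_rpow_le hX1 hE₃ hE3
          nlinarith
        · have := one_add_rpow_le hX1 hE₄ hE4
          nlinarith
        all_goals positivity
    _ = _ := by ring

set_option maxHeartbeats 1000000 in
/-- Bound for a single phase whose size lies between `M ^ (j - 3/5)` and `M ^ (j + 2/5)`. -/
lemma phase_single_step {c : ℝ} {k₀ : ℕ} (hci : ∀ z : ℤ, (z : ℝ) ≠ c) (hc : (k₀ : ℝ) < c) {σ ν₀ : ℝ}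
    (hσ : 0 < σ) (j : ℕ) (h1 : 28.4 * σ ≤ 0.26 * ν₀)
    (h2 : 4.22 * σ * ((j + 2) * (j + 3)) + 3 * σ ≤ 0.6 * ν₀) :
    ∃ C : ℝ, 1 ≤ C ∧ ∃ X₀ : ℝ, 1 ≤ X₀ ∧ ∀ (X ν t : ℝ) (a b : ℕ) (A B : ℝ),
      X₀ ≤ X → ν₀ ≤ ν → ν ≤ 1 → 2 ≤ X ^ ν → (j + 0.4) * ν ≤ t → t ≤ (j + 1.4) * ν → 0 ≤ B → B ≤ A →
      A * (X ^ ν) ^ c = X ^ t → X ^ ν / 2 ≤ a → b ≤ 2 * X ^ ν →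
      ‖∑ m ∈ Ioc a b, e (A * (m : ℝ) ^ c + B * (m : ℝ) ^ k₀)‖ ≤ C * X ^ (ν - 2.1 * σ) := by
  obtain ⟨C, hC, X₀, hX₀, H⟩ := phase_single_le (k := j + 2) (s := (j + 2) * (j + 2 + 1)) (k₀ := k₀) hci hc
    (by omega) (Nat.mul_pos (by omega) (by omega)) (meanBd_vinogradov (by omega))
    (ε := 0.01 * σ) (by positivity) hσ ⟨j, by omega⟩
  refine ⟨C, hC, X₀, hX₀, fun X ν t a b A B hX hν0 hν hM ht1 ht2 hB hBA hA ha hb => ?_⟩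
  have hj : (0 : ℝ) ≤ j := Nat.cast_nonneg j
  have hν' : 0 < ν := by nlinarith
  have hj3 : (0 : ℝ) < j + 3 := by positivity
  have e1 : 4.22 * σ * ((j + 2) * (j + 3)) + 3 * σ ≤ 0.6 * ν := by linarith
  have e2 : σ * (j + 3) * 2 ≤ σ * (j + 3) * (j + 2) := by
    have : 0 < σ * (j + 3) := by positivity
    nlinarith
  obtain ⟨q, hq⟩ : ∃ q : ℝ, q = (t + 3 * σ) / (j + 3) := ⟨_, rfl⟩
  have hq' : q * (j + 3) = t + 3 * σ := by rw [hq]; field_simp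
  refine H X ν t (ν - q) (2.1 * σ) (max 0 (t - (j + 1) * ν)) (max 0 (ν + (j + 1) * q - t)) a b A B hX
    ?_ hν ?_ ?_ hM (by linarith) ?_ ?_ hB hBA hA ha hb (le_max_left _ _) (le_max_left _ _)
    (le_max_right _ _) ?_ ?_
  · exact le_trans (by positivity) ht1
  · have : 0 ≤ (ν - q) * (j + 3) := by nlinarith
    nlinarith
  · rw [hq]; push_cast; ring_nf
  · have : 2.1 * σ * (j + 3) ≤ (ν - q) * (j + 3) := by nlinarith
    exact le_of_mul_le_mul_right this hj3
  · have : 2.1 * σ * (j + 3) ≤ q * (j + 3) := by nlinarith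
    rw [sub_sub_cancel]
    exact le_of_mul_le_mul_right this hj3
  · rw [sub_sub_cancel]; exact le_max_right _ _
  · push_cast
    have h3 : 2 * ((j + 2) * (j + 2 + 1) : ℝ) * (2.1 * σ + 0.01 * σ) = 4.22 * σ * ((j + 2) * (j + 3)) := by ring
    rw [h3]
    obtain ⟨φ, hφ⟩ : ∃ φ, t = (j + 1 + φ) * ν := ⟨t / ν - (j + 1), by field_simp; ring⟩
    have hφ1 : -0.6 ≤ φ := by
      rw [hφ] at ht1; have := le_of_mul_le_mul_right ht1 hν'; linarith
    have hφ2 : φ ≤ 0.4 := by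
      rw [hφ] at ht2; have := le_of_mul_le_mul_right ht2 hν'; linarith
    have e3 : (ν + (j + 1) * q - t) = ν - 2 * q + 3 * σ := by linarith
    have e4 : t - (j + 1) * ν = φ * ν := by rw [hφ]; ring
    rw [e3, e4]
    have hq1 : (j + 0.4) * ν + 3 * σ ≤ q * (j + 3) := by linarith
    rcases Nat.eq_zero_or_pos j with rfl | hjp
    · have b1 : φ * ν ≤ 0.4 * ν := by gcongr
      have b2 : -0.6 * ν ≤ φ * ν := by gcongr
      have b3 : t = ν + φ * ν := by rw [hφ]; push_cast; ring
      clear H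
      push_cast at *
      rcases max_cases 0 (φ * ν) with ⟨r1, r2⟩ | ⟨r1, r2⟩ <;>
      rcases max_cases 0 (ν - 2 * q + 3 * σ) with ⟨r3, r4⟩ | ⟨r3, r4⟩ <;>
      rw [r1, r3] <;> linarith
    · have hj1 : (1 : ℝ) ≤ j := by exact_mod_cast hjp
      have b1 : φ * ν ≤ 0.4 * ν := by nlinarith
      have b2 : 0.7 * ν ≤ 2 * q := by
        have : 0.7 * ν * (j + 3) ≤ 2 * q * (j + 3) := by nlinarith
        exact le_of_mul_le_mul_right this hj3
      have b3 : φ * ν + 0.6 * ν ≤ 2 * q := by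
        have : (φ * ν + 0.6 * ν) * (j + 3) ≤ 2 * q * (j + 3) := by
          have h5 : 2 * q * (j + 3) = 2 * ((j + 1 + φ) * ν) + 6 * σ := by rw [← hφ]; linarith
          rw [h5]
          have h6 : (φ + 0.6) * (j + 3) ≤ 2 * (j + 1 + φ) := by nlinarith
          nlinarith
        exact le_of_mul_le_mul_right this hj3
      rcases max_cases 0 (φ * ν) with ⟨r1, r2⟩ | ⟨r1, r2⟩ <;>
      rcases max_cases 0 (ν - 2 * q + 3 * σ) with ⟨r3, r4⟩ | ⟨r3, r4⟩ <;>
      rw [r1, r3] <;> linarith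

/-- Bound for a single phase of small size. -/
lemma phase_single_base {c : ℝ} {k₀ : ℕ} (hci : ∀ z : ℤ, (z : ℝ) ≠ c) (hc : (k₀ : ℝ) < c) {σ ν₀ : ℝ}
    (hσ : 0 < σ) (h1 : 28.4 * σ ≤ 0.26 * ν₀) :
    ∃ C : ℝ, 1 ≤ C ∧ ∃ X₀ : ℝ, 1 ≤ X₀ ∧ ∀ (X ν t : ℝ) (a b : ℕ) (A B : ℝ),
      X₀ ≤ X → ν₀ ≤ ν → ν ≤ 1 → 2 ≤ X ^ ν → 12 * σ ≤ t → t ≤ 0.4 * ν → 0 ≤ B → B ≤ A →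
      A * (X ^ ν) ^ c = X ^ t → X ^ ν / 2 ≤ a → b ≤ 2 * X ^ ν →
      ‖∑ m ∈ Ioc a b, e (A * (m : ℝ) ^ c + B * (m : ℝ) ^ k₀)‖ ≤ C * X ^ (ν - 2.1 * σ) := by
  obtain ⟨C, hC, X₀, hX₀, H⟩ := phase_single_le (k := 1) (s := 1) (k₀ := k₀) hci hc
    le_rfl le_rfl meanBd_one (ε := 0.01 * σ) (by positivity) hσ 0
  refine ⟨C, hC, X₀, hX₀, fun X ν t a b A B hX hν0 hν hM ht1 ht2 hB hBA hA ha hb => ?_⟩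
  refine H X ν t (ν - (t + 3 * σ) / 2) (2.1 * σ) 0 (max 0 (ν - (t - 3 * σ) / 2)) a b A B hX
    (by linarith) hν (by linarith) (by norm_num) hM (by linarith) (by linarith) (by linarith) hB hBA hA ha hb
    le_rfl (le_max_left _ _) (by simp; linarith)
    (le_trans (by simp; linarith) (le_max_right _ _)) ?_
  rcases max_cases 0 (ν - (t - 3 * σ) / 2) with ⟨r3, r4⟩ | ⟨r3, r4⟩ <;> rw [r3] <;> push_cast <;> linarith

/-- Bound for a single phase, uniformly in its size. -/
lemma phase_single_bound {c : ℝ} {k₀ : ℕ} (hci : ∀ z : ℤ, (z : ℝ) ≠ c) (hc : (k₀ : ℝ) < c) {σ ν₀ : ℝ}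
    (hσ : 0 < σ) (h1 : 28.4 * σ ≤ 0.26 * ν₀) (J : ℕ)
    (h2 : 4.22 * σ * ((J + 1) * (J + 2)) + 3 * σ ≤ 0.6 * ν₀) :
    ∃ C : ℝ, 1 ≤ C ∧ ∃ X₀ : ℝ, 1 ≤ X₀ ∧ ∀ (X ν t : ℝ) (a b : ℕ) (A B : ℝ),
      X₀ ≤ X → ν₀ ≤ ν → ν ≤ 1 → 2 ≤ X ^ ν → 12 * σ ≤ t → t ≤ (J + 0.4) * ν → 0 ≤ B → B ≤ A →
      A * (X ^ ν) ^ c = X ^ t → X ^ ν / 2 ≤ a → b ≤ 2 * X ^ ν →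
      ‖∑ m ∈ Ioc a b, e (A * (m : ℝ) ^ c + B * (m : ℝ) ^ k₀)‖ ≤ C * X ^ (ν - 2.1 * σ) := by
  induction J with
  | zero => simpa using phase_single_base (k₀ := k₀) hci hc hσ h1
  | succ J ih =>
    push_cast at h2
    obtain ⟨C, hC, X₀, hX₀, H⟩ := ih (by
      refine le_trans ?_ h2
      have : (0 : ℝ) ≤ J := Nat.cast_nonneg J
      have h3 : ((J : ℝ) + 1) * (J + 2) ≤ (J + 1 + 1) * (J + 1 + 2) := by nlinarith
      have := mul_le_mul_of_nonneg_left h3 (by positivity : 0 ≤ 4.22 * σ)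
      linarith)
    obtain ⟨C', hC', X₀', hX₀', H'⟩ := phase_single_step (k₀ := k₀) hci hc hσ J h1
      (by convert h2 using 3; ring)
    refine ⟨C + C', by linarith, max X₀ X₀', le_max_of_le_left hX₀, ?_⟩
    intro X ν t a b A B hX hν0 hν hM ht1 ht2 hB hBA hA ha hb
    have hX0 : 0 < X := by linarith [(le_max_left _ _).trans hX]
    have hp := Real.rpow_pos_of_pos hX0 (ν - 2.1 * σ)
    push_cast at ht2
    rcases le_or_gt t ((J + 0.4) * ν) with h | h
    · have := H X ν t a b A B ((le_max_left _ _).trans hX) hν0 hν hM ht1 h hB hBA hA ha hb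
      nlinarith
    · have := H' X ν t a b A B ((le_max_right _ _).trans hX) hν0 hν hM h.le
        (ht2.trans (le_of_eq (by ring))) hB hBA hA ha hb
      nlinarith

set_option maxHeartbeats 1000000 in
/-- The numerical inequality behind the choice of the exponent. -/
lemma exponent_ineq {c σ ν φ : ℝ} {j : ℕ} (hc3 : 3 < c) (hσ : 0 < σ)
    (hσD : σ * (24 * c ^ 2 + 36 * c + 30) ≤ 1.03) (hj : 4 ≤ j) (hφ1 : -0.6 ≤ φ) (hφ2 : φ ≤ 0.4)
    (hν1 : 1 / 2 ≤ ν) (hν2 : ν ≤ 24 / 25) (ht : ν * (j + φ) ≤ c + 2 * σ) :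
    4.22 * σ * ((j + 1) * (j + 2)) + 5.3 * σ ≤ 1 - ν * (max 0 φ + (2 - φ) / (j + 2)) := by
  have hj4 : (4 : ℝ) ≤ j := by exact_mod_cast hj
  have hj2 : (0 : ℝ) < j + 2 := by linarith
  set b := max 0 φ + (2 - φ) / (j + 2) with hb
  set D := 24 * c ^ 2 + 36 * c + 30 with hD
  have hD354 : 354 ≤ D := by rw [hD]; nlinarith
  have hb0 : 0 ≤ b := by
    have : 0 ≤ (2 - φ) / (j + 2) := div_nonneg (by linarith) hj2.le
    have := le_max_left 0 φ
    positivity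
  have hb' : b * (j + 2) = max 0 φ * (j + 2) + (2 - φ) := by rw [hb]; field_simp
  have hb1 : b ≤ 2 / 3 := by
    have : b * (j + 2) ≤ 2 / 3 * (j + 2) := by
      rw [hb']
      rcases max_cases 0 φ with ⟨r1, r2⟩ | ⟨r1, r2⟩ <;> rw [r1] <;> nlinarith
    exact le_of_mul_le_mul_right this hj2
  have hνb : 0 ≤ 1 - ν * b := by nlinarith
  suffices h : 1.03 * (4.22 * ((j + 1) * (j + 2)) + 5.3) ≤ (1 - ν * b) * D by
    have h1 : σ * (1.03 * (4.22 * ((j + 1) * (j + 2)) + 5.3)) ≤ (1 - ν * b) * 1.03 :=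
      calc _ ≤ σ * ((1 - ν * b) * D) := by gcongr
        _ = (1 - ν * b) * (σ * D) := by ring
        _ ≤ _ := by gcongr
    linarith
  by_cases hsmall : φ < 0 ∧ j < 6
  · obtain ⟨hφ0, hj6⟩ := hsmall
    have hD' : (1 - ν * b) * 354 ≤ (1 - ν * b) * D := by gcongr
    refine le_trans ?_ hD'
    have hmx : max 0 φ = 0 := max_eq_left hφ0.le
    rw [hmx, zero_mul, zero_add] at hb'
    interval_cases j <;> push_cast at * <;> nlinarith
  set x := j + φ with hx
  have hx3 : 3.4 ≤ x := by rw [hx]; linarith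
  set P := 6 * x ^ 2 + 18 * x + 30 with hP
  have hP0 : 0 < P := by positivity
  have hσ' : σ ≤ 0.003 := by nlinarith
  -- lower bound for `D`
  have hDP : 2 * ν * P - 1.1 ≤ D := by
    have h1 : σ * (96 * c + 96 * σ + 72) ≤ 1.1 := by
      have h2 : 96 * c + 96 * σ + 72 ≤ 1.06 * D := by rw [hD]; nlinarith
      calc _ ≤ σ * (1.06 * D) := by gcongr
        _ ≤ _ := by linarith
    have hνx : 0 ≤ ν * x := by positivity
    have h3 : 24 * (ν * x) ^ 2 + 36 * (ν * x) + 30 ≤ 24 * (c + 2 * σ) ^ 2 + 36 * (c + 2 * σ) + 30 := by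
      gcongr
    have h4 : 24 * (c + 2 * σ) ^ 2 + 36 * (c + 2 * σ) + 30 = D + σ * (96 * c + 96 * σ + 72) := by
      rw [hD]; ring
    have h5 : 2 * ν * P ≤ 24 * (ν * x) ^ 2 + 36 * (ν * x) + 30 := by
      have h6 : 24 * (ν * x) ^ 2 + 36 * (ν * x) + 30 - 2 * ν * P = (2 * ν - 1) * (12 * ν * x ^ 2 - 30) := by
        rw [hP]; ring
      have h7 : 0 ≤ 12 * ν * x ^ 2 - 30 := by nlinarith
      have := mul_nonneg (by linarith : 0 ≤ 2 * ν - 1) h7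
      linarith
    linarith
  have hkey : (1 - b / 2) * P - 1.1 ≤ (1 - ν * b) * D := by
    have h1 : 1 - b / 2 ≤ (1 - ν * b) * (2 * ν) := by
      have : (1 - ν * b) * (2 * ν) - (1 - b / 2) = (2 * ν - 1) * (1 - b * (2 * ν + 1) / 2) := by ring
      have h2 : 0 ≤ 1 - b * (2 * ν + 1) / 2 := by nlinarith
      have := mul_nonneg (by linarith : 0 ≤ 2 * ν - 1) h2
      linarith
    have h2 : (1 - ν * b) * 1.1 ≤ 1.1 := by
      have : 0 ≤ ν * b := by positivity
      nlinarith
    calc _ ≤ ((1 - ν * b) * (2 * ν)) * P - (1 - ν * b) * 1.1 := by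
          have := mul_le_mul_of_nonneg_right h1 hP0.le
          linarith
      _ = (1 - ν * b) * (2 * ν * P - 1.1) := by ring
      _ ≤ _ := by gcongr
  refine le_trans ?_ hkey
  suffices h : (4.3466 * ((j + 1) * (j + 2)) + 6.56) * (j + 2) ≤ ((1 - b / 2) * (j + 2)) * P by
    have : (4.3466 * ((j + 1) * (j + 2)) + 6.56) ≤ ((1 - b / 2)) * P :=
      le_of_mul_le_mul_right (h.trans (le_of_eq (by ring))) hj2
    linarith
  rcases le_or_gt 0 φ with h0 | h0
  · rw [max_eq_right h0] at hb'
    have h1 : (1 - b / 2) * (j + 2) = (j + 1) * (1 - φ / 2) := by linarith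
    have h2 : 4.8 * (j : ℝ) ^ 2 + 18 * j + 30 ≤ (1 - φ / 2) * P := by
      have h3 : (1 - φ / 2) * P - (4.8 * (j : ℝ) ^ 2 + 18 * j + 30) =
          3 * (0.4 - φ) * j ^ 2 + φ * (j * (3 - 6 * φ) + 3 - 9 * φ) + (1 - φ / 2) * (6 * φ ^ 2) := by
        rw [hP, hx]; ring
      have h4 : 0 ≤ 3 * (0.4 - φ) * (j : ℝ) ^ 2 := mul_nonneg (by linarith) (by positivity)
      have h5 : 0 ≤ φ * (j * (3 - 6 * φ) + 3 - 9 * φ) := mul_nonneg h0 (by nlinarith)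
      have h6 : 0 ≤ (1 - φ / 2) * (6 * φ ^ 2) := mul_nonneg (by linarith) (by positivity)
      linarith
    rw [h1, mul_assoc]
    refine le_trans ?_ (mul_le_mul_of_nonneg_left h2 (by linarith))
    obtain ⟨z, hz⟩ : ∃ z : ℝ, (j : ℝ) = z + 4 := ⟨j - 4, by ring⟩
    have hz0 : 0 ≤ z := by linarith
    rw [hz, ← sub_nonneg]
    have h3 : (z + 4 + 1) * (4.8 * (z + 4) ^ 2 + 18 * (z + 4) + 30) -
        (4.3466 * ((z + 4 + 1) * (z + 4 + 2)) + 6.56) * (z + 4 + 2) =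
        0.4534 * z ^ 3 + 6.5078 * z ^ 2 + 36.9664 * z + 72.252 := by ring
    rw [h3]
    positivity
  · have hj6 : (6 : ℝ) ≤ j := by
      have : 6 ≤ j := by by_contra h; exact hsmall ⟨h0, by omega⟩
      exact_mod_cast this
    rw [max_eq_left h0.le] at hb'
    have h1 : (1 - b / 2) * (j + 2) = (j + 1) + φ / 2 := by linarith
    have h2 : 6 * (j : ℝ) ^ 2 + 10.8 * j + 21.36 ≤ P := by
      rw [hP, hx]; nlinarith
    rw [h1]
    calc _ ≤ ((j : ℝ) + 0.7) * (6 * (j : ℝ) ^ 2 + 10.8 * j + 21.36) := by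
          obtain ⟨z, hz⟩ : ∃ z : ℝ, (j : ℝ) = z + 6 := ⟨j - 6, by ring⟩
          have hz0 : 0 ≤ z := by linarith
          rw [hz]
          linarith [pow_nonneg hz0 3, pow_nonneg hz0 2]
      _ ≤ _ := mul_le_mul (by linarith) h2 (by positivity) (by linarith)

/-- A family of phases `A l * m ^ c + B l * m ^ k₀`, where `m` has size `X ^ ν`, of size about `X ^ t` and
separated in the `l` aspect. -/
structure PhaseFamily (c : ℝ) (k₀ : ℕ) (σ X ν t : ℝ) (L : Finset ℕ) (a b : ℕ → ℕ) (A B : ℕ → ℝ) : Prop where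
  card_le : (#L : ℝ) ≤ 2 * X ^ (1 - ν)
  nonneg : ∀ l ∈ L, 0 ≤ B l
  le : ∀ l ∈ L, B l ≤ A l
  upper : ∀ l ∈ L, A l * (X ^ ν) ^ c ≤ X ^ t
  lower : ∀ l ∈ L, X ^ (t - 2.3 * σ) ≤ A l * (X ^ ν) ^ c
  left : ∀ l ∈ L, X ^ ν / 2 ≤ a l
  right : ∀ l ∈ L, b l ≤ 2 * X ^ ν
  sep : ∀ l ∈ L, ∀ l' ∈ L,
    X ^ (t - (1 - ν) - 0.1 * σ) * |(l : ℝ) - l'| ≤ |A l * (X ^ ν) ^ c - A l' * (X ^ ν) ^ c|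

lemma phase_joint_step {c : ℝ} {k₀ : ℕ} (hci : ∀ z : ℤ, (z : ℝ) ≠ c) (hc : (k₀ : ℝ) < c) (hc3 : 3 < c) {σ : ℝ}
    (hσ : 0 < σ) (hσD : σ * (24 * c ^ 2 + 36 * c + 30) ≤ 1.03) (j : ℕ) (hj : 4 ≤ j) (hkj : k₀ < j) :
    ∃ C : ℝ, 1 ≤ C ∧ ∃ X₀ : ℝ, 1 ≤ X₀ ∧ ∀ (X ν t : ℝ) (L : Finset ℕ) (a b : ℕ → ℕ) (A B : ℕ → ℝ),
      X₀ ≤ X → 1 / 2 ≤ ν → ν ≤ 24 / 25 → 2 ≤ X ^ ν → (j - 0.6) * ν ≤ t → t ≤ (j + 0.4) * ν → t ≤ c + 2 * σ →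
      PhaseFamily c k₀ σ X ν t L a b A B →
      ∑ l ∈ L, ‖∑ m ∈ Ioc (a l) (b l), e (A l * (m : ℝ) ^ c + B l * (m : ℝ) ^ k₀)‖ ≤
        C * X ^ (1 - 2.1 * σ) := by
  obtain ⟨C, hC, X₀, hX₀, H⟩ := phase_joint_le (k := j + 1) (s := (j + 1) * (j + 1 + 1)) (k₀ := k₀) hci hc
    (by omega) (Nat.mul_pos (by omega) (by omega)) (meanBd_vinogradov (by omega))
    (ε := 0.01 * σ) (by positivity) hσ ⟨j - 1, by omega⟩ ⟨j, by omega⟩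
    (by simp only; omega) (by simp only; omega)
  refine ⟨C, hC, X₀, hX₀, fun X ν t L a b A B hX hν1 hν2 hM ht1 ht2 htc hF => ?_⟩
  have hj4 : (4 : ℝ) ≤ j := by exact_mod_cast hj
  have hj2 : (0 : ℝ) < j + 2 := by linarith
  have hν0 : 0 < ν := by linarith
  have hcast : ((j - 1 : ℕ) : ℝ) = j - 1 := by rw [Nat.cast_sub (by omega), Nat.cast_one]
  have hσ' : σ ≤ 0.003 := by nlinarith
  obtain ⟨φ, hφ⟩ : ∃ φ, t = (j + φ) * ν := ⟨t / ν - j, by field_simp; ring⟩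
  have hφ1 : -0.6 ≤ φ := by
    rw [hφ] at ht1; have := le_of_mul_le_mul_right ht1 hν0; linarith
  have hφ2 : φ ≤ 0.4 := by
    rw [hφ] at ht2; have := le_of_mul_le_mul_right ht2 hν0; linarith
  have key := exponent_ineq hc3 hσ hσD hj hφ1 hφ2 hν1 hν2 (by rw [mul_comm, ← hφ]; exact htc)
  obtain ⟨q, hq⟩ : ∃ q : ℝ, q = (t + 3 * σ) / (j + 2) := ⟨_, rfl⟩
  have hq' : q * (j + 2) = t + 3 * σ := by rw [hq]; field_simp
  have hmax := le_max_left 0 φ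
  have hd0 : 0 ≤ (2 - φ) / (j + 2) := div_nonneg (by linarith) hj2.le
  have hq2 : 1.13 * ν ≤ 2 * q := by
    have : 1.13 * ν * (j + 2) ≤ 2 * q * (j + 2) := by nlinarith
    exact le_of_mul_le_mul_right this hj2
  have hνq : (ν - q) * (j + 2) = (2 - φ) * ν - 3 * σ := by
    rw [sub_mul, hq', hφ]; ring
  have hνq' : ν - q ≤ ν * ((2 - φ) / (j + 2)) := by
    rw [mul_div_assoc', le_div_iff₀ hj2, hνq]; linarith
  have hτy : 2.1 * σ ≤ ν - q := by
    have h1 : 4.22 * σ * ((j + 1) * (j + 2)) ≤ 1 := by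
      have : 0 ≤ ν * (max 0 φ + (2 - φ) / (j + 2)) := by positivity
      linarith
    have h2 : σ * (j + 2) * 5 ≤ σ * (j + 2) * (j + 1) :=
      mul_le_mul_of_nonneg_left (by linarith) (by positivity)
    have h3 : 1.6 * ν ≤ (2 - φ) * ν := by gcongr; linarith
    have h4 : 2.1 * σ * (j + 2) ≤ (ν - q) * (j + 2) := by rw [hνq]; nlinarith
    exact le_of_mul_le_mul_right h4 hj2
  have := H X ν (1 - ν) t (t - 2.3 * σ) (t - (1 - ν) - 0.1 * σ) (ν - q) (2.1 * σ)
    (max 0 φ * ν) 0 (ν * ((2 - φ) / (j + 2)) + 5.3 * σ) 0 L a b A B hX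
    ((mul_nonneg (by linarith) hν0.le).trans ht1) (by linarith) (by linarith)
    (by rw [hq]; push_cast; ring_nf) hM (by linarith) hτy (by linarith) hF.card_le
    (fun l hl => ⟨hF.nonneg l hl, hF.le l hl, hF.upper l hl, hF.lower l hl, hF.left l hl, hF.right l hl⟩)
    hF.sep (by positivity) le_rfl (by positivity) le_rfl
    (by
      rw [hcast, hφ]
      have := le_max_right 0 φ
      nlinarith)
    (by rw [hcast]; linarith)
    (by rw [hcast]; linarith)
    (by rw [hcast]; linarith)
    (by push_cast; linarith)
  rwa [show ν + (1 - ν) - 2.1 * σ = 1 - 2.1 * σ by ring] at this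

/-- Bound for a family of phases, uniformly in its size. -/
lemma phase_family_bound {c : ℝ} {k₀ : ℕ} (hci : ∀ z : ℤ, (z : ℝ) ≠ c) (hc : (k₀ : ℝ) < c) (hc3 : 3 < c) {σ : ℝ}
    (hσ : 0 < σ) (hσD : σ * (24 * c ^ 2 + 36 * c + 30) ≤ 1.03) :
    ∃ C : ℝ, 1 ≤ C ∧ ∃ X₀ : ℝ, 1 ≤ X₀ ∧ ∀ (X ν t : ℝ) (L : Finset ℕ) (a b : ℕ → ℕ) (A B : ℕ → ℝ),
      X₀ ≤ X → 1 / 2 ≤ ν → ν ≤ 24 / 25 → 2 ≤ X ^ ν → 14.3 * σ ≤ t → t ≤ c + 2 * σ →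
      PhaseFamily c k₀ σ X ν t L a b A B →
      ∑ l ∈ L, ‖∑ m ∈ Ioc (a l) (b l), e (A l * (m : ℝ) ^ c + B l * (m : ℝ) ^ k₀)‖ ≤
        C * X ^ (1 - 2.1 * σ) := by
  have hJc : (⌊c⌋₊ : ℝ) ≤ c := Nat.floor_le (by linarith)
  have hJ3 : 3 ≤ ⌊c⌋₊ := Nat.le_floor (by exact_mod_cast hc3.le)
  have hD : 354 ≤ 24 * c ^ 2 + 36 * c + 30 := by nlinarith
  have hσ' : σ * 354 ≤ 1.03 := (mul_le_mul_of_nonneg_left hD hσ.le).trans hσD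
  suffices H : ∀ n : ℕ, ⌊c⌋₊ ≤ n →
      ∃ C : ℝ, 1 ≤ C ∧ ∃ X₀ : ℝ, 1 ≤ X₀ ∧ ∀ (X ν t : ℝ) (L : Finset ℕ) (a b : ℕ → ℕ) (A B : ℕ → ℝ),
      X₀ ≤ X → 1 / 2 ≤ ν → ν ≤ 24 / 25 → 2 ≤ X ^ ν → 14.3 * σ ≤ t → t ≤ c + 2 * σ → t ≤ (n + 0.4) * ν →
      PhaseFamily c k₀ σ X ν t L a b A B →
      ∑ l ∈ L, ‖∑ m ∈ Ioc (a l) (b l), e (A l * (m : ℝ) ^ c + B l * (m : ℝ) ^ k₀)‖ ≤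
        C * X ^ (1 - 2.1 * σ) by
    obtain ⟨C, hC, X₀, hX₀, h⟩ := H (⌊c⌋₊ + ⌈c + 5⌉₊) (by omega)
    refine ⟨C, hC, X₀, hX₀, fun X ν t L a b A B hX hν1 hν2 hM ht1 ht2 hF =>
      h X ν t L a b A B hX hν1 hν2 hM ht1 ht2 ?_ hF⟩
    have h1 := Nat.le_ceil (c + 5)
    have h2 := Nat.lt_floor_add_one c
    push_cast
    nlinarith
  intro n hn
  induction n, hn using Nat.le_induction with
  | base =>
    obtain ⟨C, hC, X₀, hX₀, H⟩ := phase_single_bound (k₀ := k₀) hci hc hσ (ν₀ := 1 / 2) (by linarith) ⌊c⌋₊ (by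
      have h1 : ((⌊c⌋₊ : ℝ) + 1) * (⌊c⌋₊ + 2) ≤ (c + 1) * (c + 2) := by gcongr
      have h2 : σ * (4.22 * ((⌊c⌋₊ + 1) * (⌊c⌋₊ + 2)) + 3) ≤ σ * (0.3 / 1.03 * (24 * c ^ 2 + 36 * c + 30)) := by
        refine mul_le_mul_of_nonneg_left ?_ hσ.le
        nlinarith
      nlinarith)
    refine ⟨2 * C, by linarith, X₀, hX₀, fun X ν t L a b A B hX hν1 hν2 hM ht1 ht2 ht3 hF => ?_⟩
    have hX1 : 1 ≤ X := hX₀.trans hX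
    have hX0 : 0 < X := by linarith
    have hP := Real.rpow_pos_of_pos hX0
    calc _ ≤ ∑ l ∈ L, C * X ^ (ν - 2.1 * σ) := Finset.sum_le_sum fun l hl => by
          have hpos : 0 < A l * (X ^ ν) ^ c := (hP _).trans_le (hF.lower l hl)
          have hX1' : 1 < X := by
            by_contra h
            have : X = 1 := le_antisymm (not_lt.1 h) hX1
            rw [this, Real.one_rpow] at hM
            norm_num at hM
          set t' := Real.logb X (A l * (X ^ ν) ^ c) with ht'
          have ht'X : A l * (X ^ ν) ^ c = X ^ t' := (Real.rpow_logb hX0 hX1'.ne' hpos).symm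
          have h1 := hF.upper l hl
          have h2 := hF.lower l hl
          rw [ht'X, Real.rpow_le_rpow_left_iff hX1'] at h1 h2
          exact H X ν t' (a l) (b l) (A l) (B l) hX hν1 (by linarith) hM (by linarith) (h1.trans ht3)
            (hF.nonneg l hl) (hF.le l hl) ht'X (hF.left l hl) (hF.right l hl)
      _ = #L * (C * X ^ (ν - 2.1 * σ)) := by simp
      _ ≤ 2 * X ^ (1 - ν) * (C * X ^ (ν - 2.1 * σ)) := by
          have := hP (ν - 2.1 * σ)
          exact mul_le_mul_of_nonneg_right hF.card_le (by positivity)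
      _ = 2 * C * (X ^ (1 - ν) * X ^ (ν - 2.1 * σ)) := by ring
      _ = _ := by rw [← Real.rpow_add hX0]; ring_nf
  | succ n hn ih =>
    obtain ⟨C, hC, X₀, hX₀, H⟩ := ih
    have hcn : c < n + 1 := (Nat.lt_floor_add_one c).trans_le (by exact_mod_cast Nat.succ_le_succ hn)
    obtain ⟨C', hC', X₀', hX₀', H'⟩ := phase_joint_step (k₀ := k₀) hci hc hc3 hσ hσD (n + 1) (by omega)
      (by exact_mod_cast hc.trans hcn)
    refine ⟨C + C', by linarith, max X₀ X₀', le_max_of_le_left hX₀, ?_⟩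
    intro X ν t L a b A B hX hν1 hν2 hM ht1 ht2 ht3 hF
    have hX0 : 0 < X := by linarith [(le_max_left _ _).trans hX]
    have hp := Real.rpow_pos_of_pos hX0 (1 - 2.1 * σ)
    rw [add_mul]
    rcases le_or_gt t ((n + 0.4) * ν) with h | h
    · have := H X ν t L a b A B ((le_max_left _ _).trans hX) hν1 hν2 hM ht1 ht2 h hF
      have : 0 ≤ C' * X ^ (1 - 2.1 * σ) := by positivity
      linarith
    · have := H' X ν t L a b A B ((le_max_right _ _).trans hX) hν1 hν2 hM
        (by push_cast; linarith) ht3 ht2 hF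
      have : 0 ≤ C * X ^ (1 - 2.1 * σ) := by positivity
      linarith

/-- The phase function `n ↦ n ^ c + n ^ k₀`. -/
def ph (c : ℝ) (k₀ : ℕ) (n : ℕ) : ℝ := (n : ℝ) ^ c + (n : ℝ) ^ k₀

lemma ph_mul (c : ℝ) (k₀ d m : ℕ) (γ : ℝ) :
    γ * ph c k₀ (d * m) = γ * (d : ℝ) ^ c * (m : ℝ) ^ c + γ * (d : ℝ) ^ k₀ * (m : ℝ) ^ k₀ := by
  rw [ph, Nat.cast_mul, Real.mul_rpow (Nat.cast_nonneg _) (Nat.cast_nonneg _), mul_pow]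
  ring

lemma pow_le_rpow_of_one_le {c : ℝ} {k₀ : ℕ} (hc : (k₀ : ℝ) < c) {x : ℝ} (hx : 1 ≤ x) : x ^ k₀ ≤ x ^ c := by
  rw [← Real.rpow_natCast]; exact Real.rpow_le_rpow_of_exponent_le hx hc.le

lemma exists_rpow_eq {X y : ℝ} (hX : 1 < X) (hy : 0 < y) : ∃ t : ℝ, X ^ t = y :=
  ⟨Real.logb X y, Real.rpow_logb (by linarith) (by linarith) hy⟩

lemma half_le_nat_div {N d : ℕ} (hd : 1 ≤ d) (hdN : d ≤ N) : (N : ℝ) / d / 2 ≤ (N / d : ℕ) := by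
  have h1 : (N : ℝ) / d < (N / d : ℕ) + 1 := by
    rw [← Nat.floor_div_eq_div (K := ℝ)]; exact Nat.lt_floor_add_one _
  have h2 : (1 : ℝ) ≤ (N / d : ℕ) := by
    exact_mod_cast (Nat.one_le_div_iff (by omega)).2 hdN
  linarith

lemma sum_ph_mul_le {c : ℝ} {k₀ : ℕ} (hci : ∀ z : ℤ, (z : ℝ) ≠ c) (hc : (k₀ : ℝ) < c) (hc3 : 3 < c) {σ : ℝ}
    (hσ : 0 < σ) (hσD : σ * (24 * c ^ 2 + 36 * c + 30) ≤ 1.03) :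
    ∃ C : ℝ, 1 ≤ C ∧ ∃ N₀ : ℝ, 1 ≤ N₀ ∧ ∀ (N d b : ℕ) (γ : ℝ), N₀ ≤ N → 1 ≤ d → (d : ℝ) ≤ (N : ℝ) ^ (1 / 8 : ℝ) →
      b ≤ 2 * N / d → (N : ℝ) ^ (-c + 16 * σ) ≤ γ → γ ≤ (N : ℝ) ^ (1.5 * σ) →
      ‖∑ m ∈ Ioc (N / d) b, e (γ * ph c k₀ (d * m))‖ ≤ C * (N / d * (N : ℝ) ^ (-(2.1 * σ))) := by
  have hD : 354 ≤ 24 * c ^ 2 + 36 * c + 30 := by nlinarith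
  have hσ' : σ * 354 ≤ 1.03 := (mul_le_mul_of_nonneg_left hD hσ.le).trans hσD
  obtain ⟨J, hJ⟩ : ∃ J : ℕ, J = ⌊(8 / 7) * (c + 2 * σ) + 0.6⌋₊ := ⟨_, rfl⟩
  have hJ1 : (J : ℝ) ≤ (8 / 7) * (c + 2 * σ) + 0.6 := by
    rw [hJ]; exact Nat.floor_le (by linarith)
  have hJ2 : (8 / 7) * (c + 2 * σ) + 0.6 < J + 1 := by
    rw [hJ]; exact Nat.lt_floor_add_one _
  have hJ3 : (J : ℝ) ≤ 1.143 * c + 0.608 := by linarith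
  have hJJ : ((J : ℝ) + 1) * (J + 2) ≤ (1.143 * c + 1.608) * (1.143 * c + 2.608) :=
    mul_le_mul (by linarith) (by linarith) (by positivity) (by linarith)
  have h2 : 4.22 * σ * ((J + 1) * (J + 2)) + 3 * σ ≤ 0.6 * (7 / 8) := by
    have h3 : 4.22 * (((J : ℝ) + 1) * (J + 2)) + 3 ≤ 0.5 * (24 * c ^ 2 + 36 * c + 30) := by
      refine (add_le_add_left (mul_le_mul_of_nonneg_left hJJ (by norm_num)) 3).trans ?_
      nlinarith
    have := mul_le_mul_of_nonneg_left h3 hσ.le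
    linarith
  obtain ⟨C, hC, X₀, hX₀, H⟩ := phase_single_bound (k₀ := k₀) hci hc hσ (ν₀ := 7 / 8) (by linarith) J h2
  refine ⟨C, hC, max X₀ 4, le_max_of_le_left hX₀, fun N d b γ hN hd hdN hb hγ1 hγ2 => ?_⟩
  have hN4 : (4 : ℝ) ≤ N := (le_max_right _ _).trans hN
  have hN0 : (0 : ℝ) < N := by linarith
  have hd0 : (0 : ℝ) < d := by exact_mod_cast hd
  have hd1 : (1 : ℝ) ≤ d := by exact_mod_cast hd
  obtain ⟨ν, hν⟩ := exists_rpow_eq (X := N) (y := N / d) (by linarith) (by positivity)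
  have hNd : (N : ℝ) ^ (7 / 8 : ℝ) ≤ N / d := by
    rw [le_div_iff₀ hd0]
    calc _ ≤ (N : ℝ) ^ (7 / 8 : ℝ) * (N : ℝ) ^ (1 / 8 : ℝ) := by gcongr
      _ = N := by rw [← Real.rpow_add hN0]; norm_num
  have hν1 : 7 / 8 ≤ ν := by
    rw [← hν] at hNd; exact (Real.rpow_le_rpow_left_iff (by linarith)).1 hNd
  have hν2 : ν ≤ 1 := by
    rw [← Real.rpow_le_rpow_left_iff (x := (N : ℝ)) (by linarith), hν, Real.rpow_one]
    exact div_le_self hN0.le hd1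
  have hγ0 : 0 < γ := lt_of_lt_of_le (Real.rpow_pos_of_pos hN0 _) hγ1
  have hdN' : d ≤ N := by
    have : (N : ℝ) ^ (1 / 8 : ℝ) ≤ (N : ℝ) ^ (1 : ℝ) := Real.rpow_le_rpow_of_exponent_le (by linarith) (by norm_num)
    rw [Real.rpow_one] at this
    exact_mod_cast hdN.trans this
  obtain ⟨t, ht⟩ := exists_rpow_eq (X := N) (y := γ * (N : ℝ) ^ c) (by linarith) (by positivity)
  have ht1 : 16 * σ ≤ t := by
    rw [← Real.rpow_le_rpow_left_iff (x := (N : ℝ)) (by linarith), ht]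
    calc _ = (N : ℝ) ^ (-c + 16 * σ) * (N : ℝ) ^ c := by rw [← Real.rpow_add hN0]; congr 1; ring
      _ ≤ _ := by gcongr
  have ht2 : t ≤ c + 1.5 * σ := by
    rw [← Real.rpow_le_rpow_left_iff (x := (N : ℝ)) (by linarith), ht]
    calc _ ≤ (N : ℝ) ^ (1.5 * σ) * (N : ℝ) ^ c := by gcongr
      _ = _ := by rw [← Real.rpow_add hN0]; congr 1; ring
  have key := H N ν t (N / d) b (γ * (d : ℝ) ^ c) (γ * (d : ℝ) ^ k₀) ((le_max_left _ _).trans hN) hν1 hν2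
    (by
      rw [hν]; refine le_trans ?_ hNd
      calc (2 : ℝ) = (4 : ℝ) ^ (1 / 2 : ℝ) := by
            rw [show (4 : ℝ) = 2 ^ (2 : ℝ) by norm_num, ← Real.rpow_mul (by norm_num)]; norm_num
        _ ≤ (N : ℝ) ^ (1 / 2 : ℝ) := by gcongr
        _ ≤ _ := Real.rpow_le_rpow_of_exponent_le (by linarith) (by norm_num))
    (by linarith)
    (by
      have : ((J : ℝ) + 0.4) * (7 / 8) ≤ (J + 0.4) * ν := by gcongr
      linarith)
    (by positivity)
    (mul_le_mul_of_nonneg_left (pow_le_rpow_of_one_le hc hd1) hγ0.le)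
    (by
      rw [hν, Real.div_rpow hN0.le hd0.le, ht]
      have := Real.rpow_pos_of_pos hd0 c
      field_simp)
    (by rw [hν]; exact half_le_nat_div hd hdN')
    (by
      rw [hν]
      calc (b : ℝ) ≤ ((2 * N / d : ℕ) : ℝ) := by exact_mod_cast hb
        _ ≤ ((2 * N : ℕ) : ℝ) / d := Nat.cast_div_le
        _ = _ := by push_cast; ring)
  rw [sub_eq_add_neg, Real.rpow_add hN0, hν] at key
  simpa only [ph_mul] using key

lemma norm_sum_mul_monotone_le {w : ℕ → ℝ} (hw : Monotone w) (z : ℕ → ℂ) {a : ℕ} {B : ℝ} (b : ℕ) (hab : a ≤ b)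
    (hB : ∀ n, n ≤ b → ‖∑ m ∈ Ioc a n, z m‖ ≤ B) :
    ‖∑ m ∈ Ioc a b, (w m : ℂ) * z m - w b * ∑ m ∈ Ioc a b, z m‖ ≤ (w b - w a) * B := by
  induction b, hab using Nat.le_induction with
  | base => simp
  | succ b hab ih =>
    have h1 := ih fun n hn => hB n (by omega)
    have h2 := hB b (by omega)
    rw [Finset.sum_Ioc_succ_top (by omega), Finset.sum_Ioc_succ_top (by omega)]
    have h3 : ∑ m ∈ Ioc a b, (w m : ℂ) * z m + w (b + 1) * z (b + 1)
        - w (b + 1) * (∑ m ∈ Ioc a b, z m + z (b + 1)) =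
        (∑ m ∈ Ioc a b, (w m : ℂ) * z m - w b * ∑ m ∈ Ioc a b, z m)
          - ((w (b + 1) - w b : ℝ) : ℂ) * ∑ m ∈ Ioc a b, z m := by push_cast; ring
    rw [h3]
    have h4 : 0 ≤ w (b + 1) - w b := sub_nonneg.2 (hw (Nat.le_succ b))
    refine (norm_sub_le _ _).trans ?_
    rw [norm_mul, Complex.norm_real, Real.norm_of_nonneg h4]
    have := mul_le_mul_of_nonneg_left h2 h4
    linarith

lemma norm_sum_log_mul_le (z : ℕ → ℂ) {a b : ℕ} {B : ℝ} (hab : a ≤ b)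
    (hB : ∀ n, n ≤ b → ‖∑ m ∈ Ioc a n, z m‖ ≤ B) :
    ‖∑ m ∈ Ioc a b, (Real.log m : ℂ) * z m‖ ≤ 2 * Real.log b * B := by
  have hmono : Monotone fun n : ℕ => Real.log n := by
    intro m n hmn
    rcases Nat.eq_zero_or_pos m with rfl | hm
    · simpa using Real.log_natCast_nonneg n
    · exact Real.log_le_log (by exact_mod_cast hm) (by exact_mod_cast hmn)
  have h := norm_sum_mul_monotone_le hmono z b hab hB
  have h1 := hB b le_rfl
  have hB0 : 0 ≤ B := (norm_nonneg _).trans h1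
  have hb := Real.log_natCast_nonneg b
  have ha := Real.log_natCast_nonneg a
  have h2 := norm_sub_norm_le (∑ m ∈ Ioc a b, (Real.log m : ℂ) * z m) (Real.log b * ∑ m ∈ Ioc a b, z m)
  rw [norm_mul, Complex.norm_real, Real.norm_of_nonneg hb] at h2
  have h3 := mul_le_mul_of_nonneg_left h1 hb
  have h4 := mul_nonneg ha hB0
  linarith

lemma rpow_sub_one_mul_sub_le {c x y : ℝ} (hc : 1 < c) (hx : 0 < x) (hxy : x ≤ y) :
    y ^ (c - 1) * (y - x) ≤ y ^ c - x ^ c := by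
  have h1 : ∀ z : ℝ, 0 < z → z ^ c = z ^ (c - 1) * z := fun z hz => by
    rw [← Real.rpow_add_one hz.ne']; congr 1; ring
  rw [h1 y (by linarith), h1 x hx]
  have : x ^ (c - 1) ≤ y ^ (c - 1) := Real.rpow_le_rpow hx.le hxy (by linarith)
  have := mul_le_mul_of_nonneg_right this hx.le
  linarith

lemma pow_sub_pow_le_rpow_sub_rpow {c : ℝ} {k : ℕ} (hc : (k : ℝ) < c) {x y : ℝ} (hx : 1 ≤ x) (hxy : x ≤ y) :
    y ^ k - x ^ k ≤ y ^ c - x ^ c := by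
  have h1 : ∀ z : ℝ, 1 ≤ z → z ^ c - z ^ k = z ^ k * (z ^ (c - k) - 1) := fun z hz => by
    have hz0 : 0 < z := by linarith
    rw [Real.rpow_sub_natCast hz0.ne']
    field_simp
  have h2 : x ^ k * (x ^ (c - k) - 1) ≤ y ^ k * (y ^ (c - k) - 1) := by
    have h3 := Real.one_le_rpow hx (sub_nonneg.2 hc.le)
    have h4 : x ^ (c - k) ≤ y ^ (c - k) := Real.rpow_le_rpow (by linarith) hxy (by linarith)
    have : x ^ k ≤ y ^ k := pow_le_pow_left₀ (by linarith) hxy k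
    exact mul_le_mul this (by linarith) (by linarith) (pow_nonneg (by linarith) k)
  rw [← h1 x hx, ← h1 y (hx.trans hxy)] at h2
  linarith

lemma eventually_le_rpow (a : ℝ) {s : ℝ} (hs : 0 < s) : ∃ X₀ : ℝ, 1 ≤ X₀ ∧ ∀ X, X₀ ≤ X → a ≤ X ^ s := by
  obtain ⟨X₀, h⟩ := eventually_atTop.1 ((tendsto_rpow_atTop hs).eventually_ge_atTop a)
  exact ⟨max 1 X₀, le_max_left _ _, fun X hX => h X ((le_max_right _ _).trans hX)⟩

lemma card_le_of_subset_dyadic {P : ℝ} (hP : 0 ≤ P) {L : Finset ℕ} (hL : ∀ l ∈ L, P < l ∧ (l : ℝ) ≤ 2 * P) :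
    (#L : ℝ) ≤ 2 * P := by
  have h1 : L ⊆ Ioc 0 ⌊2 * P⌋₊ := fun l hl => by
    obtain ⟨h1, h2⟩ := hL l hl
    exact mem_Ioc.2 ⟨by exact_mod_cast hP.trans_lt h1, Nat.le_floor h2⟩
  have h2 := card_le_card h1
  rw [Nat.card_Ioc, Nat.sub_zero] at h2
  exact (Nat.cast_le.2 h2).trans (Nat.floor_le (by positivity))

set_option maxHeartbeats 1000000 in
lemma sum_far_le {c : ℝ} {k₀ : ℕ} (hci : ∀ z : ℤ, (z : ℝ) ≠ c) (hc : (k₀ : ℝ) < c) (hc3 : 3 < c) {σ : ℝ}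
    (hσ : 0 < σ) (hσD : σ * (24 * c ^ 2 + 36 * c + 30) ≤ 1.03) :
    ∃ C : ℝ, 1 ≤ C ∧ ∃ N₀ : ℝ, 1 ≤ N₀ ∧ ∀ (N : ℕ) (γ P : ℝ) (L : Finset ℕ) (l' : ℕ), N₀ ≤ N →
      (N : ℝ) ^ (1 / 25 : ℝ) ≤ P → P ≤ (N : ℝ) ^ (1 / 2 : ℝ) → (∀ l ∈ L, P < l ∧ (l : ℝ) ≤ 2 * P) → P < l' →
      (∀ l ∈ L, (l' : ℝ) + P * (N : ℝ) ^ (-(2.2 * σ)) < l) →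
      (N : ℝ) ^ (-c + 16 * σ) ≤ γ → γ ≤ (N : ℝ) ^ (1.5 * σ) →
      ∑ l ∈ L, ‖∑ m ∈ Ioc (N / l') (2 * N / l), e (γ * ph c k₀ (l * m) - γ * ph c k₀ (l' * m))‖ ≤
        C * (N : ℝ) ^ (1 - 2.1 * σ) := by
  have hD : 354 ≤ 24 * c ^ 2 + 36 * c + 30 := by nlinarith
  have hσ' : σ * 354 ≤ 1.03 := (mul_le_mul_of_nonneg_left hD hσ.le).trans hσD
  obtain ⟨C, hC, X₀, hX₀, H⟩ := phase_family_bound (k₀ := k₀) hci hc hc3 hσ hσD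
  obtain ⟨X₁, hX₁, H₁⟩ := eventually_le_rpow (2 ^ c) (s := 0.1 * σ) (by positivity)
  obtain ⟨X₂, hX₂, H₂⟩ := eventually_le_rpow 4 (s := 1 / 2 - 2.2 * σ) (by linarith)
  refine ⟨C, hC, max X₀ (max X₁ (max X₂ 4)), le_max_of_le_left hX₀, fun N γ P L l' hN hP1 hP2 hL hl' hfar hγ1 hγ2 => ?_⟩
  simp only [max_le_iff] at hN
  obtain ⟨hN1, hN2, hN3, hN4⟩ := hN
  have hN0 : (0 : ℝ) < N := by linarith
  have hP0 : 0 < P := lt_of_lt_of_le (Real.rpow_pos_of_pos hN0 _) hP1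
  have hP11 : 1 ≤ P := (Real.one_le_rpow (by linarith) (by norm_num)).trans hP1
  have hγ0 : 0 < γ := lt_of_lt_of_le (Real.rpow_pos_of_pos hN0 _) hγ1
  obtain ⟨ν, hν⟩ := exists_rpow_eq (X := N) (y := N / P) (by linarith) (by positivity)
  have hνP : (N : ℝ) ^ (1 - ν) = P := by
    rw [Real.rpow_sub hN0, Real.rpow_one, hν]; field_simp
  have hNP : (N : ℝ) ^ (1 / 2 : ℝ) ≤ N / P := by
    rw [le_div_iff₀ hP0]
    calc _ ≤ (N : ℝ) ^ (1 / 2 : ℝ) * (N : ℝ) ^ (1 / 2 : ℝ) := by gcongr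
      _ = N := by rw [← Real.rpow_add hN0]; norm_num
  have hν1 : 1 / 2 ≤ ν := by
    rw [← hν] at hNP; exact (Real.rpow_le_rpow_left_iff (by linarith)).1 hNP
  have hν2 : ν ≤ 24 / 25 := by
    rw [← hνP] at hP1
    have := (Real.rpow_le_rpow_left_iff (by linarith)).1 hP1
    linarith
  have h2c : (1 : ℝ) ≤ 2 ^ c := Real.one_le_rpow (by norm_num) (by linarith)
  have h2N := H₁ N hN2
  obtain ⟨t, ht⟩ := exists_rpow_eq (X := N) (y := γ * 2 ^ c * (N : ℝ) ^ c) (by linarith) (by positivity)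
  have ht1 : 16 * σ ≤ t := by
    rw [← Real.rpow_le_rpow_left_iff (x := (N : ℝ)) (by linarith), ht]
    calc _ = (N : ℝ) ^ (-c + 16 * σ) * (N : ℝ) ^ c := by rw [← Real.rpow_add hN0]; congr 1; ring
      _ ≤ γ * (N : ℝ) ^ c := by gcongr
      _ ≤ _ := by gcongr; exact le_mul_of_one_le_right hγ0.le h2c
  have ht2 : t ≤ c + 1.6 * σ := by
    rw [← Real.rpow_le_rpow_left_iff (x := (N : ℝ)) (by linarith), ht]
    calc _ ≤ (N : ℝ) ^ (1.5 * σ) * (N : ℝ) ^ (0.1 * σ) * (N : ℝ) ^ c := by gcongr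
      _ = _ := by rw [← Real.rpow_add hN0, ← Real.rpow_add hN0]; congr 1; ring
  have hl'0 : (0 : ℝ) < l' := by linarith
  have hPc : P ^ (c - 1) * P = P ^ c := by rw [← Real.rpow_add_one hP0.ne']; congr 1; ring
  have hPMc : P ^ c * (N / P) ^ c = (N : ℝ) ^ c := by
    rw [← Real.mul_rpow hP0.le (by positivity)]; congr 1; field_simp
  have hnm : (N : ℝ) ^ (t - 0.1 * σ) ≤ γ * (N : ℝ) ^ c := by
    rw [Real.rpow_sub hN0, ht, div_le_iff₀ (Real.rpow_pos_of_pos hN0 _)]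
    calc _ = γ * (N : ℝ) ^ c * 2 ^ c := by ring
      _ ≤ _ := by gcongr
  have hdiff : ∀ x y : ℝ, P < x → x ≤ y → P ^ (c - 1) * (y - x) ≤ y ^ c - x ^ c := fun x y hx hxy => by
    refine le_trans ?_ (rpow_sub_one_mul_sub_le (by linarith) (by linarith) hxy)
    exact mul_le_mul_of_nonneg_right (Real.rpow_le_rpow hP0.le (by linarith) (by linarith)) (by linarith)
  have hM0 : 0 < (N / P) ^ c := Real.rpow_pos_of_pos (by positivity) _
  have hN22 := Real.rpow_pos_of_pos hN0 (-(2.2 * σ))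
  have hll : ∀ l ∈ L, (l' : ℝ) ≤ l := fun l hl => by
    have := hfar l hl
    have := mul_pos hP0 hN22
    linarith
  have hF : PhaseFamily c k₀ σ N ν t L (fun _ => N / l') (fun l => 2 * N / l)
      (fun l => γ * ((l : ℝ) ^ c - (l' : ℝ) ^ c)) (fun l => γ * ((l : ℝ) ^ k₀ - (l' : ℝ) ^ k₀)) := by
    refine ⟨?_, ?_, ?_, ?_, ?_, ?_, ?_, ?_⟩
    · rw [hνP]; exact card_le_of_subset_dyadic hP0.le hL
    · intro l hl
      exact mul_nonneg hγ0.le (sub_nonneg.2 (pow_le_pow_left₀ hl'0.le (hll l hl) _))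
    · intro l hl
      exact mul_le_mul_of_nonneg_left (pow_sub_pow_le_rpow_sub_rpow hc (by linarith) (hll l hl)) hγ0.le
    · intro l hl
      rw [hν, ht]
      calc _ ≤ γ * (2 * P) ^ c * (N / P) ^ c := by
            gcongr
            have h1 : (l : ℝ) ^ c ≤ (2 * P) ^ c := Real.rpow_le_rpow (by positivity) (hL l hl).2 (by linarith)
            have := Real.rpow_pos_of_pos hl'0 c
            linarith
        _ = γ * 2 ^ c * (P ^ c * (N / P) ^ c) := by rw [Real.mul_rpow (by norm_num) hP0.le]; ring
        _ = _ := by rw [hPMc]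
    · intro l hl
      rw [hν]
      calc (N : ℝ) ^ (t - 2.3 * σ) = (N : ℝ) ^ (t - 0.1 * σ) * (N : ℝ) ^ (-(2.2 * σ)) := by
            rw [← Real.rpow_add hN0]; congr 1; ring
        _ ≤ γ * (N : ℝ) ^ c * (N : ℝ) ^ (-(2.2 * σ)) := by gcongr
        _ = γ * (P ^ (c - 1) * (P * (N : ℝ) ^ (-(2.2 * σ)))) * (N / P) ^ c := by
            rw [← hPMc, ← hPc]; ring
        _ ≤ _ := by
            gcongr
            refine le_trans ?_ (hdiff l' l hl' (hll l hl))
            gcongr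
            linarith [hfar l hl]
    · intro l hl
      rw [hν]
      have h1 : (N : ℝ) / l' < (N / l' : ℕ) + 1 := by
        rw [← Nat.floor_div_eq_div (K := ℝ)]; exact Nat.lt_floor_add_one _
      have h2 := hfar l hl
      have h3 := (hL l hl).2
      have h4 : (N : ℝ) / P / 2 + 1 ≤ N / l' := by
        rw [le_div_iff₀ hl'0]
        have h5 : (l' : ℝ) ≤ 2 * P - P * (N : ℝ) ^ (-(2.2 * σ)) := by linarith
        have h6 : (l' : ℝ) ≤ 2 * P := by have := mul_pos hP0 hN22; linarith
        have h7 : N / P / 2 * (l' : ℝ) ≤ N / P / 2 * (2 * P - P * (N : ℝ) ^ (-(2.2 * σ))) := by gcongr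
        have h8 : N / P / 2 * (2 * P - P * (N : ℝ) ^ (-(2.2 * σ))) = N - N * (N : ℝ) ^ (-(2.2 * σ)) / 2 := by
          field_simp
        have h9 : 4 * P ≤ N * (N : ℝ) ^ (-(2.2 * σ)) := by
          calc 4 * P ≤ (N : ℝ) ^ (1 / 2 - 2.2 * σ) * (N : ℝ) ^ (1 / 2 : ℝ) := by
                gcongr; exact H₂ N hN3
            _ = (N : ℝ) ^ (1 : ℝ) * (N : ℝ) ^ (-(2.2 * σ)) := by
                rw [← Real.rpow_add hN0, ← Real.rpow_add hN0]; congr 1; ring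
            _ = _ := by rw [Real.rpow_one]
        linarith
      linarith
    · intro l hl
      rw [hν]
      have hl0 : (0 : ℝ) < l := by linarith [(hL l hl).1]
      calc ((2 * N / l : ℕ) : ℝ) ≤ ((2 * N : ℕ) : ℝ) / l := Nat.cast_div_le
        _ = 2 * N / l := by push_cast; ring
        _ ≤ 2 * N / P := by gcongr; exact (hL l hl).1.le
        _ = _ := by ring
    · have key : ∀ x y : ℝ, P < x → x ≤ y →
          (N : ℝ) ^ (t - (1 - ν) - 0.1 * σ) * (y - x) ≤ γ * (y ^ c - x ^ c) * (N / P) ^ c := fun x y hx hxy => by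
        have h1 : (N : ℝ) ^ (t - (1 - ν) - 0.1 * σ) = (N : ℝ) ^ (t - 0.1 * σ) / P := by
          rw [show t - (1 - ν) - 0.1 * σ = (t - 0.1 * σ) - (1 - ν) by ring, Real.rpow_sub hN0, hνP]
        rw [h1]
        calc _ ≤ γ * (N : ℝ) ^ c / P * (y - x) := by gcongr
          _ = γ * (P ^ (c - 1) * (y - x)) * (N / P) ^ c := by
            rw [← hPMc, ← hPc]; field_simp
          _ ≤ _ := by gcongr; exact hdiff x y hx hxy
      intro l hl l'' hl''
      rw [hν]
      have h1 : γ * ((l : ℝ) ^ c - (l' : ℝ) ^ c) * (N / P) ^ c - γ * ((l'' : ℝ) ^ c - (l' : ℝ) ^ c) * (N / P) ^ c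
          = γ * ((l : ℝ) ^ c - (l'' : ℝ) ^ c) * (N / P) ^ c := by ring
      rw [h1]
      rcases le_total (l : ℝ) l'' with h | h
      · rw [abs_sub_comm, abs_of_nonneg (sub_nonneg.2 h), abs_mul, abs_mul, abs_sub_comm, ← abs_mul, ← abs_mul]
        exact (key l l'' (hL l hl).1 h).trans (le_abs_self _)
      · rw [abs_of_nonneg (sub_nonneg.2 h)]
        exact (key l'' l (hL l'' hl'').1 h).trans (le_abs_self _)
  have := H N ν t L _ _ _ _ hN1 hν1 hν2 (by
      rw [hν]; refine le_trans ?_ hNP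
      calc (2 : ℝ) = (4 : ℝ) ^ (1 / 2 : ℝ) := by
            rw [show (4 : ℝ) = 2 ^ (2 : ℝ) by norm_num, ← Real.rpow_mul (by norm_num)]; norm_num
        _ ≤ (N : ℝ) ^ (1 / 2 : ℝ) := by gcongr) (by linarith) (by linarith) hF
  convert this using 8 with l _ m _
  rw [ph_mul, ph_mul]; ring

open scoped ComplexConjugate in
lemma sum_norm_sq_sum_ite_le (L R : Finset ℕ) (I : ℕ → Finset ℕ) (hI : ∀ l ∈ L, I l ⊆ R) (α : ℕ → ℂ) {K : ℝ}
    (hα : ∀ l ∈ L, ‖α l‖ ≤ K) (φ : ℕ → ℕ → ℝ) :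
    ∑ m ∈ R, ‖∑ l ∈ L, if m ∈ I l then α l * e (φ l m) else 0‖ ^ 2 ≤
      K ^ 2 * ∑ l ∈ L, ∑ l' ∈ L, ‖∑ m ∈ I l ∩ I l', e (φ l m - φ l' m)‖ := by
  have h1 : ((∑ m ∈ R, ‖∑ l ∈ L, if m ∈ I l then α l * e (φ l m) else 0‖ ^ 2 : ℝ) : ℂ) =
      ∑ l ∈ L, ∑ l' ∈ L, α l * conj (α l') * ∑ m ∈ I l ∩ I l', e (φ l m - φ l' m) := by
    push_cast
    have h2 : ∀ m ∈ R, ((‖∑ l ∈ L, if m ∈ I l then α l * e (φ l m) else 0‖ : ℂ)) ^ 2 =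
        ∑ l ∈ L, ∑ l' ∈ L, if m ∈ I l ∩ I l' then α l * conj (α l') * e (φ l m - φ l' m) else 0 := by
      intro m _
      rw [← Complex.mul_conj', map_sum, Finset.sum_mul_sum]
      refine Finset.sum_congr rfl fun l _ => Finset.sum_congr rfl fun l' _ => ?_
      by_cases h : m ∈ I l <;> by_cases h' : m ∈ I l' <;> simp only [h, h', if_true, if_false, mem_inter, and_true,
        and_false, zero_mul, mul_zero, map_zero]
      rw [sub_eq_add_neg, e_add, e_neg, map_mul]; ring
    rw [Finset.sum_congr rfl h2, Finset.sum_comm]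
    refine Finset.sum_congr rfl fun l hl => ?_
    rw [Finset.sum_comm]
    refine Finset.sum_congr rfl fun l' _ => ?_
    rw [← Finset.sum_filter, Finset.mul_sum]
    refine Finset.sum_congr ?_ fun _ _ => rfl
    ext m
    simp only [mem_filter, mem_inter, and_iff_right_iff_imp, and_imp]
    exact fun h _ => hI l hl h
  have h3 : ∑ m ∈ R, ‖∑ l ∈ L, if m ∈ I l then α l * e (φ l m) else 0‖ ^ 2 =
      ‖∑ l ∈ L, ∑ l' ∈ L, α l * conj (α l') * ∑ m ∈ I l ∩ I l', e (φ l m - φ l' m)‖ := by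
    rw [← h1, Complex.norm_real, Real.norm_of_nonneg (Finset.sum_nonneg fun _ _ => by positivity)]
  rw [h3, Finset.mul_sum]
  refine (norm_sum_le _ _).trans (Finset.sum_le_sum fun l hl => ?_)
  rw [Finset.mul_sum]
  refine (norm_sum_le _ _).trans (Finset.sum_le_sum fun l' hl' => ?_)
  have hK : 0 ≤ K := (norm_nonneg _).trans (hα l hl)
  rw [norm_mul, norm_mul, RCLike.norm_conj, sq]
  gcongr
  · exact hα l hl
  · exact hα l' hl'

lemma norm_sq_sum_bilinear_le (L R : Finset ℕ) (I : ℕ → Finset ℕ) (hI : ∀ l ∈ L, I l ⊆ R) (α β : ℕ → ℂ) {K : ℝ}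
    (hα : ∀ l ∈ L, ‖α l‖ ≤ K) (hβ : ∀ m ∈ R, ‖β m‖ ≤ K) (φ : ℕ → ℕ → ℝ) :
    ‖∑ l ∈ L, α l * ∑ m ∈ I l, β m * e (φ l m)‖ ^ 2 ≤
      K ^ 4 * #R * ∑ l ∈ L, ∑ l' ∈ L, ‖∑ m ∈ I l ∩ I l', e (φ l m - φ l' m)‖ := by
  have h1 : ∑ l ∈ L, α l * ∑ m ∈ I l, β m * e (φ l m) =
      ∑ m ∈ R, β m * ∑ l ∈ L, if m ∈ I l then α l * e (φ l m) else 0 := by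
    simp only [Finset.mul_sum]
    rw [Finset.sum_comm' (t' := R) (s' := fun m => L.filter fun l => m ∈ I l)]
    · refine Finset.sum_congr rfl fun m _ => ?_
      rw [Finset.sum_filter]
      refine Finset.sum_congr rfl fun l _ => ?_
      split_ifs <;> ring
    · intro l m
      simp only [mem_filter]
      exact ⟨fun h => ⟨h, hI l h.1 h.2⟩, fun h => h.1⟩
  have h2 : ‖∑ l ∈ L, α l * ∑ m ∈ I l, β m * e (φ l m)‖ ≤
      K * ∑ m ∈ R, ‖∑ l ∈ L, if m ∈ I l then α l * e (φ l m) else 0‖ := by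
    rw [h1, Finset.mul_sum]
    refine (norm_sum_le _ _).trans (Finset.sum_le_sum fun m hm => ?_)
    rw [norm_mul]
    exact mul_le_mul_of_nonneg_right (hβ m hm) (norm_nonneg _)
  have h3 := sum_norm_sq_sum_ite_le L R I hI α hα φ
  calc _ ≤ (K * ∑ m ∈ R, ‖∑ l ∈ L, if m ∈ I l then α l * e (φ l m) else 0‖) ^ 2 := by gcongr
    _ = K ^ 2 * (∑ m ∈ R, ‖∑ l ∈ L, if m ∈ I l then α l * e (φ l m) else 0‖) ^ 2 := mul_pow _ _ _
    _ ≤ K ^ 2 * (#R * ∑ m ∈ R, ‖∑ l ∈ L, if m ∈ I l then α l * e (φ l m) else 0‖ ^ 2) := by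
        gcongr; exact sq_sum_le_card_mul_sum_sq
    _ ≤ K ^ 2 * (#R * (K ^ 2 * ∑ l ∈ L, ∑ l' ∈ L, ‖∑ m ∈ I l ∩ I l', e (φ l m - φ l' m)‖)) := by gcongr
    _ = _ := by ring

lemma card_abs_sub_le (L : Finset ℕ) (l : ℕ) {Δ : ℝ} (hΔ : 1 ≤ Δ) :
    (#(L.filter fun l' : ℕ => |(l : ℝ) - l'| ≤ Δ) : ℝ) ≤ 3 * Δ := by
  have h1 : (L.filter (fun l' : ℕ => |(l : ℝ) - l'| ≤ Δ) : Finset ℕ) ⊆ Icc (l - ⌊Δ⌋₊) (l + ⌊Δ⌋₊) := fun l' hl' => by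
    have h := abs_le.1 (mem_filter.1 hl').2
    rw [mem_Icc]
    constructor
    · have : (l - l' : ℕ) ≤ ⌊Δ⌋₊ := by
        rcases le_total l' l with h' | h'
        · exact Nat.le_floor (by rw [Nat.cast_sub h']; exact h.2)
        · rw [Nat.sub_eq_zero_of_le h']; exact Nat.zero_le _
      omega
    · have : (l' - l : ℕ) ≤ ⌊Δ⌋₊ := by
        rcases le_total l l' with h' | h'
        · exact Nat.le_floor (by rw [Nat.cast_sub h']; linarith)
        · rw [Nat.sub_eq_zero_of_le h']; exact Nat.zero_le _
      omega
  have h2 := card_le_card h1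
  rw [Nat.card_Icc] at h2
  have h3 : (#(L.filter fun l' : ℕ => |(l : ℝ) - l'| ≤ Δ) : ℝ) ≤ ((2 * ⌊Δ⌋₊ + 1 : ℕ) : ℝ) := by
    exact_mod_cast h2.trans (by omega)
  have := Nat.floor_le (by linarith : 0 ≤ Δ)
  push_cast at h3
  linarith

lemma sum_symm_le {L : Finset ℕ} {W : ℕ → ℕ → ℝ} (hW : ∀ l l', W l l' = W l' l) {R Δ F : ℝ} (hΔ : 1 ≤ Δ)
    (hR : 0 ≤ R) (h0 : ∀ l l', 0 ≤ W l l')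
    (hnear : ∀ l ∈ L, ∀ l' ∈ L, W l l' ≤ R) (hfar : ∀ l' ∈ L, ∑ l ∈ L.filter (fun l : ℕ => (l' : ℝ) + Δ < l), W l l' ≤ F) :
    ∑ l ∈ L, ∑ l' ∈ L, W l l' ≤ #L * (3 * Δ * R + 2 * F) := by
  have h1 : ∀ l ∈ L, ∀ l' ∈ L, W l l' ≤ (if |(l : ℝ) - l'| ≤ Δ then R else 0) +
      ((if (l' : ℝ) + Δ < l then W l l' else 0) + (if (l : ℝ) + Δ < l' then W l' l else 0)) := by
    intro l hl l' hl'
    by_cases h : |(l : ℝ) - l'| ≤ Δ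
    · rw [if_pos h]
      have h3 := hnear l hl l' hl'
      have := h0 l l'
      have := h0 l' l
      split_ifs <;> linarith
    · rw [if_neg h, zero_add]
      rcases lt_abs.1 (not_le.1 h) with h3 | h3
      · rw [if_pos (by linarith), if_neg (by linarith), add_zero]
      · rw [if_neg (by linarith), if_pos (by linarith), zero_add, hW]
  have h2 : ∑ l ∈ L, ∑ l' ∈ L, (if |(l : ℝ) - l'| ≤ Δ then R else 0) ≤ #L * (3 * Δ * R) := by
    rw [← nsmul_eq_mul]
    refine Finset.sum_le_card_nsmul _ _ _ fun l _ => ?_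
    rw [← Finset.sum_filter, Finset.sum_const, nsmul_eq_mul]
    exact mul_le_mul_of_nonneg_right (card_abs_sub_le L l hΔ) hR
  have h3 : ∑ l' ∈ L, ∑ l ∈ L, (if (l' : ℝ) + Δ < l then W l l' else 0) ≤ #L * F := by
    rw [← nsmul_eq_mul]
    refine Finset.sum_le_card_nsmul _ _ _ fun l' hl' => ?_
    rw [← Finset.sum_filter]
    exact hfar l' hl'
  refine (Finset.sum_le_sum fun l hl => Finset.sum_le_sum fun l' hl' => h1 l hl l' hl').trans ?_
  simp only [Finset.sum_add_distrib]
  rw [Finset.sum_comm (f := fun l l' : ℕ => if (l' : ℝ) + Δ < l then W l l' else 0)]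
  linarith

lemma norm_sum_e_sub_symm (S : Finset ℕ) (f g : ℕ → ℝ) : ‖∑ m ∈ S, e (f m - g m)‖ = ‖∑ m ∈ S, e (g m - f m)‖ := by
  rw [← RCLike.norm_conj, map_sum]
  congr 1
  refine Finset.sum_congr rfl fun m _ => ?_
  rw [← e_neg, neg_sub]

set_option maxHeartbeats 1000000 in
lemma norm_sum_bilinear_le {c : ℝ} {k₀ : ℕ} (hci : ∀ z : ℤ, (z : ℝ) ≠ c) (hc : (k₀ : ℝ) < c) (hc3 : 3 < c) {σ : ℝ}
    (hσ : 0 < σ) (hσD : σ * (24 * c ^ 2 + 36 * c + 30) ≤ 1.03) :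
    ∃ C : ℝ, 1 ≤ C ∧ ∃ N₀ : ℝ, 1 ≤ N₀ ∧ ∀ (N : ℕ) (γ P K : ℝ) (L : Finset ℕ) (α β : ℕ → ℂ), N₀ ≤ N →
      (N : ℝ) ^ (1 / 25 : ℝ) ≤ P → P ≤ (N : ℝ) ^ (1 / 2 : ℝ) → (∀ l ∈ L, P < l ∧ (l : ℝ) ≤ 2 * P) → 0 ≤ K →
      (∀ l ∈ L, ‖α l‖ ≤ K) → (∀ m, m ≤ 2 * N → ‖β m‖ ≤ K) →
      (N : ℝ) ^ (-c + 16 * σ) ≤ γ → γ ≤ (N : ℝ) ^ (1.5 * σ) →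
      ‖∑ l ∈ L, α l * ∑ m ∈ Ioc (N / l) (2 * N / l), β m * e (γ * ph c k₀ (l * m))‖ ≤
        C * (K ^ 2 * (N : ℝ) ^ (1 - 1.05 * σ)) := by
  have hD : 354 ≤ 24 * c ^ 2 + 36 * c + 30 := by nlinarith
  have hσ' : σ * 354 ≤ 1.03 := (mul_le_mul_of_nonneg_left hD hσ.le).trans hσD
  obtain ⟨C, hC, X₀, hX₀, H⟩ := sum_far_le (k₀ := k₀) hci hc hc3 hσ hσD
  refine ⟨24 + 8 * C, by linarith, X₀, hX₀, fun N γ P K L α β hN hP1 hP2 hL hK hα hβ hγ1 hγ2 => ?_⟩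
  have hN1 : (1 : ℝ) ≤ N := hX₀.trans hN
  have hN0 : (0 : ℝ) < N := by linarith
  have hP0 : 0 < P := lt_of_lt_of_le (Real.rpow_pos_of_pos hN0 _) hP1
  have hP11 : 1 ≤ P := (Real.one_le_rpow (by linarith) (by norm_num)).trans hP1
  have hl0 : ∀ l ∈ L, (0 : ℝ) < l := fun l hl => by linarith [(hL l hl).1]
  obtain ⟨R, hR⟩ : ∃ R : ℕ, R = ⌊2 * N / P⌋₊ := ⟨_, rfl⟩
  have hR1 : (R : ℝ) ≤ 2 * N / P := by rw [hR]; exact Nat.floor_le (by positivity)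
  have hR2 : R ≤ 2 * N := by
    have : 2 * N / P ≤ 2 * (N : ℝ) := div_le_self (by positivity) hP11
    exact_mod_cast hR1.trans this
  have hI : ∀ l ∈ L, Ioc (N / l) (2 * N / l) ⊆ Ioc 0 R := fun l hl m hm => by
    rw [mem_Ioc] at hm ⊢
    refine ⟨(Nat.zero_le _).trans_lt hm.1, ?_⟩
    rw [hR]
    refine Nat.le_floor ?_
    calc (m : ℝ) ≤ ((2 * N / l : ℕ) : ℝ) := by exact_mod_cast hm.2
      _ ≤ ((2 * N : ℕ) : ℝ) / l := Nat.cast_div_le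
      _ = 2 * N / l := by push_cast; ring
      _ ≤ 2 * N / P := by have := (hL l hl).1.le; gcongr
  have h1 := norm_sq_sum_bilinear_le L (Ioc 0 R) _ hI α β hα
    (fun m hm => hβ m ((mem_Ioc.1 hm).2.trans hR2)) (fun l m => γ * ph c k₀ (l * m))
  have hΔ : 1 ≤ P * (N : ℝ) ^ (-(2.2 * σ)) := by
    calc (1 : ℝ) ≤ (N : ℝ) ^ (1 / 25 - 2.2 * σ) := Real.one_le_rpow hN1 (by linarith)
      _ = (N : ℝ) ^ (1 / 25 : ℝ) * (N : ℝ) ^ (-(2.2 * σ)) := by rw [← Real.rpow_add hN0]; congr 1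
      _ ≤ _ := by gcongr
  have h2 := sum_symm_le (L := L)
    (W := fun l l' => ‖∑ m ∈ Ioc (N / l) (2 * N / l) ∩ Ioc (N / l') (2 * N / l'), e (γ * ph c k₀ (l * m) - γ * ph c k₀ (l' * m))‖)
    (R := R) (F := C * (N : ℝ) ^ (1 - 2.1 * σ)) (fun l l' => by
      rw [inter_comm, norm_sum_e_sub_symm]) hΔ (Nat.cast_nonneg _) (fun _ _ => norm_nonneg _)
    (fun l hl l' hl' => by
      refine (norm_sum_le _ _).trans ?_
      simp only [norm_e, sum_const, nsmul_eq_mul, mul_one]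
      have := card_le_card (inter_subset_left.trans (hI l hl) : Ioc (N / l) (2 * N / l) ∩ Ioc (N / l') (2 * N / l') ⊆ _)
      rw [Nat.card_Ioc, Nat.sub_zero] at this
      exact_mod_cast this)
    (fun l' hl' => by
      have := H N γ P {l ∈ L | (l' : ℝ) + P * (N : ℝ) ^ (-(2.2 * σ)) < l} l' hN hP1 hP2
        (fun l hl => hL l (mem_filter.1 hl).1) (hL l' hl').1 (fun l hl => (mem_filter.1 hl).2) hγ1 hγ2
      refine le_trans (le_of_eq (Finset.sum_congr rfl fun l hl => ?_)) this
      rw [mem_filter] at hl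
      have hll : l' ≤ l := by
        have : (l' : ℝ) ≤ l := by linarith
        exact_mod_cast this
      have hl'1 : 0 < l' := by exact_mod_cast hl0 l' hl'
      rw [Ioc_inter_Ioc, sup_eq_right.2 (Nat.div_le_div_left hll hl'1),
        inf_eq_left.2 (Nat.div_le_div_left hll hl'1)])
  rw [Nat.card_Ioc, Nat.sub_zero] at h1
  have hcard := card_le_of_subset_dyadic hP0.le hL
  have hp := Real.rpow_pos_of_pos hN0 (1 - 2.1 * σ)
  have hΔ0 := Real.rpow_pos_of_pos hN0 (-(2.2 * σ))
  have h3 : 3 * (P * (N : ℝ) ^ (-(2.2 * σ))) * R + 2 * (C * (N : ℝ) ^ (1 - 2.1 * σ)) ≤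
      (6 + 2 * C) * (N : ℝ) ^ (1 - 2.1 * σ) := by
    have h4 : P * (N : ℝ) ^ (-(2.2 * σ)) * R ≤ 2 * (N : ℝ) ^ (1 - 2.1 * σ) := by
      calc P * (N : ℝ) ^ (-(2.2 * σ)) * R ≤ P * (N : ℝ) ^ (-(2.2 * σ)) * (2 * N / P) := by gcongr
        _ = 2 * ((N : ℝ) ^ (-(2.2 * σ)) * (N : ℝ) ^ (1 : ℝ)) := by rw [Real.rpow_one]; field_simp
        _ ≤ _ := by
          rw [← Real.rpow_add hN0]
          exact mul_le_mul_of_nonneg_left (Real.rpow_le_rpow_of_exponent_le hN1 (by linarith)) (by norm_num)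
    linarith
  have h5 : ‖∑ l ∈ L, α l * ∑ m ∈ Ioc (N / l) (2 * N / l), β m * e (γ * ph c k₀ (l * m))‖ ^ 2 ≤
      ((24 + 8 * C) * (K ^ 2 * (N : ℝ) ^ (1 - 1.05 * σ))) ^ 2 := by
    calc _ ≤ K ^ 4 * R * (#L * (3 * (P * (N : ℝ) ^ (-(2.2 * σ))) * R + 2 * (C * (N : ℝ) ^ (1 - 2.1 * σ)))) :=
          h1.trans (mul_le_mul_of_nonneg_left h2 (by positivity))
      _ ≤ K ^ 4 * (2 * N / P) * (2 * P * ((6 + 2 * C) * (N : ℝ) ^ (1 - 2.1 * σ))) := by gcongr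
      _ = (24 + 8 * C) * (K ^ 4 * ((N : ℝ) ^ (1 : ℝ) * (N : ℝ) ^ (1 - 2.1 * σ))) := by
          rw [Real.rpow_one]; field_simp; ring
      _ = (24 + 8 * C) * (K ^ 2 * (N : ℝ) ^ (1 - 1.05 * σ)) ^ 2 := by
          rw [← Real.rpow_add hN0, mul_pow, ← pow_mul, ← Real.rpow_natCast ((N : ℝ) ^ _) 2, ← Real.rpow_mul hN0.le]
          congr 3
          push_cast; ring
      _ ≤ (24 + 8 * C) ^ 2 * (K ^ 2 * (N : ℝ) ^ (1 - 1.05 * σ)) ^ 2 := by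
          gcongr
          have : 1 ≤ 24 + 8 * C := by linarith
          calc (24 + 8 * C) = (24 + 8 * C) * 1 := (mul_one _).symm
            _ ≤ (24 + 8 * C) * (24 + 8 * C) := by gcongr
            _ = _ := (sq _).symm
      _ = _ := by ring
  exact le_of_sq_le_sq h5 (by have := Real.rpow_pos_of_pos hN0 (1 - 1.05 * σ); positivity)

section Vaughan
open ArithmeticFunction hiding log
open scoped ArithmeticFunction.Moebius ArithmeticFunction.zeta

/-- The restriction of an arithmetic function to `n ≤ U`. -/
def low (U : ℕ) (F : ArithmeticFunction ℝ) : ArithmeticFunction ℝ :=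
  ⟨fun n => if n ≤ U then F n else 0, by simp⟩

lemma low_apply (U : ℕ) (F : ArithmeticFunction ℝ) (n : ℕ) : low U F n = if n ≤ U then F n else 0 := rfl

lemma abs_low_le {U : ℕ} {F : ArithmeticFunction ℝ} {n : ℕ} : |low U F n| ≤ |F n| := by
  rw [low_apply]; split_ifs <;> simp

lemma sub_apply' (F G : ArithmeticFunction ℝ) (n : ℕ) : (F - G) n = F n - G n := by
  rw [sub_eq_add_neg, ArithmeticFunction.add_apply, ArithmeticFunction.neg_apply, ← sub_eq_add_neg]

lemma abs_sub_low_le {U : ℕ} {F : ArithmeticFunction ℝ} {n : ℕ} : |(F - low U F) n| ≤ |F n| := by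
  rw [sub_apply', low_apply]; split_ifs <;> simp

lemma sub_low_apply_eq_zero {U : ℕ} {F : ArithmeticFunction ℝ} {n : ℕ} (h : n ≤ U) : (F - low U F) n = 0 := by
  rw [sub_apply', low_apply, if_pos h, sub_self]

lemma abs_mul_apply_le_log {F G : ArithmeticFunction ℝ} (hF : ∀ n, |F n| ≤ 1) (hG : ∀ n, |G n| ≤ Λ n) (n : ℕ) :
    |(F * G) n| ≤ Real.log n := by
  rw [ArithmeticFunction.mul_apply, ← vonMangoldt_sum, ← Nat.sum_divisorsAntidiagonal' (fun _ i => Λ i)]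
  refine (Finset.abs_sum_le_sum_abs _ _).trans (Finset.sum_le_sum fun x _ => ?_)
  rw [abs_mul]
  calc _ ≤ 1 * Λ x.2 := mul_le_mul (hF _) (hG _) (abs_nonneg _) zero_le_one
    _ = _ := one_mul _

lemma abs_zeta_le (n : ℕ) : |(ζ : ArithmeticFunction ℝ) n| ≤ 1 := by
  rw [natCoe_apply, zeta_apply]; split_ifs <;> simp

lemma abs_moebius_real_le (n : ℕ) : |(μ : ArithmeticFunction ℝ) n| ≤ 1 := by
  rw [intCoe_apply]; exact_mod_cast abs_moebius_le_one (n := n)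

lemma vaughan_identity (U Z : ℕ) :
    (Λ : ArithmeticFunction ℝ) = low U Λ + low U μ * ArithmeticFunction.log - low U μ * low U Λ * ζ +
      (low Z (μ - low U μ) * (ζ * (Λ - low U Λ)) +
        ζ * (Λ - low U Λ) * ((μ - low U μ : ArithmeticFunction ℝ) - low Z (μ - low U μ))) := by
  have h1 : (μ : ArithmeticFunction ℝ) * ζ = 1 := coe_moebius_mul_coe_zeta
  have h2 : Λ * (ζ : ArithmeticFunction ℝ) = ArithmeticFunction.log := vonMangoldt_mul_zeta
  rw [← h2]
  linear_combination (-(Λ : ArithmeticFunction ℝ) + low U Λ) * h1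

lemma sum_Ioc_mul_eq (F G : ArithmeticFunction ℝ) (w : ℕ → ℂ) (N M : ℕ) :
    ∑ n ∈ Ioc N M, ((F * G) n : ℂ) * w n =
      ∑ d ∈ Ioc 0 M, (F d : ℂ) * ∑ m ∈ Ioc (N / d) (M / d), (G m : ℂ) * w (d * m) := by
  simp only [ArithmeticFunction.mul_apply, Complex.ofReal_sum, Finset.sum_mul, Finset.mul_sum, Complex.ofReal_mul]
  rw [Finset.sum_sigma', Finset.sum_sigma']
  refine Finset.sum_bij' (fun x _ => ⟨x.2.1, x.2.2⟩) (fun x _ => ⟨x.1 * x.2, (x.1, x.2)⟩) ?_ ?_ ?_ ?_ ?_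
  · rintro ⟨n, a, b⟩ h
    simp only [mem_sigma, mem_Ioc, Nat.mem_divisorsAntidiagonal] at h ⊢
    obtain ⟨⟨h1, h2⟩, rfl, h4⟩ := h
    have ha : 0 < a := Nat.pos_of_ne_zero (left_ne_zero_of_mul h4)
    have hb : 0 < b := Nat.pos_of_ne_zero (right_ne_zero_of_mul h4)
    refine ⟨⟨ha, le_trans (Nat.le_mul_of_pos_right a hb) h2⟩, ?_, ?_⟩
    · rw [Nat.div_lt_iff_lt_mul ha]; rwa [mul_comm] at h1
    · rw [Nat.le_div_iff_mul_le ha]; rwa [mul_comm] at h2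
  · rintro ⟨a, b⟩ h
    simp only [mem_sigma, mem_Ioc, Nat.mem_divisorsAntidiagonal] at h ⊢
    obtain ⟨⟨h1, h2⟩, h3, h4⟩ := h
    rw [Nat.div_lt_iff_lt_mul h1] at h3
    rw [Nat.le_div_iff_mul_le h1] at h4
    refine ⟨⟨by rwa [mul_comm], by rwa [mul_comm]⟩, trivial, ?_⟩
    rw [mul_comm]; omega
  · rintro ⟨n, a, b⟩ h
    simp only [mem_sigma, Nat.mem_divisorsAntidiagonal] at h
    obtain ⟨_, rfl, _⟩ := h
    rfl
  · rintro ⟨a, b⟩ _; rfl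
  · rintro ⟨n, a, b⟩ h
    simp only [mem_sigma, Nat.mem_divisorsAntidiagonal] at h
    obtain ⟨_, rfl, _⟩ := h
    simp only
    ring

lemma sum_inv_Ioc_le (n : ℕ) : ∑ d ∈ Ioc 0 n, (1 : ℝ) / d ≤ 1 + Real.log n := by
  have h := harmonic_le_one_add_log n
  rw [harmonic_eq_sum_Icc] at h
  push_cast at h
  rw [← Finset.Icc_succ_left_eq_Ioc]
  simpa [one_div] using h

lemma norm_sum_typeI_le {F : ℕ → ℂ} {T : ℕ → ℂ} {K B : ℝ} (hK : 0 ≤ K) (hB : 0 ≤ B) {M : ℕ}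
    (hF : ∀ d ∈ Ioc 0 M, ‖F d‖ ≤ K) (hT : ∀ d ∈ Ioc 0 M, F d ≠ 0 → ‖T d‖ ≤ B / d) :
    ‖∑ d ∈ Ioc 0 M, F d * T d‖ ≤ K * B * (1 + Real.log M) := by
  calc _ ≤ ∑ d ∈ Ioc 0 M, K * B * (1 / d) := by
        refine (norm_sum_le _ _).trans (Finset.sum_le_sum fun d hd => ?_)
        rw [norm_mul]
        by_cases h : F d = 0
        · rw [h, norm_zero, zero_mul]; positivity
        · calc _ ≤ K * (B / d) := mul_le_mul (hF d hd) (hT d hd h) (norm_nonneg _) hK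
            _ = _ := by ring
    _ ≤ _ := by
        rw [← Finset.mul_sum]
        exact mul_le_mul_of_nonneg_left (sum_inv_Ioc_le M) (by positivity)

lemma sum_dyadic_le {U Z : ℕ} {T : ℕ → ℂ} {B : ℝ} (hB : 0 ≤ B)
    (hT : ∀ (P : ℝ) (L : Finset ℕ), U / 2 ≤ P → P ≤ Z / 2 → (∀ l ∈ L, U < l ∧ l ≤ Z) →
      (∀ l ∈ L, P < l ∧ (l : ℝ) ≤ 2 * P) → ‖∑ l ∈ L, T l‖ ≤ B) :
    ‖∑ l ∈ Ioc U Z, T l‖ ≤ (Nat.log 2 Z + 1 : ℕ) * B := by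
  have hm : ∀ l ∈ Ioc U Z, Nat.log 2 (Z / l) ∈ range (Nat.log 2 Z + 1) := fun l _ =>
    mem_range.2 (Nat.lt_succ_of_le (Nat.log_mono_right (Nat.div_le_self _ _)))
  rw [← Finset.sum_fiberwise_of_maps_to hm]
  refine (norm_sum_le _ _).trans ?_
  rw [← nsmul_eq_mul]
  refine (Finset.sum_le_card_nsmul _ _ B fun i _ => ?_).trans (by rw [card_range])
  rcases (filter (fun l => Nat.log 2 (Z / l) = i) (Ioc U Z)).eq_empty_or_nonempty with h | ⟨l₀, hl₀⟩
  · rw [h]; simpa using hB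
  have hmem : ∀ l ∈ filter (fun l => Nat.log 2 (Z / l) = i) (Ioc U Z),
      (U < l ∧ l ≤ Z) ∧ (Z : ℝ) / 2 ^ (i + 1) < l ∧ (l : ℝ) ≤ 2 * (Z / 2 ^ (i + 1)) := fun l hl => by
    rw [mem_filter, mem_Ioc] at hl
    obtain ⟨⟨h1, h2⟩, h3⟩ := hl
    have hl0 : 0 < l := by omega
    have h4 : Z / l ≠ 0 := (Nat.div_pos h2 hl0).ne'
    have h5 : 2 ^ i ≤ Z / l := by rw [← h3]; exact Nat.pow_log_le_self 2 h4
    have h6 : Z / l < 2 ^ (i + 1) := by rw [← h3]; exact Nat.lt_pow_succ_log_self (by norm_num) _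
    rw [Nat.le_div_iff_mul_le hl0] at h5
    rw [Nat.div_lt_iff_lt_mul hl0] at h6
    have h7 : (2 : ℝ) ^ i * l ≤ Z := by exact_mod_cast h5
    have h8 : (Z : ℝ) < 2 ^ (i + 1) * l := by exact_mod_cast h6
    refine ⟨⟨h1, h2⟩, ?_, ?_⟩
    · rw [div_lt_iff₀ (by positivity)]; linarith
    · rw [pow_succ, mul_div_assoc', le_div_iff₀ (by positivity)]; linarith
  refine hT (Z / 2 ^ (i + 1)) _ ?_ ?_ (fun l hl => (hmem l hl).1) (fun l hl => (hmem l hl).2)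
  · obtain ⟨h1, h2, h3⟩ := hmem l₀ hl₀
    have : (U : ℝ) < l₀ := by exact_mod_cast h1.1
    linarith
  · gcongr
    exact le_self_pow₀ (by norm_num) (by omega)

end Vaughan

section VaughanSums
open ArithmeticFunction hiding log
open scoped ArithmeticFunction.Moebius ArithmeticFunction.zeta

lemma log_two_mul_ge {N : ℕ} (hN : (2 : ℝ) ≤ N) : 1 ≤ Real.log ((2 * N : ℕ) : ℝ) := by
  rw [Real.le_log_iff_exp_le (by push_cast; linarith)]
  push_cast
  linarith [Real.exp_one_lt_d9]

lemma log_le_log_two_mul {N n : ℕ} (hN : (2 : ℝ) ≤ N) (h : n ≤ 2 * N) : Real.log n ≤ Real.log ((2 * N : ℕ) : ℝ) := by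
  rcases Nat.eq_zero_or_pos n with rfl | hn
  · rw [Nat.cast_zero, Real.log_zero]; linarith [log_two_mul_ge hN]
  · exact Real.log_le_log (by exact_mod_cast hn) (by exact_mod_cast h)

variable {c : ℝ} {k₀ : ℕ} {σ : ℝ}

lemma typeI_le (hci : ∀ z : ℤ, (z : ℝ) ≠ c) (hc : (k₀ : ℝ) < c) (hc3 : 3 < c)
    (hσ : 0 < σ) (hσD : σ * (24 * c ^ 2 + 36 * c + 30) ≤ 1.03) :
    ∃ C : ℝ, 1 ≤ C ∧ ∃ N₀ : ℝ, 1 ≤ N₀ ∧ ∀ (N : ℕ) (γ : ℝ) (F G : ArithmeticFunction ℝ), N₀ ≤ N →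
      (N : ℝ) ^ (-c + 16 * σ) ≤ γ → γ ≤ (N : ℝ) ^ (1.5 * σ) →
      (∀ d ≤ 2 * N, |F d| ≤ Real.log ((2 * N : ℕ) : ℝ)) → (∀ d, F d ≠ 0 → (d : ℝ) ≤ (N : ℝ) ^ (1 / 8 : ℝ)) →
      (G = ζ ∨ G = ArithmeticFunction.log) →
      ‖∑ n ∈ Ioc N (2 * N), ((F * G) n : ℂ) * e (γ * ph c k₀ n)‖ ≤
        C * (Real.log ((2 * N : ℕ) : ℝ) ^ 3 * (N : ℝ) ^ (1 - 1.05 * σ)) := by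
  obtain ⟨C, hC, N₀, hN₀, H⟩ := sum_ph_mul_le (k₀ := k₀) hci hc hc3 hσ hσD
  refine ⟨4 * C, by linarith, max N₀ 2, le_max_of_le_left hN₀, fun N γ F G hN hγ1 hγ2 hF hF' hG => ?_⟩
  have hN2 : (2 : ℝ) ≤ N := (le_max_right _ _).trans hN
  have hN0 : (0 : ℝ) < N := by linarith
  have hl := log_two_mul_ge hN2
  have hp := Real.rpow_pos_of_pos hN0 (-(2.1 * σ))
  rw [sum_Ioc_mul_eq]
  refine (norm_sum_typeI_le (K := Real.log ((2 * N : ℕ) : ℝ)) (B := 2 * Real.log ((2 * N : ℕ) : ℝ) * (C * (N * (N : ℝ) ^ (-(2.1 * σ)))))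
    (by linarith) (by positivity) (fun d hd => ?_) (fun d hd hd0 => ?_)).trans ?_
  · rw [Complex.norm_real]; exact hF d (mem_Ioc.1 hd).2
  · have hd1 : 1 ≤ d := (mem_Ioc.1 hd).1
    have hdF := hF' d (by exact_mod_cast hd0)
    have hS : ∀ n, n ≤ 2 * N / d → ‖∑ m ∈ Ioc (N / d) n, e (γ * ph c k₀ (d * m))‖ ≤
        C * (N / d * (N : ℝ) ^ (-(2.1 * σ))) := fun n hn =>
      H N d n γ ((le_max_left _ _).trans hN) hd1 hdF hn hγ1 hγ2
    have heq : 2 * Real.log ((2 * N : ℕ) : ℝ) * (C * (N * (N : ℝ) ^ (-(2.1 * σ)))) / d =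
        2 * Real.log ((2 * N : ℕ) : ℝ) * (C * (N / d * (N : ℝ) ^ (-(2.1 * σ)))) := by ring
    rw [heq]
    have hB : 0 ≤ C * (N / d * (N : ℝ) ^ (-(2.1 * σ))) := by positivity
    rcases hG with rfl | rfl
    · have h1 : ∑ m ∈ Ioc (N / d) (2 * N / d), (((ζ : ArithmeticFunction ℝ) m : ℝ) : ℂ) * e (γ * ph c k₀ (d * m)) =
          ∑ m ∈ Ioc (N / d) (2 * N / d), e (γ * ph c k₀ (d * m)) := by
        refine Finset.sum_congr rfl fun m hm => ?_
        rw [natCoe_apply, zeta_apply_ne ((Nat.zero_le _).trans_lt (mem_Ioc.1 hm).1).ne']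
        simp
      rw [h1]
      refine (hS _ le_rfl).trans ?_
      exact le_mul_of_one_le_left hB (by linarith)
    · refine (norm_sum_log_mul_le (fun m => e (γ * ph c k₀ (d * m))) (Nat.div_le_div_right (by omega)) hS).trans ?_
      exact mul_le_mul_of_nonneg_right (mul_le_mul_of_nonneg_left
        (log_le_log_two_mul hN2 (Nat.div_le_self _ _)) (by norm_num)) hB
  · have h1 : N * (N : ℝ) ^ (-(2.1 * σ)) ≤ (N : ℝ) ^ (1 - 1.05 * σ) := by
      calc N * (N : ℝ) ^ (-(2.1 * σ)) = (N : ℝ) ^ (1 : ℝ) * (N : ℝ) ^ (-(2.1 * σ)) := by rw [Real.rpow_one]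
        _ ≤ _ := by
          rw [← Real.rpow_add hN0]
          exact Real.rpow_le_rpow_of_exponent_le (by linarith) (by linarith)
    calc _ ≤ Real.log ((2 * N : ℕ) : ℝ) * (2 * Real.log ((2 * N : ℕ) : ℝ) * (C * (N : ℝ) ^ (1 - 1.05 * σ))) *
          (2 * Real.log ((2 * N : ℕ) : ℝ)) := by
            gcongr
            linarith
      _ = _ := by ring

lemma natLog_two_succ_le {N Z : ℕ} (hN : (2 : ℝ) ≤ N) (hZ0 : 0 < Z) (hZ : Z ≤ 2 * N) :
    ((Nat.log 2 Z + 1 : ℕ) : ℝ) ≤ 3 * Real.log ((2 * N : ℕ) : ℝ) := by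
  have hl := log_two_mul_ge hN
  have h1 : (Nat.log 2 Z : ℝ) * Real.log 2 ≤ Real.log Z := by
    rw [← Real.log_pow]
    refine Real.log_le_log (by positivity) ?_
    exact_mod_cast Nat.pow_log_le_self 2 hZ0.ne'
  have h2 := log_le_log_two_mul hN hZ
  have h3 : (Nat.log 2 Z : ℝ) * (1 / 2) ≤ (Nat.log 2 Z : ℝ) * Real.log 2 := by
    gcongr
    linarith [Real.log_two_gt_d9]
  push_cast at *
  linarith

lemma typeII_le (hci : ∀ z : ℤ, (z : ℝ) ≠ c) (hc : (k₀ : ℝ) < c) (hc3 : 3 < c)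
    (hσ : 0 < σ) (hσD : σ * (24 * c ^ 2 + 36 * c + 30) ≤ 1.03) :
    ∃ C : ℝ, 1 ≤ C ∧ ∃ N₀ : ℝ, 1 ≤ N₀ ∧ ∀ (N : ℕ) (γ : ℝ) (F G : ArithmeticFunction ℝ), N₀ ≤ N →
      (N : ℝ) ^ (-c + 16 * σ) ≤ γ → γ ≤ (N : ℝ) ^ (1.5 * σ) →
      (∀ d ≤ 2 * N, |F d| ≤ Real.log ((2 * N : ℕ) : ℝ)) → (∀ d ≤ 2 * N, |G d| ≤ Real.log ((2 * N : ℕ) : ℝ)) →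
      (∀ d, d ≤ ⌊(N : ℝ) ^ (1 / 24 : ℝ)⌋₊ → F d = 0) →
      (∀ d m, Nat.sqrt (2 * N) < d → d * m ≤ 2 * N → F d * G m = 0) →
      ‖∑ n ∈ Ioc N (2 * N), ((F * G) n : ℂ) * e (γ * ph c k₀ n)‖ ≤
        C * (Real.log ((2 * N : ℕ) : ℝ) ^ 3 * (N : ℝ) ^ (1 - 1.05 * σ)) := by
  obtain ⟨C, hC, N₀, hN₀, H⟩ := norm_sum_bilinear_le (k₀ := k₀) hci hc hc3 hσ hσD
  obtain ⟨N₁, hN₁, H₁⟩ := eventually_le_rpow 4 (s := 1 / 24 - 1 / 25) (by norm_num)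
  refine ⟨3 * C, by linarith, max N₀ (max N₁ 2), le_max_of_le_left hN₀, fun N γ F G hN hγ1 hγ2 hF hG hF0 hFG => ?_⟩
  simp only [max_le_iff] at hN
  obtain ⟨hN, hNN₁, hN2⟩ := hN
  have hN0 : (0 : ℝ) < N := by linarith
  have hN1 : 1 ≤ N := by exact_mod_cast hN0
  have hl := log_two_mul_ge hN2
  have hp := Real.rpow_pos_of_pos hN0 (1 - 1.05 * σ)
  obtain ⟨U, hU⟩ : ∃ U : ℕ, U = ⌊(N : ℝ) ^ (1 / 24 : ℝ)⌋₊ := ⟨_, rfl⟩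
  obtain ⟨Z, hZ⟩ : ∃ Z : ℕ, Z = Nat.sqrt (2 * N) := ⟨_, rfl⟩
  have hZ0 : 0 < Z := by rw [hZ]; exact Nat.sqrt_pos.2 (by omega)
  have hZN : Z ≤ 2 * N := by rw [hZ]; exact Nat.sqrt_le_self _
  have h1 : ∑ n ∈ Ioc N (2 * N), ((F * G) n : ℂ) * e (γ * ph c k₀ n) =
      ∑ d ∈ Ioc U Z, (F d : ℂ) * ∑ m ∈ Ioc (N / d) (2 * N / d), (G m : ℂ) * e (γ * ph c k₀ (d * m)) := by
    rw [sum_Ioc_mul_eq]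
    symm
    refine Finset.sum_subset (fun d hd => ?_) (fun d hd hd' => ?_)
    · rw [mem_Ioc] at hd ⊢; omega
    · rw [mem_Ioc] at hd hd'
      by_cases hdU : d ≤ U
      · rw [hF0 d (by rw [← hU]; exact hdU)]; simp
      · rw [Finset.mul_sum]
        refine Finset.sum_eq_zero fun m hm => ?_
        rw [mem_Ioc] at hm
        have h2 : d * m ≤ 2 * N := by
          have := (Nat.le_div_iff_mul_le hd.1).1 hm.2
          rwa [mul_comm] at this
        have h3 := hFG d m (by rw [← hZ]; omega) h2
        rw [← mul_assoc, ← Complex.ofReal_mul, h3]; simp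
  rw [h1]
  have hUN : (N : ℝ) ^ (1 / 24 : ℝ) < U + 1 := by rw [hU]; exact Nat.lt_floor_add_one _
  have h4N : 4 * (N : ℝ) ^ (1 / 25 : ℝ) ≤ (N : ℝ) ^ (1 / 24 : ℝ) := by
    calc _ ≤ (N : ℝ) ^ (1 / 24 - 1 / 25 : ℝ) * (N : ℝ) ^ (1 / 25 : ℝ) := by
          gcongr; exact H₁ N hNN₁
      _ = _ := by rw [← Real.rpow_add hN0]; congr 1; norm_num
  have h1N : 1 ≤ (N : ℝ) ^ (1 / 25 : ℝ) := Real.one_le_rpow (by linarith) (by norm_num)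
  have hZh : (Z : ℝ) / 2 ≤ (N : ℝ) ^ (1 / 2 : ℝ) := by
    rw [← Real.sqrt_eq_rpow]
    refine Real.le_sqrt_of_sq_le ?_
    have h2 : (Z : ℝ) ^ 2 ≤ 2 * N := by
      have := Nat.sqrt_le' (2 * N)
      rw [← hZ] at this
      exact_mod_cast this
    linarith
  refine (sum_dyadic_le (B := C * (Real.log ((2 * N : ℕ) : ℝ) ^ 2 * (N : ℝ) ^ (1 - 1.05 * σ))) (by positivity)
    fun P L hP1 hP2 hL hLP => ?_).trans ?_
  · exact H N γ P (Real.log ((2 * N : ℕ) : ℝ)) L (fun l => F l) (fun m => G m) hN (by linarith) (hP2.trans hZh) hLP (by linarith)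
      (fun l hl => by rw [Complex.norm_real]; exact hF l ((hL l hl).2.trans hZN))
      (fun m hm => by rw [Complex.norm_real]; exact hG m hm) hγ1 hγ2
  · calc _ ≤ 3 * Real.log ((2 * N : ℕ) : ℝ) * (C * (Real.log ((2 * N : ℕ) : ℝ) ^ 2 * (N : ℝ) ^ (1 - 1.05 * σ))) :=
          mul_le_mul_of_nonneg_right (natLog_two_succ_le hN2 hZ0 hZN) (by positivity)
      _ = _ := by ring

lemma low_mul_low_eq_zero {U : ℕ} {F G : ArithmeticFunction ℝ} {d : ℕ} (h : (low U F * low U G) d ≠ 0) : d ≤ U * U := by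
  by_contra hd
  refine h ?_
  rw [ArithmeticFunction.mul_apply]
  refine Finset.sum_eq_zero fun x hx => ?_
  rw [Nat.mem_divisorsAntidiagonal] at hx
  rw [low_apply, low_apply]
  by_cases h1 : x.1 ≤ U
  · rw [if_neg (c := x.2 ≤ U), mul_zero]
    intro h2
    exact hd (hx.1 ▸ Nat.mul_le_mul h1 h2)
  · rw [if_neg h1, zero_mul]

lemma zeta_mul_sub_low_eq_zero {U : ℕ} {F : ArithmeticFunction ℝ} {d : ℕ} (h : d ≤ U) :
    ((ζ : ArithmeticFunction ℝ) * (F - low U F)) d = 0 := by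
  rw [coe_zeta_mul_apply]
  refine Finset.sum_eq_zero fun i hi => sub_low_apply_eq_zero ((Nat.divisor_le hi).trans h)

end VaughanSums

section VonMangoldtSums
open ArithmeticFunction hiding log
open scoped ArithmeticFunction.Moebius ArithmeticFunction.zeta

variable {c : ℝ} {k₀ : ℕ} {σ : ℝ}

lemma sum_vonMangoldt_le_log (hci : ∀ z : ℤ, (z : ℝ) ≠ c) (hc : (k₀ : ℝ) < c) (hc3 : 3 < c)
    (hσ : 0 < σ) (hσD : σ * (24 * c ^ 2 + 36 * c + 30) ≤ 1.03) :
    ∃ C : ℝ, 1 ≤ C ∧ ∃ N₀ : ℝ, 1 ≤ N₀ ∧ ∀ (N : ℕ) (γ : ℝ), N₀ ≤ N →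
      (N : ℝ) ^ (-c + 16 * σ) ≤ γ → γ ≤ (N : ℝ) ^ (1.5 * σ) →
      ‖∑ n ∈ Ioc N (2 * N), (Λ n : ℂ) * e (γ * ph c k₀ n)‖ ≤
        C * (Real.log ((2 * N : ℕ) : ℝ) ^ 3 * (N : ℝ) ^ (1 - 1.05 * σ)) := by
  obtain ⟨C₁, hC₁, N₁, hN₁, H₁⟩ := typeI_le (k₀ := k₀) hci hc hc3 hσ hσD
  obtain ⟨C₂, hC₂, N₂, hN₂, H₂⟩ := typeII_le (k₀ := k₀) hci hc hc3 hσ hσD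
  refine ⟨2 * C₁ + 2 * C₂, by linarith, max N₁ (max N₂ 2), le_max_of_le_left hN₁, fun N γ hN hγ1 hγ2 => ?_⟩
  simp only [max_le_iff] at hN
  obtain ⟨hN1, hN2, hN22⟩ := hN
  have hl := log_two_mul_ge hN22
  have hN0 : (0 : ℝ) < N := by linarith
  obtain ⟨U, hU⟩ : ∃ U : ℕ, U = ⌊(N : ℝ) ^ (1 / 24 : ℝ)⌋₊ := ⟨_, rfl⟩
  obtain ⟨Z, hZ⟩ : ∃ Z : ℕ, Z = Nat.sqrt (2 * N) := ⟨_, rfl⟩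
  have hUN : (U : ℝ) ≤ (N : ℝ) ^ (1 / 24 : ℝ) := by rw [hU]; exact Nat.floor_le (by positivity)
  have hUU : ((U * U : ℕ) : ℝ) ≤ (N : ℝ) ^ (1 / 8 : ℝ) := by
    push_cast
    calc (U : ℝ) * U ≤ (N : ℝ) ^ (1 / 24 : ℝ) * (N : ℝ) ^ (1 / 24 : ℝ) := by gcongr
      _ ≤ _ := by
        rw [← Real.rpow_add hN0]
        exact Real.rpow_le_rpow_of_exponent_le (by linarith) (by norm_num)
  have hUle : U ≤ N := by
    have h1 : (N : ℝ) ^ (1 / 24 : ℝ) ≤ (N : ℝ) ^ (1 : ℝ) := Real.rpow_le_rpow_of_exponent_le (by linarith) (by norm_num)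
    rw [Real.rpow_one] at h1
    exact_mod_cast hUN.trans h1
  have hU1 : ∀ d, d ≤ U → (d : ℝ) ≤ (N : ℝ) ^ (1 / 8 : ℝ) := fun d hd => by
    refine le_trans ?_ hUU
    exact_mod_cast hd.trans (Nat.le_mul_self U)
  have hB : ∀ n, |(ζ * (Λ - low U Λ) : ArithmeticFunction ℝ) n| ≤ Real.log n :=
    abs_mul_apply_le_log abs_zeta_le fun n => abs_sub_low_le.trans (abs_of_nonneg vonMangoldt_nonneg).le
  have hA : ∀ n, |(low U μ * low U Λ : ArithmeticFunction ℝ) n| ≤ Real.log n :=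
    abs_mul_apply_le_log (fun n => abs_low_le.trans (abs_moebius_real_le n))
      fun n => abs_low_le.trans (abs_of_nonneg vonMangoldt_nonneg).le
  have h1 := H₁ N γ (low U μ) ArithmeticFunction.log hN1 hγ1 hγ2
    (fun d _ => (abs_low_le.trans (abs_moebius_real_le d)).trans hl)
    (fun d hd => hU1 d (by
      by_contra h
      exact hd (by rw [low_apply, if_neg h]))) (Or.inr rfl)
  have h2 := H₁ N γ (low U μ * low U Λ) ζ hN1 hγ1 hγ2
    (fun d hd => (hA d).trans (log_le_log_two_mul hN22 hd))
    (fun d hd => le_trans (by exact_mod_cast low_mul_low_eq_zero hd) hUU) (Or.inl rfl)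
  have hM : ∀ d, |((μ - low U μ : ArithmeticFunction ℝ)) d| ≤ 1 := fun d => abs_sub_low_le.trans (abs_moebius_real_le d)
  have h3 := H₂ N γ (low Z (μ - low U μ)) (ζ * (Λ - low U Λ)) hN2 hγ1 hγ2
    (fun d _ => (abs_low_le.trans (hM d)).trans hl)
    (fun d hd => (hB d).trans (log_le_log_two_mul hN22 hd))
    (fun d hd => by
      rw [low_apply, sub_low_apply_eq_zero (by rw [hU]; exact hd), ite_self])
    (fun d m hd _ => by rw [low_apply, if_neg (by rw [hZ]; omega), zero_mul])
  have h4 := H₂ N γ (ζ * (Λ - low U Λ)) ((μ - low U μ : ArithmeticFunction ℝ) - low Z (μ - low U μ)) hN2 hγ1 hγ2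
    (fun d hd => (hB d).trans (log_le_log_two_mul hN22 hd))
    (fun d _ => (abs_sub_low_le.trans (hM d)).trans hl)
    (fun d hd => zeta_mul_sub_low_eq_zero (by rw [hU]; exact hd))
    (fun d m hd hdm => by
      rw [sub_low_apply_eq_zero (n := m), mul_zero]
      by_contra hm
      have h5 := Nat.lt_succ_sqrt (2 * N)
      have h6 : (Nat.sqrt (2 * N) + 1) * (Nat.sqrt (2 * N) + 1) ≤ d * m := Nat.mul_le_mul (by omega) (by omega)
      simp only [Nat.succ_eq_add_one] at h5
      omega)
  have h5 : ∑ n ∈ Ioc N (2 * N), (Λ n : ℂ) * e (γ * ph c k₀ n) =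
      ∑ n ∈ Ioc N (2 * N), ((low U μ * ArithmeticFunction.log) n : ℂ) * e (γ * ph c k₀ n) -
      ∑ n ∈ Ioc N (2 * N), ((low U μ * low U Λ * ζ) n : ℂ) * e (γ * ph c k₀ n) +
      (∑ n ∈ Ioc N (2 * N), ((low Z (μ - low U μ) * (ζ * (Λ - low U Λ))) n : ℂ) * e (γ * ph c k₀ n) +
      ∑ n ∈ Ioc N (2 * N), ((ζ * (Λ - low U Λ) * ((μ - low U μ : ArithmeticFunction ℝ) - low Z (μ - low U μ))) n : ℂ) *
        e (γ * ph c k₀ n)) := by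
    rw [← Finset.sum_sub_distrib, ← Finset.sum_add_distrib, ← Finset.sum_add_distrib]
    refine Finset.sum_congr rfl fun n hn => ?_
    rw [mem_Ioc] at hn
    have h6 := congrArg (fun F : ArithmeticFunction ℝ => F n) (vaughan_identity U Z)
    simp only [ArithmeticFunction.add_apply, sub_apply'] at h6
    rw [low_apply U Λ n, if_neg (by omega), zero_add] at h6
    rw [h6]
    push_cast
    ring
  rw [h5]
  refine (norm_add_le _ _).trans ?_
  have h7 := norm_sub_le (∑ n ∈ Ioc N (2 * N), ((low U μ * ArithmeticFunction.log) n : ℂ) * e (γ * ph c k₀ n))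
    (∑ n ∈ Ioc N (2 * N), ((low U μ * low U Λ * ζ) n : ℂ) * e (γ * ph c k₀ n))
  have h8 := norm_add_le (∑ n ∈ Ioc N (2 * N), ((low Z (μ - low U μ) * (ζ * (Λ - low U Λ))) n : ℂ) * e (γ * ph c k₀ n))
    (∑ n ∈ Ioc N (2 * N), ((ζ * (Λ - low U Λ) * ((μ - low U μ : ArithmeticFunction ℝ) - low Z (μ - low U μ))) n : ℂ) *
        e (γ * ph c k₀ n))
  linarith

lemma log_pow_three_le {s : ℝ} (hs : 0 < s) {x : ℝ} (hx : 0 ≤ x) (hx1 : 0 ≤ Real.log x) :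
    Real.log x ^ 3 ≤ x ^ s * (s / 3)⁻¹ ^ 3 := by
  have h1 := Real.log_le_rpow_div hx (show 0 < s / 3 by positivity)
  calc _ ≤ (x ^ (s / 3) / (s / 3)) ^ 3 := by gcongr
    _ = _ := by
      rw [div_eq_mul_inv, mul_pow, ← Real.rpow_natCast, ← Real.rpow_mul hx]
      congr 2
      push_cast; ring

lemma sum_vonMangoldt_le (hci : ∀ z : ℤ, (z : ℝ) ≠ c) (hc : (k₀ : ℝ) < c) (hc3 : 3 < c)
    (hσ : 0 < σ) (hσD : σ * (24 * c ^ 2 + 36 * c + 30) ≤ 1.03) :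
    ∃ C : ℝ, 1 ≤ C ∧ ∃ N₀ : ℝ, 1 ≤ N₀ ∧ ∀ (N : ℕ) (γ : ℝ), N₀ ≤ N →
      (N : ℝ) ^ (-c + 16 * σ) ≤ |γ| → |γ| ≤ (N : ℝ) ^ (1.5 * σ) →
      ‖∑ n ∈ Ioc N (2 * N), (Λ n : ℂ) * e (γ * ph c k₀ n)‖ ≤ C * (N : ℝ) ^ (1 - 1.04 * σ) := by
  obtain ⟨C, hC, N₀, hN₀, H⟩ := sum_vonMangoldt_le_log (k₀ := k₀) hci hc hc3 hσ hσD
  obtain ⟨K, hK⟩ : ∃ K : ℝ, K = C * (2 ^ (0.01 * σ) * (0.01 * σ / 3)⁻¹ ^ 3) := ⟨_, rfl⟩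
  refine ⟨max 1 K, le_max_left _ _, max N₀ 2, le_max_of_le_left hN₀, fun N γ hN hγ1 hγ2 => ?_⟩
  have hN2 : (2 : ℝ) ≤ N := (le_max_right _ _).trans hN
  have hN0 : (0 : ℝ) < N := by linarith
  have hl := log_two_mul_ge hN2
  have h1 := log_pow_three_le (s := 0.01 * σ) (by positivity) (Nat.cast_nonneg (2 * N)) (by linarith)
  have habs : ‖∑ n ∈ Ioc N (2 * N), (Λ n : ℂ) * e (γ * ph c k₀ n)‖ =
      ‖∑ n ∈ Ioc N (2 * N), (Λ n : ℂ) * e (|γ| * ph c k₀ n)‖ := by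
    rcases abs_choice γ with h | h
    · rw [h]
    · rw [h, ← RCLike.norm_conj, map_sum]
      congr 1
      refine Finset.sum_congr rfl fun n _ => ?_
      rw [map_mul, Complex.conj_ofReal, ← e_neg, neg_mul]
  rw [habs]
  have hp := Real.rpow_pos_of_pos hN0 (1 - 1.05 * σ)
  refine (H N |γ| ((le_max_left _ _).trans hN) hγ1 hγ2).trans ?_
  calc _ ≤ C * (((2 * N : ℕ) : ℝ) ^ (0.01 * σ) * (0.01 * σ / 3)⁻¹ ^ 3 * (N : ℝ) ^ (1 - 1.05 * σ)) := by gcongr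
    _ = K * ((N : ℝ) ^ (0.01 * σ) * (N : ℝ) ^ (1 - 1.05 * σ)) := by
      rw [hK]; push_cast
      rw [Real.mul_rpow (by norm_num) hN0.le]; ring
    _ = K * (N : ℝ) ^ (1 - 1.04 * σ) := by
      rw [← Real.rpow_add hN0]; congr 2; ring
    _ ≤ _ := by
      have := Real.rpow_pos_of_pos hN0 (1 - 1.04 * σ)
      gcongr
      exact le_max_right _ _

end VonMangoldtSums

section PrimeSums
open ArithmeticFunction hiding log

variable {c : ℝ} {k₀ : ℕ} {σ : ℝ}

/-- The exponential sum over the primes in `(N, 2 N]`, with logarithmic weights. -/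
def primeSum (c : ℝ) (k₀ N : ℕ) (γ : ℝ) : ℂ :=
  ∑ p ∈ (Ioc N (2 * N)).filter Nat.Prime, (Real.log p : ℂ) * e (γ * ph c k₀ p)

lemma norm_sum_vonMangoldt_sub_primeSum_le (N : ℕ) (γ : ℝ) :
    ‖∑ n ∈ Ioc N (2 * N), (Λ n : ℂ) * e (γ * ph c k₀ n) - primeSum c k₀ N γ‖ ≤
      Chebyshev.psi ((2 * N : ℕ) : ℝ) - Chebyshev.theta ((2 * N : ℕ) : ℝ) := by
  rw [Chebyshev.psi_sub_theta_eq_sum_not_prime, Nat.floor_natCast]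
  have h1 : primeSum c k₀ N γ =
      ∑ p ∈ (Ioc N (2 * N)).filter Nat.Prime, (Λ p : ℂ) * e (γ * ph c k₀ p) := by
    refine Finset.sum_congr rfl fun p hp => ?_
    rw [vonMangoldt_apply_prime (Finset.mem_filter.1 hp).2]
  rw [h1, ← Finset.sum_filter_add_sum_filter_not (Ioc N (2 * N)) Nat.Prime, add_sub_cancel_left]
  refine (norm_sum_le _ _).trans ?_
  calc _ = ∑ n ∈ (Ioc N (2 * N)).filter (fun n => ¬ n.Prime), Λ n := by
        refine Finset.sum_congr rfl fun n _ => ?_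
        rw [norm_mul, norm_e, mul_one, Complex.norm_real, Real.norm_of_nonneg vonMangoldt_nonneg]
    _ ≤ _ := by
        refine Finset.sum_le_sum_of_subset_of_nonneg ?_ fun _ _ _ => vonMangoldt_nonneg
        refine Finset.filter_subset_filter _ fun n hn => ?_
        rw [Finset.mem_Ioc] at hn ⊢
        omega

lemma norm_primeSum_le (hci : ∀ z : ℤ, (z : ℝ) ≠ c) (hc : (k₀ : ℝ) < c) (hc3 : 3 < c)
    (hσ : 0 < σ) (hσD : σ * (24 * c ^ 2 + 36 * c + 30) ≤ 1.03) :
    ∃ C : ℝ, 1 ≤ C ∧ ∃ N₀ : ℝ, 1 ≤ N₀ ∧ ∀ (N : ℕ) (γ : ℝ), N₀ ≤ N →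
      (N : ℝ) ^ (-c + 16 * σ) ≤ |γ| → |γ| ≤ (N : ℝ) ^ (1.5 * σ) →
      ‖primeSum c k₀ N γ‖ ≤ C * (N : ℝ) ^ (1 - 1.04 * σ) := by
  obtain ⟨C₁, hC₁, N₀, hN₀, H⟩ := sum_vonMangoldt_le (k₀ := k₀) hci hc hc3 hσ hσD
  obtain ⟨C₂, hC₂⟩ := Chebyshev.psi_sub_theta_le_mul_sqrt
  refine ⟨C₁ + |C₂| * 2, by linarith [abs_nonneg C₂], N₀, hN₀, fun N γ hN h1 h2 => ?_⟩
  have hN1 : (1 : ℝ) ≤ N := hN₀.trans hN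
  have hσ' : σ ≤ 0.01 := by nlinarith
  have hsq : √((2 * N : ℕ) : ℝ) ≤ 2 * (N : ℝ) ^ (1 - 1.04 * σ) := by
    have h3 : √((2 * N : ℕ) : ℝ) ≤ 2 * √(N : ℝ) := by
      rw [Real.sqrt_le_left (by positivity), mul_pow, Real.sq_sqrt (by positivity)]
      push_cast
      linarith
    have h4 : √(N : ℝ) ≤ (N : ℝ) ^ (1 - 1.04 * σ) := by
      rw [Real.sqrt_eq_rpow]
      exact Real.rpow_le_rpow_of_exponent_le hN1 (by linarith)
    linarith
  have h5 := norm_sum_vonMangoldt_sub_primeSum_le (c := c) (k₀ := k₀) N γ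
  have h6 : C₂ * √((2 * N : ℕ) : ℝ) ≤ |C₂| * (2 * (N : ℝ) ^ (1 - 1.04 * σ)) :=
    mul_le_mul (le_abs_self _) hsq (Real.sqrt_nonneg _) (abs_nonneg _)
  have h7 := H N γ hN h1 h2
  have h8 := norm_sub_norm_le (primeSum c k₀ N γ) (∑ n ∈ Ioc N (2 * N), (Λ n : ℂ) * e (γ * ph c k₀ n))
  rw [norm_sub_rev] at h8
  have h9 := hC₂ ((2 * N : ℕ) : ℝ)
  linarith

end PrimeSums

lemma exists_primeMass_ge : ∃ N₀ : ℕ, ∀ N : ℕ, N₀ ≤ N → ∃ L : ℕ, (L = N ∨ L = 2 * N) ∧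
    (L : ℝ) / 4 ≤ ∑ p ∈ (Ioc L (2 * L)).filter Nat.Prime, Real.log p := by
  obtain ⟨X₀, hX₀, HX⟩ := eventually_le_rpow 1000 (s := 1 / 4) (by norm_num)
  refine ⟨⌈X₀⌉₊, fun N hN => ?_⟩
  have hNX : X₀ ≤ N := (Nat.le_ceil X₀).trans (by exact_mod_cast hN)
  have hN1 : (1 : ℝ) ≤ N := hX₀.trans hNX
  have hsplit : Chebyshev.theta ((2 * (2 * N) : ℕ) : ℝ) = Chebyshev.theta (N : ℝ) +
      (∑ p ∈ (Ioc N (2 * N)).filter Nat.Prime, Real.log p +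
        ∑ p ∈ (Ioc (2 * N) (2 * (2 * N))).filter Nat.Prime, Real.log p) := by
    simp only [Chebyshev.theta, Nat.floor_natCast, Finset.sum_filter]
    rw [Finset.sum_Ioc_consecutive _ (by omega) (by omega),
      Finset.sum_Ioc_consecutive _ (by omega) (by omega)]
  have hup := Chebyshev.theta_le_log4_mul_x (x := (N : ℝ)) (by positivity)
  have hlow := Chebyshev.theta_ge (2 * (2 * N))
  set x : ℝ := ((2 * (2 * N) : ℕ) : ℝ) with hx
  have hx4 : x = 4 * N := by rw [hx]; push_cast; ring
  have hx1 : 1 ≤ x := by linarith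
  have hx0 : 0 ≤ x := by linarith
  have hq := HX x (by linarith)
  have hlog : Real.log x ≤ 4 * x ^ (1 / 4 : ℝ) := by
    have := Real.log_le_rpow_div hx0 (ε := 1 / 4) (by norm_num)
    linarith
  have hp : x ^ (1 / 4 : ℝ) * (x ^ (1 / 4 : ℝ) * √x) = x := by
    rw [Real.sqrt_eq_rpow, ← Real.rpow_add (by linarith), ← Real.rpow_add (by linarith)]
    norm_num
  have hsq : 1 ≤ √x := Real.one_le_sqrt.2 hx1
  have hy : 1000 * (x ^ (1 / 4 : ℝ) * √x) ≤ x := by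
    conv_rhs => rw [← hp]
    exact mul_le_mul_of_nonneg_right hq (by positivity)
  have hmain : 2 * √x * Real.log x ≤ 8 * (x ^ (1 / 4 : ℝ) * √x) := by
    have := mul_le_mul_of_nonneg_left hlog (by positivity : 0 ≤ 2 * √x)
    linarith
  have hlog1 : Real.log (x + 1) ≤ 1 + 4 * (x ^ (1 / 4 : ℝ) * √x) := by
    have h1 : Real.log (x + 1) ≤ Real.log 2 + Real.log x := by
      rw [← Real.log_mul (by norm_num) (by linarith)]
      exact Real.log_le_log (by linarith) (by linarith)
    have h2 : x ^ (1 / 4 : ℝ) * 1 ≤ x ^ (1 / 4 : ℝ) * √x :=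
      mul_le_mul_of_nonneg_left hsq (by positivity)
    linarith [Real.log_two_lt_d9]
  have hl2 := Real.log_two_gt_d9
  have hl4 : Real.log 4 = 2 * Real.log 2 := by
    rw [show (4 : ℝ) = 2 ^ 2 by norm_num, Real.log_pow]
    push_cast
    ring
  have h1000 : (1000 : ℝ) ≤ x := by
    have : 1 * 1 ≤ x ^ (1 / 4 : ℝ) * √x :=
      mul_le_mul (by linarith) hsq (by norm_num) (by positivity)
    linarith
  have hN2 : 0.69 * (N : ℝ) ≤ Real.log 2 * N := mul_le_mul_of_nonneg_right (by linarith) (by linarith)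
  have hxl : x * Real.log 2 = 4 * (Real.log 2 * N) := by rw [hx4]; ring
  rw [hl4] at hup
  by_contra! hcon
  have hA := hcon N (Or.inl rfl)
  have hB := hcon (2 * N) (Or.inr rfl)
  push_cast at hB
  linarith

lemma sum_log_prime_le (L : ℕ) :
    ∑ p ∈ (Ioc L (2 * L)).filter Nat.Prime, Real.log p ≤ 4 * L := by
  have h1 : ∑ p ∈ (Ioc L (2 * L)).filter Nat.Prime, Real.log p ≤
      Chebyshev.theta ((2 * L : ℕ) : ℝ) := by
    rw [Chebyshev.theta, Nat.floor_natCast]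
    refine Finset.sum_le_sum_of_subset_of_nonneg (Finset.filter_subset_filter _ fun n hn => ?_)
      fun p _ _ => Real.log_natCast_nonneg p
    rw [Finset.mem_Ioc] at hn ⊢
    omega
  have h2 := Chebyshev.theta_le_log4_mul_x (x := ((2 * L : ℕ) : ℝ)) (by positivity)
  have h3 : Real.log 4 ≤ 2 := by
    rw [show (4 : ℝ) = 2 ^ 2 by norm_num, Real.log_pow]
    push_cast
    linarith [Real.log_two_lt_d9]
  have h4 : Real.log 4 * ((2 * L : ℕ) : ℝ) ≤ 2 * ((2 * L : ℕ) : ℝ) :=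
    mul_le_mul_of_nonneg_right h3 (by positivity)
  push_cast at h1 h2 h4
  linarith

section Detection
open scoped ComplexConjugate

lemma e_sub_round (t : ℝ) : e (t - round t) = e t := by
  have := e_add_int (t - round t) (round t)
  rw [sub_add_cancel] at this
  exact this.symm

lemma four_mul_nearestIntDist_le (t : ℝ) : 4 * nearestIntDist t ≤ ‖e t - 1‖ := by
  rw [← e_sub_round, nearestIntDist]
  have h := abs_sub_round t
  set u := t - round t
  rw [e, mul_comm _ Complex.I, Complex.norm_exp_I_mul_ofReal_sub_one, Real.norm_eq_abs, abs_mul,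
    abs_two, show 2 * Real.pi * u / 2 = Real.pi * u by ring]
  have h1 : |Real.pi * u| = Real.pi * |u| := by rw [abs_mul, abs_of_pos Real.pi_pos]
  have h2 := Real.mul_abs_le_abs_sin (x := Real.pi * u)
    (by rw [h1]; linarith [mul_le_mul_of_nonneg_left h Real.pi_pos.le])
  rw [h1, ← mul_assoc, div_mul_cancel₀ _ Real.pi_ne_zero] at h2
  linarith

lemma nearestIntDist_mul_norm_sum_le (t : ℝ) (H : ℕ) :
    2 * nearestIntDist t * ‖∑ j ∈ range H, e (j * t)‖ ≤ 1 := by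
  have h1 : (∑ j ∈ range H, e (j * t)) * (e t - 1) = e (H * t) - 1 := by
    rw [e_nat_mul, ← geom_sum_mul]
    simp only [e_nat_mul]
  have h2 : ‖∑ j ∈ range H, e (j * t)‖ * ‖e t - 1‖ ≤ 2 := by
    rw [← norm_mul, h1]
    refine (norm_sub_le _ _).trans ?_
    rw [norm_e, norm_one]
    norm_num
  have h3 := mul_le_mul_of_nonneg_left (four_mul_nearestIntDist_le t)
    (norm_nonneg (∑ j ∈ range H, e (j * t)))
  linarith

lemma pow_le_mul_card_sum_eq {r H : ℕ} (hr : 1 ≤ r) (hH : 1 ≤ H) :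
    (H ^ r) ^ 2 ≤ r * H * #{x ∈ (Fintype.piFinset fun _ : Fin r => range H) ×ˢ
      (Fintype.piFinset fun _ : Fin r => range H) | ∑ i, x.1 i = ∑ i, x.2 i} := by
  set I := Fintype.piFinset fun _ : Fin r => range H with hI
  have hcard : #I = H ^ r := by rw [hI, Fintype.card_piFinset]; simp
  have hmaps : ∀ J ∈ I, ∑ i, J i ∈ range (r * H) := by
    intro J hJ
    rw [hI, Fintype.mem_piFinset] at hJ
    rw [Finset.mem_range]
    have h1 : ∑ i, J i ≤ ∑ _i : Fin r, (H - 1) :=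
      Finset.sum_le_sum fun i _ => by have := Finset.mem_range.1 (hJ i); omega
    rw [Finset.sum_const, Finset.card_univ, Fintype.card_fin, smul_eq_mul] at h1
    have h2 : r * (H - 1) < r * H := Nat.mul_lt_mul_of_pos_left (by omega) (by omega)
    omega
  have h1 : ∑ v ∈ range (r * H), #{J ∈ I | ∑ i, J i = v} = H ^ r := by
    rw [← hcard, Finset.card_eq_sum_card_fiberwise hmaps]
  have h2 : #{x ∈ I ×ˢ I | ∑ i, x.1 i = ∑ i, x.2 i} =
      ∑ v ∈ range (r * H), #{J ∈ I | ∑ i, J i = v} ^ 2 := by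
    rw [Finset.card_eq_sum_card_fiberwise (f := fun x => ∑ i, x.1 i) (t := range (r * H))]
    · refine Finset.sum_congr rfl fun v _ => ?_
      rw [sq, ← Finset.card_product]
      congr 1
      ext x
      simp only [Finset.mem_filter, Finset.mem_product]
      constructor
      · rintro ⟨⟨⟨h1, h2⟩, h3⟩, h4⟩
        exact ⟨⟨h1, h4⟩, h2, h3 ▸ h4⟩
      · rintro ⟨⟨h1, h4⟩, h2, h3⟩
        exact ⟨⟨⟨h1, h2⟩, h4.trans h3.symm⟩, h4⟩
    · intro x hx
      exact hmaps x.1 (Finset.mem_product.1 (Finset.mem_filter.1 hx).1).1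
  have h3 := sq_sum_le_card_mul_sum_sq (s := range (r * H)) (f := fun v => #{J ∈ I | ∑ i, J i = v})
  rw [Finset.card_range, h1, ← h2] at h3
  exact h3

/-- If the exponential sums `∑ wₙ e (h tₙ)` are all small, some `tₙ` is close to an integer. -/
lemma exists_nearestIntDist_lt {ι : Type*} (s : Finset ι) (w t : ι → ℝ) (hw : ∀ i ∈ s, 0 ≤ w i)
    (hW : 0 < ∑ i ∈ s, w i) {r H : ℕ} (hr : 1 ≤ r) (hH : 1 ≤ H) {δ B : ℝ} (hδ : 0 < δ)
    (hδH : 4 * (r * H : ℝ) ≤ (2 * δ * H) ^ (2 * r))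
    (hB : 4 * (r * H) * B ≤ ∑ i ∈ s, w i)
    (hS : ∀ h : ℕ, 1 ≤ h → h ≤ r * H → ‖∑ i ∈ s, (w i : ℂ) * e (h * t i)‖ ≤ B) :
    ∃ i ∈ s, nearestIntDist (t i) < δ := by
  by_contra! hcon
  set W := ∑ i ∈ s, w i with hWdef
  set I := Fintype.piFinset fun _ : Fin r => range H with hI
  have hcard : #I = H ^ r := by rw [hI, Fintype.card_piFinset]; simp
  have hle : ∀ J ∈ I, ∑ i, J i ≤ r * H := by
    intro J hJ
    rw [hI, Fintype.mem_piFinset] at hJ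
    have h1 : ∑ i, J i ≤ ∑ _i : Fin r, H :=
      Finset.sum_le_sum fun i _ => (Finset.mem_range.1 (hJ i)).le
    simpa using h1
  have hB0 : 0 ≤ B := (norm_nonneg _).trans (hS 1 le_rfl (Nat.mul_pos hr hH))
  have hSn : ∀ J ∈ I, ∀ J' ∈ I, ∑ i, J i ≠ ∑ i, J' i →
      ‖∑ i ∈ s, (w i : ℂ) * e (((∑ l, J l : ℕ) - (∑ l, J' l : ℕ) : ℝ) * t i)‖ ≤ B := by
    intro J hJ J' hJ' hne
    rcases lt_or_gt_of_ne hne with h | h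
    · have := hS (∑ i, J' i - ∑ i, J i) (by omega) ((Nat.sub_le _ _).trans (hle J' hJ'))
      rw [← Complex.norm_conj, map_sum]
      convert this using 3 with i hi
      rw [map_mul, Complex.conj_ofReal, ← e_neg, Nat.cast_sub h.le]
      ring_nf
    · have := hS (∑ i, J i - ∑ i, J' i) (by omega) ((Nat.sub_le _ _).trans (hle J hJ))
      rwa [Nat.cast_sub h.le] at this
  have hexp : ∀ x : ℝ, ((‖∑ j ∈ range H, e (j * x)‖ ^ (2 * r) : ℝ) : ℂ) =
      ∑ y ∈ I ×ˢ I, e (((∑ l, y.1 l : ℕ) - (∑ l, y.2 l : ℕ) : ℝ) * x) := by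
    intro x
    have h1 : (∑ j ∈ range H, e (j * x)) ^ r = ∑ J ∈ I, e ((∑ l, J l : ℕ) * x) := by
      rw [Finset.sum_pow']
      refine Finset.sum_congr rfl fun J _ => ?_
      rw [← e_sum, ← Finset.sum_mul]
      push_cast
      rfl
    rw [mul_comm 2 r, pow_mul, ← norm_pow, ← Complex.normSq_eq_norm_sq, ← Complex.mul_conj, h1,
      map_sum, Finset.sum_mul_sum, ← Finset.sum_product']
    refine Finset.sum_congr rfl fun y _ => ?_
    rw [← e_neg, ← e_add]
    ring_nf
  have hsum : ((∑ i ∈ s, w i * ‖∑ j ∈ range H, e (j * t i)‖ ^ (2 * r) : ℝ) : ℂ) =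
      ∑ y ∈ I ×ˢ I, ∑ i ∈ s, (w i : ℂ) * e (((∑ l, y.1 l : ℕ) - (∑ l, y.2 l : ℕ) : ℝ) * t i) := by
    rw [Finset.sum_comm, Complex.ofReal_sum]
    refine Finset.sum_congr rfl fun i _ => ?_
    rw [Complex.ofReal_mul, hexp, Finset.mul_sum]
  set T := ∑ i ∈ s, w i * ‖∑ j ∈ range H, e (j * t i)‖ ^ (2 * r) with hT
  set E := (I ×ˢ I).filter (fun y => ∑ i, y.1 i = ∑ i, y.2 i) with hE
  have hT1 : T ≤ W * (1 / (2 * δ)) ^ (2 * r) := by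
    rw [hT, hWdef, Finset.sum_mul]
    refine Finset.sum_le_sum fun i hi => mul_le_mul_of_nonneg_left ?_ (hw i hi)
    refine pow_le_pow_left₀ (norm_nonneg _) ?_ _
    rw [le_div_iff₀ (by positivity)]
    have h1 := nearestIntDist_mul_norm_sum_le (t i) H
    have h2 := mul_le_mul_of_nonneg_right (hcon i hi) (norm_nonneg (∑ j ∈ range H, e (j * t i)))
    linarith
  have hT2 : W * #E ≤ T + (H ^ r) ^ 2 * B := by
    have h1 : ‖(T : ℂ) - W * #E‖ ≤ (H ^ r) ^ 2 * B := by
      rw [hsum, ← Finset.sum_filter_add_sum_filter_not (I ×ˢ I)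
        (fun y => ∑ i, y.1 i = ∑ i, y.2 i), ← hE]
      have h2 : ∑ y ∈ E, ∑ i ∈ s,
          (w i : ℂ) * e (((∑ l, y.1 l : ℕ) - (∑ l, y.2 l : ℕ) : ℝ) * t i) = W * #E := by
        rw [Finset.sum_congr rfl (g := fun _ => (W : ℂ)), Finset.sum_const, nsmul_eq_mul, mul_comm]
        intro y hy
        rw [(Finset.mem_filter.1 hy).2, hWdef, Complex.ofReal_sum]
        simp [e_zero]
      rw [h2, add_sub_cancel_left]
      refine (norm_sum_le _ _).trans ((Finset.sum_le_card_nsmul _ _ B ?_).trans ?_)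
      · intro y hy
        rw [Finset.mem_filter, Finset.mem_product] at hy
        exact hSn _ hy.1.1 _ hy.1.2 hy.2
      · rw [nsmul_eq_mul]
        refine mul_le_mul_of_nonneg_right ?_ hB0
        have h3 := Finset.card_filter_le (I ×ˢ I) (fun y => ¬∑ i, y.1 i = ∑ i, y.2 i)
        rw [Finset.card_product, hcard, ← sq] at h3
        exact_mod_cast h3
    have h2 := (Complex.abs_re_le_norm ((T : ℂ) - W * #E)).trans h1
    have h3 : ((T : ℂ) - W * #E).re = T - W * #E := by
      rw [show ((T : ℂ) - W * #E) = ((T - W * #E : ℝ) : ℂ) by push_cast; rfl, Complex.ofReal_re]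
    rw [h3] at h2
    linarith [(abs_le.1 h2).1]
  have hE1 : ((H : ℝ) ^ r) ^ 2 ≤ r * H * #E := by exact_mod_cast pow_le_mul_card_sum_eq hr hH
  have hr0 : (0 : ℝ) < r := by exact_mod_cast hr
  have hH0 : (0 : ℝ) < H := by exact_mod_cast hH
  set P : ℝ := ((H : ℝ) ^ r) ^ 2 with hP
  have hP0 : 0 < P := by positivity
  have hδP : (1 / (2 * δ)) ^ (2 * r) * (4 * (r * H)) ≤ P := by
    have h1 := mul_le_mul_of_nonneg_left hδH (by positivity : 0 ≤ (1 / (2 * δ)) ^ (2 * r))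
    rw [← mul_pow, show 1 / (2 * δ) * (2 * δ * H) = H by field_simp, mul_comm 2 r] at h1
    rw [mul_comm 2 r, hP, ← pow_mul]
    exact h1
  have hA := mul_le_mul_of_nonneg_left hE1 hW.le
  have hT3 := hT2.trans (add_le_add hT1 le_rfl)
  have hC := mul_le_mul_of_nonneg_left hT3 (by positivity : 0 ≤ (r : ℝ) * H)
  have hD := mul_le_mul_of_nonneg_left hδP hW.le
  have hF := mul_le_mul_of_nonneg_left hB hP0.le
  have hG := mul_pos hW hP0
  linarith

end Detection

section FloorExpansion

lemma integral_e_mul {b : ℝ} (hb : b ≠ 0) :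
    ∫ x in (0 : ℝ)..1, e (b * x) = (e b - 1) / (2 * Real.pi * b * Complex.I) := by
  have hc : (2 * Real.pi * b * Complex.I : ℂ) ≠ 0 := by
    simp [hb, Real.pi_ne_zero]
  have := integral_exp_mul_complex (a := 0) (b := 1) hc
  convert this using 1
  · refine intervalIntegral.integral_congr fun x _ => ?_
    rw [e]
    congr 1
    push_cast
    ring
  · rw [e]
    congr 1
    push_cast
    simp only [mul_one, mul_zero, Complex.exp_zero]

lemma continuous_e : Continuous e := by
  unfold e
  fun_prop

/-- On `[0, 1]` this is `sin² (π x) e (-θ x)`. -/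
def sinTwist (θ x : ℝ) : ℂ := (2 - e x - e (-x)) / 4 * e (-θ * x)

lemma sinTwist_weight (x : ℝ) : (2 - e x - e (-x)) / 4 = (Real.sin (Real.pi * x) ^ 2 : ℝ) := by
  have h : e x + e (-x) = (2 * Real.cos (2 * (Real.pi * x)) : ℝ) := by
    rw [e_neg, Complex.add_conj, e_re]
    congr 3
    ring_nf
  rw [sub_sub, h, Real.cos_two_mul, Real.sin_sq]
  push_cast
  ring

lemma norm_sinTwist_le (θ x : ℝ) : ‖sinTwist θ x‖ ≤ 1 := by
  rw [sinTwist, sinTwist_weight, norm_mul, norm_e, mul_one, Complex.norm_real,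
    Real.norm_of_nonneg (sq_nonneg _)]
  exact Real.sin_sq_le_one _

/-- `sinTwist θ` extended periodically. -/
def sinTwistCircle (θ : ℝ) : C(AddCircle (1 : ℝ), ℂ) where
  toFun := AddCircle.liftIco 1 0 (sinTwist θ)
  continuous_toFun := by
    refine AddCircle.liftIco_zero_continuous ?_ ?_
    · have h1 : e (1 : ℝ) = 1 := by simpa using e_int 1
      have h2 : e (-1 : ℝ) = 1 := by simpa using e_int (-1)
      rw [sinTwist, sinTwist, neg_zero, e_zero, h1, h2]
      norm_num
    · unfold sinTwist
      have := continuous_e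
      fun_prop

lemma fourierCoeff_sinTwistCircle (θ : ℝ) (n : ℤ) :
    fourierCoeff (sinTwistCircle θ) n = ∫ x in (0 : ℝ)..1, e (-(n : ℝ) * x) * sinTwist θ x := by
  have h := fourierCoeff_liftIco_eq (T := 1) (a := 0) (sinTwist θ) n
  rw [show (⇑(sinTwistCircle θ)) = AddCircle.liftIco 1 0 (sinTwist θ) from rfl, h,
    fourierCoeffOn_eq_integral]
  norm_num
  refine intervalIntegral.integral_congr fun x _ => ?_
  congr 1
  rw [e, ← Complex.exp_conj]
  congr 1
  simp only [map_mul, Complex.conj_ofReal, Complex.conj_I, map_ofNat, map_intCast]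
  push_cast
  ring

lemma norm_fourierCoeff_sinTwistCircle_le {θ : ℝ} (hθ : |θ| ≤ 1 / 2) (n : ℤ) :
    ‖fourierCoeff (sinTwistCircle θ) n‖ * ((1 + |(n : ℝ)|) * (1 + (n : ℝ) ^ 2)) ≤ 4 := by
  rcases le_or_gt |n| 1 with hn | hn
  · have h1 : ‖fourierCoeff (sinTwistCircle θ) n‖ ≤ 1 := by
      rw [fourierCoeff_sinTwistCircle]
      have := intervalIntegral.norm_integral_le_of_norm_le_const (a := 0) (b := 1) (C := 1)
        (f := fun x => e (-(n : ℝ) * x) * sinTwist θ x)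
        (fun x _ => by rw [norm_mul, norm_e, one_mul]; exact norm_sinTwist_le θ x)
      simpa using this
    have h2 : |(n : ℝ)| ≤ 1 := by exact_mod_cast hn
    have h3 : (n : ℝ) ^ 2 ≤ 1 := by rw [← sq_abs]; exact pow_le_one₀ (abs_nonneg _) h2
    have h4 : (1 + |(n : ℝ)|) * (1 + (n : ℝ) ^ 2) ≤ 2 * 2 :=
      mul_le_mul (by linarith) (by linarith) (by positivity) (by norm_num)
    calc _ ≤ 1 * ((1 + |(n : ℝ)|) * (1 + (n : ℝ) ^ 2)) :=
          mul_le_mul_of_nonneg_right h1 (by positivity)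
      _ ≤ 4 := by linarith
  · have hn2 : (2 : ℝ) ≤ |(n : ℝ)| := by exact_mod_cast hn
    set s : ℝ := n + θ with hs
    have hsn : |(n : ℝ)| - 1 / 2 ≤ |s| := by
      have h1 := abs_sub_abs_le_abs_sub (n : ℝ) (-θ)
      rw [abs_neg, sub_neg_eq_add] at h1
      linarith
    have hs1 : 3 / 2 ≤ |s| := by linarith
    have hs2 : s ^ 2 = |s| ^ 2 := (sq_abs s).symm
    have hs3 : (9 / 4 : ℝ) ≤ s ^ 2 := by rw [hs2]; nlinarith
    have hs0 : s ≠ 0 := by intro h; rw [h] at hs3; norm_num at hs3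
    have hsm : s - 1 ≠ 0 := by intro h; rw [show s = 1 by linarith] at hs3; norm_num at hs3
    have hsp : s + 1 ≠ 0 := by intro h; rw [show s = -1 by linarith] at hs3; norm_num at hs3
    have hval : fourierCoeff (sinTwistCircle θ) n =
        (e (-s) - 1) / (8 * Real.pi * Complex.I) * (2 / (s * (s - 1) * (s + 1))) := by
      have hint : ∀ b : ℝ, IntervalIntegrable (fun x : ℝ => e (b * x)) MeasureTheory.volume 0 1 :=
        fun b => (continuous_e.comp (continuous_const.mul continuous_id)).intervalIntegrable _ _
      have h1 : ∀ x : ℝ, e (-(n : ℝ) * x) * sinTwist θ x =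
          1 / 2 * e (-s * x) - 1 / 4 * e (-(s - 1) * x) - 1 / 4 * e (-(s + 1) * x) := by
        intro x
        rw [sinTwist, show -s * x = -(n : ℝ) * x + -θ * x by rw [hs]; ring,
          show -(s - 1) * x = -(n : ℝ) * x + (x + -θ * x) by rw [hs]; ring,
          show -(s + 1) * x = -(n : ℝ) * x + (-x + -θ * x) by rw [hs]; ring]
        simp only [e_add]
        ring
      have h2 : e (-(s - 1)) = e (-s) := by
        have := e_add_int (-s) 1
        rw [← this]
        congr 1
        push_cast
        ring
      have h3 : e (-(s + 1)) = e (-s) := by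
        have := e_add_int (-s) (-1)
        rw [← this]
        congr 1
        push_cast
        ring
      rw [fourierCoeff_sinTwistCircle]
      simp_rw [h1]
      rw [intervalIntegral.integral_sub (((hint _).const_mul _).sub ((hint _).const_mul _))
          ((hint _).const_mul _),
        intervalIntegral.integral_sub ((hint _).const_mul _) ((hint _).const_mul _)]
      simp only [intervalIntegral.integral_const_mul]
      rw [integral_e_mul (neg_ne_zero.2 hs0), integral_e_mul (neg_ne_zero.2 hsm),
        integral_e_mul (neg_ne_zero.2 hsp), h2, h3]
      have hc0 : (s : ℂ) ≠ 0 := by exact_mod_cast hs0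
      have hcm : (s : ℂ) - 1 ≠ 0 := by exact_mod_cast hsm
      have hcp : (s : ℂ) + 1 ≠ 0 := by exact_mod_cast hsp
      have hpi : (Real.pi : ℂ) ≠ 0 := by exact_mod_cast Real.pi_ne_zero
      have hI := Complex.I_ne_zero
      push_cast
      have hcm' : -((s : ℂ) - 1) ≠ 0 := neg_ne_zero.2 hcm
      have hcp' : -((s : ℂ) + 1) ≠ 0 := neg_ne_zero.2 hcp
      field_simp
      ring
    have hnum : ‖e (-s) - 1‖ ≤ 2 := by
      refine (norm_sub_le _ _).trans ?_
      rw [norm_e, norm_one]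
      norm_num
    have hden : |s * (s - 1) * (s + 1)| = |s| * (s ^ 2 - 1) := by
      rw [mul_assoc, abs_mul, show (s - 1) * (s + 1) = s ^ 2 - 1 by ring,
        abs_of_nonneg (by linarith : 0 ≤ s ^ 2 - 1)]
    have hnorm : ‖fourierCoeff (sinTwistCircle θ) n‖ =
        ‖e (-s) - 1‖ / (8 * Real.pi) * (2 / (|s| * (s ^ 2 - 1))) := by
      rw [hval, norm_mul, norm_div, norm_div]
      congr 2
      · simp [abs_of_pos Real.pi_pos]
      · simp
      · rw [← hden, ← Real.norm_eq_abs, ← Complex.norm_real]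
        push_cast
        rfl
    have hpos : 0 < |s| * (s ^ 2 - 1) := mul_pos (by linarith) (by linarith)
    have hcmp : (1 + |(n : ℝ)|) * (1 + (n : ℝ) ^ 2) ≤ 24 * (|s| * (s ^ 2 - 1)) := by
      rw [← sq_abs (n : ℝ), hs2]
      set u := |(n : ℝ)|
      set v := |s|
      have h1 : u ≤ v + 1 / 2 := by linarith
      have h2 : u ^ 2 ≤ (v + 1 / 2) ^ 2 := pow_le_pow_left₀ (by linarith) h1 2
      calc (1 + u) * (1 + u ^ 2) ≤ (1 + (v + 1 / 2)) * (1 + (v + 1 / 2) ^ 2) :=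
            mul_le_mul (by linarith) (by linarith) (by positivity) (by linarith)
        _ ≤ _ := by nlinarith [sq_nonneg (v - 3 / 2), mul_nonneg (by linarith : 0 ≤ v - 3 / 2) (sq_nonneg v)]
    have hpi := Real.pi_gt_three
    have h8 : ‖e (-s) - 1‖ / (8 * Real.pi) ≤ 1 / 12 := by
      rw [div_le_iff₀ (by positivity)]
      linarith
    rw [hnorm]
    calc _ ≤ 1 / 12 * (2 / (|s| * (s ^ 2 - 1))) * (24 * (|s| * (s ^ 2 - 1))) :=
          mul_le_mul (mul_le_mul_of_nonneg_right h8 (by positivity)) hcmp (by positivity)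
            (by positivity)
      _ = 4 * (|s| * (s ^ 2 - 1) / (|s| * (s ^ 2 - 1))) := by ring
      _ = 4 := by rw [div_self hpos.ne', mul_one]

lemma summable_int_four_div : Summable fun m : ℤ => 4 / (1 + (m : ℝ) ^ 2) := by
  refine Summable.of_norm_bounded_eventually
    ((Real.summable_one_div_int_pow (p := 2)).2 (by norm_num) |>.mul_left 4) ?_
  rw [Filter.eventually_cofinite]
  refine (Set.finite_singleton (0 : ℤ)).subset fun m hm => ?_
  by_contra h0
  have h1 : (0 : ℝ) < (m : ℝ) ^ 2 := by
    have : (m : ℝ) ≠ 0 := by exact_mod_cast h0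
    positivity
  refine hm ?_
  rw [Real.norm_of_nonneg (by positivity), mul_one_div]
  exact div_le_div_of_nonneg_left (by norm_num) h1 (by linarith)

lemma hasSum_sin_sq_mul_e_fract {θ : ℝ} (hθ : |θ| ≤ 1 / 2) (x : ℝ) :
    HasSum (fun m : ℤ => fourierCoeff (sinTwistCircle θ) m * e (m * x))
      ((Real.sin (Real.pi * x) ^ 2 : ℝ) * e (-θ * Int.fract x)) := by
  have hsum : Summable (fourierCoeff (sinTwistCircle θ)) := by
    refine Summable.of_norm_bounded summable_int_four_div fun m => ?_
    rw [le_div_iff₀ (by positivity)]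
    have h1 := norm_fourierCoeff_sinTwistCircle_le hθ m
    have h2 : ‖fourierCoeff (sinTwistCircle θ) m‖ * (1 + (m : ℝ) ^ 2) ≤
        ‖fourierCoeff (sinTwistCircle θ) m‖ * ((1 + |(m : ℝ)|) * (1 + (m : ℝ) ^ 2)) := by
      refine mul_le_mul_of_nonneg_left ?_ (norm_nonneg _)
      have := mul_nonneg (abs_nonneg (m : ℝ)) (by positivity : 0 ≤ 1 + (m : ℝ) ^ 2)
      linarith
    linarith
  have h := has_pointwise_sum_fourier_series_of_summable hsum ((Int.fract x : ℝ) : AddCircle (1 : ℝ))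
  convert h using 1
  · funext m
    rw [smul_eq_mul, fourier_coe_apply]
    congr 1
    have h1 : e (m * x) = e (m * Int.fract x) := by
      have := e_add_int (m * Int.fract x) (m * ⌊x⌋)
      rw [← this]
      congr 1
      push_cast
      rw [← mul_add, Int.fract_add_floor]
    rw [h1, e]
    congr 1
    push_cast
    ring
  · have h1 : (sinTwistCircle θ) ((Int.fract x : ℝ) : AddCircle (1 : ℝ)) = sinTwist θ (Int.fract x) := by
      change AddCircle.liftIco 1 0 (sinTwist θ) _ = _
      exact AddCircle.liftIco_zero_coe_apply ⟨Int.fract_nonneg x, Int.fract_lt_one x⟩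
    rw [h1, sinTwist, ← sinTwist_weight]
    have h2 : e (Int.fract x) = e x := by
      rw [← e_add_int _ ⌊x⌋, Int.fract_add_floor]
    rw [e_neg, e_neg, h2]

end FloorExpansion

section FloorSums
variable {c : ℝ} {k₀ : ℕ} {σ : ℝ}

lemma norm_primeSum_le_trivial (N : ℕ) (γ : ℝ) : ‖primeSum c k₀ N γ‖ ≤ 4 * N := by
  refine (norm_sum_le _ _).trans (le_trans (le_of_eq ?_) (sum_log_prime_le N))
  refine Finset.sum_congr rfl fun p _ => ?_
  rw [norm_mul, norm_e, mul_one, Complex.norm_real, Real.norm_of_nonneg (Real.log_natCast_nonneg p)]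

lemma e_mul_floor (β x : ℝ) : e (β * ⌊x⌋) =
    e ((β - round β) * x) * e (-(β - round β) * Int.fract x) := by
  have h := e_add_int ((β - round β) * ⌊x⌋) (round β * ⌊x⌋)
  rw [← e_add, show (β - round β) * x + -(β - round β) * Int.fract x = (β - round β) * ⌊x⌋ by
    rw [Int.fract]; ring, ← h]
  congr 1
  push_cast
  ring

lemma norm_sum_log_mul_e_floor_le (hci : ∀ z : ℤ, (z : ℝ) ≠ c) (hc : (k₀ : ℝ) < c) (hc3 : 3 < c)
    (hσ : 0 < σ) (hσD : σ * (24 * c ^ 2 + 36 * c + 30) ≤ 1.03) :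
    ∃ C : ℝ, 1 ≤ C ∧ ∃ N₀ : ℝ, 1 ≤ N₀ ∧ ∀ (N : ℕ) (β : ℝ), N₀ ≤ N →
      (N : ℝ) ^ (-c + 16 * σ) ≤ nearestIntDist β →
      ‖∑ p ∈ (Ioc N (2 * N)).filter Nat.Prime,
        ((Real.log p * Real.sin (Real.pi * ph c k₀ p) ^ 2 : ℝ) : ℂ) * e (β * ⌊ph c k₀ p⌋)‖ ≤
        C * (N : ℝ) ^ (1 - 1.04 * σ) := by
  obtain ⟨C₁, hC₁, N₀, hN₀, H⟩ := norm_primeSum_le (k₀ := k₀) hci hc hc3 hσ hσD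
  obtain ⟨A, hA⟩ := summable_int_four_div
  refine ⟨1 + |A * (C₁ + 4)|, by linarith [abs_nonneg (A * (C₁ + 4))], N₀, hN₀, fun N β hN hβ => ?_⟩
  have hN1 : (1 : ℝ) ≤ N := hN₀.trans hN
  have hN0 : (0 : ℝ) < N := by linarith
  have hθ : |β - round β| ≤ 1 / 2 := abs_sub_round β
  rw [nearestIntDist] at hβ
  set θ := β - round β with hθdef
  set B : ℝ := (C₁ + 4) * (N : ℝ) ^ (1 - 1.04 * σ) with hB
  have hP0 : 0 < (N : ℝ) ^ (1 - 1.04 * σ) := Real.rpow_pos_of_pos hN0 _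
  have hsum : HasSum (fun m : ℤ => fourierCoeff (sinTwistCircle θ) m * primeSum c k₀ N (θ + m))
      (∑ p ∈ (Ioc N (2 * N)).filter Nat.Prime,
        ((Real.log p * Real.sin (Real.pi * ph c k₀ p) ^ 2 : ℝ) : ℂ) * e (β * ⌊ph c k₀ p⌋)) := by
    have h1 : ∀ p ∈ (Ioc N (2 * N)).filter Nat.Prime, HasSum
        (fun m : ℤ => (Real.log p : ℂ) * e (θ * ph c k₀ p) *
          (fourierCoeff (sinTwistCircle θ) m * e (m * ph c k₀ p)))
        (((Real.log p * Real.sin (Real.pi * ph c k₀ p) ^ 2 : ℝ) : ℂ) * e (β * ⌊ph c k₀ p⌋)) := by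
      intro p _
      have h2 := (hasSum_sin_sq_mul_e_fract hθ (ph c k₀ p)).mul_left
        ((Real.log p : ℂ) * e (θ * ph c k₀ p))
      have h3 : (Real.log p : ℂ) * e (θ * ph c k₀ p) *
          ((Real.sin (Real.pi * ph c k₀ p) ^ 2 : ℝ) * e (-θ * Int.fract (ph c k₀ p))) =
          ((Real.log p * Real.sin (Real.pi * ph c k₀ p) ^ 2 : ℝ) : ℂ) * e (β * ⌊ph c k₀ p⌋) := by
        rw [e_mul_floor, ← hθdef]
        push_cast
        ring
      rwa [h3] at h2
    convert hasSum_sum h1 using 1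
    funext m
    rw [primeSum, Finset.mul_sum]
    refine Finset.sum_congr rfl fun p _ => ?_
    rw [add_mul, e_add]
    ring
  have hbound : ∀ m : ℤ, ‖fourierCoeff (sinTwistCircle θ) m * primeSum c k₀ N (θ + m)‖ ≤
      4 / (1 + (m : ℝ) ^ 2) * B := by
    intro m
    have hF := norm_fourierCoeff_sinTwistCircle_le hθ m
    rw [norm_mul, div_mul_eq_mul_div, le_div_iff₀ (by positivity)]
    set a := ‖fourierCoeff (sinTwistCircle θ) m‖ with ha
    have ha0 : 0 ≤ a := norm_nonneg _
    have hm0 : (0 : ℝ) ≤ 1 + (m : ℝ) ^ 2 := by positivity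
    have ham : 0 ≤ a * (1 + (m : ℝ) ^ 2) := mul_nonneg ha0 hm0
    have ham' : 0 ≤ a * (1 + (m : ℝ) ^ 2) * |(m : ℝ)| := mul_nonneg ham (abs_nonneg _)
    have hsmall : a * (1 + (m : ℝ) ^ 2) ≤ 4 := by linarith
    rcases le_or_gt |θ + m| ((N : ℝ) ^ (1.5 * σ)) with hle | hgt
    · have hlow : |θ| ≤ |θ + m| := by
        rcases eq_or_ne m 0 with rfl | hm
        · simp
        · have h1 : (1 : ℝ) ≤ |(m : ℝ)| := by exact_mod_cast Int.one_le_abs hm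
          have h2 := abs_sub_abs_le_abs_sub (m : ℝ) (-θ)
          rw [abs_neg, sub_neg_eq_add, add_comm (m : ℝ)] at h2
          linarith
      have h1 := H N (θ + m) hN (hβ.trans hlow) hle
      have h2 : ‖primeSum c k₀ N (θ + m)‖ ≤ B := by rw [hB]; linarith
      calc _ = a * (1 + (m : ℝ) ^ 2) * ‖primeSum c k₀ N (θ + m)‖ := by ring
        _ ≤ 4 * B := mul_le_mul hsmall h2 (norm_nonneg _) (by norm_num)
    · have hm : (N : ℝ) ^ (1.5 * σ) ≤ 1 + |(m : ℝ)| := by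
        have := abs_add_le θ (m : ℝ)
        linarith
      have h1 : a * (1 + (m : ℝ) ^ 2) * (N : ℝ) ^ (1.5 * σ) ≤ 4 := by
        have := mul_le_mul_of_nonneg_left hm ham
        linarith
      have h2 : (N : ℝ) ≤ (N : ℝ) ^ (1.5 * σ) * (N : ℝ) ^ (1 - 1.04 * σ) := by
        rw [← Real.rpow_add hN0]
        conv_lhs => rw [← Real.rpow_one (N : ℝ)]
        exact Real.rpow_le_rpow_of_exponent_le hN1 (by linarith)
      calc a * ‖primeSum c k₀ N (θ + m)‖ * (1 + (m : ℝ) ^ 2)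
          = a * (1 + (m : ℝ) ^ 2) * ‖primeSum c k₀ N (θ + m)‖ := by ring
        _ ≤ a * (1 + (m : ℝ) ^ 2) * (4 * ((N : ℝ) ^ (1.5 * σ) * (N : ℝ) ^ (1 - 1.04 * σ))) :=
            mul_le_mul_of_nonneg_left ((norm_primeSum_le_trivial _ _).trans (by linarith)) ham
        _ = a * (1 + (m : ℝ) ^ 2) * (N : ℝ) ^ (1.5 * σ) * (4 * (N : ℝ) ^ (1 - 1.04 * σ)) := by ring
        _ ≤ 4 * (4 * (N : ℝ) ^ (1 - 1.04 * σ)) :=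
            mul_le_mul_of_nonneg_right h1 (by positivity)
        _ ≤ 4 * B := by
            rw [hB]
            have := mul_nonneg (by linarith : 0 ≤ C₁) hP0.le
            linarith
  have h1 := hsum.norm_le_of_bounded (hA.mul_right B) hbound
  refine h1.trans ?_
  rw [hB, ← mul_assoc]
  exact mul_le_mul_of_nonneg_right (by linarith [le_abs_self (A * (C₁ + 4))]) hP0.le

lemma exists_sum_log_mul_sin_sq_ge (hci : ∀ z : ℤ, (z : ℝ) ≠ c) (hc : (k₀ : ℝ) < c) (hc3 : 3 < c)
    (hσ : 0 < σ) (hσD : σ * (24 * c ^ 2 + 36 * c + 30) ≤ 1.03) :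
    ∃ N₀ : ℝ, 1 ≤ N₀ ∧ ∀ N : ℕ, N₀ ≤ N →
      (N : ℝ) / 4 ≤ ∑ p ∈ (Ioc N (2 * N)).filter Nat.Prime, Real.log p →
      (N : ℝ) / 16 ≤ ∑ p ∈ (Ioc N (2 * N)).filter Nat.Prime,
        Real.log p * Real.sin (Real.pi * ph c k₀ p) ^ 2 := by
  obtain ⟨C, hC, N₁, hN₁, H⟩ := norm_primeSum_le (k₀ := k₀) hci hc hc3 hσ hσD
  obtain ⟨N₂, hN₂, H₂⟩ := eventually_le_rpow (8 * C) (s := 1.04 * σ) (by linarith)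
  refine ⟨max N₁ N₂, le_max_of_le_left hN₁, fun N hN hmass => ?_⟩
  have hN1 : (1 : ℝ) ≤ N := (le_max_of_le_left hN₁).trans hN
  have hN0 : (0 : ℝ) < N := by linarith
  have hσ' : σ ≤ 0.01 := by nlinarith
  have h1 := H N 1 ((le_max_left _ _).trans hN)
    (by rw [abs_one]; exact Real.rpow_le_one_of_one_le_of_nonpos hN1 (by linarith))
    (by rw [abs_one]; exact Real.one_le_rpow hN1 (by linarith))
  have h2 : C * (N : ℝ) ^ (1 - 1.04 * σ) ≤ N / 8 := by
    have h3 := mul_le_mul_of_nonneg_right (H₂ N ((le_max_right _ _).trans hN))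
      (Real.rpow_nonneg hN0.le (1 - 1.04 * σ))
    rw [← Real.rpow_add hN0, show 1.04 * σ + (1 - 1.04 * σ) = 1 by ring, Real.rpow_one] at h3
    linarith
  have h3 : ∑ p ∈ (Ioc N (2 * N)).filter Nat.Prime,
      Real.log p * Real.sin (Real.pi * ph c k₀ p) ^ 2 =
      1 / 2 * ∑ p ∈ (Ioc N (2 * N)).filter Nat.Prime, Real.log p -
        1 / 2 * (primeSum c k₀ N 1).re := by
    rw [primeSum, Complex.re_sum, Finset.mul_sum, Finset.mul_sum, ← Finset.sum_sub_distrib]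
    refine Finset.sum_congr rfl fun p _ => ?_
    rw [Complex.re_ofReal_mul, e_re, Real.sin_sq_eq_half_sub]
    ring_nf
  have h4 := Complex.re_le_norm (primeSum c k₀ N 1)
  rw [h3]
  linarith

end FloorSums

section Cases
variable {c : ℝ} {k₀ : ℕ} {ρ : ℝ}

set_option maxHeartbeats 1000000 in
lemma exists_prime_nearestIntDist_lt (hci : ∀ z : ℤ, (z : ℝ) ≠ c) (hc : (k₀ : ℝ) < c)
    (hc3 : 3 < c) (hρ : 0 < ρ) (hρD : ρ * (24 * c ^ 2 + 36 * c + 30) ≤ 1) {ε : ℝ} (hε : 0 < ε) :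
    ∃ N₀ : ℝ, 1 ≤ N₀ ∧ ∀ (N : ℕ) (ξ : ℝ), N₀ ≤ N →
      (N : ℝ) / 4 ≤ ∑ p ∈ (Ioc N (2 * N)).filter Nat.Prime, Real.log p →
      (∀ h : ℕ, 1 ≤ h → (h : ℝ) ≤ (N : ℝ) ^ (1.01 * ρ) →
        (N : ℝ) ^ (-c + 16 * (1.03 * ρ)) ≤ nearestIntDist (h * ξ)) →
      ∃ p ∈ (Ioc N (2 * N)).filter Nat.Prime,
        nearestIntDist (ξ * ⌊ph c k₀ p⌋) < (N : ℝ) ^ (-ρ + ε) := by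
  have hσ : 0 < 1.03 * ρ := by linarith
  have hσD : 1.03 * ρ * (24 * c ^ 2 + 36 * c + 30) ≤ 1.03 := by
    rw [mul_assoc]; linarith
  have hρ' : ρ ≤ 0.01 := by nlinarith
  obtain ⟨C, hC, N₁, hN₁, H₁⟩ := norm_sum_log_mul_e_floor_le (k₀ := k₀) hci hc hc3 hσ hσD
  obtain ⟨N₂, hN₂, H₂⟩ := exists_sum_log_mul_sin_sq_ge (k₀ := k₀) hci hc hc3 hσ hσD
  set r : ℕ := ⌈1 / ε⌉₊ with hr
  have hr1 : 1 ≤ r := Nat.one_le_ceil_iff.2 (by positivity)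
  have hrε : 1 ≤ r * ε := by
    have := mul_le_mul_of_nonneg_right (Nat.le_ceil (1 / ε)) hε.le
    rwa [one_div_mul_cancel hε.ne'] at this
  obtain ⟨N₃, hN₃, H₃⟩ := eventually_le_rpow r (s := 0.01 * ρ) (by linarith)
  obtain ⟨N₄, hN₄, H₄⟩ := eventually_le_rpow (64 * C) (s := 0.06 * ρ) (by linarith)
  refine ⟨max 4 (max (max N₁ N₂) (max N₃ N₄)), le_max_of_le_left (by norm_num),
    fun N ξ hN hmass hξ => ?_⟩
  simp only [max_le_iff] at hN
  obtain ⟨hN4, ⟨hNN₁, hNN₂⟩, hNN₃, hNN₄⟩ := hN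
  have hN1 : (1 : ℝ) ≤ N := by linarith
  have hN0 : (0 : ℝ) < N := by linarith
  have hW := H₂ N hNN₂ hmass
  have hr0 : (1 : ℝ) ≤ r := by exact_mod_cast hr1
  set Y : ℝ := (N : ℝ) ^ ρ with hY
  have hY1 : 1 ≤ Y := Real.one_le_rpow hN1 hρ.le
  set H : ℕ := ⌊Y⌋₊ with hH
  have hH1 : 1 ≤ H := Nat.le_floor (by exact_mod_cast hY1)
  have hHY : (H : ℝ) ≤ Y := Nat.floor_le (by linarith)
  have hHY2 : Y ≤ 2 * H := by
    have h1 := Nat.lt_floor_add_one Y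
    have h2 : (1 : ℝ) ≤ H := by exact_mod_cast hH1
    linarith
  have hrH : (r * H : ℝ) ≤ (N : ℝ) ^ (1.01 * ρ) := by
    rw [show 1.01 * ρ = 0.01 * ρ + ρ by ring, Real.rpow_add hN0]
    exact mul_le_mul (H₃ N hNN₃) hHY (by positivity) (by positivity)
  have hP0 : 0 < (N : ℝ) ^ (1 - 1.04 * (1.03 * ρ)) := Real.rpow_pos_of_pos hN0 _
  refine exists_nearestIntDist_lt ((Ioc N (2 * N)).filter Nat.Prime)
    (fun p => Real.log p * Real.sin (Real.pi * ph c k₀ p) ^ 2) (fun p => ξ * ⌊ph c k₀ p⌋)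
    (fun p _ => mul_nonneg (Real.log_natCast_nonneg p) (sq_nonneg _)) (by linarith) hr1 hH1
    (B := C * (N : ℝ) ^ (1 - 1.04 * (1.03 * ρ))) (Real.rpow_pos_of_pos hN0 _) ?_ ?_ ?_
  · have h1 : (N : ℝ) ^ ε ≤ 2 * (N : ℝ) ^ (-ρ + ε) * H := by
      have h2 : (N : ℝ) ^ ε = (N : ℝ) ^ (-ρ + ε) * Y := by
        rw [hY, ← Real.rpow_add hN0]
        congr 1
        ring
      have h3 := mul_le_mul_of_nonneg_left hHY2 (Real.rpow_nonneg hN0.le (-ρ + ε))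
      linarith
    calc 4 * (r * H : ℝ) ≤ N * N ^ (1 : ℝ) := by
          refine mul_le_mul hN4 (hrH.trans ?_) (by positivity) hN0.le
          exact Real.rpow_le_rpow_of_exponent_le hN1 (by linarith)
      _ = (N : ℝ) ^ (2 : ℝ) := by rw [Real.rpow_one, Real.rpow_two, sq]
      _ ≤ (N : ℝ) ^ (ε * (2 * r : ℕ)) := by
          refine Real.rpow_le_rpow_of_exponent_le hN1 ?_
          push_cast
          linarith
      _ = ((N : ℝ) ^ ε) ^ (2 * r) := by rw [Real.rpow_mul_natCast hN0.le]
      _ ≤ _ := pow_le_pow_left₀ (by positivity) h1 _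
  · refine le_trans ?_ hW
    have h1 : (N : ℝ) ^ (1.01 * ρ) * (N : ℝ) ^ (1 - 1.04 * (1.03 * ρ)) * (N : ℝ) ^ (0.06 * ρ) ≤ N := by
      rw [← Real.rpow_add hN0, ← Real.rpow_add hN0]
      conv_rhs => rw [← Real.rpow_one (N : ℝ)]
      exact Real.rpow_le_rpow_of_exponent_le hN1 (by linarith)
    have h2 := mul_le_mul_of_nonneg_right hrH hP0.le
    have h3 := mul_le_mul_of_nonneg_left (H₄ N hNN₄) (by positivity :
      0 ≤ (N : ℝ) ^ (1.01 * ρ) * (N : ℝ) ^ (1 - 1.04 * (1.03 * ρ)))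
    have h4 := mul_le_mul_of_nonneg_left h2 (by linarith : 0 ≤ 4 * C)
    linarith
  · intro h hh1 hh2
    have h1 : (h : ℝ) ≤ (N : ℝ) ^ (1.01 * ρ) := by
      refine le_trans ?_ hrH
      exact_mod_cast hh2
    have h2 := H₁ N (h * ξ) hNN₁ (hξ h hh1 h1)
    refine le_trans (le_of_eq ?_) h2
    simp only [mul_assoc]

end Cases

lemma dvd_floor_of_nearestIntDist_lt {x : ℝ} {q : ℕ} (hq : 1 ≤ q)
    (h : nearestIntDist (x / q - 1 / (2 * q)) < 1 / (2 * q)) : (q : ℤ) ∣ ⌊x⌋ := by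
  have hq0 : (0 : ℝ) < q := by exact_mod_cast hq
  rw [nearestIntDist] at h
  set m := round (x / q - 1 / (2 * q) : ℝ)
  rw [abs_lt] at h
  have h1 : x / q * q = x := div_mul_cancel₀ x hq0.ne'
  have h2 : 1 / (2 * (q : ℝ)) * q = 1 / 2 := by field_simp
  have h3 := mul_lt_mul_of_pos_right h.1 hq0
  have h4 := mul_lt_mul_of_pos_right h.2 hq0
  refine ⟨m, ?_⟩
  rw [Int.floor_eq_iff]
  push_cast
  constructor <;> linarith

section Cases
variable {c : ℝ} {k₀ : ℕ} {ρ : ℝ}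

set_option maxHeartbeats 1000000 in
lemma exists_prime_dvd_floor (hci : ∀ z : ℤ, (z : ℝ) ≠ c) (hc : (k₀ : ℝ) < c)
    (hc3 : 3 < c) (hρ : 0 < ρ) (hρD : ρ * (24 * c ^ 2 + 36 * c + 30) ≤ 1) :
    ∃ N₀ : ℝ, 1 ≤ N₀ ∧ ∀ N q : ℕ, N₀ ≤ N →
      (N : ℝ) / 4 ≤ ∑ p ∈ (Ioc N (2 * N)).filter Nat.Prime, Real.log p →
      1 ≤ q → (q : ℝ) ≤ (N : ℝ) ^ (1.03 * ρ) →
      ∃ p ∈ (Ioc N (2 * N)).filter Nat.Prime, (q : ℤ) ∣ ⌊ph c k₀ p⌋ := by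
  have hσ : 0 < 1.03 * ρ := by linarith
  have hσD : 1.03 * ρ * (24 * c ^ 2 + 36 * c + 30) ≤ 1.03 := by
    rw [mul_assoc]; linarith
  have hρ' : ρ ≤ 0.01 := by nlinarith
  obtain ⟨C, hC, N₁, hN₁, H₁⟩ := norm_primeSum_le (k₀ := k₀) hci hc hc3 hσ hσD
  set r : ℕ := ⌈100 / ρ⌉₊ with hr
  have hr1 : 1 ≤ r := Nat.one_le_ceil_iff.2 (by positivity)
  have hrρ : 100 ≤ r * ρ := by
    have := mul_le_mul_of_nonneg_right (Nat.le_ceil (100 / ρ)) hρ.le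
    rwa [div_mul_cancel₀ _ hρ.ne'] at this
  obtain ⟨N₃, hN₃, H₃⟩ := eventually_le_rpow (2 * r) (s := 0.005 * ρ) (by linarith)
  obtain ⟨N₄, hN₄, H₄⟩ := eventually_le_rpow (16 * C) (s := 0.026 * ρ) (by linarith)
  refine ⟨max 4 (max N₁ (max N₃ N₄)), le_max_of_le_left (by norm_num),
    fun N q hN hmass hq hqN => ?_⟩
  simp only [max_le_iff] at hN
  obtain ⟨hN4, hNN₁, hNN₃, hNN₄⟩ := hN
  have hN1 : (1 : ℝ) ≤ N := by linarith
  have hN0 : (0 : ℝ) < N := by linarith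
  have hr0 : (1 : ℝ) ≤ r := by exact_mod_cast hr1
  have hq1 : (1 : ℝ) ≤ q := by exact_mod_cast hq
  have hq0 : (0 : ℝ) < q := by linarith
  set Y : ℝ := (N : ℝ) ^ (0.01 * ρ) with hY
  have hY1 : 1 ≤ Y := Real.one_le_rpow hN1 (by linarith)
  have hqY : 1 ≤ q * Y := one_le_mul_of_one_le_of_one_le hq1 hY1
  set H : ℕ := ⌈q * Y⌉₊ with hH
  have hHY : q * Y ≤ H := Nat.le_ceil _
  have hH1 : 1 ≤ H := by exact_mod_cast hqY.trans hHY
  have hHY2 : (H : ℝ) ≤ 2 * (q * Y) := by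
    have := Nat.ceil_lt_add_one (by linarith : 0 ≤ q * Y)
    linarith
  have hrH' : (r * H : ℝ) ≤ q * (N : ℝ) ^ (0.015 * ρ) := by
    have h1 : (N : ℝ) ^ (0.015 * ρ) = (N : ℝ) ^ (0.005 * ρ) * Y := by
      rw [hY, ← Real.rpow_add hN0]
      congr 1
      ring
    have h2 := mul_le_mul_of_nonneg_right (H₃ N hNN₃) (by linarith : 0 ≤ q * Y)
    have h3 := mul_le_mul_of_nonneg_left hHY2 (by linarith : (0 : ℝ) ≤ r)
    rw [h1]
    linarith
  have hrH : (r * H : ℝ) ≤ (N : ℝ) ^ (1.045 * ρ) := by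
    refine hrH'.trans ?_
    rw [show 1.045 * ρ = 1.03 * ρ + 0.015 * ρ by ring, Real.rpow_add hN0]
    exact mul_le_mul_of_nonneg_right hqN (by positivity)
  have hP0 : 0 < (N : ℝ) ^ (1 - 1.04 * (1.03 * ρ)) := Real.rpow_pos_of_pos hN0 _
  suffices hdet : ∃ p ∈ (Ioc N (2 * N)).filter Nat.Prime,
      nearestIntDist (ph c k₀ p / q - 1 / (2 * q)) < 1 / (2 * q) by
    obtain ⟨p, hp, hpt⟩ := hdet
    exact ⟨p, hp, dvd_floor_of_nearestIntDist_lt hq hpt⟩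
  refine exists_nearestIntDist_lt ((Ioc N (2 * N)).filter Nat.Prime)
    (fun p => Real.log p) (fun p => ph c k₀ p / q - 1 / (2 * q))
    (fun p _ => Real.log_natCast_nonneg p) (by linarith) hr1 hH1
    (δ := 1 / (2 * q)) (B := C * (N : ℝ) ^ (1 - 1.04 * (1.03 * ρ))) (by positivity) ?_ ?_ ?_
  · have h1 : Y ≤ 2 * (1 / (2 * q)) * H := by
      rw [show 2 * (1 / (2 * (q : ℝ))) * H = H / q by field_simp, le_div_iff₀ hq0]
      linarith
    calc 4 * (r * H : ℝ) ≤ N * N ^ (1 : ℝ) := by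
          refine mul_le_mul hN4 (hrH.trans ?_) (by positivity) hN0.le
          exact Real.rpow_le_rpow_of_exponent_le hN1 (by linarith)
      _ = (N : ℝ) ^ (2 : ℝ) := by rw [Real.rpow_one, Real.rpow_two, sq]
      _ ≤ (N : ℝ) ^ (0.01 * ρ * (2 * r : ℕ)) := by
          refine Real.rpow_le_rpow_of_exponent_le hN1 ?_
          push_cast
          linarith
      _ = Y ^ (2 * r) := by rw [Real.rpow_mul_natCast hN0.le]
      _ ≤ _ := pow_le_pow_left₀ (by positivity) h1 _
  · refine le_trans ?_ hmass
    have h1 : (N : ℝ) ^ (1.045 * ρ) * (N : ℝ) ^ (1 - 1.04 * (1.03 * ρ)) * (N : ℝ) ^ (0.026 * ρ) ≤ N := by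
      rw [← Real.rpow_add hN0, ← Real.rpow_add hN0]
      conv_rhs => rw [← Real.rpow_one (N : ℝ)]
      exact Real.rpow_le_rpow_of_exponent_le hN1 (by linarith)
    have h2 := mul_le_mul_of_nonneg_right hrH hP0.le
    have h3 := mul_le_mul_of_nonneg_left (H₄ N hNN₄) (by positivity :
      0 ≤ (N : ℝ) ^ (1.045 * ρ) * (N : ℝ) ^ (1 - 1.04 * (1.03 * ρ)))
    have h4 := mul_le_mul_of_nonneg_left h2 (by linarith : 0 ≤ 4 * C)
    linarith
  · intro h hh1 hh2
    have hh0 : (1 : ℝ) ≤ h := by exact_mod_cast hh1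
    have habs : |(h : ℝ) / q| = h / q := abs_of_nonneg (by positivity)
    have h1 := H₁ N (h / q) hNN₁ (by
      rw [habs, le_div_iff₀ hq0]
      refine le_trans ?_ hh0
      have h2 := mul_le_mul_of_nonneg_left hqN (Real.rpow_nonneg hN0.le (-c + 16 * (1.03 * ρ)))
      refine h2.trans ?_
      rw [← Real.rpow_add hN0]
      exact Real.rpow_le_one_of_one_le_of_nonpos hN1 (by linarith)) (by
      rw [habs, div_le_iff₀ hq0]
      have h2 : (h : ℝ) ≤ r * H := by exact_mod_cast hh2
      have h3 : (N : ℝ) ^ (0.015 * ρ) ≤ (N : ℝ) ^ (1.5 * (1.03 * ρ)) :=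
        Real.rpow_le_rpow_of_exponent_le hN1 (by linarith)
      have h4 := mul_le_mul_of_nonneg_left h3 hq0.le
      linarith)
    refine le_trans (le_of_eq ?_) h1
    have h2 : ∑ p ∈ (Ioc N (2 * N)).filter Nat.Prime,
        (Real.log p : ℂ) * e (h * (ph c k₀ p / q - 1 / (2 * q))) =
        primeSum c k₀ N (h / q) * e (-(h / (2 * q))) := by
      rw [primeSum, Finset.sum_mul]
      refine Finset.sum_congr rfl fun p _ => ?_
      rw [mul_assoc, ← e_add]
      congr 2
      ring
    rw [h2, norm_mul, norm_e, mul_one]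

end Cases

lemma nearestIntDist_int_mul_le (m : ℤ) (x : ℝ) :
    nearestIntDist (m * x) ≤ |(m : ℝ)| * nearestIntDist x := by
  rw [nearestIntDist, nearestIntDist, ← abs_mul, mul_sub]
  have := round_le (m * x) (m * round x)
  push_cast at this
  exact this

lemma rpow_le_of_div_eight_le {x y : ℝ} (hx : 0 < x) (hxy : x ≤ y) (hyx : y / 8 ≤ x) (a : ℝ) :
    x ^ a ≤ 8 ^ |a| * y ^ a := by
  have hy : 0 < y := by linarith
  rcases le_or_gt 0 a with ha | ha
  · have h1 := Real.rpow_le_rpow hx.le hxy ha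
    have h2 : (1 : ℝ) ≤ 8 ^ |a| := Real.one_le_rpow (by norm_num) (abs_nonneg a)
    have h3 := mul_le_mul_of_nonneg_right h2 (Real.rpow_nonneg hy.le a)
    linarith
  · have h1 := Real.rpow_le_rpow_of_nonpos (by linarith : 0 < y / 8) hyx ha.le
    rw [Real.div_rpow hy.le (by norm_num)] at h1
    rw [abs_of_neg ha, Real.rpow_neg (by norm_num), mul_comm, ← div_eq_mul_inv]
    exact h1

section Main
variable {c : ℝ} {k₀ : ℕ} {ρ : ℝ}

set_option maxHeartbeats 1000000 in
lemma exists_prime_of_small_multiple (hci : ∀ z : ℤ, (z : ℝ) ≠ c) (hc : (k₀ : ℝ) < c)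
    (hc3 : 3 < c) (hρ : 0 < ρ) (hρD : ρ * (24 * c ^ 2 + 36 * c + 30) ≤ 1) :
    ∃ N₀ : ℝ, 1 ≤ N₀ ∧ ∀ (N q : ℕ) (ξ : ℝ), N₀ ≤ N → 1 ≤ q → (q : ℝ) ≤ (N : ℝ) ^ (1.01 * ρ) →
      nearestIntDist (q * ξ) < (N : ℝ) ^ (-c + 16 * (1.03 * ρ)) →
      ∃ p : ℕ, p.Prime ∧ p ≤ N ∧
        nearestIntDist (ξ * ⌊ph c k₀ p⌋) ≤ 2 * 4 ^ c * (N : ℝ) ^ (-ρ) := by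
  have hρ' : ρ * 354 ≤ 1 := by nlinarith
  obtain ⟨N₁, hN₁, H₁⟩ := exists_prime_dvd_floor (k₀ := k₀) hci hc hc3 hρ hρD
  obtain ⟨M₀, hM₀⟩ := exists_primeMass_ge
  set η : ℝ := (17.48 * ρ) / c with hη
  have hηc : η * c = 17.48 * ρ := div_mul_cancel₀ _ (by linarith)
  have hη0 : 0 < η := by positivity
  have hη1 : η ≤ 0.01647 := by
    rw [hη, div_le_iff₀ (by linarith)]
    linarith
  obtain ⟨N₂, hN₂, H₂⟩ := eventually_le_rpow (2 * (M₀ + 1 + N₁)) (s := 1 - η) (by linarith)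
  obtain ⟨N₃, hN₃, H₃⟩ := eventually_le_rpow 4 (s := η) hη0
  obtain ⟨N₄, hN₄, H₄⟩ := eventually_le_rpow 2 (s := 0.003 * ρ) (by linarith)
  refine ⟨max N₂ (max N₃ N₄), le_max_of_le_left hN₂, fun N q ξ hN hq hqN hξ => ?_⟩
  simp only [max_le_iff] at hN
  obtain ⟨hNN₂, hNN₃, hNN₄⟩ := hN
  have hN1 : (1 : ℝ) ≤ N := hN₂.trans hNN₂
  have hN0 : (0 : ℝ) < N := by linarith
  set X : ℝ := (N : ℝ) ^ (1 - η) with hX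
  have hX2 := H₂ N hNN₂
  have hM₀' : (0 : ℝ) ≤ M₀ := Nat.cast_nonneg _
  have hX0 : 0 < X := by linarith
  set M : ℕ := ⌊X⌋₊ with hM
  have hMX : (M : ℝ) ≤ X := Nat.floor_le hX0.le
  have hXM : X / 2 ≤ M := by
    have := Nat.lt_floor_add_one X
    linarith
  obtain ⟨L, hL, hmass⟩ := hM₀ M (Nat.le_floor (by linarith))
  have hLX : (L : ℝ) ≤ 2 * X ∧ X / 2 ≤ L := by
    rcases hL with rfl | rfl
    · constructor <;> linarith
    · push_cast
      constructor <;> linarith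
  have hqL : (q : ℝ) ≤ (L : ℝ) ^ (1.03 * ρ) := by
    have h1 := Real.rpow_le_rpow (by positivity) hLX.2 (by linarith : 0 ≤ 1.03 * ρ)
    refine le_trans ?_ h1
    rw [Real.div_rpow hX0.le (by norm_num), le_div_iff₀ (by positivity), hX, ← Real.rpow_mul hN0.le]
    have h2 : (2 : ℝ) ^ (1.03 * ρ) ≤ (N : ℝ) ^ (0.003 * ρ) := by
      refine le_trans ?_ (H₄ N hNN₄)
      conv_rhs => rw [← Real.rpow_one (2 : ℝ)]
      exact Real.rpow_le_rpow_of_exponent_le (by norm_num) (by linarith)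
    calc (q : ℝ) * 2 ^ (1.03 * ρ) ≤ (N : ℝ) ^ (1.01 * ρ) * (N : ℝ) ^ (0.003 * ρ) :=
          mul_le_mul hqN h2 (by positivity) (by positivity)
      _ = (N : ℝ) ^ (1.013 * ρ) := by
          rw [← Real.rpow_add hN0]
          congr 1
          ring
      _ ≤ _ := by
          refine Real.rpow_le_rpow_of_exponent_le hN1 ?_
          have := mul_le_mul_of_nonneg_right hη1 hρ.le
          linarith
  obtain ⟨p, hp, m, hm⟩ := H₁ L q (by linarith) hmass hq hqL
  rw [Finset.mem_filter, Finset.mem_Ioc] at hp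
  have hpL : (p : ℝ) ≤ 2 * L := by exact_mod_cast hp.1.2
  have hpX : (p : ℝ) ≤ 4 * X := by linarith
  have hXN : 4 * X ≤ N := by
    have h1 := mul_le_mul_of_nonneg_right (H₃ N hNN₃) hX0.le
    rw [hX, ← Real.rpow_add hN0, add_sub_cancel, Real.rpow_one] at h1
    exact h1
  refine ⟨p, hp.2, by exact_mod_cast hpX.trans hXN, ?_⟩
  have hp1 : (1 : ℝ) ≤ p := by exact_mod_cast hp.2.one_lt.le
  have hph0 : 0 ≤ ph c k₀ p := by rw [ph]; positivity
  have hph : ph c k₀ p ≤ 2 * (4 ^ c * X ^ c) := by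
    have h1 : (p : ℝ) ^ c ≤ 4 ^ c * X ^ c := by
      rw [← Real.mul_rpow (by norm_num) hX0.le]
      exact Real.rpow_le_rpow (by positivity) hpX (by linarith)
    have h2 : (p : ℝ) ^ k₀ ≤ (p : ℝ) ^ c := by
      rw [← Real.rpow_natCast]
      exact Real.rpow_le_rpow_of_exponent_le hp1 hc.le
    rw [ph]
    linarith
  have hfl0 : 0 ≤ ⌊ph c k₀ p⌋ := Int.floor_nonneg.2 hph0
  have hq0 : (0 : ℤ) < q := by exact_mod_cast hq
  have hm0 : 0 ≤ m := by
    rw [hm] at hfl0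
    exact nonneg_of_mul_nonneg_right hfl0 hq0
  have hmle : |(m : ℝ)| ≤ ph c k₀ p := by
    have h1 : m ≤ ⌊ph c k₀ p⌋ := by
      rw [hm]
      nlinarith
    have h2 : (m : ℝ) ≤ ⌊ph c k₀ p⌋ := by exact_mod_cast h1
    rw [abs_of_nonneg (by exact_mod_cast hm0)]
    exact h2.trans (Int.floor_le _)
  have h1 := nearestIntDist_int_mul_le m (q * ξ)
  have h2 : ξ * (⌊ph c k₀ p⌋ : ℝ) = m * (q * ξ) := by
    rw [hm]
    push_cast
    ring
  rw [h2]
  refine h1.trans ((mul_le_mul (hmle.trans hph) hξ.le (abs_nonneg _) (by positivity)).trans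
    (le_of_eq ?_))
  have h3 : X ^ c * (N : ℝ) ^ (-c + 16 * (1.03 * ρ)) = (N : ℝ) ^ (-ρ) := by
    rw [hX, ← Real.rpow_mul hN0.le, ← Real.rpow_add hN0]
    congr 1
    linarith
  rw [← h3]
  ring

end Main

end PS

theorem min_frac_part_piatetski_shapiro_along_primes
    (ξ c : ℝ) (k : ℕ) (hk : 1 ≤ k) (hc3 : 3 < c)
    (hcint : ∀ z : ℤ, (z : ℝ) ≠ c) (hck : (k : ℝ) < c)
    (ε : ℝ) (hε : 0 < ε) :
    ∃ C > (0 : ℝ), ∀ᶠ N : ℕ in atTop, ∃ p : ℕ, p.Prime ∧ 2 ≤ p ∧ p ≤ N ∧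
      nearestIntDist (ξ * (⌊(p : ℝ) ^ c + (p : ℝ) ^ k⌋ : ℝ)) ≤
        C * (N : ℝ) ^ (-(1 / (24 * c ^ 2 + 36 * c + 30)) + ε) := by
  have hD : 0 < 24 * c ^ 2 + 36 * c + 30 := by positivity
  have hρ : 0 < 1 / (24 * c ^ 2 + 36 * c + 30) := by positivity
  have hρD := (one_div_mul_cancel hD.ne').le
  set ρ := 1 / (24 * c ^ 2 + 36 * c + 30)
  obtain ⟨N₁, hN₁, H₁⟩ := PS.exists_prime_nearestIntDist_lt (k₀ := k) hcint hck hc3 hρ hρD hε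
  obtain ⟨N₂, hN₂, H₂⟩ := PS.exists_prime_of_small_multiple (k₀ := k) hcint hck hc3 hρ hρD
  obtain ⟨M₀, hM₀⟩ := PS.exists_primeMass_ge
  refine ⟨8 ^ |-ρ + ε| + 2 * 4 ^ c * 8 ^ |-ρ|, by positivity, ?_⟩
  filter_upwards [eventually_ge_atTop (8 * (M₀ + ⌈N₁⌉₊ + ⌈N₂⌉₊ + 1))] with N hN
  obtain ⟨L, hL, hmass⟩ := hM₀ (N / 4) (by omega)
  have hLN : 2 * L ≤ N ∧ N ≤ 8 * L ∧ ⌈N₁⌉₊ ≤ L ∧ ⌈N₂⌉₊ ≤ L ∧ 1 ≤ L := by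
    rcases hL with rfl | rfl <;> omega
  obtain ⟨hL2, hL8, hLN₁, hLN₂, hL1⟩ := hLN
  have hL1' : (1 : ℝ) ≤ L := by exact_mod_cast hL1
  have hL2' : (L : ℝ) ≤ N := by exact_mod_cast (by omega : L ≤ N)
  have hL8' : (N : ℝ) / 8 ≤ L := by
    have : (N : ℝ) ≤ 8 * L := by exact_mod_cast hL8
    linarith
  have hN1 : (1 : ℝ) ≤ N := hL1'.trans hL2'
  have hpow := fun a => PS.rpow_le_of_div_eight_le (by linarith) hL2' hL8' a
  have hP : 0 < (N : ℝ) ^ (-ρ + ε) := Real.rpow_pos_of_pos (by linarith) _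
  by_cases hcase : ∀ h : ℕ, 1 ≤ h → (h : ℝ) ≤ (L : ℝ) ^ (1.01 * ρ) →
      (L : ℝ) ^ (-c + 16 * (1.03 * ρ)) ≤ nearestIntDist (h * ξ)
  · obtain ⟨p, hp, hlt⟩ := H₁ L ξ (Nat.ceil_le.1 hLN₁) hmass hcase
    rw [Finset.mem_filter, Finset.mem_Ioc] at hp
    refine ⟨p, hp.2, hp.2.two_le, by omega, (hlt.le.trans (hpow _)).trans ?_⟩
    rw [add_mul]
    exact le_add_of_nonneg_right (by positivity)
  · push Not at hcase
    obtain ⟨q, hq1, hq2, hq3⟩ := hcase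
    obtain ⟨p, hp, hpL, hle⟩ := H₂ L q ξ (Nat.ceil_le.1 hLN₂) hq1 hq2 hq3
    refine ⟨p, hp, hp.two_le, by omega, hle.trans ?_⟩
    have h1 := mul_le_mul_of_nonneg_left (hpow (-ρ)) (by positivity : (0 : ℝ) ≤ 2 * 4 ^ c)
    have h2 : (N : ℝ) ^ (-ρ) ≤ (N : ℝ) ^ (-ρ + ε) :=
      Real.rpow_le_rpow_of_exponent_le hN1 (by linarith)
    have h3 := mul_le_mul_of_nonneg_left h2 (by positivity : (0 : ℝ) ≤ 2 * 4 ^ c * 8 ^ |-ρ|)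
    have h4 := mul_pos (by positivity : (0 : ℝ) < 8 ^ |-ρ + ε|) hP
    linarith
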